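/- Minimal covariant basis of S₆ ⊕ S₄ ⊕ S₂: for V = S₆ ⊕ S₄ ⊕ S₂, the covariant algebra Cov(V) admits a minimal basis consisting of exactly 494 homogeneous covariants; equivalently, dim_ℂ (C₊ / C₊²) = 494, where C₊ is the ideal of Cov(V) spanned by the homogeneous components of positive total degree. -/

import Mathlib

noncomputable section
set_option synthInstance.maxHeartbeats 1000000
set_option maxHeartbeats 1000000
open MvPolynomial

abbrev SL2 : Type := Matrix.SpecialLinearGroup (Fin 2) ℂ
abbrev Var {ι : Type} (ν : ι → ℕ) : Type := (Σ i : ι, Fin (ν i + 1)) ⊕ Fin 2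
abbrev CoordRing {ι : Type} (ν : ι → ℕ) : Type := MvPolynomial (Var ν) ℂ
def form (n : ℕ) (a : Fin (n + 1) → ℂ) : MvPolynomial (Fin 2) ℂ :=
  ∑ i : Fin (n + 1), MvPolynomial.C (a i) * X 0 ^ (n - (i : ℕ)) * X 1 ^ (i : ℕ)
def subst2 (g : SL2) : MvPolynomial (Fin 2) ℂ →ₐ[ℂ] MvPolynomial (Fin 2) ℂ :=
  aeval fun i => ∑ j : Fin 2, MvPolynomial.C ((g⁻¹).1 i j) * X j
def coeffOf (n : ℕ) (p : MvPolynomial (Fin 2) ℂ) (i : Fin (n + 1)) : ℂ :=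
  MvPolynomial.coeff (Finsupp.single 0 (n - (i : ℕ)) + Finsupp.single 1 ((i : ℕ))) p
def coeffAct (g : SL2) (n : ℕ) (a : Fin (n + 1) → ℂ) : Fin (n + 1) → ℂ :=
  coeffOf n (subst2 g (form n a))
def ptAct {ι : Type} (ν : ι → ℕ) (g : SL2) (pt : Var ν → ℂ) : Var ν → ℂ :=
  Sum.elim
    (fun c => coeffAct g (ν c.1) (fun k => pt (Sum.inl ⟨c.1, k⟩)) c.2)
    (fun i => ∑ j : Fin 2, (g).1 i j * pt (Sum.inr j))
def Covariants {ι : Type} (ν : ι → ℕ) : Subalgebra ℂ (CoordRing ν) where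
  carrier := {p | ∀ (g : SL2) (pt : Var ν → ℂ), eval (ptAct ν g pt) p = eval pt p}
  mul_mem' := by intro a b ha hb g pt; simp only [map_mul, ha g pt, hb g pt]
  one_mem' := by intro g pt; simp
  add_mem' := by intro a b ha hb g pt; simp only [map_add, ha g pt, hb g pt]
  zero_mem' := by intro g pt; simp
  algebraMap_mem' := by intro c g pt; simp [MvPolynomial.algebraMap_eq]
def wBi {ι : Type} (ν : ι → ℕ) : Var ν → ℕ × ℕ :=
  Sum.elim (fun _ => (1, 0)) (fun _ => (0, 1))

-- new defs to test
/-- The set of covariants that are bihomogeneous of degree `d` and order `k`,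
i.e. the homogeneous component `Cov_{d,k}(V)`. -/
def CovHom {ι : Type} (ν : ι → ℕ) (d k : ℕ) : Set (CoordRing ν) :=
  {h | h ∈ Covariants ν ∧ h.IsWeightedHomogeneous (wBi ν) (d, k)}

/-- A covariant of degree `d` and order `k` is *reducible* if it belongs to the
subalgebra generated by the homogeneous covariants of degree `d' ≤ d` and order
`k' ≤ k` with `(d',k') ≠ (d,k)`. -/
def IsReducibleAt {ι : Type} (ν : ι → ℕ) (d k : ℕ) (h : CoordRing ν) : Prop :=
  h ∈ Algebra.adjoin ℂ
    {p | ∃ d' k' : ℕ, d' ≤ d ∧ k' ≤ k ∧ (d', k') ≠ (d, k) ∧ p ∈ CovHom ν d' k'}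

/-- The ideal `C₊` of `Cov(V)` spanned by the homogeneous components of positive
total degree, as a `ℂ`-submodule of `Cov(V)`. -/
def Cplus {ι : Type} (ν : ι → ℕ) : Submodule ℂ ↥(Covariants ν) :=
  Submodule.span ℂ
    {h | ∃ d k : ℕ, 0 < d + k ∧ (h : CoordRing ν).IsWeightedHomogeneous (wBi ν) (d, k)}

/-- The `ℂ`-submodule `C₊²` of `Cov(V)` spanned by products of two elements of `C₊`. -/
def CplusSq {ι : Type} (ν : ι → ℕ) : Submodule ℂ ↥(Covariants ν) :=
  Submodule.span ℂ {h | ∃ x ∈ Cplus ν, ∃ y ∈ Cplus ν, h = x * y}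

/-- A *minimal basis* of `Cov(V)`: a family of bihomogeneous covariants of positive
total degree whose image in the quotient vector space `C₊/C₊²` is a `ℂ`-basis
(rendered as: the images in `Cov(V)/C₊²` are linearly independent and span the
image of `C₊`). -/
def IsMinimalBasis {ι : Type} (ν : ι → ℕ) {κ : Type} (B : κ → ↥(Covariants ν)) : Prop :=
  (∀ x, ∃ d k : ℕ, 0 < d + k ∧
      ((B x : CoordRing ν)).IsWeightedHomogeneous (wBi ν) (d, k)) ∧
  LinearIndependent ℂ (fun x => (CplusSq ν).mkQ (B x)) ∧
  Submodule.span ℂ (Set.range fun x => (CplusSq ν).mkQ (B x))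
    = (Cplus ν).map (CplusSq ν).mkQ

/-- A commutative algebra with an action of `sl₂` by derivations, graded by a multidegree and a
weight, with finite-dimensional pieces of bounded even weights. -/
structure SlAlg (R : Type) [CommRing R] [Algebra ℂ R] where
  E : R →ₗ[ℂ] R
  F : R →ₗ[ℂ] R
  G : ℕ × ℕ × ℕ → ℤ → Submodule ℂ R
  E_mul : ∀ x y, E (x * y) = E x * y + x * E y
  F_mul : ∀ x y, F (x * y) = F x * y + x * F y
  E_mem : ∀ {d u x}, x ∈ G d u → E x ∈ G d (u + 2)
  F_mem : ∀ {d u x}, x ∈ G d u → F x ∈ G d (u - 2)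
  comm : ∀ {d u x}, x ∈ G d u → E (F x) = F (E x) + (u : ℂ) • x
  bdd : ∀ d, ∃ N : ℕ, ∀ u : ℤ, N < |u| → G d u = ⊥
  fin : ∀ d u, FiniteDimensional ℂ (G d u)
  mul_mem : ∀ {d d' u u' x y}, x ∈ G d u → y ∈ G d' u' → x * y ∈ G (d + d') (u + u')
  odd : ∀ {d u}, Odd u → G d u = ⊥
  zero : ∀ {u}, u ≠ 0 → G 0 u = ⊥
  const : ∀ {x}, x ∈ G 0 0 → ∃ c : ℂ, x = algebraMap ℂ R c

namespace SlAlg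

variable {R : Type} [CommRing R] [Algebra ℂ R] (S : SlAlg R)

/-- The algebra with the roles of `E` and `F` exchanged. -/
def swap : SlAlg R where
  E := S.F
  F := S.E
  G d u := S.G d (-u)
  E_mul := S.F_mul
  F_mul := S.E_mul
  E_mem h := by have := S.F_mem h; rwa [show ∀ u : ℤ, -(u + 2) = -u - 2 by intro u; ring]
  F_mem h := by have := S.E_mem h; rwa [show ∀ u : ℤ, -(u - 2) = -u + 2 by intro u; ring]
  comm h := by have := S.comm h; push_cast at this; rw [this]; module
  bdd d := by
    obtain ⟨N, h⟩ := S.bdd d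
    exact ⟨N, fun u hu => h _ (by rwa [abs_neg])⟩
  fin d u := S.fin d (-u)
  mul_mem h h' := by have := S.mul_mem h h'; rwa [neg_add]
  odd h := S.odd h.neg
  zero h := S.zero (neg_ne_zero.2 h)
  const h := S.const (by rwa [neg_zero] at h)

/-- Highest weight vectors. -/
def A (d : ℕ × ℕ × ℕ) (u : ℤ) : Submodule ℂ R := S.G d u ⊓ LinearMap.ker S.E

variable {S} {d d' d₁ d₂ : ℕ × ℕ × ℕ} {u u' : ℤ} {x y z : R}

lemma mem_A : x ∈ S.A d u ↔ x ∈ S.G d u ∧ S.E x = 0 := by simp [A]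

lemma A_le : S.A d u ≤ S.G d u := inf_le_left

lemma A_mul (hx : x ∈ S.A d u) (hy : y ∈ S.A d' u') : x * y ∈ S.A (d + d') (u + u') := by
  rw [mem_A] at *
  exact ⟨S.mul_mem hx.1 hy.1, by rw [S.E_mul, hx.2, hy.2]; ring⟩

lemma Fpow_succ (i : ℕ) (x : R) : (S.F ^ (i + 1)) x = S.F ((S.F ^ i) x) := by
  rw [pow_succ', Module.End.mul_apply]

lemma Epow_succ (i : ℕ) (x : R) : (S.E ^ (i + 1)) x = S.E ((S.E ^ i) x) := by
  rw [pow_succ', Module.End.mul_apply]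

lemma Epow_succ' (i : ℕ) (x : R) : (S.E ^ (i + 1)) x = (S.E ^ i) (S.E x) := by
  rw [pow_succ, Module.End.mul_apply]

lemma Fpow_mem (h : x ∈ S.G d u) (i : ℕ) : (S.F ^ i) x ∈ S.G d (u - 2 * i) := by
  induction i with
  | zero => simpa using h
  | succ i ih =>
    rw [Fpow_succ]
    have := S.F_mem ih
    rwa [show u - 2 * ((i + 1 : ℕ) : ℤ) = u - 2 * i - 2 by push_cast; ring]

lemma Epow_mem (h : x ∈ S.G d u) (i : ℕ) : (S.E ^ i) x ∈ S.G d (u + 2 * i) := by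
  have := Fpow_mem (S := S.swap) (u := -u) (d := d) (x := x)
    (show x ∈ S.G d (- -u) by rwa [neg_neg]) i
  have e : -(-u - 2 * (i : ℤ)) = u + 2 * i := by ring
  rw [← e]
  exact this

lemma E_Fpow (h : x ∈ S.G d u) (i : ℕ) : S.E ((S.F ^ (i + 1)) x) =
    (S.F ^ (i + 1)) (S.E x) + (((i : ℂ) + 1) * (u - i)) • (S.F ^ i) x := by
  induction i with
  | zero => simpa using S.comm h
  | succ i ih =>
    rw [Fpow_succ, S.comm (Fpow_mem h (i + 1)), ih, map_add, map_smul, ← Fpow_succ, ← Fpow_succ]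
    push_cast
    module

lemma exists_Epow_eq_zero (h : x ∈ S.G d u) : ∃ i, (S.E ^ i) x = 0 := by
  obtain ⟨N, hN⟩ := S.bdd d
  refine ⟨N + (-u).toNat + 1, ?_⟩
  have := Epow_mem h (N + (-u).toNat + 1)
  rw [hN _ (by rw [lt_abs]; left; push_cast; omega)] at this
  simpa using this

lemma exists_Fpow_eq_zero (h : x ∈ S.G d u) : ∃ i, (S.F ^ i) x = 0 :=
  exists_Epow_eq_zero (S := S.swap) (u := -u) (d := d) (show x ∈ S.G d (- -u) by rwa [neg_neg])

/-- `E F` maps each piece of positive weight onto itself. -/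
lemma EF_surj (hu : 1 ≤ u) (h : x ∈ S.G d u) : ∃ y ∈ S.G d u, S.E (S.F y) = x := by
  obtain ⟨n, hn⟩ := exists_Epow_eq_zero h
  have key : ∀ j ≤ n, ∃ y ∈ S.G d u, S.E (S.F y) = (S.F ^ (n - j)) ((S.E ^ (n - j)) x) := by
    intro j
    induction j with
    | zero => intro _; exact ⟨0, zero_mem _, by simp [hn]⟩
    | succ j ih =>
      intro hj
      obtain ⟨y, hy, e⟩ := ih (by omega)
      obtain ⟨i, hi⟩ : ∃ i, i = n - (j + 1) := ⟨_, rfl⟩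
      rw [show n - j = i + 1 by omega] at e
      rw [← hi]
      have hE := Epow_mem h i
      have e1 := E_Fpow hE i
      have hc : ((i : ℂ) + 1) * (((u + 2 * i : ℤ) : ℂ) - i) ≠ 0 := by
        have : ((((i : ℤ) + 1) * (u + 2 * i - i) : ℤ) : ℂ) ≠ 0 := by
          rw [Int.cast_ne_zero]
          refine mul_ne_zero (by omega) (by omega)
        simpa using this
      refine ⟨(((i : ℂ) + 1) * (((u + 2 * i : ℤ) : ℂ) - i))⁻¹ • ((S.F ^ i) ((S.E ^ i) x) - y),
        Submodule.smul_mem _ _ (sub_mem ?_ hy), ?_⟩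
      · have := Fpow_mem hE i
        rwa [show u + 2 * (i : ℤ) - 2 * i = u by ring] at this
      · rw [map_smul, map_smul, map_sub, map_sub, e, ← Fpow_succ, e1, ← Epow_succ,
          add_sub_cancel_left, smul_smul, inv_mul_cancel₀ hc, one_smul]
  simpa using key n le_rfl

lemma FE_surj (hu : u ≤ -1) (h : x ∈ S.G d u) : ∃ y ∈ S.G d u, S.F (S.E y) = x := by
  have := EF_surj (S := S.swap) (u := -u) (d := d) (x := x) (by omega)
    (show x ∈ S.G d (- -u) by rwa [neg_neg])
  obtain ⟨y, hy, e⟩ := this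
  refine ⟨y, ?_, e⟩
  have : y ∈ S.G d (- -u) := hy
  rwa [neg_neg] at this

lemma EFpow (h : x ∈ S.A d u) (i : ℕ) :
    S.E ((S.F ^ (i + 1)) x) = (((i : ℂ) + 1) * (u - i)) • (S.F ^ i) x := by
  rw [E_Fpow (A_le h), (mem_A.1 h).2, map_zero, zero_add]

lemma A_neg (hu : u < 0) (h : x ∈ S.A d u) : x = 0 := by
  obtain ⟨n, hn⟩ := exists_Fpow_eq_zero (A_le h)
  have key : ∀ j ≤ n, (S.F ^ (n - j)) x = 0 := by
    intro j
    induction j with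
    | zero => intro _; simpa using hn
    | succ j ih =>
      intro hj
      have e := ih (by omega)
      obtain ⟨i, hi⟩ : ∃ i, i = n - (j + 1) := ⟨_, rfl⟩
      rw [show n - j = i + 1 by omega] at e
      rw [← hi]
      have e1 := EFpow h i
      rw [e, map_zero] at e1
      refine (smul_eq_zero.1 e1.symm).resolve_left ?_
      have : ((((i : ℤ) + 1) * (u - i) : ℤ) : ℂ) ≠ 0 := by
        rw [Int.cast_ne_zero]
        refine mul_ne_zero (by omega) (by omega)
      simpa using this
  simpa using key n le_rfl

lemma Fpow_eq_zero {k : ℕ} (h : x ∈ S.A d k) : (S.F ^ (k + 1)) x = 0 := by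
  have h1 := Fpow_mem (A_le h) (k + 1)
  refine A_neg (S := S) (d := d) (u := k - 2 * (k + 1 : ℕ)) (by push_cast; omega) (mem_A.2 ⟨h1, ?_⟩)
  rw [EFpow h]
  simp

lemma Fpow_eq_zero_of_lt {k i : ℕ} (h : x ∈ S.A d k) (hi : k < i) : (S.F ^ i) x = 0 := by
  obtain ⟨j, rfl⟩ := Nat.exists_eq_add_of_lt hi
  rw [show k + j + 1 = j + (k + 1) by ring, pow_add, Module.End.mul_apply, Fpow_eq_zero h, map_zero]

lemma exists_A_add_F (h : x ∈ S.G d u) : ∃ y ∈ S.A d u, ∃ z ∈ S.G d (u + 2), x = y + S.F z := by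
  rcases le_or_gt 0 u with hu | hu
  · obtain ⟨z, hz, e⟩ := EF_surj (by omega) (S.E_mem h)
    have hF := S.F_mem hz
    rw [show u + 2 - 2 = u by ring] at hF
    exact ⟨x - S.F z, mem_A.2 ⟨sub_mem h hF, by rw [map_sub, e, sub_self]⟩, z, hz, by ring⟩
  · obtain ⟨z, hz, e⟩ := FE_surj (by omega) h
    exact ⟨0, zero_mem _, S.E z, S.E_mem hz, by rw [e, zero_add]⟩

lemma exists_decomp (h : x ∈ S.G d u) : ∃ (n : ℕ) (f : ℕ → R),
    (∀ s : ℕ, f s ∈ S.A d (u + 2 * s)) ∧ x = ∑ s ∈ Finset.range n, (S.F ^ s) (f s) := by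
  obtain ⟨N, hN⟩ := S.bdd d
  have key : ∀ m : ℕ, ∀ u x, x ∈ S.G d u → (N : ℤ) < u + 2 * m → ∃ (n : ℕ) (f : ℕ → R),
      (∀ s : ℕ, f s ∈ S.A d (u + 2 * s)) ∧ x = ∑ s ∈ Finset.range n, (S.F ^ s) (f s) := by
    intro m
    induction m with
    | zero =>
      intro u x h hu
      rw [hN u (by rw [lt_abs]; left; simpa using hu)] at h
      exact ⟨0, fun _ => 0, fun _ => zero_mem _, by simpa using h⟩
    | succ m ih =>
      intro u x h hu
      obtain ⟨y, hy, z, hz, rfl⟩ := exists_A_add_F h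
      obtain ⟨n, f, hf, rfl⟩ := ih _ _ hz (by push_cast at hu; omega)
      refine ⟨n + 1, fun s => Nat.casesOn s y f, ?_, ?_⟩
      · rintro (_ | s)
        · simpa using hy
        · have := hf s
          rwa [show u + 2 + 2 * (s : ℤ) = u + 2 * ((s + 1 : ℕ) : ℤ) by push_cast; ring] at this
      · rw [Finset.sum_range_succ', map_sum, add_comm]
        simp only [Fpow_succ, pow_zero, Module.End.one_apply]
        rfl
  exact key (N + (-u).toNat + 1) u x h (by push_cast; omega)

lemma EpowFpow (h : x ∈ S.A d u) (s : ℕ) :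
    (S.E ^ s) ((S.F ^ s) x) = (∏ i ∈ Finset.range s, ((i : ℂ) + 1) * (u - i)) • x := by
  induction s with
  | zero => simp
  | succ s ih =>
    rw [Epow_succ', EFpow h, map_smul, ih, Finset.prod_range_succ, smul_smul, mul_comm]

lemma EpowFpow_lt (h : x ∈ S.A d u) {s t : ℕ} (hst : s < t) : (S.E ^ t) ((S.F ^ s) x) = 0 := by
  obtain ⟨j, rfl⟩ := Nat.exists_eq_add_of_lt hst
  rw [show s + j + 1 = (j + 1) + s by ring, pow_add, Module.End.mul_apply, EpowFpow h, map_smul,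
    Epow_succ', (mem_A.1 h).2, map_zero, smul_zero]

lemma Fpow_eq_zero_of_Epow (h : x ∈ S.A d u) {s : ℕ} (e : (S.E ^ s) ((S.F ^ s) x) = 0) :
    (S.F ^ s) x = 0 := by
  rcases lt_or_ge u 0 with hu | hu
  · rw [A_neg hu h, map_zero]
  lift u to ℕ using hu
  rcases lt_or_ge u s with hs | hs
  · exact Fpow_eq_zero_of_lt h hs
  rw [EpowFpow h] at e
  rw [(smul_eq_zero.1 e).resolve_left, map_zero]
  refine Finset.prod_ne_zero_iff.2 ?_
  intro i hi
  have hi := Finset.mem_range.1 hi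
  have : ((((i : ℤ) + 1) * (u - i) : ℤ) : ℂ) ≠ 0 := by
    rw [Int.cast_ne_zero]
    refine mul_ne_zero (by omega) (by omega)
  simpa using this

/-- A vector killed by `E ^ m` is a sum of `F ^ s h` with `s < m`, `h` of highest weight. -/
lemma exists_decomp_lt (h : x ∈ S.G d u) {m : ℕ} (hm : (S.E ^ m) x = 0) : ∃ f : ℕ → R,
    (∀ s : ℕ, f s ∈ S.A d (u + 2 * s)) ∧ x = ∑ s ∈ Finset.range m, (S.F ^ s) (f s) := by
  obtain ⟨n, f, hf, e⟩ := exists_decomp h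
  have key : ∀ k, x = ∑ s ∈ Finset.range (m + k), (S.F ^ s) (f s) →
      x = ∑ s ∈ Finset.range m, (S.F ^ s) (f s) := by
    intro k
    induction k with
    | zero => exact id
    | succ k ih =>
      intro e
      apply ih
      rw [← add_assoc, Finset.sum_range_succ] at e
      have e0 : (S.E ^ (m + k)) x = 0 := by
        rw [add_comm, pow_add, Module.End.mul_apply, hm, map_zero]
      rw [e, map_add, map_sum, Finset.sum_eq_zero, zero_add] at e0
      · rw [Fpow_eq_zero_of_Epow (hf _) e0, add_zero] at e
        exact e
      · intro s hs
        exact EpowFpow_lt (hf s) (Finset.mem_range.1 hs)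
  rcases le_or_gt n m with hnm | hnm
  · refine ⟨fun s => if s < n then f s else 0, fun s => ?_, ?_⟩
    · dsimp only
      split_ifs
      · exact hf s
      · exact zero_mem _
    · rw [e]
      obtain ⟨k, rfl⟩ := Nat.exists_eq_add_of_le hnm
      rw [Finset.sum_range_add]
      rw [Finset.sum_congr rfl (g := fun s => (S.F ^ s) (if s < n then f s else 0))]
      · simp
      · intro s hs; rw [if_pos (Finset.mem_range.1 hs)]
  · obtain ⟨k, rfl⟩ := Nat.exists_eq_add_of_lt hnm
    exact ⟨f, hf, key (k + 1) e⟩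

lemma A_inf_F (hu : 0 ≤ u) (hz : z ∈ S.G d (u + 2)) (h : S.E (S.F z) = 0) : z = 0 := by
  have := S.fin d (u + 2)
  let T : S.G d (u + 2) →ₗ[ℂ] S.G d (u + 2) := (S.E ∘ₗ S.F).restrict (by
    intro x hx
    have := S.E_mem (S.F_mem hx)
    rwa [sub_add_cancel] at this)
  have hs : Function.Surjective T := by
    rintro ⟨x, hx⟩
    obtain ⟨y, hy, e⟩ := EF_surj (by omega) hx
    exact ⟨⟨y, hy⟩, Subtype.ext e⟩
  have hi := LinearMap.injective_iff_surjective.2 hs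
  have : T ⟨z, hz⟩ = 0 := Subtype.ext h
  have := hi (this.trans (map_zero T).symm)
  exact congrArg Subtype.val this

lemma finrank_A (hu : 0 ≤ u) : Module.finrank ℂ (S.A d u) + Module.finrank ℂ (S.G d (u + 2)) =
    Module.finrank ℂ (S.G d u) := by
  have := S.fin d u
  have := S.fin d (u + 2)
  let T : S.G d u →ₗ[ℂ] S.G d (u + 2) := S.E.restrict (fun x hx => S.E_mem hx)
  have hs : LinearMap.range T = ⊤ := by
    rw [LinearMap.range_eq_top]
    rintro ⟨x, hx⟩
    obtain ⟨y, hy, e⟩ := EF_surj (by omega) hx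
    have := S.F_mem hy
    rw [add_sub_cancel_right] at this
    exact ⟨⟨S.F y, this⟩, Subtype.ext e⟩
  have h1 := LinearMap.finrank_range_add_finrank_ker T
  rw [hs, finrank_top] at h1
  rw [← h1, add_comm]
  congr 1
  have e : (LinearMap.ker T).map (S.G d u).subtype = S.A d u := by
    ext x
    constructor
    · rintro ⟨y, hy, rfl⟩
      exact mem_A.2 ⟨y.2, congrArg Subtype.val (LinearMap.mem_ker.1 hy)⟩
    · intro hx
      exact ⟨⟨x, A_le hx⟩, LinearMap.mem_ker.2 (Subtype.ext (mem_A.1 hx).2), rfl⟩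
  rw [← e]
  exact Submodule.finrank_map_subtype_eq (S.G d u) (LinearMap.ker T)
end SlAlg

namespace SlAlg

variable {R : Type} [CommRing R] [Algebra ℂ R]

/-- Decomposable highest weight vectors. -/
def Q (S : SlAlg R) (d : ℕ × ℕ × ℕ) (u : ℤ) : Submodule ℂ R :=
  Submodule.span ℂ {t | ∃ d₁ d₂ u₁ u₂, d₁ ≠ 0 ∧ d₂ ≠ 0 ∧ d₁ + d₂ = d ∧ u₁ + u₂ = u ∧
    ∃ x ∈ S.A d₁ u₁, ∃ y ∈ S.A d₂ u₂, t = x * y}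

/-- Decomposable highest weight vectors modulo the image of `F`. -/
def W (S : SlAlg R) (d : ℕ × ℕ × ℕ) (u : ℤ) : Submodule ℂ R := S.Q d u ⊔ (S.G d (u + 2)).map S.F

/-- All highest weight vectors of the given degree and order are decomposable. -/
def Red (S : SlAlg R) (d : ℕ × ℕ × ℕ) (p : ℕ) : Prop := S.A d p ≤ S.Q d p

variable {S : SlAlg R} {d d' d₁ d₂ d₃ : ℕ × ℕ × ℕ} {u u' u₁ u₂ : ℤ} {x y z : R}

lemma Q_le : S.Q d u ≤ S.A d u := by
  refine Submodule.span_le.2 ?_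
  rintro _ ⟨d₁, d₂, u₁, u₂, -, -, rfl, rfl, x, hx, y, hy, rfl⟩
  exact A_mul hx hy

lemma mem_Q_of_W (hu : 0 ≤ u) (hx : x ∈ S.A d u) (h : x ∈ S.W d u) : x ∈ S.Q d u := by
  obtain ⟨q, hq, _, ⟨z, hz, rfl⟩, rfl⟩ := Submodule.mem_sup.1 h
  have h1 := (mem_A.1 hx).2
  rw [map_add, (mem_A.1 (Q_le hq)).2, zero_add] at h1
  rw [A_inf_F hu hz h1, map_zero, add_zero]
  exact hq

lemma mul_mem_Q (h₁ : d₁ ≠ 0) (h₂ : d₂ ≠ 0) (hx : x ∈ S.A d₁ u₁) (hy : y ∈ S.A d₂ u₂) :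
    x * y ∈ S.Q (d₁ + d₂) (u₁ + u₂) :=
  Submodule.subset_span ⟨_, _, _, _, h₁, h₂, rfl, rfl, x, hx, y, hy, rfl⟩

lemma mem_W_of_Q (h : x ∈ S.Q d u) : x ∈ S.W d u := Submodule.mem_sup_left h

lemma F_mem_W (h : x ∈ S.G d u') (e : u' = u + 2) : S.F x ∈ S.W d u :=
  Submodule.mem_sup_right ⟨x, e ▸ h, rfl⟩

lemma move (hx : x ∈ S.G d₁ u₁) (hy : y ∈ S.G d₂ u₂) (s : ℕ) (hd : d₁ + d₂ = d)
    (hu : u₁ + u₂ = u + 2 * s) :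
    (S.F ^ s) x * y - (-1) ^ s * (x * (S.F ^ s) y) ∈ S.W d u := by
  subst hd
  induction s generalizing u₂ y with
  | zero => simp
  | succ s ih =>
    have h1 := ih (S.F_mem hy) (by push_cast at hu; linarith)
    have h2 := F_mem_W (S := S) (S.mul_mem (Fpow_mem hx s) hy) (u := u) (by push_cast at hu; linarith)
    rw [S.F_mul] at h2
    have h3 := sub_mem h2 h1
    rw [← Module.End.mul_apply (S.F ^ s), ← pow_succ] at h3
    rw [Fpow_succ]
    convert h3 using 1
    ring

lemma neg_one_pow_mul_mem {V : Submodule ℂ R} (s : ℕ) : (-1) ^ s * x ∈ V ↔ x ∈ V := by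
  rcases neg_one_pow_eq_or R s with h | h <;> rw [h] <;> simp

lemma int_mul_mem {V : Submodule ℂ R} (m : ℤ) (h : x ∈ V) : (m : R) * x ∈ V := by
  rw [← zsmul_eq_mul]; exact V.toAddSubgroup.zsmul_mem h m

lemma of_int_mul_mem {V : Submodule ℂ R} (m : ℤ) (hm : m ≠ 0) (h : (m : R) * x ∈ V) : x ∈ V := by
  have e : x = ((m : ℂ))⁻¹ • ((m : R) * x) := by
    rw [← zsmul_eq_mul, ← Int.cast_smul_eq_zsmul ℂ, smul_smul, inv_mul_cancel₀ (by exact_mod_cast hm),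
      one_smul]
  rw [e]
  exact V.smul_mem _ h

lemma move_iff (hx : x ∈ S.G d₁ u₁) (hy : y ∈ S.G d₂ u₂) (s : ℕ) (hd : d₁ + d₂ = d)
    (hu : u₁ + u₂ = u + 2 * s) : (S.F ^ s) x * y ∈ S.W d u ↔ x * (S.F ^ s) y ∈ S.W d u := by
  have h := move hx hy s hd hu
  rw [← neg_one_pow_mul_mem s (x := x * _)]
  constructor
  · intro h1; simpa using sub_mem h1 h
  · intro h1; simpa using add_mem h h1

lemma A_odd (hu : Odd u) (hx : x ∈ S.A d u) : x = 0 := by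
  have := A_le hx
  rwa [S.odd hu, Submodule.mem_bot] at this

/-- Sums defining transvectants are highest weight vectors. -/
lemma transvectant_mem {p n i : ℕ} (hx : x ∈ S.A d₁ p) (hy : y ∈ S.A d₂ n) (c : ℕ → ℂ)
    (hc : ∀ l < i, c (l + 1) * ((l + 1) * (p - l)) + c l * ((i - l) * (n - i + l + 1)) = 0) :
    ∑ l ∈ Finset.range (i + 1), c l • ((S.F ^ l) x * (S.F ^ (i - l)) y) ∈
      S.A (d₁ + d₂) (p + n - 2 * i) := by
  rw [mem_A]
  constructor
  · refine Submodule.sum_mem _ fun l hl => Submodule.smul_mem _ _ ?_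
    have hl := Finset.mem_range.1 hl
    have := S.mul_mem (Fpow_mem (A_le hx) l) (Fpow_mem (A_le hy) (i - l))
    rwa [show (p : ℤ) - 2 * l + (n - 2 * ((i - l : ℕ) : ℤ)) = p + n - 2 * i by omega] at this
  · simp only [map_sum, map_smul, S.E_mul, smul_add, Finset.sum_add_distrib]
    rw [Finset.sum_range_succ', Finset.sum_range_succ (n := i)]
    simp only [pow_zero, Module.End.one_apply, (mem_A.1 hx).2, (mem_A.1 hy).2, Nat.sub_self,
      zero_mul, mul_zero, smul_zero, add_zero]
    rw [← Finset.sum_add_distrib]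
    refine Finset.sum_eq_zero fun l hl => ?_
    have hl := Finset.mem_range.1 hl
    obtain ⟨k, rfl⟩ := Nat.exists_eq_add_of_lt hl
    rw [show l + k + 1 - l = k + 1 by omega, show l + k + 1 - (l + 1) = k by omega, EFpow hx, EFpow hy,
      smul_mul_assoc, mul_smul_comm, smul_smul, smul_smul, ← add_smul]
    have := hc l hl
    push_cast at this
    rw [show c (l + 1) * (((l : ℂ) + 1) * ((p : ℤ) - l)) + c l * (((k : ℂ) + 1) * ((n : ℤ) - k)) = 0 by
      rw [← this]; push_cast; ring, zero_smul]

lemma mul_F_mem {p q n : ℕ} (h₁ : d₁ ≠ 0) (h₂ : d₂ ≠ 0) (h₃ : d₃ ≠ 0) (hx : x ∈ S.A d₁ p)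
    (hy : y ∈ S.A d₂ q) (hz : z ∈ S.A d₃ n) (hd : d₁ + d₂ + d₃ = d) (hu : (p + q + n : ℤ) = u + 2) :
    x * y * S.F z ∈ S.W d u := by
  rcases Nat.eq_zero_or_pos n with rfl | hn
  · have := Fpow_eq_zero hz
    simp only [zero_add, pow_one] at this
    simp [this]
  have br : ∀ {p q : ℕ} {d₁ d₂ d₃ : ℕ × ℕ × ℕ} {x y z : R}, d₁ ≠ 0 → d₂ ≠ 0 → d₃ ≠ 0 →
      x ∈ S.A d₁ p → y ∈ S.A d₂ q → z ∈ S.A d₃ n → d₁ + d₂ + d₃ = d → (p + q + n : ℤ) = u + 2 →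
      y * ((n : R) * (S.F x * z) - (p : R) * (x * S.F z)) ∈ S.W d u := by
    intro p q d₁ d₂ d₃ x y z h₁ h₂ h₃ hx hy hz hd hu
    have ht := transvectant_mem (i := 1) hx hz (fun l => Nat.casesOn l (-p : ℂ) (fun _ => n))
      (by intro l hl; obtain rfl : l = 0 := by omega
          simp; ring)
    have hq := mem_W_of_Q (mul_mem_Q h₂ (by simp [h₁]) hy ht)
    rw [show d₂ + (d₁ + d₃) = d by rw [← hd]; abel,
      show (q : ℤ) + (p + n - 2 * (1 : ℕ)) = u by push_cast; linarith] at hq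
    convert hq using 1
    simp [Finset.sum_range_succ, Algebra.smul_def]
    ring
  have t1 := br h₁ h₂ h₃ hx hy hz hd hu
  have t2 := br h₂ h₁ h₃ hy hx hz (by rw [← hd]; abel) (by rw [← hu]; ring)
  have t3 := F_mem_W (S := S) (A_le (A_mul (A_mul hx hy) hz)) hu
  rw [hd] at t3
  refine of_int_mul_mem (p + q + n) (by positivity) ?_
  convert sub_mem (sub_mem (int_mul_mem n t3) t1) t2 using 1
  rw [S.F_mul, S.F_mul]
  push_cast
  ring

lemma mul_FF_mem {p q n : ℕ} (h₁ : d₁ ≠ 0) (h₂ : d₂ ≠ 0) (h₃ : d₃ ≠ 0) (hx : x ∈ S.A d₁ p)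
    (hy : y ∈ S.A d₂ q) (hz : z ∈ S.A d₃ n) (hd : d₁ + d₂ + d₃ = d) (hu : (p + q + n : ℤ) = u + 4) :
    x * y * S.F (S.F z) ∈ S.W d u := by
  have F0 : ∀ {d : ℕ × ℕ × ℕ} {x : R}, x ∈ S.A d (0 : ℕ) → S.F x = 0 := by
    intro d x hx
    simpa using Fpow_eq_zero hx
  rcases Nat.lt_or_ge n 2 with hn | hn
  · have := Fpow_eq_zero_of_lt (i := 2) hz (by omega)
    rw [Fpow_succ, pow_one] at this
    simp [this]
  rcases Nat.even_or_odd p with ⟨p', hp⟩ | hp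
  swap
  · rw [A_odd (by exact_mod_cast hp) hx]; simp
  rcases Nat.even_or_odd q with ⟨q', hq⟩ | hq
  swap
  · rw [A_odd (by exact_mod_cast hq) hy]; simp
  have br : ∀ {p q n : ℕ} {d₁ d₂ d₃ : ℕ × ℕ × ℕ} {x y z : R}, d₁ ≠ 0 → d₂ ≠ 0 → d₃ ≠ 0 →
      x ∈ S.A d₁ p → y ∈ S.A d₂ q → z ∈ S.A d₃ n → d₁ + d₂ + d₃ = d → (p + q + n : ℤ) = u + 4 →
      y * ((n : R) * (n - 1) * (S.F (S.F x) * z) - 2 * ((p : R) - 1) * (n - 1) * (S.F x * S.F z) +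
        (p : R) * (p - 1) * (x * S.F (S.F z))) ∈ S.W d u := by
    intro p q n d₁ d₂ d₃ x y z h₁ h₂ h₃ hx hy hz hd hu
    have ht := transvectant_mem (i := 2) hx hz (fun l => if l = 0 then (p : ℂ) * (p - 1) else
        if l = 1 then - 2 * ((p : ℂ) - 1) * (n - 1) else (n : ℂ) * (n - 1))
      (by intro l hl
          interval_cases l <;> simp <;> ring)
    have hq := mem_W_of_Q (mul_mem_Q h₂ (by simp [h₁]) hy ht)
    rw [show d₂ + (d₁ + d₃) = d by rw [← hd]; abel,
      show (q : ℤ) + (p + n - 2 * (2 : ℕ)) = u by push_cast; linarith] at hq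
    convert hq using 1
    have h2 : algebraMap ℂ R 2 = 2 := map_ofNat _ 2
    simp [Finset.sum_range_succ, Algebra.smul_def, Fpow_succ, h2]
    ring
  have hx' := S.F_mem (A_le hx)
  have hy' := S.F_mem (A_le hy)
  have hz' := S.F_mem (A_le hz)
  have r1 := F_mem_W (S := S) (u := u) (S.mul_mem (S.mul_mem hx' (A_le hy)) (A_le hz)) (by linarith)
  have r2 := F_mem_W (S := S) (u := u) (S.mul_mem (S.mul_mem (A_le hx) hy') (A_le hz)) (by linarith)
  have r3 := F_mem_W (S := S) (u := u) (S.mul_mem (S.mul_mem (A_le hx) (A_le hy)) hz') (by linarith)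
  rw [hd, S.F_mul, S.F_mul] at r1 r2 r3
  have b1 := br h₁ h₂ h₃ hx hy hz hd hu
  have b2 := br h₂ h₁ h₃ hy hx hz (by rw [← hd]; abel) (by rw [← hu]; ring)
  have b3 := br h₁ h₃ h₂ hx hz hy (by rw [← hd]; abel) (by rw [← hu]; ring)
  rcases Nat.eq_zero_or_pos p with rfl | hp0
  · rw [F0 hx] at r1 r2 r3
    rcases Nat.eq_zero_or_pos q with rfl | hq0
    · rw [F0 hy] at r1 r2 r3
      simpa using r3
    · refine of_int_mul_mem ((n + q - 1) * (n + q - 2)) (mul_ne_zero (by omega) (by omega)) ?_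
      convert add_mem (sub_mem b2 (int_mul_mem ((n : ℤ) * (n - 1)) r2))
        (int_mul_mem ((n : ℤ) * (n - 1) + 2 * (q - 1) * (n - 1)) r3) using 1
      push_cast
      ring
  rcases Nat.eq_zero_or_pos q with rfl | hq0
  · rw [F0 hy] at r1 r2 r3
    refine of_int_mul_mem ((n + p - 1) * (n + p - 2)) (mul_ne_zero (by omega) (by omega)) ?_
    convert add_mem (sub_mem b1 (int_mul_mem ((n : ℤ) * (n - 1)) r1))
      (int_mul_mem ((n : ℤ) * (n - 1) + 2 * (p - 1) * (n - 1)) r3) using 1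
    push_cast
    ring
  obtain ⟨a, rfl⟩ : ∃ a, p = a + 2 := ⟨p - 2, by omega⟩
  obtain ⟨b, rfl⟩ : ∃ b, q = b + 2 := ⟨q - 2, by omega⟩
  obtain ⟨c, rfl⟩ : ∃ c, n = c + 2 := ⟨n - 2, by omega⟩
  refine of_int_mul_mem ((a + 1) * (b + 1) * ((c + 1) * (c + 2) +
    (a + b + 3) * (2 * (c + 1) + a + b + 4))) (by positivity) ?_
  convert add_mem (sub_mem (sub_mem (add_mem (int_mul_mem ((a + 1) * (a + b + 3)) b2)
    (int_mul_mem ((b + 1) * (a + b + 3)) b1)) (int_mul_mem ((c + 1) * (c + 2)) b3))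
    (int_mul_mem ((a + 1) * (b + 1) * (c + 1) * (c + 2)) (sub_mem (add_mem r1 r2) r3)))
    (int_mul_mem (2 * (a + 1) * (b + 1) * (c + 1) * (a + b + 3)) r3) using 1
  push_cast
  ring

lemma mul_Fpow_mem {p q n j : ℕ} (hj : j ≤ 2) (h₁ : d₁ ≠ 0) (h₂ : d₂ ≠ 0) (h₃ : d₃ ≠ 0)
    (hx : x ∈ S.A d₁ p) (hy : y ∈ S.A d₂ q) (hz : z ∈ S.A d₃ n) (hd : d₁ + d₂ + d₃ = d)
    (hu : (p + q + n : ℤ) = u + 2 * j) : x * y * (S.F ^ j) z ∈ S.W d u := by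
  interval_cases j
  · have := mul_mem_Q (by simp [h₁]) h₃ (A_mul hx hy) hz
    rw [hd, show (p + q + n : ℤ) = u by rw [hu]; simp] at this
    exact mem_W_of_Q (by simpa using this)
  · simpa using mul_F_mem h₁ h₂ h₃ hx hy hz hd (by simpa using hu)
  · rw [Fpow_succ, pow_one]
    exact mul_FF_mem h₁ h₂ h₃ hx hy hz hd (by rw [hu]; norm_num)

lemma Red.mul_Fpow_mem {p q j : ℕ} (h : S.Red d₁ p) (h₂ : d₂ ≠ 0) (hj : j ≤ 2) (hx : x ∈ S.A d₁ p)
    (hy : y ∈ S.A d₂ q) (hd : d₁ + d₂ = d) (hu : (p + q : ℤ) = u + 2 * j) :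
    x * (S.F ^ j) y ∈ S.W d u := by
  refine Submodule.span_induction (p := fun x _ => x * (S.F ^ j) y ∈ S.W d u) ?_ ?_ ?_ ?_ (h hx)
  · rintro _ ⟨e₁, e₂, u₁, u₂, he₁, he₂, rfl, hu', x, hx, z, hz, rfl⟩
    rcases lt_or_ge u₁ 0 with h1 | h1
    · simp [A_neg h1 hx]
    rcases lt_or_ge u₂ 0 with h2 | h2
    · simp [A_neg h2 hz]
    lift u₁ to ℕ using h1
    lift u₂ to ℕ using h2
    exact SlAlg.mul_Fpow_mem hj he₁ he₂ h₂ hx hz hy hd (by rw [hu', hu])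
  · simp
  · intro a b _ _ ha hb; rw [add_mul]; exact add_mem ha hb
  · intro c a _ ha; rw [smul_mul_assoc]; exact Submodule.smul_mem _ _ ha
end SlAlg

namespace SlAlg

variable {R : Type} [CommRing R] [Algebra ℂ R]
variable {S : SlAlg R} {d d' d₁ d₂ e : ℕ × ℕ × ℕ} {u : ℤ} {x y : R}

lemma exists_EpowFpow {k m : ℕ} (hx : x ∈ S.A d k) (hm : m ≤ k) :
    ∃ c : ℕ, 0 < c ∧ (S.E ^ m) ((S.F ^ m) x) = (c : ℂ) • x := by
  refine ⟨∏ i ∈ Finset.range m, (i + 1) * (k - i), Finset.prod_pos fun i hi => ?_, ?_⟩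
  · have := Finset.mem_range.1 hi
    exact Nat.mul_pos (by omega) (by omega)
  · rw [EpowFpow hx, Nat.cast_prod]
    congr 1
    refine Finset.prod_congr rfl fun i hi => ?_
    have := Finset.mem_range.1 hi
    rw [Nat.cast_mul, Nat.cast_sub (by omega)]
    push_cast
    ring

lemma exists_Epow_mul {p q : ℕ} (hx : x ∈ S.A d₁ p) (hy : y ∈ S.A d₂ q) (m : ℕ) :
    ∀ l j, l + j = m → l ≤ p → j ≤ q → ∃ c : ℕ, 0 < c ∧
      (S.E ^ m) ((S.F ^ l) x * (S.F ^ j) y) = (c : ℂ) • (x * y) := by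
  induction m with
  | zero =>
    intro l j h _ _
    obtain ⟨rfl, rfl⟩ : l = 0 ∧ j = 0 := by omega
    exact ⟨1, one_pos, by simp⟩
  | succ m ih =>
    intro l j h hl hj
    have aux : ∀ {k : ℕ} {d} {x : R} (s : ℕ), x ∈ S.A d k → s + 1 ≤ k →
        S.E ((S.F ^ (s + 1)) x) = (((s + 1) * (k - s) : ℕ) : ℂ) • (S.F ^ s) x := by
      intro k d x s hx hs
      rw [EFpow hx, Nat.cast_mul, Nat.cast_sub (by omega)]
      push_cast
      rfl
    rw [Epow_succ', S.E_mul, map_add]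
    rcases l with _ | l
    · rcases j with _ | j
      · omega
      obtain ⟨c, hc, e⟩ := ih 0 j (by omega) hl (by omega)
      refine ⟨(j + 1) * (q - j) * c, Nat.mul_pos (Nat.mul_pos (by omega) (by omega)) hc, ?_⟩
      rw [pow_zero, Module.End.one_apply] at e ⊢
      rw [aux j hy hj, mul_smul_comm, map_smul, e, (mem_A.1 hx).2, zero_mul, map_zero, zero_add,
        smul_smul, Nat.cast_mul ((j + 1) * (q - j))]
    · obtain ⟨c, hc, e⟩ := ih l j (by omega) (by omega) hj
      rcases j with _ | j
      · refine ⟨(l + 1) * (p - l) * c, Nat.mul_pos (Nat.mul_pos (by omega) (by omega)) hc, ?_⟩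
        rw [pow_zero, Module.End.one_apply] at e ⊢
        rw [aux l hx hl, smul_mul_assoc, map_smul, e, (mem_A.1 hy).2, mul_zero, map_zero, add_zero,
          smul_smul, Nat.cast_mul ((l + 1) * (p - l))]
      · obtain ⟨c', hc', e'⟩ := ih (l + 1) j (by omega) hl (by omega)
        refine ⟨(l + 1) * (p - l) * c + (j + 1) * (q - j) * c',
          Nat.add_pos_left (Nat.mul_pos (Nat.mul_pos (by omega) (by omega)) hc) _, ?_⟩
        rw [aux l hx hl, aux j hy hj, smul_mul_assoc, mul_smul_comm, map_smul, map_smul, e, e',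
          smul_smul, smul_smul, ← add_smul, Nat.cast_add, Nat.cast_mul ((l + 1) * (p - l)),
          Nat.cast_mul ((j + 1) * (q - j))]

/-- A product `P Q F^(i+j) f` is, modulo decomposable vectors and the image of `F`, a combination of
terms with fewer applications of `F` to `f`, if `(f, P)_i F^j Q` is decomposable. -/
lemma mul_Fpow_mem_of_transvectant {p q n i j : ℕ} {P Q f : R} (hP : P ∈ S.A d₁ p)
    (hQ : Q ∈ S.A d₂ q) (hf : f ∈ S.A e n) (hip : i ≤ p) (hin : i ≤ n) (hjq : j ≤ q)
    (hd : d₁ + d₂ + e = d) (hu : (p + q + n : ℤ) = u + 2 * (i + j : ℕ))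
    (hZ : ∀ Z ∈ S.A (d₁ + e) (p + n - 2 * i), Z * (S.F ^ j) Q ∈ S.W d u)
    (lower : ∀ s < i + j, ∀ h ∈ S.A (d₁ + d₂) (u - n + 2 * s), h * (S.F ^ s) f ∈ S.W d u) :
    P * Q * (S.F ^ (i + j)) f ∈ S.W d u := by
  have hPQ : P * Q ∈ S.A (d₁ + d₂) ((p + q : ℕ) : ℤ) := by
    have := A_mul hP hQ
    rwa [← Nat.cast_add] at this
  have key : ∀ l ≤ i, ∃ ρ : ℚ, 0 < ρ ∧ (S.F ^ l) P * (S.F ^ j) Q * (S.F ^ (i - l)) f -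
      ((-1) ^ (l + j) * ρ : ℂ) • (P * Q * (S.F ^ (i + j)) f) ∈ S.W d u := by
    intro l hl
    obtain ⟨c, hc, e1⟩ := exists_EpowFpow hPQ (m := l + j) (by omega)
    obtain ⟨c', hc', e2⟩ := exists_Epow_mul hP hQ (l + j) l j rfl (by omega) hjq
    have hG : (S.F ^ l) P * (S.F ^ j) Q ∈ S.G (d₁ + d₂) ((p + q : ℕ) - 2 * (l + j : ℕ)) := by
      have := S.mul_mem (Fpow_mem (A_le hP) l) (Fpow_mem (A_le hQ) j)
      rwa [show (p : ℤ) - 2 * l + (q - 2 * j) = (p + q : ℕ) - 2 * (l + j : ℕ) by push_cast; ring]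
        at this
    obtain ⟨h, hh, e3⟩ := exists_decomp_lt (S := S) (m := l + j) (d := d₁ + d₂)
      (u := (p + q : ℕ) - 2 * (l + j : ℕ))
      (x := (S.F ^ l) P * (S.F ^ j) Q - ((c' : ℂ) / c) • (S.F ^ (l + j)) (P * Q))
      (sub_mem hG (Submodule.smul_mem _ _ (Fpow_mem (A_le hPQ) _)))
      (by
        rw [map_sub, map_smul, e1, e2, smul_smul, div_mul_cancel₀, sub_self]
        exact_mod_cast hc.ne')
    refine ⟨(c' : ℚ) / c, by positivity, ?_⟩
    rw [sub_eq_iff_eq_add] at e3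
    rw [e3, add_mul, add_sub_assoc]
    refine add_mem ?_ ?_
    · rw [Finset.sum_mul]
      refine Submodule.sum_mem _ fun s hs => ?_
      have hs := Finset.mem_range.1 hs
      rw [move_iff (A_le (hh s)) (Fpow_mem (A_le hf) (i - l)) s hd (by push_cast at hu ⊢; omega),
        ← Module.End.mul_apply, ← pow_add]
      refine lower _ (by omega) _ ?_
      have := hh s
      rwa [show (((p + q : ℕ) : ℤ) - 2 * (l + j : ℕ) + 2 * s) = u - n + 2 * (s + (i - l) : ℕ) by
        push_cast at hu ⊢; omega] at this
    · have := move (A_le hPQ) (Fpow_mem (A_le hf) (i - l)) (l + j) hd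
        (u := u) (by push_cast at hu ⊢; omega)
      rw [← Module.End.mul_apply (S.F ^ (l + j)), ← pow_add,
        show l + j + (i - l) = i + j by omega] at this
      have := Submodule.smul_mem _ ((c' : ℂ) / c) this
      rw [smul_sub] at this
      rw [smul_mul_assoc]
      convert this using 2
      rw [Algebra.smul_def, Algebra.smul_def, map_mul, map_pow, map_neg, map_one]
      push_cast
      ring
  choose! ρ hρ hW using key
  let b : ℕ → ℕ := fun l => i.choose l * ((p - l).factorial * (n - i + l).factorial)
  have hZ' := hZ _ (transvectant_mem (i := i) hP hf (fun l => (-1) ^ l * (b l : ℂ)) (by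
    intro l hl
    have h1 : (i.choose (l + 1) : ℂ) * (l + 1) = i.choose l * (i - l) := by
      have := Nat.choose_succ_right_eq i l
      rw [← Nat.cast_sub hl.le]
      exact_mod_cast this
    obtain ⟨k, hk⟩ : ∃ k, p - l = k + 1 := ⟨p - l - 1, by omega⟩
    have h2 : (p : ℂ) - l = k + 1 := by
      rw [← Nat.cast_sub (by omega), hk]; push_cast; ring
    have h3 : (n : ℂ) - i = (n - i : ℕ) := by rw [Nat.cast_sub hin]
    simp only [b, hk, show p - (l + 1) = k by omega, Nat.factorial_succ, ← add_assoc, h2, h3]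
    push_cast
    linear_combination (-1) ^ (l + 1) * (k + 1 : ℂ) * k.factorial *
      ((n - i : ℕ) + l + 1 : ℂ) * (n - i + l).factorial * h1))
  rw [Finset.sum_mul] at hZ'
  have hsum := Submodule.sum_mem (S.W d u) (t := Finset.range (i + 1))
    (f := fun l => ((-1) ^ l * (b l : ℂ)) • ((S.F ^ l) P * (S.F ^ j) Q * (S.F ^ (i - l)) f -
      ((-1) ^ (l + j) * ρ l : ℂ) • (P * Q * (S.F ^ (i + j)) f)))
    fun l hl => Submodule.smul_mem _ _ (hW l (by have := Finset.mem_range.1 hl; omega))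
  have h4 := sub_mem hZ' hsum
  rw [← Finset.sum_sub_distrib] at h4
  have h5 : ∑ l ∈ Finset.range (i + 1), ((-1) ^ j * ((b l * ρ l : ℚ) : ℂ)) •
      (P * Q * (S.F ^ (i + j)) f) ∈ S.W d u := by
    convert h4 using 1
    refine Finset.sum_congr rfl fun l _ => ?_
    rw [smul_sub, smul_smul, smul_mul_assoc, mul_right_comm ((S.F ^ l) P), sub_sub_cancel]
    congr 1
    have : ((-1 : ℂ) ^ l) * (-1) ^ l = 1 := by rw [← mul_pow]; simp
    rw [pow_add]
    push_cast
    linear_combination (-(-1 : ℂ) ^ j * b l * ρ l) * this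
  rw [← Finset.sum_smul, ← Finset.mul_sum, ← Rat.cast_sum] at h5
  have hpos : 0 < ∑ l ∈ Finset.range (i + 1), (b l * ρ l : ℚ) := by
    refine Finset.sum_pos (fun l hl => ?_) ⟨0, by simp⟩
    have := Finset.mem_range.1 hl
    refine mul_pos ?_ (hρ l (by omega))
    have : 0 < i.choose l := Nat.choose_pos (by omega)
    positivity
  refine (Submodule.smul_mem_iff _ (mul_ne_zero (pow_ne_zero _ (by norm_num)) ?_)).1 h5
  exact_mod_cast hpos.ne'

/-- The finiteness criterion: if decomposability of the vectors of finitely many degrees and orders is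
known, it follows for all degrees and orders outside the list `K`. -/
theorem red_of_not_mem (S : SlAlg R) (K : ℕ × ℕ × ℕ → ℕ → Prop)
    (sel : ℕ × ℕ × ℕ → (ℕ × ℕ × ℕ) × ℕ)
    (hsel : ∀ d ≠ 0, ∃ f ∈ S.A (sel d).1 (sel d).2, ∃ d', d' + (sel d).1 = d ∧ d'.1 + d'.2.1 + d'.2.2 <
      d.1 + d.2.1 + d.2.2 ∧ ∀ u, S.G d u ≤ Submodule.span ℂ
        {t | ∃ r : ℕ, ∃ z ∈ S.G d' (u - (sel d).2 + 2 * r), t = z * (S.F ^ r) f})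
    (h0 : ∀ d, (sel d).1 = d → K d (sel d).2)
    (h1 : ∀ d' d r p, d' + (sel d).1 = d → K d' p → 1 ≤ r → r ≤ (sel d).2 → r ≤ p →
      K d (p + (sel d).2 - 2 * r) ∨ S.Red d (p + (sel d).2 - 2 * r))
    (h2 : ∀ d₁ d₂ d r p q, d₁ + d₂ + (sel d).1 = d → 3 ≤ r → r ≤ (sel d).2 → p < r → q < r → r ≤ p + q →
      Even p → Even q →
      (∀ i j, i + j = r → i ≤ p → j ≤ q → j ≤ 2 → K (d₁ + (sel d).1) (p + (sel d).2 - 2 * i) ∧ K d₂ q) →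
      (∀ i j, i + j = r → i ≤ q → j ≤ p → j ≤ 2 → K (d₂ + (sel d).1) (q + (sel d).2 - 2 * i) ∧ K d₁ p) →
      K d (p + q + (sel d).2 - 2 * r) ∨ S.Red d (p + q + (sel d).2 - 2 * r))
    (d : ℕ × ℕ × ℕ) (hd : d ≠ 0) (k : ℕ) (hk : ¬ K d k) : S.Red d k := by
  obtain ⟨m, hm⟩ : ∃ m, d.1 + d.2.1 + d.2.2 = m := ⟨_, rfl⟩
  induction m using Nat.strong_induction_on generalizing d k with
  | _ m IH =>
  by_contra hred
  have hn : ¬ (K d k ∨ S.Red d k) := by tauto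
  apply hred
  obtain ⟨f, hf, d', hd', hlt, hspan⟩ := hsel d hd
  obtain ⟨e, n, hen⟩ : ∃ e n, sel d = (e, n) := ⟨_, _, rfl⟩
  have he1 : (sel d).1 = e := by rw [hen]
  have hn1 : (sel d).2 = n := by rw [hen]
  rw [he1, hn1] at hf
  rw [he1] at hd'
  simp only [hn1] at hspan
  have IH' : ∀ d₁ d₂ p, d₁ ≠ 0 → d₂ ≠ 0 → d₁ + d₂ = d → ¬ K d₁ p → S.Red d₁ p := by
    rintro d₁ d₂ p h1 h2 rfl hK
    refine IH _ ?_ d₁ h1 p hK rfl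
    rw [← hm]
    have : 0 < d₂.1 + d₂.2.1 + d₂.2.2 := by
      rw [Nat.pos_iff_ne_zero]
      intro h
      exact h2 (Prod.ext (by simp; omega) (Prod.ext (by simp; omega) (by simp; omega)))
    simp only [Prod.fst_add, Prod.snd_add]
    omega
  have he0 : e ≠ 0 := by
    rintro rfl
    rw [add_zero] at hd'
    rw [hd'] at hlt
    omega
  have claim : ∀ r : ℕ, ∀ a ∈ S.A d' ((k : ℤ) - n + 2 * r), a * (S.F ^ r) f ∈ S.W d k := by
    intro r
    induction r using Nat.strong_induction_on with
    | _ r ihr =>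
    intro a ha
    rcases lt_or_ge ((k : ℤ) - n + 2 * r) 0 with hneg | hpos
    · simp [A_neg hneg ha]
    obtain ⟨p, hp⟩ : ∃ p : ℕ, (p : ℤ) = (k : ℤ) - n + 2 * r := ⟨_, Int.toNat_of_nonneg hpos⟩
    rw [← hp] at ha
    rcases lt_or_ge n r with hnr | hnr
    · simp [Fpow_eq_zero_of_lt hf hnr]
    rcases lt_or_ge p r with hpr | hpr
    · rw [← move_iff (A_le ha) (A_le hf) r hd' (by linarith), Fpow_eq_zero_of_lt ha hpr, zero_mul]
      exact zero_mem _
    by_cases hd0 : d' = 0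
    · subst hd0
      rcases Nat.eq_zero_or_pos p with rfl | hp0
      · rw [zero_add] at hd'
        have := h0 d (he1.trans hd')
        rw [hn1, show n = k by omega] at this
        exact absurd this hk
      · have := A_le ha
        rw [S.zero (by exact_mod_cast hp0.ne'), Submodule.mem_bot] at this
        simp [this]
    rcases Nat.eq_zero_or_pos r with rfl | hr0
    · have := mul_mem_Q hd0 he0 ha hf
      rw [hd', show (p : ℤ) + n = k by rw [hp]; simp] at this
      exact mem_W_of_Q (by simpa using this)
    have hpk : k = p + n - 2 * r := by omega
    have hR : S.Red d' p := by
      refine IH' d' e p hd0 he0 hd' fun hK => hn ?_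
      have := h1 d' d r p (by rw [he1, hd']) hK hr0 (by rwa [hn1]) hpr
      rwa [hn1, ← hpk] at this
    refine Submodule.span_induction (p := fun a _ => a * (S.F ^ r) f ∈ S.W d k) ?_ ?_ ?_ ?_ (hR ha)
    · rintro _ ⟨d₁, d₂, u₁, u₂, hd₁, hd₂, hdd, huu, P, hP, Q, hQ, rfl⟩
      rcases lt_or_ge u₁ 0 with hu1 | hu1
      · simp [A_neg hu1 hP]
      rcases lt_or_ge u₂ 0 with hu2 | hu2
      · simp [A_neg hu2 hQ]
      obtain ⟨p', rfl⟩ := Int.eq_ofNat_of_zero_le hu1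
      obtain ⟨q, rfl⟩ := Int.eq_ofNat_of_zero_le hu2
      have hpq : p' + q = p := by exact_mod_cast huu
      subst hpq
      have hd1 : d₁ + d₂ + e = d := by rw [hdd, hd']
      rcases le_or_gt r 2 with hr2 | hr2
      · exact mul_Fpow_mem hr2 hd₁ hd₂ he0 hP hQ hf hd1 (by push_cast at hp; linarith)
      rcases Nat.even_or_odd p' with hpe | hpo
      swap
      · rw [A_odd (by exact_mod_cast hpo) hP]; simp
      rcases Nat.even_or_odd q with hqe | hqo
      swap
      · rw [A_odd (by exact_mod_cast hqo) hQ]; simp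
      have hd2 : d₂ + d₁ + e = d := by rw [add_comm d₂, hd1]
      have red : ∀ {d₁ d₂ : ℕ × ℕ × ℕ} {p q i j : ℕ} {P Q : R}, d₁ ≠ 0 → d₂ ≠ 0 → d₁ + d₂ = d' →
          P ∈ S.A d₁ p → Q ∈ S.A d₂ q → i + j = r → i ≤ p → j ≤ q →
          k = p + q + n - 2 * r → r ≤ p + q → d₁ + d₂ + e = d →
          (∀ Z ∈ S.A (d₁ + e) ((p + n - 2 * i : ℕ) : ℤ), Z * (S.F ^ j) Q ∈ S.W d k) →
          P * Q * (S.F ^ r) f ∈ S.W d k := by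
        rintro d₁ d₂ p q i j P Q h1 h2 h12 hP hQ rfl hip hjq hk hr hd hZ
        refine mul_Fpow_mem_of_transvectant hP hQ hf hip (by omega) hjq hd ?_ ?_ ?_
        · rw [hk]; omega
        · intro Z hZA
          refine hZ Z ?_
          rwa [show ((p + n - 2 * i : ℕ) : ℤ) = p + n - 2 * i by omega]
        · intro s hs h hh
          rw [h12] at hh
          exact ihr s hs h hh
      have red0 : ∀ {d₁ d₂ : ℕ × ℕ × ℕ} {p q : ℕ} {P Q : R}, d₁ ≠ 0 → d₂ ≠ 0 → d₁ + d₂ = d' →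
          P ∈ S.A d₁ p → Q ∈ S.A d₂ q → r ≤ p →
          k = p + q + n - 2 * r → d₁ + d₂ + e = d → P * Q * (S.F ^ r) f ∈ S.W d k := by
        intro d₁ d₂ p q P Q h1 h2 h12 hP hQ hr hk hd
        refine red h1 h2 h12 hP hQ (add_zero r) hr (Nat.zero_le _) hk (by omega) hd fun Z hZ => ?_
        have := mul_mem_Q (S := S) (by simp [h1]) h2 hZ hQ
        rw [show d₁ + e + d₂ = d by rw [← hd]; abel,
          show ((p + n - 2 * r : ℕ) : ℤ) + q = k by omega] at this
        exact mem_W_of_Q (by simpa using this)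
      have red1 : ∀ {d₁ d₂ : ℕ × ℕ × ℕ} {p q i j : ℕ} {P Q : R}, d₁ ≠ 0 → d₂ ≠ 0 → d₁ + d₂ = d' →
          P ∈ S.A d₁ p → Q ∈ S.A d₂ q → i + j = r → i ≤ p → j ≤ q → j ≤ 2 →
          k = p + q + n - 2 * r → r ≤ p + q → d₁ + d₂ + e = d →
          ¬ (K (d₁ + e) (p + n - 2 * i) ∧ K d₂ q) → P * Q * (S.F ^ r) f ∈ S.W d k := by
        intro d₁ d₂ p q i j P Q h1 h2 h12 hP hQ hij hip hjq hj2 hk hr hd hK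
        refine red h1 h2 h12 hP hQ hij hip hjq hk hr hd fun Z hZ => ?_
        have hd2 : d₁ + e + d₂ = d := by rw [← hd]; abel
        have hd3 : d₂ + (d₁ + e) = d := by rw [← hd]; abel
        have hne : d₁ + e ≠ 0 := by simp [h1]
        by_cases hKZ : K (d₁ + e) (p + n - 2 * i)
        · have hQR : S.Red d₂ q := IH' d₂ (d₁ + e) q h2 hne hd3 fun h => hK ⟨hKZ, h⟩
          rw [← move_iff (A_le hZ) (A_le hQ) j hd2 (by omega), mul_comm]
          exact hQR.mul_Fpow_mem hne hj2 hQ hZ hd3 (by omega)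
        · have hZR : S.Red (d₁ + e) (p + n - 2 * i) := IH' _ d₂ _ hne h2 hd2 hKZ
          exact hZR.mul_Fpow_mem h2 hj2 hZ hQ hd2 (by omega)
      rcases Nat.lt_or_ge p' r with hp'r | hp'r
      swap
      · exact red0 hd₁ hd₂ hdd hP hQ hp'r hpk hd1
      rcases Nat.lt_or_ge q r with hqr | hqr
      swap
      · rw [mul_comm P]
        exact red0 hd₂ hd₁ (by rw [add_comm, hdd]) hQ hP hqr (by omega) hd2
      by_contra hcon
      refine hn ?_
      have := h2 d₁ d₂ d r p' q (by rw [he1, hd1]) hr2 (by rwa [hn1]) hp'r hqr hpr hpe hqe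
      rw [hn1, he1, ← hpk] at this
      refine this ?_ ?_
      · intro i j hij hi hj hj2
        by_contra hK
        exact hcon (red1 hd₁ hd₂ hdd hP hQ hij hi hj hj2 hpk hpr hd1 hK)
      · intro i j hij hi hj hj2
        by_contra hK
        rw [mul_comm P] at hcon
        exact hcon (red1 hd₂ hd₁ (by rw [add_comm, hdd]) hQ hP hij hi hj hj2 (by omega) (by omega) hd2 hK)
    · simp
    · intro a b _ _ ha hb; rw [add_mul]; exact add_mem ha hb
    · intro c a _ ha; rw [smul_mul_assoc]; exact Submodule.smul_mem _ _ ha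
  intro x hx
  refine mem_Q_of_W (Int.natCast_nonneg k) hx ?_
  refine Submodule.span_le.2 ?_ (hspan _ (A_le hx))
  rintro _ ⟨r, z, hz, rfl⟩
  obtain ⟨N, g, hg, rfl⟩ := exists_decomp hz
  rw [Finset.sum_mul]
  refine Submodule.sum_mem _ fun s _ => ?_
  rw [move_iff (A_le (hg s)) (Fpow_mem (A_le hf) r) s hd' (by linarith), ← Module.End.mul_apply,
    ← pow_add]
  refine claim _ _ ?_
  have := hg s
  rwa [show (k : ℤ) - n + 2 * r + 2 * s = k - n + 2 * (s + r : ℕ) by push_cast; ring] at this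
end SlAlg

namespace BinaryForms

variable {ν : Fin 3 → ℕ}

/-- The coordinates of a triple of binary forms. -/
abbrev Ix (ν : Fin 3 → ℕ) : Type := Σ i : Fin 3, Fin (ν i + 1)

abbrev Pol (ν : Fin 3 → ℕ) : Type := MvPolynomial (Ix ν) ℂ

/-- The coordinate `k` of the `i`-th form, zero if out of range. -/
def coord (ν : Fin 3 → ℕ) (i : Fin 3) (k : ℕ) : Pol ν :=
  if h : k < ν i + 1 then X ⟨i, ⟨k, h⟩⟩ else 0

def derE (ν : Fin 3 → ℕ) : Derivation ℂ (Pol ν) (Pol ν) :=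
  mkDerivation ℂ fun v => ((ν v.1 : ℂ) - (v.2 : ℕ) + 1) •
    if (v.2 : ℕ) = 0 then 0 else coord ν v.1 (v.2 - 1)

def derF (ν : Fin 3 → ℕ) : Derivation ℂ (Pol ν) (Pol ν) :=
  mkDerivation ℂ fun v => ((v.2 : ℕ) + 1 : ℂ) • coord ν v.1 (v.2 + 1)

lemma coord_coe (v : Ix ν) : coord ν v.1 v.2 = X v := dif_pos v.2.2

lemma coord_of_lt {i : Fin 3} {k : ℕ} (h : ν i < k) : coord ν i k = 0 := by
  rw [coord, dif_neg (by omega)]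

lemma derE_coord_zero (i : Fin 3) : derE ν (coord ν i 0) = 0 := by
  simp [coord, derE, mkDerivation_X]

lemma derE_coord_succ (i : Fin 3) (k : ℕ) :
    derE ν (coord ν i (k + 1)) = ((ν i : ℂ) - k) • coord ν i k := by
  rcases lt_trichotomy k (ν i) with h | h | h
  · rw [coord, dif_pos (by omega), derE, mkDerivation_X]
    simp only [Nat.succ_ne_zero, if_false, Nat.add_sub_cancel]
    congr 1
    push_cast
    ring
  · subst h
    rw [coord_of_lt (Nat.lt_succ_self _)]
    simp
  · rw [coord_of_lt h, coord_of_lt (by omega)]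
    simp

lemma derF_coord (i : Fin 3) (k : ℕ) :
    derF ν (coord ν i k) = ((k : ℂ) + 1) • coord ν i (k + 1) := by
  rcases le_or_gt k (ν i) with h | h
  · rw [coord, dif_pos (by omega), derF, mkDerivation_X]
  · rw [coord_of_lt h, coord_of_lt (by omega)]
    simp

lemma derE_derF_coord (i : Fin 3) (k : ℕ) :
    derE ν (derF ν (coord ν i k)) = derF ν (derE ν (coord ν i k)) + ((ν i : ℂ) - 2 * k) • coord ν i k := by
  rw [derF_coord, Derivation.map_smul, derE_coord_succ]
  rcases k with _ | k
  · rw [derE_coord_zero]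
    simp
  · rw [derE_coord_succ, Derivation.map_smul, derF_coord]
    push_cast
    module

def unit3 : Fin 3 → ℕ × ℕ × ℕ := ![(1, 0, 0), (0, 1, 0), (0, 0, 1)]

/-- Multidegree and weight of the coordinates. -/
def wt (ν : Fin 3 → ℕ) (v : Ix ν) : (ℕ × ℕ × ℕ) × ℤ :=
  (unit3 v.1, (ν v.1 : ℤ) - 2 * (v.2 : ℕ))

def piece (ν : Fin 3 → ℕ) (d : ℕ × ℕ × ℕ) (u : ℤ) : Submodule ℂ (Pol ν) :=
  weightedHomogeneousSubmodule ℂ (wt ν) (d, u)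

lemma coord_mem (i : Fin 3) (k : ℕ) : coord ν i k ∈ piece ν (unit3 i) (ν i - 2 * k) := by
  rw [coord]
  split_ifs with h
  · exact isWeightedHomogeneous_X ℂ (wt ν) ⟨i, ⟨k, h⟩⟩
  · exact zero_mem _

lemma derivation_mem {σ M : Type} [AddCancelCommMonoid M] {w : σ → M} {m s : M}
    (D : Derivation ℂ (MvPolynomial σ ℂ) (MvPolynomial σ ℂ))
    (hD : ∀ v, D (X v) ∈ weightedHomogeneousSubmodule ℂ w (w v + s)) {p : MvPolynomial σ ℂ}
    (hp : p ∈ weightedHomogeneousSubmodule ℂ w m) :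
    D p ∈ weightedHomogeneousSubmodule ℂ w (m + s) := by
  rw [p.as_sum, map_sum]
  refine Submodule.sum_mem _ fun e he => ?_
  have hw := hp (mem_support_iff.1 he)
  have hD' : D = mkDerivation ℂ fun v => D (X v) := derivation_ext fun v => by rw [mkDerivation_X]
  rw [hD', mkDerivation_monomial]
  refine Submodule.smul_mem _ _ (Submodule.sum_mem _ fun i hi => ?_)
  change monomial (e - Finsupp.single i 1) (e i : ℂ) • D (X i) ∈ _
  have h1 : IsWeightedHomogeneous w (monomial (e - Finsupp.single i 1) (e i : ℂ))
      (Finsupp.weight w (e - Finsupp.single i 1)) := isWeightedHomogeneous_monomial _ _ _ rfl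
  have h2 := h1.mul (hD i)
  rw [smul_eq_mul]
  have h3 : Finsupp.single i 1 ≤ e := by
    rw [Finsupp.single_le_iff]
    exact Nat.one_le_iff_ne_zero.2 (Finsupp.mem_support_iff.1 hi)
  have h4 : Finsupp.weight w (e - Finsupp.single i 1) + w i = m := by
    rw [← hw]
    conv_rhs => rw [← tsub_add_cancel_of_le h3, map_add]
    simp [Finsupp.weight_single]
  rw [← add_assoc, h4] at h2
  exact h2

lemma derE_mem {d : ℕ × ℕ × ℕ} {u : ℤ} {p : Pol ν} (h : p ∈ piece ν d u) :
    derE ν p ∈ piece ν d (u + 2) := by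
  have := derivation_mem (w := wt ν) (s := (0, 2)) (derE ν) ?_ h
  · simpa [piece] using this
  · intro v
    rw [← coord_coe]
    rcases hk : (v.2 : ℕ) with _ | k
    · rw [derE_coord_zero]
      exact zero_mem _
    · rw [derE_coord_succ]
      refine Submodule.smul_mem _ _ ?_
      have e : wt ν v + (0, 2) = (unit3 v.1, (ν v.1 : ℤ) - 2 * k) := by
        simp only [wt, hk, Prod.mk_add_mk, add_zero]
        push_cast
        refine congrArg _ ?_
        ring
      rw [e]
      exact coord_mem v.1 k

lemma derF_mem {d : ℕ × ℕ × ℕ} {u : ℤ} {p : Pol ν} (h : p ∈ piece ν d u) :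
    derF ν p ∈ piece ν d (u - 2) := by
  have := derivation_mem (w := wt ν) (s := (0, -2)) (derF ν) ?_ h
  · simpa [piece, sub_eq_add_neg] using this
  · intro v
    rw [← coord_coe, derF_coord]
    refine Submodule.smul_mem _ _ ?_
    have e : wt ν v + (0, -2) = (unit3 v.1, (ν v.1 : ℤ) - 2 * (v.2 + 1 : ℕ)) := by
      simp only [wt, Prod.mk_add_mk, add_zero]
      push_cast
      refine congrArg _ ?_
      ring
    rw [e]
    exact coord_mem v.1 (v.2 + 1)

lemma piece_induction {d : ℕ × ℕ × ℕ} {u : ℤ} {P : Pol ν → Prop} (h0 : P 0)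
    (hadd : ∀ p q, P p → P q → P (p + q))
    (hmon : ∀ e c, Finsupp.weight (wt ν) e = (d, u) → P (monomial e c)) {p : Pol ν}
    (h : p ∈ piece ν d u) : P p := by
  rw [p.as_sum]
  exact Finset.sum_induction _ P hadd h0 fun e he => hmon _ _ (h (mem_support_iff.1 he))

lemma weight_fst (e : Ix ν →₀ ℕ) :
    (Finsupp.weight (wt ν) e).1 = e.sum fun v k => k • unit3 v.1 := by
  rw [Finsupp.weight_apply, Finsupp.sum, Finsupp.sum, Prod.fst_sum]
  rfl

lemma weight_snd (e : Ix ν →₀ ℕ) : (Finsupp.weight (wt ν) e).2 =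
    e.sum fun v k => (k : ℤ) * ((ν v.1 : ℤ) - 2 * (v.2 : ℕ)) := by
  rw [Finsupp.weight_apply, Finsupp.sum, Finsupp.sum, Prod.snd_sum]
  simp [wt]

lemma degree_eq {e : Ix ν →₀ ℕ} {d : ℕ × ℕ × ℕ} {u : ℤ} (h : Finsupp.weight (wt ν) e = (d, u)) :
    e.degree = d.1 + d.2.1 + d.2.2 := by
  have h1 := congrArg Prod.fst h
  rw [weight_fst] at h1
  dsimp only at h1
  rw [← h1, Finsupp.sum, Prod.fst_sum, Prod.snd_sum, Prod.fst_sum, Prod.snd_sum,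
    ← Finset.sum_add_distrib, ← Finset.sum_add_distrib, Finsupp.degree_apply]
  refine Finset.sum_congr rfl fun v _ => ?_
  obtain ⟨i, k⟩ := v
  fin_cases i <;> simp [unit3]

lemma derE_derF {d : ℕ × ℕ × ℕ} {u : ℤ} {p : Pol ν} (h : p ∈ piece ν d u) :
    derE ν (derF ν p) = derF ν (derE ν p) + (u : ℂ) • p := by
  have key : ⁅derE ν, derF ν⁆ = mkDerivation ℂ fun v => ((ν v.1 : ℂ) - 2 * (v.2 : ℕ)) • X v := by
    refine derivation_ext fun v => ?_
    rw [Derivation.commutator_apply, ← coord_coe, derE_derF_coord, add_sub_cancel_left, coord_coe,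
      mkDerivation_X]
  have := congrArg (fun D => D p) key
  simp only [Derivation.commutator_apply] at this
  rw [sub_eq_iff_eq_add'] at this
  rw [this, add_right_inj]
  refine piece_induction (P := fun p => mkDerivation ℂ (fun v : Ix ν => ((ν v.1 : ℂ) - 2 * (v.2 : ℕ)) • X v) p = (u : ℂ) • p) (by simp) (by intro p q hp hq; rw [map_add, hp, hq, smul_add]) ?_ h
  intro e c he
  rw [mkDerivation_monomial]
  have h2 := congrArg Prod.snd he
  rw [weight_snd] at h2
  dsimp only at h2
  rw [← h2, Finsupp.sum, Finsupp.sum, Int.cast_sum, Finset.smul_sum, Finset.sum_smul]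
  refine Finset.sum_congr rfl fun v hv => ?_
  have h3 : Finsupp.single v 1 ≤ e := by
    rw [Finsupp.single_le_iff]
    exact Nat.one_le_iff_ne_zero.2 (Finsupp.mem_support_iff.1 hv)
  rw [smul_comm, smul_eq_mul, X, mul_smul_comm, mul_smul_comm, monomial_mul, tsub_add_cancel_of_le h3, mul_one, smul_monomial,
    smul_monomial, smul_monomial, smul_eq_mul, smul_eq_mul, smul_eq_mul]
  refine congrArg (monomial e) ?_
  push_cast
  ring

lemma abs_weight_le {e : Ix ν →₀ ℕ} :
    |(Finsupp.weight (wt ν) e).2| ≤ e.degree * (ν 0 + ν 1 + ν 2 : ℕ) := by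
  rw [weight_snd, Finsupp.sum, Finsupp.degree_apply]
  push_cast
  rw [Finset.sum_mul]
  refine (Finset.abs_sum_le_sum_abs _ _).trans (Finset.sum_le_sum fun v _ => ?_)
  rw [abs_mul, Nat.abs_cast]
  refine mul_le_mul_of_nonneg_left ?_ (Nat.cast_nonneg _)
  have h1 := v.2.2
  have h2 : ν v.1 ≤ ν 0 + ν 1 + ν 2 := by
    obtain ⟨i, k⟩ := v
    fin_cases i <;> simp <;> omega
  rw [abs_le]
  constructor <;> omega

lemma piece_eq_bot {d : ℕ × ℕ × ℕ} {u : ℤ} (h : ∀ e : Ix ν →₀ ℕ, Finsupp.weight (wt ν) e ≠ (d, u)) :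
    piece ν d u = ⊥ :=
  (Submodule.eq_bot_iff _).2 fun p hp => piece_induction (P := fun p => p = 0) rfl
    (by rintro p q rfl rfl; simp) (fun e c he => absurd he (h e)) hp

lemma finite_weight (d : ℕ × ℕ × ℕ) (u : ℤ) : {e : Ix ν →₀ ℕ | Finsupp.weight (wt ν) e = (d, u)}.Finite := by
  refine Set.Finite.subset (Finsupp.finite_of_degree_le (σ := Ix ν) (d.1 + d.2.1 + d.2.2)) ?_
  intro e he
  exact (degree_eq he).le

lemma piece_eq_supported (d : ℕ × ℕ × ℕ) (u : ℤ) :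
    piece ν d u = restrictSupport ℂ {e : Ix ν →₀ ℕ | Finsupp.weight (wt ν) e = (d, u)} :=
  weightedHomogeneousSubmodule_eq_finsupp_supported ℂ _ _

def slAlg (ν : Fin 3 → ℕ) (hν : ∀ i, Even (ν i)) : SlAlg (Pol ν) where
  E := derE ν
  F := derF ν
  G := piece ν
  E_mul x y := by simp [mul_comm]; ring
  F_mul x y := by simp [mul_comm]; ring
  E_mem := derE_mem
  F_mem := derF_mem
  comm := derE_derF
  bdd d := by
    refine ⟨(d.1 + d.2.1 + d.2.2) * (ν 0 + ν 1 + ν 2), fun u hu => piece_eq_bot fun e he => ?_⟩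
    have := abs_weight_le (e := e)
    rw [degree_eq he, he] at this
    exact absurd hu (by exact_mod_cast this.not_gt)
  fin d u := by
    rw [piece_eq_supported]
    have := (finite_weight (ν := ν) d u).to_subtype
    exact Module.Finite.of_basis (basisRestrictSupport ℂ _)
  mul_mem h h' := by
    have := IsWeightedHomogeneous.mul h h'
    simpa [piece] using this
  odd {d u} hu := piece_eq_bot fun e he => by
    have h2 := congrArg Prod.snd he
    rw [weight_snd] at h2
    dsimp only at h2
    rw [← h2, ← Int.not_even_iff_odd] at hu
    refine hu (Finset.even_sum _ fun v _ => Even.mul_left ?_ _)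
    exact (by exact_mod_cast hν v.1 : Even (ν v.1 : ℤ)).sub (even_two_mul _)
  zero {u} hu := piece_eq_bot fun e he => by
    have h1 := degree_eq he
    simp only [Prod.fst_zero, Prod.snd_zero, add_zero, Finsupp.degree_eq_zero_iff] at h1
    subst h1
    simp only [map_zero] at he
    exact hu (congrArg Prod.snd he).symm
  const {x} hx := by
    refine piece_induction (P := fun x => ∃ c : ℂ, x = algebraMap ℂ _ c) ⟨0, by simp⟩ ?_ ?_ hx
    · rintro _ _ ⟨a, rfl⟩ ⟨b, rfl⟩
      exact ⟨a + b, by simp⟩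
    · intro e c he
      have h1 := degree_eq he
      simp only [Prod.fst_zero, Prod.snd_zero, add_zero, Finsupp.degree_eq_zero_iff] at h1
      subst h1
      exact ⟨c, rfl⟩

variable {hν : ∀ i, Even (ν i)}

lemma slAlg_F (p : Pol ν) : (slAlg ν hν).F p = derF ν p := rfl

lemma slAlg_E (p : Pol ν) : (slAlg ν hν).E p = derE ν p := rfl

lemma Fpow_coord (i : Fin 3) (r : ℕ) :
    ((slAlg ν hν).F ^ r) (coord ν i 0) = (r.factorial : ℂ) • coord ν i r := by
  induction r with
  | zero => simp
  | succ r ih =>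
    rw [SlAlg.Fpow_succ, ih, map_smul, slAlg_F, derF_coord, smul_smul, Nat.factorial_succ]
    push_cast
    rw [mul_comm]

lemma coord_zero_mem (i : Fin 3) : coord ν i 0 ∈ (slAlg ν hν).A (unit3 i) (ν i) :=
  SlAlg.mem_A.2 ⟨by
    have := coord_mem (ν := ν) i 0
    rwa [Nat.cast_zero, mul_zero, sub_zero] at this, derE_coord_zero i⟩

lemma exists_mem_support {e : Ix ν →₀ ℕ} {d' : ℕ × ℕ × ℕ} {u : ℤ} {i : Fin 3}
    (h : Finsupp.weight (wt ν) e = (d' + unit3 i, u)) : ∃ v ∈ e.support, v.1 = i := by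
  by_contra! hcon
  have h1 := congrArg Prod.fst h
  rw [weight_fst] at h1
  dsimp only at h1
  rw [Finsupp.sum] at h1
  have hc : ∀ {φ : ℕ × ℕ × ℕ →+ ℕ}, (∀ j, j ≠ i → φ (unit3 j) = 0) → φ (unit3 i) = 0 := by
    intro φ hφ
    have := congrArg φ h1
    rw [map_sum, Finset.sum_eq_zero, map_add] at this
    · omega
    · intro v hv
      rw [map_nsmul, hφ _ (hcon v hv), smul_zero]
  fin_cases i
  · have := hc (φ := AddMonoidHom.fst ℕ (ℕ × ℕ)) (by decide)
    simp [unit3] at this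
  · have := hc (φ := (AddMonoidHom.fst ℕ ℕ).comp (AddMonoidHom.snd ℕ (ℕ × ℕ))) (by decide)
    simp [unit3] at this
  · have := hc (φ := (AddMonoidHom.snd ℕ ℕ).comp (AddMonoidHom.snd ℕ (ℕ × ℕ))) (by decide)
    simp [unit3] at this

lemma piece_le_span (d' : ℕ × ℕ × ℕ) (i : Fin 3) (u : ℤ) :
    (slAlg ν hν).G (d' + unit3 i) u ≤ Submodule.span ℂ
      {t | ∃ r : ℕ, ∃ z ∈ (slAlg ν hν).G d' (u - ν i + 2 * r),
        t = z * ((slAlg ν hν).F ^ r) (coord ν i 0)} := by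
  intro p hp
  refine piece_induction (zero_mem _) (fun p q hp hq => add_mem hp hq) ?_ hp
  intro e c he
  obtain ⟨v, hv, rfl⟩ := exists_mem_support he
  have h3 : Finsupp.single v 1 ≤ e := by
    rw [Finsupp.single_le_iff]
    exact Nat.one_le_iff_ne_zero.2 (Finsupp.mem_support_iff.1 hv)
  refine Submodule.subset_span ⟨v.2, monomial (e - Finsupp.single v 1) (c / (v.2 : ℕ).factorial),
    isWeightedHomogeneous_monomial _ _ _ ?_, ?_⟩
  · have h4 := congrArg (Finsupp.weight (wt ν)) (tsub_add_cancel_of_le h3)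
    rw [map_add, he, Finsupp.weight_single, one_smul] at h4
    refine add_right_cancel (h4.trans ?_)
    simp only [wt, Prod.mk_add_mk, Prod.mk.injEq, true_and]
    ring
  · rw [Fpow_coord, coord_coe, mul_smul_comm, X, monomial_mul, tsub_add_cancel_of_le h3, mul_one,
      smul_monomial, smul_eq_mul, mul_div_cancel₀]
    exact_mod_cast Nat.factorial_ne_zero _

/-- The form used to build up the vectors of a given multidegree. -/
def selIx (d : ℕ × ℕ × ℕ) : Fin 3 := if d.2.2 ≠ 0 then 2 else if d.2.1 ≠ 0 then 1 else 0

lemma exists_add_unit3 (d : ℕ × ℕ × ℕ) (hd : d ≠ 0) : ∃ d', d' + unit3 (selIx d) = d := by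
  obtain ⟨a, b, c⟩ := d
  simp only [selIx]
  split_ifs with h1 h2
  · exact ⟨(a, b, c - 1), by simp [unit3]; omega⟩
  · exact ⟨(a, b - 1, c), by simp [unit3]; omega⟩
  · refine ⟨(a - 1, b, c), ?_⟩
    simp only [ne_eq, not_not] at h1 h2
    subst h1 h2
    have : a ≠ 0 := by rintro rfl; exact hd rfl
    simp [unit3]; omega

lemma exists_sel (d : ℕ × ℕ × ℕ) (hd : d ≠ 0) :
    ∃ f ∈ (slAlg ν hν).A (unit3 (selIx d)) (ν (selIx d)), ∃ d', d' + unit3 (selIx d) = d ∧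
      d'.1 + d'.2.1 + d'.2.2 < d.1 + d.2.1 + d.2.2 ∧
      ∀ u, (slAlg ν hν).G d u ≤ Submodule.span ℂ
        {t | ∃ r : ℕ, ∃ z ∈ (slAlg ν hν).G d' (u - ν (selIx d) + 2 * r),
          t = z * ((slAlg ν hν).F ^ r) f} := by
  obtain ⟨d', h⟩ := exists_add_unit3 d hd
  refine ⟨_, coord_zero_mem _, d', h, ?_, ?_⟩
  · rw [← h]
    generalize selIx d = i
    fin_cases i <;> simp [unit3]
  · rw [← h]
    have := piece_le_span (ν := ν) (hν := hν) d' (selIx d)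
    rwa [h] at this ⊢

end BinaryForms

namespace BinaryForms

variable {ν : Fin 3 → ℕ}

lemma subst2_X (g : SL2) (i : Fin 2) :
    subst2 g (X i) = C ((g⁻¹).1 i 0) * X 0 + C ((g⁻¹).1 i 1) * X 1 := by
  simp [subst2]

lemma coeffOf_monomial {n i j : ℕ} (hij : i + j = n) (k : Fin (n + 1)) :
    coeffOf n (X 0 ^ i * X 1 ^ j) k = if j = k then 1 else 0 := by
  have : (X 0 ^ i * X 1 ^ j : MvPolynomial (Fin 2) ℂ) =
      monomial (Finsupp.single 0 i + Finsupp.single 1 j) 1 := by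
    rw [X_pow_eq_monomial, X_pow_eq_monomial, monomial_mul, mul_one]
  rw [coeffOf, this, coeff_monomial]
  have hk := k.2
  congr 1
  rw [eq_iff_iff]
  constructor
  · intro h
    have := DFunLike.congr_fun h 1
    simpa using this
  · rintro rfl
    rw [show n - (k : ℕ) = i by omega]

lemma coeffOf_add (n : ℕ) (p q : MvPolynomial (Fin 2) ℂ) (k : Fin (n + 1)) :
    coeffOf n (p + q) k = coeffOf n p k + coeffOf n q k := by simp [coeffOf]

lemma coeffOf_sum {ι : Type} (s : Finset ι) (n : ℕ) (p : ι → MvPolynomial (Fin 2) ℂ) (k : Fin (n + 1)) :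
    coeffOf n (∑ i ∈ s, p i) k = ∑ i ∈ s, coeffOf n (p i) k := by simp [coeffOf, coeff_sum]

lemma coeffOf_C_mul (n : ℕ) (c : ℂ) (p : MvPolynomial (Fin 2) ℂ) (k : Fin (n + 1)) :
    coeffOf n (C c * p) k = c * coeffOf n p k := by simp [coeffOf]

lemma coeffAct_eq (g : SL2) (n : ℕ) (a : Fin (n + 1) → ℂ) (k : Fin (n + 1)) :
    coeffAct g n a k = ∑ j : Fin (n + 1),
      a j * coeffOf n (subst2 g (X 0) ^ (n - (j : ℕ)) * subst2 g (X 1) ^ (j : ℕ)) k := by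
  rw [coeffAct, form, map_sum, coeffOf_sum]
  refine Finset.sum_congr rfl fun j _ => ?_
  rw [map_mul, map_mul, map_pow, map_pow, mul_assoc, algHom_C, algebraMap_eq, coeffOf_C_mul]

lemma form_coeffOf {n : ℕ} {p : MvPolynomial (Fin 2) ℂ} (hp : p.IsHomogeneous n) :
    form n (coeffOf n p) = p := by
  have key : ∀ i j, i + j = n → ∀ c : ℂ, form n (coeffOf n (C c * (X 0 ^ i * X 1 ^ j))) =
      C c * (X 0 ^ i * X 1 ^ j) := by
    intro i j hij c
    rw [form, Finset.sum_eq_single ⟨j, by omega⟩]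
    · rw [coeffOf_C_mul, coeffOf_monomial hij, if_pos rfl, mul_one, mul_assoc]
      simp [← hij]
    · intro b _ hb
      rw [coeffOf_C_mul, coeffOf_monomial hij, if_neg]
      · simp
      · rintro rfl
        exact hb rfl
    · simp
  have hadd : ∀ p q : MvPolynomial (Fin 2) ℂ,
      form n (coeffOf n (p + q)) = form n (coeffOf n p) + form n (coeffOf n q) := by
    intro p q
    simp only [form, coeffOf_add, map_add, add_mul, Finset.sum_add_distrib]
  rw [p.as_sum]
  refine Finset.sum_induction _ (fun p => form n (coeffOf n p) = p) ?_ ?_ ?_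
  · intro p q hp hq
    rw [hadd, hp, hq]
  · simp [form, coeffOf]
  · intro e he
    have h1 := hp (mem_support_iff.1 he)
    rw [Finsupp.weight_apply, Finsupp.sum_fintype _ _ (by simp), Fin.sum_univ_two] at h1
    have h2 : monomial e (coeff e p) = C (coeff e p) * (X 0 ^ e 0 * X 1 ^ e 1) := by
      rw [monomial_eq, Finsupp.prod_fintype _ _ (by simp), Fin.prod_univ_two]
    rw [h2]
    exact key _ _ (by simpa using h1) _

lemma form_isHomogeneous (n : ℕ) (a : Fin (n + 1) → ℂ) : (form n a).IsHomogeneous n := by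
  refine IsHomogeneous.sum _ _ _ fun i _ => ?_
  have h := ((isHomogeneous_C (Fin 2) (a i)).mul (isHomogeneous_X_pow (R := ℂ) (0 : Fin 2)
    (n - (i : ℕ)))).mul (isHomogeneous_X_pow (R := ℂ) (1 : Fin 2) (i : ℕ))
  have hi := i.2
  rwa [show 0 + (n - (i : ℕ)) + i = n by omega] at h

lemma subst2_isHomogeneous (g : SL2) {n : ℕ} {p : MvPolynomial (Fin 2) ℂ} (hp : p.IsHomogeneous n) :
    (subst2 g p).IsHomogeneous n := by
  have := hp.aeval (fun i => ∑ j : Fin 2, C ((g⁻¹).1 i j) * X j) (n := 1) fun i =>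
    IsHomogeneous.sum _ _ _ fun j _ => by
      simpa using (isHomogeneous_C (Fin 2) ((g⁻¹).1 i j)).mul (isHomogeneous_X ℂ j)
  simpa [subst2] using this

lemma form_coeffAct (g : SL2) (n : ℕ) (a : Fin (n + 1) → ℂ) :
    form n (coeffAct g n a) = subst2 g (form n a) :=
  form_coeffOf (subst2_isHomogeneous g (form_isHomogeneous n a))

lemma subst2_mul (g g' : SL2) (p : MvPolynomial (Fin 2) ℂ) :
    subst2 (g * g') p = subst2 g (subst2 g' p) := by
  suffices h : subst2 (g * g') = (subst2 g).comp (subst2 g') by rw [h, AlgHom.comp_apply]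
  refine algHom_ext fun i => ?_
  rw [AlgHom.comp_apply, subst2_X, subst2_X, map_add, map_mul, map_mul, algHom_C, algHom_C,
    subst2_X, subst2_X, mul_inv_rev]
  simp only [Matrix.SpecialLinearGroup.coe_mul, Matrix.mul_apply, Fin.sum_univ_two, map_add, map_mul,
    algebraMap_eq]
  ring

lemma ptAct_mul (g g' : SL2) (pt : Var ν → ℂ) : ptAct ν (g * g') pt = ptAct ν g (ptAct ν g' pt) := by
  funext v
  rcases v with ⟨i, k⟩ | i
  · have (a : Fin (ν i + 1) → ℂ) :
        coeffAct (g * g') (ν i) a = coeffAct g (ν i) (coeffAct g' (ν i) a) := by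
      rw [coeffAct, coeffAct.eq_1 g, form_coeffAct, subst2_mul]
    exact congrFun (this _) k
  · simp only [ptAct, Sum.elim_inr, Fin.sum_univ_two, Matrix.SpecialLinearGroup.coe_mul,
      Matrix.mul_apply]
    ring

def upper (s : ℂ) : SL2 := ⟨!![1, s; 0, 1], by simp [Matrix.det_fin_two]⟩

def lower (s : ℂ) : SL2 := ⟨!![1, 0; s, 1], by simp [Matrix.det_fin_two]⟩

lemma upper_inv (s : ℂ) : (upper s)⁻¹ = upper (-s) := by
  refine inv_eq_of_mul_eq_one_right (Subtype.ext ?_)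
  change (!![1, s; 0, 1] * !![1, -s; 0, 1] : Matrix (Fin 2) (Fin 2) ℂ) = 1
  simp [Matrix.one_fin_two]

lemma lower_inv (s : ℂ) : (lower s)⁻¹ = lower (-s) := by
  refine inv_eq_of_mul_eq_one_right (Subtype.ext ?_)
  change (!![1, 0; s, 1] * !![1, 0; -s, 1] : Matrix (Fin 2) (Fin 2) ℂ) = 1
  simp [Matrix.one_fin_two]

lemma coeffAct_upper (s : ℂ) (n : ℕ) (a : Fin (n + 1) → ℂ) (k : Fin (n + 1)) :
    coeffAct (upper s) n a k = ∑ j : Fin (n + 1), a j *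
      if (j : ℕ) ≤ k then ((n - j : ℕ).choose (k - j) : ℂ) * (-s) ^ ((k : ℕ) - j) else 0 := by
  rw [coeffAct_eq]
  refine Finset.sum_congr rfl fun j _ => ?_
  have h0 : subst2 (upper s) (X 0) = C (-s) * X 1 + X 0 := by
    rw [subst2_X, upper_inv]; simp [upper]; ring
  have h1 : subst2 (upper s) (X 1) = X 1 := by
    rw [subst2_X, upper_inv]; simp [upper]
  have hj := j.2
  have hk := k.2
  rw [h0, h1, add_pow, Finset.sum_mul, coeffOf_sum]
  have : ∀ l ∈ Finset.range (n - (j : ℕ) + 1), coeffOf n ((C (-s) * X 1) ^ l *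
      X 0 ^ (n - (j : ℕ) - l) * ((n - (j : ℕ)).choose l : MvPolynomial (Fin 2) ℂ) * X 1 ^ (j : ℕ)) k =
      if l + j = k then ((n - j : ℕ).choose l : ℂ) * (-s) ^ l else 0 := by
    intro l hl
    have hl := Finset.mem_range.1 hl
    have : (C (-s) * X 1) ^ l *
      X 0 ^ (n - (j : ℕ) - l) * ((n - (j : ℕ)).choose l : MvPolynomial (Fin 2) ℂ) * X 1 ^ (j : ℕ) =
        C (((n - j : ℕ).choose l : ℂ) * (-s) ^ l) * (X 0 ^ (n - (j : ℕ) - l) * X 1 ^ (l + j)) := by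
      rw [mul_pow, map_mul, map_pow, map_natCast, pow_add]
      ring
    rw [this, coeffOf_C_mul, coeffOf_monomial (by omega)]
    simp
  rw [Finset.sum_congr rfl this]
  congr 1
  split_ifs with h
  · rw [Finset.sum_eq_single ((k : ℕ) - j)]
    · rw [if_pos (by omega)]
    · intro b _ hb
      rw [if_neg (by omega)]
    · intro hb
      exact absurd (Finset.mem_range.2 (by omega)) hb
  · refine Finset.sum_eq_zero fun l _ => ?_
    rw [if_neg (by omega)]

lemma coeffAct_lower (s : ℂ) (n : ℕ) (a : Fin (n + 1) → ℂ) (k : Fin (n + 1)) :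
    coeffAct (lower s) n a k = ∑ j : Fin (n + 1), a j *
      if (k : ℕ) ≤ j then ((j : ℕ).choose k : ℂ) * (-s) ^ ((j : ℕ) - k) else 0 := by
  rw [coeffAct_eq]
  refine Finset.sum_congr rfl fun j _ => ?_
  have h0 : subst2 (lower s) (X 0) = X 0 := by
    rw [subst2_X, lower_inv]; simp [lower]
  have h1 : subst2 (lower s) (X 1) = X 1 + C (-s) * X 0 := by
    rw [subst2_X, lower_inv]; simp [lower]; ring
  have hj := j.2
  have hk := k.2
  rw [h0, h1, add_pow, Finset.mul_sum, coeffOf_sum]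
  have : ∀ l ∈ Finset.range ((j : ℕ) + 1), coeffOf n (X 0 ^ (n - (j : ℕ)) * (X 1 ^ l *
      (C (-s) * X 0) ^ ((j : ℕ) - l) * ((j : ℕ).choose l : MvPolynomial (Fin 2) ℂ))) k =
      if l = k then ((j : ℕ).choose l : ℂ) * (-s) ^ ((j : ℕ) - l) else 0 := by
    intro l hl
    have hl := Finset.mem_range.1 hl
    have : X 0 ^ (n - (j : ℕ)) * (X 1 ^ l *
      (C (-s) * X 0) ^ ((j : ℕ) - l) * ((j : ℕ).choose l : MvPolynomial (Fin 2) ℂ)) =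
        C (((j : ℕ).choose l : ℂ) * (-s) ^ ((j : ℕ) - l)) * (X 0 ^ (n - (j : ℕ) + (j - l)) * X 1 ^ l) := by
      rw [mul_pow, map_mul, map_pow, map_natCast, pow_add]
      ring
    rw [this, coeffOf_C_mul, coeffOf_monomial (by omega)]
    simp
  rw [Finset.sum_congr rfl this]
  congr 1
  split_ifs with h
  · rw [Finset.sum_eq_single (k : ℕ)]
    · rw [if_pos rfl]
    · intro b _ hb
      rw [if_neg hb]
    · intro hb
      exact absurd (Finset.mem_range.2 (by omega)) hb
  · refine Finset.sum_eq_zero fun l hl => ?_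
    have := Finset.mem_range.1 hl
    rw [if_neg (by omega)]

end BinaryForms

namespace BinaryForms

variable {ν : Fin 3 → ℕ}

lemma hasDerivAt_eval {σ : Type} {γ : ℂ → σ → ℂ}
    {D : Derivation ℂ (MvPolynomial σ ℂ) (MvPolynomial σ ℂ)} {s : ℂ}
    (h : ∀ v, HasDerivAt (fun s => γ s v) (eval (γ s) (D (X v))) s) (p : MvPolynomial σ ℂ) :
    HasDerivAt (fun s => eval (γ s) p) (eval (γ s) (D p)) s := by
  induction p using MvPolynomial.induction_on with
  | C a => simpa using hasDerivAt_const s a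
  | add p q hp hq =>
    simp only [map_add]
    exact hp.fun_add hq
  | mul_X p v hp =>
    have := hp.fun_mul (h v)
    simp only [Derivation.leibniz, map_add, map_mul, eval_X, smul_eq_mul]
    rwa [add_comm, mul_comm (γ s v)]

/-- The infinitesimal action of `upper`. -/
def derU (ν : Fin 3 → ℕ) : Derivation ℂ (CoordRing ν) (CoordRing ν) :=
  mkDerivation ℂ (Sum.elim (fun v => -rename Sum.inl (derE ν (X v))) ![X (Sum.inr 1), 0])

/-- The infinitesimal action of `lower`. -/
def derL (ν : Fin 3 → ℕ) : Derivation ℂ (CoordRing ν) (CoordRing ν) :=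
  mkDerivation ℂ (Sum.elim (fun v => -rename Sum.inl (derF ν (X v))) ![0, X (Sum.inr 0)])

lemma rename_derivation {D : Derivation ℂ (CoordRing ν) (CoordRing ν)}
    {D' : Derivation ℂ (Pol ν) (Pol ν)}
    (h : ∀ v, D (X (Sum.inl v)) = -rename Sum.inl (D' (X v))) (p : Pol ν) :
    D (rename Sum.inl p) = -rename Sum.inl (D' p) := by
  induction p using MvPolynomial.induction_on with
  | C a => simp
  | add p q hp hq => rw [map_add, map_add, map_add, hp, hq, map_add, neg_add]
  | mul_X p v hp =>
    rw [map_mul, rename_X, Derivation.leibniz, Derivation.leibniz, hp, h]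
    simp only [smul_eq_mul, map_add, map_mul, rename_X]
    ring

lemma derU_rename (p : Pol ν) : derU ν (rename Sum.inl p) = -rename Sum.inl (derE ν p) :=
  rename_derivation (fun v => by rw [derU, mkDerivation_X, Sum.elim_inl]) p

lemma derL_rename (p : Pol ν) : derL ν (rename Sum.inl p) = -rename Sum.inl (derF ν p) :=
  rename_derivation (fun v => by rw [derL, mkDerivation_X, Sum.elim_inl]) p

lemma hasDerivAt_neg_pow (m : ℕ) (s : ℂ) :
    HasDerivAt (fun s : ℂ => (-s) ^ m) (-(m * (-s) ^ (m - 1))) s := by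
  have := (hasDerivAt_neg s).fun_pow m
  simpa using this

lemma ptAct_inl (g : SL2) (pt : Var ν → ℂ) (i : Fin 3) (k : Fin (ν i + 1)) :
    ptAct ν g pt (Sum.inl ⟨i, k⟩) = coeffAct g (ν i) (fun k => pt (Sum.inl ⟨i, k⟩)) k := rfl

lemma hasDerivAt_upper (pt : Var ν → ℂ) (s : ℂ) (v : Var ν) :
    HasDerivAt (fun s => ptAct ν (upper s) pt v) (eval (ptAct ν (upper s) pt) (derU ν (X v))) s := by
  rcases v with ⟨i, k⟩ | i
  · rw [derU, mkDerivation_X, Sum.elim_inl, map_neg, eval_rename, ← coord_coe]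
    simp only [ptAct_inl, coeffAct_upper]
    obtain ⟨k, hk⟩ := k
    dsimp only
    rcases k with _ | k
    · rw [derE_coord_zero, map_zero, neg_zero]
      have : ∀ s : ℂ, (∑ j : Fin (ν i + 1), pt (Sum.inl ⟨i, j⟩) * if (j : ℕ) ≤ 0 then
          ((ν i - (j : ℕ)).choose (0 - j) : ℂ) * (-s) ^ (0 - (j : ℕ)) else 0) =
          ∑ j : Fin (ν i + 1), pt (Sum.inl ⟨i, j⟩) * if (j : ℕ) ≤ 0 then 1 else 0 := by
        intro s
        simp
      simp only [this]
      exact hasDerivAt_const _ _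
    · rw [derE_coord_succ, smul_eval, coord, dif_pos (by omega), eval_X,
        Function.comp_apply, ptAct_inl, coeffAct_upper, Finset.mul_sum,
        ← Finset.sum_neg_distrib]
      refine HasDerivAt.fun_sum fun j _ => ?_
      rw [mul_left_comm, ← mul_neg]
      refine HasDerivAt.const_mul _ ?_
      dsimp only
      rcases lt_trichotomy (j : ℕ) (k + 1) with h | h | h
      · rw [if_pos (by omega)]
        have := (hasDerivAt_neg_pow (k + 1 - j) s).const_mul ((ν i - (j : ℕ)).choose (k + 1 - j) : ℂ)
        simp only [if_pos h.le]
        convert this using 1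
        obtain ⟨m, hm⟩ : ∃ m, k = j + m := ⟨k - j, by omega⟩
        have e := Nat.choose_succ_right_eq (ν i - j) m
        have e2 : ((ν i - j).choose (m + 1) : ℂ) * (m + 1 : ℕ) = (ν i - j).choose m * (ν i - j - m : ℕ) := by
          exact_mod_cast e
        rw [show k + 1 - j = m + 1 by omega, show k - (j : ℕ) = m by omega, Nat.add_sub_cancel]
        rw [show ν i - j - m = ν i - k by omega, Nat.cast_sub (by omega)] at e2
        linear_combination (-s) ^ m * e2
      · simp only [h, le_refl, if_true, Nat.sub_self, pow_zero]
        rw [if_neg (by omega)]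
        simpa using hasDerivAt_const s (1 : ℂ)
      · rw [if_neg (by omega)]
        simp only [if_neg (not_le.2 h)]
        simpa using hasDerivAt_const s (0 : ℂ)
  · rw [derU, mkDerivation_X, Sum.elim_inr]
    simp only [ptAct, Sum.elim_inr, Fin.sum_univ_two, upper]
    fin_cases i
    · simpa using ((hasDerivAt_id s).mul_const (pt (Sum.inr 1))).const_add (pt (Sum.inr 0))
    · simpa using hasDerivAt_const s (pt (Sum.inr 1))

lemma hasDerivAt_lower (pt : Var ν → ℂ) (s : ℂ) (v : Var ν) :
    HasDerivAt (fun s => ptAct ν (lower s) pt v) (eval (ptAct ν (lower s) pt) (derL ν (X v))) s := by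
  rcases v with ⟨i, k⟩ | i
  · rw [derL, mkDerivation_X, Sum.elim_inl, map_neg, eval_rename, ← coord_coe, derF_coord]
    simp only [ptAct_inl, coeffAct_lower]
    obtain ⟨k, hk⟩ := k
    dsimp only
    rw [smul_eval]
    rcases Nat.lt_or_ge k (ν i) with hk' | hk'
    · rw [coord, dif_pos (by omega), eval_X,
        Function.comp_apply, ptAct_inl, coeffAct_lower, Finset.mul_sum, ← Finset.sum_neg_distrib]
      refine HasDerivAt.fun_sum fun j _ => ?_
      rw [mul_left_comm, ← mul_neg]
      refine HasDerivAt.const_mul _ ?_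
      dsimp only
      rcases lt_trichotomy k (j : ℕ) with h | h | h
      · rw [if_pos (by omega)]
        have := (hasDerivAt_neg_pow ((j : ℕ) - k) s).const_mul ((j : ℕ).choose k : ℂ)
        simp only [if_pos h.le]
        convert this using 1
        have e := Nat.choose_succ_right_eq j k
        have e2 : ((j : ℕ).choose (k + 1) : ℂ) * (k + 1 : ℕ) = (j : ℕ).choose k * ((j : ℕ) - k : ℕ) := by
          exact_mod_cast e
        rw [show (j : ℕ) - k - 1 = j - (k + 1) by omega]
        push_cast at e2 ⊢
        linear_combination -(-s) ^ ((j : ℕ) - (k + 1)) * e2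
      · simp only [← h, le_refl, if_true, Nat.sub_self, pow_zero]
        rw [if_neg (by omega)]
        simpa using hasDerivAt_const s (1 : ℂ)
      · rw [if_neg (by omega)]
        simp only [if_neg (not_le.2 h)]
        simpa using hasDerivAt_const s (0 : ℂ)
    · rw [coord_of_lt (by omega), map_zero, mul_zero, neg_zero]
      have : ∀ s : ℂ, (∑ j : Fin (ν i + 1), pt (Sum.inl ⟨i, j⟩) * if k ≤ (j : ℕ) then
          ((j : ℕ).choose k : ℂ) * (-s) ^ ((j : ℕ) - k) else 0) =
          ∑ j : Fin (ν i + 1), pt (Sum.inl ⟨i, j⟩) * if k ≤ (j : ℕ) then 1 else 0 := by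
        intro s
        refine Finset.sum_congr rfl fun j _ => ?_
        congr 1
        split_ifs with h
        · rw [show (j : ℕ) = k by omega]; simp
        · rfl
      simp only [this]
      exact hasDerivAt_const _ _
  · rw [derL, mkDerivation_X, Sum.elim_inr]
    simp only [ptAct, Sum.elim_inr, Fin.sum_univ_two, lower]
    fin_cases i
    · simpa using hasDerivAt_const s (pt (Sum.inr 0))
    · simpa using ((hasDerivAt_id s).mul_const (pt (Sum.inr 0))).add_const (pt (Sum.inr 1))

lemma ptAct_one (pt : Var ν → ℂ) : ptAct ν 1 pt = pt := by
  funext v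
  rcases v with ⟨i, k⟩ | i
  · have hk := k.2
    have : subst2 1 = AlgHom.id ℂ _ := algHom_ext fun i => by
      rw [subst2_X]
      fin_cases i <;> simp
    simp only [ptAct, Sum.elim_inl]
    rw [coeffAct_eq, Finset.sum_eq_single k]
    · rw [this, AlgHom.id_apply, AlgHom.id_apply, coeffOf_monomial (by omega), if_pos rfl, mul_one]
    · intro j _ hj
      have hj' := j.2
      rw [this, AlgHom.id_apply, AlgHom.id_apply, coeffOf_monomial (by omega), if_neg, mul_zero]
      rwa [← Fin.ext_iff]
    · simp
  · simp only [ptAct, Sum.elim_inr, Fin.sum_univ_two]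
    fin_cases i <;> simp

lemma upper_zero : upper 0 = 1 := Subtype.ext (by simp [upper, Matrix.one_fin_two])

lemma lower_zero : lower 0 = 1 := Subtype.ext (by simp [lower, Matrix.one_fin_two])

lemma eval_ptAct_of_der {D : Derivation ℂ (CoordRing ν) (CoordRing ν)} {γ : ℂ → SL2} (h0 : γ 0 = 1)
    (hD : ∀ pt s v, HasDerivAt (fun s => ptAct ν (γ s) pt v) (eval (ptAct ν (γ s) pt) (D (X v))) s)
    {h : CoordRing ν} (hh : D h = 0) (s : ℂ) (pt : Var ν → ℂ) :
    eval (ptAct ν (γ s) pt) h = eval pt h := by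
  have := is_const_of_deriv_eq_zero (f := fun s => eval (ptAct ν (γ s) pt) h)
    (fun s => (hasDerivAt_eval (hD pt s) h).differentiableAt)
    (fun s => by rw [(hasDerivAt_eval (hD pt s) h).deriv, hh, map_zero]) s 0
  rwa [h0, ptAct_one] at this

lemma exists_upper_lower (g : SL2) (hg : g.1 1 0 ≠ 0) :
    ∃ x y z, g = upper x * (lower y * upper z) := by
  refine ⟨(g.1 0 0 - 1) / g.1 1 0, g.1 1 0, (g.1 1 1 - 1) / g.1 1 0, Subtype.ext ?_⟩
  have hdet := g.2
  rw [Matrix.det_fin_two] at hdet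
  change g.1 = !![1, _; 0, 1] * (!![1, 0; _, 1] * !![1, _; 0, 1])
  rw [Matrix.mul_fin_two, Matrix.mul_fin_two, Matrix.eta_fin_two g.1]
  congr 1
  funext i j
  fin_cases i <;> fin_cases j <;> simp <;> field_simp
  · ring
  · linear_combination -hdet
  · ring

lemma mem_covariants_of_der {h : CoordRing ν} (hU : derU ν h = 0) (hL : derL ν h = 0) :
    h ∈ Covariants ν := by
  have hu := eval_ptAct_of_der upper_zero hasDerivAt_upper hU
  have hl := eval_ptAct_of_der lower_zero hasDerivAt_lower hL
  have key : ∀ g : SL2, g.1 1 0 ≠ 0 → ∀ pt, eval (ptAct ν g pt) h = eval pt h := by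
    intro g hg pt
    obtain ⟨x, y, z, rfl⟩ := exists_upper_lower g hg
    rw [ptAct_mul, ptAct_mul, hu, hl, hu]
  intro g pt
  by_cases hg : g.1 1 0 = 0
  · have hdet := g.2
    rw [Matrix.det_fin_two, hg, mul_zero, sub_zero] at hdet
    have h1 : (g * lower 1).1 1 0 ≠ 0 := by
      have e : (g * lower 1).1 1 0 = g.1 1 1 := by
        rw [Matrix.SpecialLinearGroup.coe_mul, Matrix.mul_apply, Fin.sum_univ_two, hg]
        simp [lower]
      rw [e]
      exact right_ne_zero_of_mul_eq_one hdet
    rw [← mul_inv_cancel_right g (lower 1), ptAct_mul, key _ h1, lower_inv, hl]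
  · exact key g hg pt

end BinaryForms

namespace BinaryForms

section Diagonal

variable {σ : Type}

lemma mkDerivation_smul_X_monomial (w : σ → ℂ) (e : σ →₀ ℕ) (c : ℂ) :
    mkDerivation ℂ (fun v => w v • (X v : MvPolynomial σ ℂ)) (monomial e c) =
      monomial e ((e.sum fun v k => (k : ℂ) * w v) * c) := by
  rw [mkDerivation_monomial, Finsupp.sum, Finsupp.sum, Finset.smul_sum, Finset.sum_mul, map_sum]
  refine Finset.sum_congr rfl fun v hv => ?_
  have h : Finsupp.single v 1 ≤ e := by
    rw [Finsupp.single_le_iff]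
    exact Nat.one_le_iff_ne_zero.2 (Finsupp.mem_support_iff.1 hv)
  rw [smul_eq_mul, X, mul_smul_comm, monomial_mul, tsub_add_cancel_of_le h, mul_one, smul_monomial,
    smul_monomial, smul_eq_mul, smul_eq_mul]
  refine congrArg (monomial e) ?_
  ring

lemma coeff_mkDerivation_smul_X (w : σ → ℂ) (e : σ →₀ ℕ) (p : MvPolynomial σ ℂ) :
    coeff e (mkDerivation ℂ (fun v => w v • (X v : MvPolynomial σ ℂ)) p) =
      (e.sum fun v k => (k : ℂ) * w v) * coeff e p := by
  induction p using MvPolynomial.induction_on' with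
  | monomial e' c =>
    classical
    rw [mkDerivation_smul_X_monomial, coeff_monomial, coeff_monomial]
    split_ifs with h
    · rw [h]
    · rw [mul_zero]
  | add p q hp hq => rw [map_add, coeff_add, coeff_add, hp, hq, mul_add]

lemma aeval_mem_weightedHomogeneousSubmodule {τ M : Type} [AddCommMonoid M] {w : σ → M} {w' : τ → M}
    {f : σ → MvPolynomial τ ℂ} (hf : ∀ v, IsWeightedHomogeneous w' (f v) (w v)) (e : σ →₀ ℕ) (c : ℂ) :
    IsWeightedHomogeneous w' (aeval f (monomial e c)) (Finsupp.weight w e) := by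
  rw [aeval_monomial, algebraMap_eq, Finsupp.weight_apply, ← zero_add (e.sum _)]
  exact (isWeightedHomogeneous_C w' c).mul
    (IsWeightedHomogeneous.prod _ _ _ fun v _ => (hf v).pow (e v))

end Diagonal

variable {ν : Fin 3 → ℕ}

lemma eval_der_eq_zero {D : Derivation ℂ (CoordRing ν) (CoordRing ν)} {γ : ℂ → SL2} (h0 : γ 0 = 1)
    (hD : ∀ pt s v, HasDerivAt (fun s => ptAct ν (γ s) pt v) (eval (ptAct ν (γ s) pt) (D (X v))) s)
    {h : CoordRing ν} (hh : h ∈ Covariants ν) : D h = 0 := by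
  refine MvPolynomial.funext fun pt => ?_
  have h1 := hasDerivAt_eval (hD pt 0) h
  have h2 : (fun s => eval (ptAct ν (γ s) pt) h) = fun _ => eval pt h := _root_.funext fun s => hh _ _
  rw [h2, h0, ptAct_one] at h1
  rw [h1.unique (hasDerivAt_const _ _), map_zero]

lemma derU_eq_zero {h : CoordRing ν} (hh : h ∈ Covariants ν) : derU ν h = 0 :=
  eval_der_eq_zero upper_zero hasDerivAt_upper hh

lemma derL_eq_zero {h : CoordRing ν} (hh : h ∈ Covariants ν) : derL ν h = 0 :=
  eval_der_eq_zero lower_zero hasDerivAt_lower hh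

/-- Evaluation at the point `(1, 0)` of the plane. -/
def source (ν : Fin 3 → ℕ) : CoordRing ν →ₐ[ℂ] Pol ν := aeval (Sum.elim X ![1, 0])

lemma source_inl (v : Ix ν) : source ν (X (Sum.inl v)) = X v := by simp [source]

lemma source_inr_zero : source ν (X (Sum.inr 0)) = 1 := by simp [source]

lemma source_inr_one : source ν (X (Sum.inr 1)) = 0 := by simp [source]

lemma source_rename (p : Pol ν) : source ν (rename Sum.inl p) = p := by
  have : (source ν).comp (rename Sum.inl) = AlgHom.id ℂ (Pol ν) := algHom_ext fun v => by
    rw [AlgHom.comp_apply, rename_X, source_inl, AlgHom.id_apply]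
  rw [← AlgHom.comp_apply, this, AlgHom.id_apply]

lemma eval_source (a : Ix ν → ℂ) (h : CoordRing ν) :
    eval a (source ν h) = eval (Sum.elim a ![1, 0]) h := by
  induction h using MvPolynomial.induction_on with
  | C c => simp [source]
  | add p q hp hq => rw [map_add, map_add, map_add, hp, hq]
  | mul_X p v hp =>
    rw [map_mul, map_mul, map_mul, hp, eval_X]
    rcases v with v | i
    · rw [source_inl, eval_X, Sum.elim_inl]
    · fin_cases i
      · rw [Fin.zero_eta, source_inr_zero, map_one, Sum.elim_inr, Matrix.cons_val_zero]
      · rw [Fin.mk_one, source_inr_one, map_zero, Sum.elim_inr, Matrix.cons_val_one,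
          Matrix.cons_val_fin_one]

lemma source_derU (h : CoordRing ν) : source ν (derU ν h) = -derE ν (source ν h) := by
  induction h using MvPolynomial.induction_on with
  | C c => simp [source]
  | add p q hp hq => rw [map_add, map_add, map_add, map_add, hp, hq, neg_add]
  | mul_X p v hp =>
    have hv : source ν (derU ν (X v)) = -derE ν (source ν (X v)) := by
      rw [derU, mkDerivation_X]
      rcases v with v | i
      · rw [Sum.elim_inl, map_neg, source_rename, source_inl]
      · rw [Sum.elim_inr]
        fin_cases i
        · rw [Fin.zero_eta, Matrix.cons_val_zero, source_inr_zero, source_inr_one,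
            Derivation.map_one_eq_zero, neg_zero]
        · rw [Fin.mk_one, Matrix.cons_val_one, Matrix.cons_val_fin_one, source_inr_one, map_zero, map_zero, neg_zero]
    rw [map_mul (source ν), Derivation.leibniz, Derivation.leibniz]
    simp only [smul_eq_mul, map_add, map_mul, hp, hv]
    ring

lemma derE_source {h : CoordRing ν} (hh : h ∈ Covariants ν) : derE ν (source ν h) = 0 := by
  rw [← neg_eq_zero, ← source_derU, derU_eq_zero hh, map_zero]

lemma eq_zero_of_source {h : CoordRing ν} (hh : h ∈ Covariants ν) (h0 : source ν h = 0) : h = 0 := by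
  have key : h * X (Sum.inr 0) = 0 := by
    refine MvPolynomial.funext fun pt => ?_
    rw [map_mul, eval_X, map_zero]
    by_cases hx : pt (Sum.inr 0) = 0
    · rw [hx, mul_zero]
    let g : SL2 := ⟨!![(pt (Sum.inr 0))⁻¹, 0; -pt (Sum.inr 1), pt (Sum.inr 0)], by
      rw [Matrix.det_fin_two_of, inv_mul_cancel₀ hx, zero_mul, sub_zero]⟩
    have e : ptAct ν g pt = Sum.elim (fun v => ptAct ν g pt (Sum.inl v)) ![1, 0] := by
      refine _root_.funext fun v => ?_
      rcases v with v | i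
      · rfl
      · simp only [ptAct, Sum.elim_inr, Fin.sum_univ_two]
        fin_cases i
        · simp [g, hx]
        · simp [g]
          ring
    rw [← hh g pt, e, ← eval_source, h0, map_zero, zero_mul]
  exact (mul_eq_zero.1 key).resolve_right (X_ne_zero _)

/-- The weights of the torus, with the order added. -/
def torusWt (ν : Fin 3 → ℕ) : Var ν → (ℕ × ℕ × ℕ) × ℤ := Sum.elim (wt ν) ![(0, 0), (0, 2)]

lemma isWeightedHomogeneous_source (v : Var ν) :
    IsWeightedHomogeneous (wt ν) ((Sum.elim X ![1, 0] : Var ν → Pol ν) v) (torusWt ν v) := by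
  rcases v with v | i
  · exact isWeightedHomogeneous_X ℂ _ v
  · fin_cases i
    · exact isWeightedHomogeneous_one ℂ _
    · exact isWeightedHomogeneous_zero ℂ _ _

lemma weight_of_mem_support {h : CoordRing ν} (hh : h ∈ Covariants ν) {d k : ℕ}
    (hw : h.IsWeightedHomogeneous (wBi ν) (d, k)) {e : Var ν →₀ ℕ} (he : coeff e h ≠ 0) :
    (Finsupp.weight (torusWt ν) e).1.1 + (Finsupp.weight (torusWt ν) e).1.2.1 +
      (Finsupp.weight (torusWt ν) e).1.2.2 = d ∧ (Finsupp.weight (torusWt ν) e).2 = k := by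
  have hD : ⁅derU ν, derL ν⁆ = mkDerivation ℂ fun v => (Sum.elim
      (fun v : Ix ν => ((ν v.1 : ℂ) - 2 * (v.2 : ℕ))) ![-1, 1] v : ℂ) • X v := by
    refine derivation_ext fun v => ?_
    rw [Derivation.commutator_apply, mkDerivation_X]
    rcases v with v | i
    · rw [← rename_X, derL_rename, derU_rename, map_neg, map_neg, derU_rename, derL_rename,
        neg_neg, neg_neg, ← map_sub, ← coord_coe, derE_derF_coord, add_sub_cancel_left, map_smul,
        Sum.elim_inl]
    · rw [derU, derL, mkDerivation_X, mkDerivation_X, Sum.elim_inr, Sum.elim_inr, Sum.elim_inr]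
      fin_cases i <;> simp [mkDerivation_X]
  have h1 := congrArg (fun D => coeff e (D h)) hD
  simp only [Derivation.commutator_apply, derU_eq_zero hh, derL_eq_zero hh, map_zero, sub_zero,
    coeff_zero] at h1
  rw [coeff_mkDerivation_smul_X, eq_comm, mul_eq_zero, or_iff_left he] at h1
  have h2 := hw he
  rw [Finsupp.weight_apply, Finsupp.sum_fintype _ _ (by simp), Fintype.sum_sum_type,
    Fin.sum_univ_two] at h2
  rw [Finsupp.sum_fintype _ _ (by simp), Fintype.sum_sum_type, Fin.sum_univ_two] at h1
  simp only [wBi, Sum.elim_inl, Sum.elim_inr, Matrix.cons_val_zero, Matrix.cons_val_one,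
    Matrix.cons_val_fin_one] at h1 h2
  rw [Finsupp.weight_apply, Finsupp.sum_fintype _ _ (by simp), Fintype.sum_sum_type,
    Fin.sum_univ_two]
  simp only [torusWt, Sum.elim_inl, Sum.elim_inr, Matrix.cons_val_zero, Matrix.cons_val_one,
    Matrix.cons_val_fin_one]
  have h3 := congrArg Prod.fst h2
  have h4 := congrArg Prod.snd h2
  simp only [Prod.fst_add, Prod.snd_add, Prod.fst_sum, Prod.snd_sum, Prod.smul_fst, Prod.smul_snd,
    smul_zero, add_zero, zero_add, smul_eq_mul, mul_one, mul_zero, Finset.sum_const_zero] at h3 h4 ⊢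
  constructor
  · rw [← h3, ← Finset.sum_add_distrib, ← Finset.sum_add_distrib]
    refine Finset.sum_congr rfl fun v _ => ?_
    obtain ⟨i, k⟩ := v
    fin_cases i <;> simp [wt, unit3]
  · have h5 : (((∑ v : Ix ν, e (Sum.inl v) • (wt ν v).2) : ℤ) : ℂ) =
        ∑ v : Ix ν, (e (Sum.inl v) : ℂ) * ((ν v.1 : ℂ) - 2 * (v.2 : ℕ)) := by
      push_cast
      refine Finset.sum_congr rfl fun v _ => ?_
      simp [wt]
    rw [← h5] at h1
    have h6 : (((∑ v : Ix ν, e (Sum.inl v) • (wt ν v).2 + e (Sum.inr 1) • 2 : ℤ)) : ℂ) =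
        ((k : ℤ) : ℂ) := by
      rw [← h4]
      simp only [nsmul_eq_mul] at h1 ⊢
      push_cast at h1 ⊢
      linear_combination h1
    exact_mod_cast h6

variable {hν : ∀ i, Even (ν i)}

lemma component_mem_A {p : Pol ν} (hp : derE ν p = 0) (d : ℕ × ℕ × ℕ) (u : ℤ) :
    weightedHomogeneousComponent (wt ν) (d, u) p ∈ (slAlg ν hν).A d u := by
  refine SlAlg.mem_A.2 ⟨weightedHomogeneousComponent_isWeightedHomogeneous _ _, ?_⟩
  have key : ∀ q : Pol ν, derE ν (weightedHomogeneousComponent (wt ν) (d, u) q) =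
      weightedHomogeneousComponent (wt ν) (d, u + 2) (derE ν q) := by
    intro q
    induction q using MvPolynomial.induction_on' with
    | monomial e c =>
      have h1 : monomial e c ∈ piece ν (Finsupp.weight (wt ν) e).1 (Finsupp.weight (wt ν) e).2 :=
        isWeightedHomogeneous_monomial _ _ _ rfl
      have h2 := derE_mem h1
      by_cases h : Finsupp.weight (wt ν) e = (d, u)
      · rw [h] at h1 h2
        rw [IsWeightedHomogeneous.weightedHomogeneousComponent_same h1,
          IsWeightedHomogeneous.weightedHomogeneousComponent_same h2]
      · rw [IsWeightedHomogeneous.weightedHomogeneousComponent_ne _ h1 (Ne.symm h),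
          IsWeightedHomogeneous.weightedHomogeneousComponent_ne _ h2, map_zero]
        intro h3
        rw [Prod.mk.injEq] at h3
        exact h (Prod.ext h3.1.symm (by simpa using h3.2.symm))
    | add p q hp hq => rw [map_add, map_add, map_add, map_add, hp, hq]
  rw [slAlg_E, key, hp, map_zero]

lemma mem_of_component_mem {p : Pol ν} {V : Submodule ℂ (Pol ν)}
    (h : ∀ d u, weightedHomogeneousComponent (wt ν) (d, u) p ∈ V) : p ∈ V := by
  rw [← finsum_weightedHomogeneousComponent (wt ν) p]
  exact finsum_induction (· ∈ V) (zero_mem V) (fun _ _ => add_mem) fun i => h i.1 i.2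

/-- The source of a covariant of positive degree or order. -/
lemma source_mem {h : CoordRing ν} (hh : h ∈ Covariants ν) {d k : ℕ} (hdk : 0 < d + k)
    (hw : h.IsWeightedHomogeneous (wBi ν) (d, k)) {V : Submodule ℂ (Pol ν)}
    (hV : ∀ δ ≠ 0, ∀ u, (slAlg ν hν).A δ u ≤ V) : source ν h ∈ V := by
  refine mem_of_component_mem fun δ u => ?_
  have h1 := component_mem_A (hν := hν) (derE_source hh) δ u
  by_cases hδ : δ = 0
  · suffices h2 : weightedHomogeneousComponent (wt ν) (δ, u) (source ν h) = 0 by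
      rw [h2]
      exact zero_mem V
    by_cases hu : u = 0
    · rw [h.as_sum, map_sum, map_sum]
      refine Finset.sum_eq_zero fun e he => ?_
      obtain ⟨h3, h4⟩ := weight_of_mem_support hh hw (mem_support_iff.1 he)
      refine IsWeightedHomogeneous.weightedHomogeneousComponent_ne _
        (aeval_mem_weightedHomogeneousSubmodule isWeightedHomogeneous_source e _) fun h5 => ?_
      rw [← h5] at h3 h4
      subst hδ hu
      simp at h3 h4
      omega
    · have h2 := SlAlg.A_le h1
      rwa [hδ, (slAlg ν hν).zero hu, Submodule.mem_bot, ← hδ] at h2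
  · exact hV δ hδ u h1

lemma derU_inr_zero : derU ν (X (Sum.inr 0)) = X (Sum.inr 1) := by simp [derU, mkDerivation_X]

lemma derU_inr_one : derU ν (X (Sum.inr 1)) = 0 := by simp [derU, mkDerivation_X]

lemma derL_inr_zero : derL ν (X (Sum.inr 0)) = 0 := by simp [derL, mkDerivation_X]

lemma derL_inr_one : derL ν (X (Sum.inr 1)) = X (Sum.inr 0) := by simp [derL, mkDerivation_X]

/-- The covariant with the given source. -/
lemma exists_covariant {d : ℕ × ℕ × ℕ} {k : ℕ} {p : Pol ν} (hp : p ∈ (slAlg ν hν).A d k) :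
    ∃ h ∈ Covariants ν, h.IsWeightedHomogeneous (wBi ν) (d.1 + d.2.1 + d.2.2, k) ∧
      source ν h = p := by
  have hfac : ∀ m : ℕ, (m.factorial : ℂ) ≠ 0 := fun m => by exact_mod_cast m.factorial_ne_zero
  have hE : derE ν p = 0 := (SlAlg.mem_A.1 hp).2
  refine ⟨∑ m ∈ Finset.range (k + 1), (m.factorial : ℂ)⁻¹ •
    (rename Sum.inl (((slAlg ν hν).F ^ m) p) * (X (Sum.inr 0) ^ (k - m) * X (Sum.inr 1) ^ m)),
    mem_covariants_of_der ?_ ?_, ?_, ?_⟩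
  · let V : ℕ → CoordRing ν := fun n => Nat.casesOn n 0 fun m =>
      (((m.factorial : ℂ)⁻¹ * ((k : ℂ) - m)) • (rename Sum.inl (((slAlg ν hν).F ^ m) p) *
        (X (Sum.inr 0) ^ (k - m - 1) * X (Sum.inr 1) ^ (m + 1))))
    have hV : ∀ m ∈ Finset.range (k + 1), derU ν ((m.factorial : ℂ)⁻¹ •
        (rename Sum.inl (((slAlg ν hν).F ^ m) p) * (X (Sum.inr 0) ^ (k - m) * X (Sum.inr 1) ^ m))) =
        V (m + 1) - V m := by
      intro m hm
      have hm := Finset.mem_range.1 hm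
      rw [Derivation.map_smul, Derivation.leibniz, Derivation.leibniz, Derivation.leibniz_pow,
        Derivation.leibniz_pow, derU_inr_zero, derU_inr_one, derU_rename]
      rcases m with _ | m
      · simp only [V, pow_zero, Module.End.one_apply, hE]
        simp [smul_eq_C_mul]
        ring
      · have h1 := SlAlg.EFpow hp m
        rw [slAlg_E] at h1
        rw [h1, map_smul]
        have h2 : ((m + 1).factorial : ℂ) = (m + 1) * m.factorial := by
          rw [Nat.factorial_succ]
          push_cast
          rfl
        have h3 := hfac m
        have h4 : (m : ℂ) + 1 ≠ 0 := by exact_mod_cast m.succ_ne_zero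
        simp only [V, h2, smul_eq_mul, nsmul_eq_mul, smul_eq_C_mul, smul_zero, mul_zero, zero_add,
          Nat.add_sub_cancel]
        have h5 : (C ((m : ℂ) + 1 : ℂ)⁻¹ * C ((m : ℂ) + 1) : CoordRing ν) = 1 := by
          rw [← map_mul, inv_mul_cancel₀ h4, map_one]
        have h6 : ((k - (m + 1) : ℕ) : CoordRing ν) = C ((k : ℂ) - (m + 1)) := by
          rw [← map_natCast C, Nat.cast_sub (by omega)]
          push_cast
          rfl
        rw [h6, mul_inv, Nat.sub_sub k m 1]
        simp only [map_mul, map_sub, map_add, map_one, Nat.cast_add, Nat.cast_one, Int.cast_natCast] at h5 ⊢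
        linear_combination (-(C (m.factorial : ℂ)⁻¹ * (C (k : ℂ) - C (m : ℂ)) *
          rename Sum.inl (((slAlg ν hν).F ^ m) p) *
          (X (Sum.inr 0) ^ (k - (m + 1)) * X (Sum.inr 1) ^ (m + 1)))) * h5
    rw [map_sum, Finset.sum_congr rfl hV, Finset.sum_range_sub]
    simp [V]
  · let V : ℕ → CoordRing ν := fun m => (((m.factorial : ℂ)⁻¹ * m) •
      (rename Sum.inl (((slAlg ν hν).F ^ m) p) *
        (X (Sum.inr 0) ^ (k + 1 - m) * X (Sum.inr 1) ^ (m - 1))))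
    have hV : ∀ m ∈ Finset.range (k + 1), derL ν ((m.factorial : ℂ)⁻¹ •
        (rename Sum.inl (((slAlg ν hν).F ^ m) p) * (X (Sum.inr 0) ^ (k - m) * X (Sum.inr 1) ^ m))) =
        V m - V (m + 1) := by
      intro m hm
      have hm := Finset.mem_range.1 hm
      rw [Derivation.map_smul, Derivation.leibniz, Derivation.leibniz, Derivation.leibniz_pow,
        Derivation.leibniz_pow, derL_inr_zero, derL_inr_one, derL_rename]
      have h2 : ((m + 1).factorial : ℂ) = (m + 1) * m.factorial := by
        rw [Nat.factorial_succ]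
        push_cast
        rfl
      have h3 := hfac m
      have h4 : (m : ℂ) + 1 ≠ 0 := by exact_mod_cast m.succ_ne_zero
      have h5 : (C ((m : ℂ) + 1 : ℂ)⁻¹ * C ((m : ℂ) + 1) : CoordRing ν) = 1 := by
        rw [← map_mul, inv_mul_cancel₀ h4, map_one]
      simp only [V, h2, smul_eq_mul, nsmul_eq_mul, smul_eq_C_mul, smul_zero, mul_zero, add_zero,
          Nat.add_sub_cancel, SlAlg.Fpow_succ, slAlg_F]
      rw [show k + 1 - m = (k - m) + 1 by omega, show k + 1 - (m + 1) = k - m by omega, mul_inv,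
        ← map_natCast C m]
      simp only [map_mul, map_add, map_one, Nat.cast_add, Nat.cast_one] at h5 ⊢
      linear_combination (C (m.factorial : ℂ)⁻¹ *
          rename Sum.inl (derF ν (((slAlg ν hν).F ^ m) p)) *
          (X (Sum.inr 0) ^ (k - m) * X (Sum.inr 1) ^ m)) * h5
    rw [map_sum, Finset.sum_congr rfl hV, Finset.sum_range_sub']
    simp only [V, SlAlg.Fpow_eq_zero hp]
    simp
  · refine IsWeightedHomogeneous.sum _ _ _ fun m hm => ?_
    have hm := Finset.mem_range.1 hm
    rw [smul_eq_C_mul]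
    refine IsWeightedHomogeneous.C_mul ?_ _
    have h1 : IsWeightedHomogeneous (wBi ν) (rename Sum.inl (((slAlg ν hν).F ^ m) p))
        (d.1 + d.2.1 + d.2.2, 0) := by
      refine piece_induction (P := fun q : Pol ν => IsWeightedHomogeneous (wBi ν) (rename Sum.inl q)
        (d.1 + d.2.1 + d.2.2, 0)) ?_ ?_ ?_ (SlAlg.Fpow_mem (SlAlg.A_le hp) m)
      · rw [map_zero]
        exact isWeightedHomogeneous_zero ℂ _ _
      · intro p q hp hq
        rw [map_add]
        exact hp.add hq
      · intro e c he
        rw [rename_monomial]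
        refine isWeightedHomogeneous_monomial _ _ _ ?_
        rw [Finsupp.weight_apply, Finsupp.sum_mapDomain_index_inj Sum.inl_injective]
        simp only [wBi, Sum.elim_inl]
        rw [← degree_eq he, Finsupp.degree_apply, Finsupp.sum]
        ext
        · simp [Prod.fst_sum]
        · simp [Prod.snd_sum]
    have h2 := h1.mul (((isWeightedHomogeneous_X ℂ (wBi ν) (Sum.inr 0)).pow (k - m)).mul
      ((isWeightedHomogeneous_X ℂ (wBi ν) (Sum.inr 1)).pow m))
    convert h2 using 1
    simp [wBi]
    omega
  · rw [map_sum, Finset.sum_eq_single 0]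
    · rw [map_smul, map_mul, source_rename, map_mul, map_pow, source_inr_zero]
      simp
    · intro m _ hm
      rw [map_smul, map_mul, map_mul, map_pow, map_pow, source_inr_one, zero_pow hm, mul_zero,
        mul_zero, smul_zero]
    · simp

end BinaryForms

namespace BinaryForms

variable {ν : Fin 3 → ℕ} {hν : ∀ i, Even (ν i)}

/-- The linear map taking a covariant to its source. -/
def sourceCov (ν : Fin 3 → ℕ) : ↥(Covariants ν) →ₐ[ℂ] Pol ν := (source ν).comp (Covariants ν).val

lemma sourceCov_injective : Function.Injective (sourceCov ν) := by
  refine (injective_iff_map_eq_zero _).2 fun h hh => ?_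
  exact Subtype.ext (eq_zero_of_source h.2 hh)

/-- Span of the highest weight vectors of positive degree. -/
def plus (ν : Fin 3 → ℕ) (hν : ∀ i, Even (ν i)) : Submodule ℂ (Pol ν) :=
  ⨆ d : {d : ℕ × ℕ × ℕ // d ≠ 0}, ⨆ u : ℤ, (slAlg ν hν).A d u

/-- Span of the decomposable highest weight vectors. -/
def plusSq (ν : Fin 3 → ℕ) (hν : ∀ i, Even (ν i)) : Submodule ℂ (Pol ν) :=
  ⨆ d : {d : ℕ × ℕ × ℕ // d ≠ 0}, ⨆ u : ℤ, (slAlg ν hν).Q d u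

lemma A_le_plus {d : ℕ × ℕ × ℕ} (hd : d ≠ 0) (u : ℤ) : (slAlg ν hν).A d u ≤ plus ν hν :=
  le_iSup_of_le ⟨d, hd⟩ (le_iSup_of_le u le_rfl)

lemma Q_le_plusSq {d : ℕ × ℕ × ℕ} (hd : d ≠ 0) (u : ℤ) : (slAlg ν hν).Q d u ≤ plusSq ν hν :=
  le_iSup_of_le ⟨d, hd⟩ (le_iSup_of_le u le_rfl)

lemma sourceCov_mem_plus {h : ↥(Covariants ν)} (hh : h ∈ Cplus ν) : sourceCov ν h ∈ plus ν hν := by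
  have : Cplus ν ≤ (plus ν hν).comap (sourceCov ν).toLinearMap := by
    refine Submodule.span_le.2 ?_
    rintro x ⟨d, k, hdk, hx⟩
    exact source_mem (hν := hν) x.2 hdk hx fun δ hδ u => A_le_plus hδ u
  exact this hh

lemma exists_mem_Cplus {d : ℕ × ℕ × ℕ} (hd : d ≠ 0) {u : ℤ} {p : Pol ν} (hp : p ∈ (slAlg ν hν).A d u) :
    ∃ h ∈ Cplus ν, sourceCov ν h = p := by
  rcases lt_or_ge u 0 with hu | hu
  · exact ⟨0, zero_mem _, by rw [map_zero, SlAlg.A_neg hu hp]⟩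
  · lift u to ℕ using hu
    obtain ⟨h, hh, hw, e⟩ := exists_covariant hp
    refine ⟨⟨h, hh⟩, Submodule.subset_span ⟨_, _, ?_, hw⟩, e⟩
    by_contra! h0
    apply hd
    ext <;> simp <;> omega

lemma mul_mem_plusSq {x y : Pol ν} (hx : x ∈ plus ν hν) (hy : y ∈ plus ν hν) :
    x * y ∈ plusSq ν hν := by
  have key : ∀ d : {d : ℕ × ℕ × ℕ // d ≠ 0}, ∀ u, ∀ x ∈ (slAlg ν hν).A d u, ∀ y ∈ plus ν hν,
      x * y ∈ plusSq ν hν := by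
    intro d u x hx y hy
    suffices h : plus ν hν ≤ (plusSq ν hν).comap (LinearMap.mulLeft ℂ x) from h hy
    refine iSup_le fun d' => iSup_le fun u' => fun y hy => ?_
    refine Q_le_plusSq (d := d.1 + d'.1) ?_ (u + u') (SlAlg.mul_mem_Q d.2 d'.2 hx hy)
    intro h
    exact d.2 (add_eq_zero.1 h).1
  suffices h : plus ν hν ≤ (plusSq ν hν).comap (LinearMap.mulRight ℂ y) from h hx
  exact iSup_le fun d => iSup_le fun u => fun x hx => key d u x hx y hy

lemma sourceCov_mem_plusSq {h : ↥(Covariants ν)} (hh : h ∈ CplusSq ν) :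
    sourceCov ν h ∈ plusSq ν hν := by
  have : CplusSq ν ≤ (plusSq ν hν).comap (sourceCov ν).toLinearMap := by
    refine Submodule.span_le.2 ?_
    rintro _ ⟨x, hx, y, hy, rfl⟩
    change sourceCov ν (x * y) ∈ plusSq ν hν
    rw [map_mul]
    exact mul_mem_plusSq (sourceCov_mem_plus hx) (sourceCov_mem_plus hy)
  exact this hh

lemma plusSq_le : plusSq ν hν ≤ (CplusSq ν).map (sourceCov ν).toLinearMap := by
  refine iSup_le fun d => iSup_le fun u => Submodule.span_le.2 ?_
  rintro _ ⟨d₁, d₂, u₁, u₂, h₁, h₂, -, -, x, hx, y, hy, rfl⟩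
  obtain ⟨x, hx', rfl⟩ := exists_mem_Cplus h₁ hx
  obtain ⟨y, hy', rfl⟩ := exists_mem_Cplus h₂ hy
  exact ⟨x * y, Submodule.subset_span ⟨x, hx', y, hy', rfl⟩, map_mul (sourceCov ν) x y⟩

lemma component_mem_Q {p : Pol ν} (hp : p ∈ plusSq ν hν) (d : ℕ × ℕ × ℕ) (u : ℤ) :
    weightedHomogeneousComponent (wt ν) (d, u) p ∈ (slAlg ν hν).Q d u := by
  suffices h : plusSq ν hν ≤ ((slAlg ν hν).Q d u).comap (weightedHomogeneousComponent (wt ν) (d, u))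
    from h hp
  refine iSup_le fun d' => iSup_le fun u' => fun x hx => ?_
  have h1 : x ∈ piece ν d' u' := SlAlg.A_le (SlAlg.Q_le hx)
  rw [Submodule.mem_comap]
  by_cases h : (d, u) = ((d' : ℕ × ℕ × ℕ), u')
  · rw [h, IsWeightedHomogeneous.weightedHomogeneousComponent_same h1]
    rw [Prod.mk.injEq] at h
    rwa [h.1, h.2]
  · rw [IsWeightedHomogeneous.weightedHomogeneousComponent_ne _ h1 h]
    exact zero_mem _

/-- Families of highest weight vectors forming bases modulo decomposables give minimal bases. -/
theorem exists_isMinimalBasis (hν : ∀ i, Even (ν i)) {N : ℕ} (g : Fin N → Pol ν)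
    (δ : Fin N → ℕ × ℕ × ℕ) (o : Fin N → ℕ) (hδ : ∀ x, δ x ≠ 0) (hg : ∀ x, g x ∈ (slAlg ν hν).A (δ x) (o x))
    (span : ∀ d ≠ 0, ∀ k : ℕ, (slAlg ν hν).A d k ≤
      (slAlg ν hν).Q d k ⊔ Submodule.span ℂ (g '' {x | δ x = d ∧ o x = k}))
    (indep : ∀ d ≠ 0, ∀ k : ℕ, ∀ c : Fin N → ℂ, (∀ x, ¬(δ x = d ∧ o x = k) → c x = 0) →
      ∑ x, c x • g x ∈ (slAlg ν hν).Q d k → c = 0) :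
    (∃ B : Fin N → ↥(Covariants ν), IsMinimalBasis ν B) ∧
      Module.finrank ℂ ↥((Cplus ν).map (CplusSq ν).mkQ) = N := by
  have hex : ∀ x, ∃ B : ↥(Covariants ν), (B : CoordRing ν).IsWeightedHomogeneous (wBi ν)
      ((δ x).1 + (δ x).2.1 + (δ x).2.2, o x) ∧ sourceCov ν B = g x := by
    intro x
    obtain ⟨h, hh, hw, e⟩ := exists_covariant (hg x)
    exact ⟨⟨h, hh⟩, hw, e⟩
  choose B hB hBg using hex
  have hpos : ∀ x, 0 < (δ x).1 + (δ x).2.1 + (δ x).2.2 + o x := by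
    intro x
    by_contra! h0
    apply hδ x
    ext <;> simp <;> omega
  have hLI : LinearIndependent ℂ (fun x => (CplusSq ν).mkQ (B x)) := by
    rw [Fintype.linearIndependent_iff]
    intro c hc
    have h1 : ∑ x, c x • B x ∈ CplusSq ν := by
      rw [← (CplusSq ν).ker_mkQ, LinearMap.mem_ker, map_sum, ← hc]
      simp only [map_smul]
    have h2 := sourceCov_mem_plusSq (hν := hν) h1
    simp only [map_sum, map_smul, hBg] at h2
    intro x
    have h3 := component_mem_Q h2 (δ x) (o x)
    have h4 : weightedHomogeneousComponent (wt ν) (δ x, (o x : ℤ)) (∑ x, c x • g x) =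
        ∑ y, (if δ y = δ x ∧ o y = o x then c y else 0) • g y := by
      rw [map_sum]
      refine Finset.sum_congr rfl fun y _ => ?_
      have h5 : g y ∈ piece ν (δ y) (o y) := SlAlg.A_le (hg y)
      rw [map_smul]
      split_ifs with h
      · rw [← h.1, ← h.2, IsWeightedHomogeneous.weightedHomogeneousComponent_same h5]
      · rw [IsWeightedHomogeneous.weightedHomogeneousComponent_ne _ h5, smul_zero, zero_smul]
        intro h6
        rw [Prod.mk.injEq] at h6
        exact h ⟨h6.1.symm, by exact_mod_cast h6.2.symm⟩
    rw [h4] at h3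
    have h5 := indep (δ x) (hδ x) (o x) _ (fun y hy => if_neg hy) h3
    have h6 := congrFun h5 x
    simpa using h6
  have hspan : Submodule.span ℂ (Set.range fun x => (CplusSq ν).mkQ (B x)) =
      (Cplus ν).map (CplusSq ν).mkQ := by
    refine le_antisymm (Submodule.span_le.2 ?_) ?_
    · rintro _ ⟨x, rfl⟩
      exact ⟨B x, Submodule.subset_span ⟨_, _, hpos x, hB x⟩, rfl⟩
    · rintro _ ⟨h, hh, rfl⟩
      have h1 := sourceCov_mem_plus (hν := hν) hh
      have h2 : plus ν hν ≤
          (CplusSq ν ⊔ Submodule.span ℂ (Set.range B)).map (sourceCov ν).toLinearMap := by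
        refine iSup_le fun d => iSup_le fun u => fun p hp => ?_
        rcases lt_or_ge u 0 with hu | hu
        · rw [SlAlg.A_neg hu hp]
          exact zero_mem _
        · lift u to ℕ using hu
          have h3 := span d d.2 u hp
          revert h3
          rw [Submodule.map_sup]
          refine fun h3 => (sup_le_sup (le_trans (Q_le_plusSq d.2 _) plusSq_le) ?_) h3
          rw [Submodule.map_span]
          refine Submodule.span_mono ?_
          rintro _ ⟨x, -, rfl⟩
          exact ⟨B x, ⟨x, rfl⟩, hBg x⟩
      obtain ⟨h', hh', e⟩ := h2 h1
      rw [← sourceCov_injective e]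
      obtain ⟨q, hq, b, hb, rfl⟩ := Submodule.mem_sup.1 hh'
      rw [map_add, (Submodule.mkQ_apply _ q).trans ((Submodule.Quotient.mk_eq_zero _).2 hq), zero_add]
      have h3 : Submodule.span ℂ (Set.range B) ≤
          (Submodule.span ℂ (Set.range fun x => (CplusSq ν).mkQ (B x))).comap (CplusSq ν).mkQ := by
        refine Submodule.span_le.2 ?_
        rintro _ ⟨x, rfl⟩
        exact Submodule.subset_span ⟨x, rfl⟩
      exact h3 hb
  refine ⟨⟨B, fun x => ⟨_, _, hpos x, hB x⟩, hLI, hspan⟩, ?_⟩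
  rw [← hspan, finrank_span_eq_card hLI, Fintype.card_fin]

end BinaryForms

namespace BinaryForms

variable {ν : Fin 3 → ℕ}

/-- The generating polynomial of the numbers of multisets of size `a` in `{0, …, n - 1}` by sum. -/
def multisetPoly : ℕ → ℕ → Polynomial ℕ
  | 0, 0 => 1
  | 0, _ + 1 => 0
  | n + 1, 0 => multisetPoly n 0
  | n + 1, a + 1 => multisetPoly n (a + 1) + Polynomial.X ^ n * multisetPoly (n + 1) a

def toFun3 (d : ℕ × ℕ × ℕ) : Fin 3 → ℕ := ![d.1, d.2.1, d.2.2]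

lemma toFun3_add_unit3 (d : ℕ × ℕ × ℕ) (i j : Fin 3) :
    toFun3 (d + unit3 i) j = toFun3 d j + if j = i then 1 else 0 := by
  fin_cases i <;> fin_cases j <;> simp [toFun3, unit3]

lemma toFun3_eq_zero {d : ℕ × ℕ × ℕ} : toFun3 d = 0 ↔ d = 0 := by
  obtain ⟨a, b, c⟩ := d
  simp [toFun3, funext_iff, Fin.forall_fin_succ]

lemma exists_eq_add_unit3 {d : ℕ × ℕ × ℕ} {i : Fin 3} (h : toFun3 d i ≠ 0) :
    ∃ d', d = d' + unit3 i := by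
  obtain ⟨a, b, c⟩ := d
  fin_cases i
  · exact ⟨(a - 1, b, c), by simp [toFun3] at h; simp [unit3]; omega⟩
  · exact ⟨(a, b - 1, c), by simp [toFun3] at h; simp [unit3]; omega⟩
  · exact ⟨(a, b, c - 1), by simp [toFun3] at h; simp [unit3]; omega⟩

/-- Multidegree and index of the coordinates. -/
def ixWt (ν : Fin 3 → ℕ) (v : Ix ν) : (ℕ × ℕ × ℕ) × ℕ := (unit3 v.1, (v.2 : ℕ))

def ixHom (ν : Fin 3 → ℕ) : (ℕ × ℕ × ℕ) × ℕ →+ (ℕ × ℕ × ℕ) × ℤ where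
  toFun t := (t.1, ((ν 0 * t.1.1 + ν 1 * t.1.2.1 + ν 2 * t.1.2.2 : ℕ) : ℤ) - 2 * (t.2 : ℤ))
  map_zero' := by simp
  map_add' s t := by
    refine Prod.ext rfl ?_
    simp only [Prod.fst_add, Prod.snd_add]
    push_cast
    ring

lemma ixHom_injective : Function.Injective (ixHom ν) := by
  rintro ⟨d, w⟩ ⟨d', w'⟩ h
  simp only [ixHom, AddMonoidHom.coe_mk, ZeroHom.coe_mk, Prod.mk.injEq] at h
  obtain ⟨rfl, h⟩ := h
  have : w = w' := by omega
  rw [this]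

lemma ixHom_weight (e : Ix ν →₀ ℕ) : ixHom ν (Finsupp.weight (ixWt ν) e) = Finsupp.weight (wt ν) e := by
  rw [Finsupp.weight_apply, Finsupp.weight_apply, map_finsuppSum]
  refine Finset.sum_congr rfl fun v _ => ?_
  have : ixHom ν (ixWt ν v) = wt ν v := by
    obtain ⟨i, k⟩ := v
    fin_cases i <;> simp [ixHom, ixWt, wt, unit3]
  simp only [← this]
  exact map_nsmul _ _ _

/-- Exponents of multidegree and weight `t` supported on the coordinates below `m`. -/
def expSet (ν m : Fin 3 → ℕ) (t : (ℕ × ℕ × ℕ) × ℕ) : Set (Ix ν →₀ ℕ) :=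
  {e | (∀ v, e v ≠ 0 → (v.2 : ℕ) < m v.1) ∧ Finsupp.weight (ixWt ν) e = t}

lemma weight_iff {e : Ix ν →₀ ℕ} {t : (ℕ × ℕ × ℕ) × ℕ} :
    Finsupp.weight (wt ν) e = ixHom ν t ↔ Finsupp.weight (ixWt ν) e = t := by
  rw [← ixHom_weight, ixHom_injective.eq_iff]

lemma expSet_finite (m : Fin 3 → ℕ) (t : (ℕ × ℕ × ℕ) × ℕ) : (expSet ν m t).Finite :=
  (finite_weight (ixHom ν t).1 (ixHom ν t).2).subset fun _ he => weight_iff.2 he.2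

lemma expSet_succ {m : Fin 3 → ℕ} {i : Fin 3} {n : ℕ} (hn : n < ν i + 1) (hm : m i = n + 1)
    (t : (ℕ × ℕ × ℕ) × ℕ) :
    expSet ν m (t + (unit3 i, n)) = expSet ν (Function.update m i n) (t + (unit3 i, n)) ∪
      (fun e => e + Finsupp.single ⟨i, ⟨n, hn⟩⟩ 1) '' expSet ν m t := by
  set v₀ : Ix ν := ⟨i, ⟨n, hn⟩⟩ with hv₀
  have hw : Finsupp.weight (ixWt ν) (Finsupp.single v₀ 1) = (unit3 i, n) := by
    rw [Finsupp.weight_single, one_smul]; rfl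
  ext e
  simp only [expSet, Set.mem_union, Set.mem_image, Set.mem_ofPred_eq]
  constructor
  · rintro ⟨h1, h2⟩
    by_cases h : e v₀ = 0
    · left
      refine ⟨fun v hv => ?_, h2⟩
      have := h1 v hv
      rcases eq_or_ne v.1 i with rfl | hi
      · rw [Function.update_self]
        have : (v.2 : ℕ) ≠ n := by
          rintro rfl
          exact hv h
        omega
      · rwa [Function.update_of_ne hi]
    · right
      have he : e - Finsupp.single v₀ 1 + Finsupp.single v₀ 1 = e := by
        refine tsub_add_cancel_of_le ?_
        rw [Finsupp.single_le_iff]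
        omega
      refine ⟨e - Finsupp.single v₀ 1, ⟨fun v hv => h1 v fun h0 => hv ?_, ?_⟩, he⟩
      · simp [h0]
      · rw [← he, map_add, hw] at h2
        exact add_right_cancel h2
  · rintro (⟨h1, h2⟩ | ⟨e, ⟨h1, h2⟩, rfl⟩)
    · refine ⟨fun v hv => (h1 v hv).trans_le ?_, h2⟩
      rcases eq_or_ne v.1 i with h | hi
      · rw [h, Function.update_self]; omega
      · rw [Function.update_of_ne hi]
    · refine ⟨fun v hv => ?_, by rw [map_add, hw, h2]⟩
      rcases eq_or_ne v v₀ with rfl | hne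
      · rw [hv₀, hm]; exact Nat.lt_succ_self n
      · refine h1 v fun h0 => hv ?_
        simp [h0, hne.symm]

lemma expSet_update {m : Fin 3 → ℕ} {i : Fin 3} {n : ℕ} (hn : n < ν i + 1) (hm : m i = n + 1)
    (t : (ℕ × ℕ × ℕ) × ℕ) (ht : ∀ s, t ≠ s + (unit3 i, n)) :
    expSet ν m t = expSet ν (Function.update m i n) t := by
  set v₀ : Ix ν := ⟨i, ⟨n, hn⟩⟩ with hv₀
  have hw : Finsupp.weight (ixWt ν) (Finsupp.single v₀ 1) = (unit3 i, n) := by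
    rw [Finsupp.weight_single, one_smul]; rfl
  ext e
  simp only [expSet, Set.mem_ofPred_eq]
  refine and_congr_left fun h2 => ?_
  have h : e v₀ = 0 := by
    by_contra h
    refine ht (Finsupp.weight (ixWt ν) (e - Finsupp.single v₀ 1)) ?_
    rw [← h2, ← hw, ← map_add, tsub_add_cancel_of_le]
    rw [Finsupp.single_le_iff]
    omega
  refine forall_congr' fun v => forall_congr' fun hv => ?_
  rcases eq_or_ne v.1 i with rfl | hi
  · rw [Function.update_self, hm]
    have : (v.2 : ℕ) ≠ n := by
      rintro rfl
      exact hv h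
    omega
  · rw [Function.update_of_ne hi]

lemma expSet_zero (t : (ℕ × ℕ × ℕ) × ℕ) : expSet ν 0 t = if t = 0 then {0} else ∅ := by
  ext e
  have : (∀ v : Ix ν, e v ≠ 0 → (v.2 : ℕ) < (0 : Fin 3 → ℕ) v.1) ↔ e = 0 := by
    simp [Finsupp.ext_iff]
  simp only [expSet, Set.mem_ofPred_eq, this]
  split_ifs with h
  · subst h
    simp only [Set.mem_singleton_iff, and_iff_left_iff_imp]
    rintro rfl
    simp
  · simp only [Set.mem_empty_iff_false, iff_false, not_and]
    rintro rfl
    simpa using Ne.symm h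

theorem expSet_ncard {m : Fin 3 → ℕ} (hm : ∀ i, m i ≤ ν i + 1) (d : ℕ × ℕ × ℕ) (w : ℕ) :
    (expSet ν m (d, w)).ncard = (∏ i, multisetPoly (m i) (toFun3 d i)).coeff w := by
  obtain ⟨M, hM⟩ : ∃ M, ∑ i, m i = M := ⟨_, rfl⟩
  induction M generalizing m d w with
  | zero =>
    have : m = 0 := by
      funext i
      exact Finset.sum_eq_zero_iff.1 hM i (Finset.mem_univ _)
    subst this
    rw [expSet_zero]
    by_cases hd : d = 0
    · subst hd
      have : ∀ i, toFun3 0 i = 0 := fun i => by rw [toFun3_eq_zero.2 rfl]; rfl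
      simp only [this, Pi.zero_apply, multisetPoly, Finset.prod_const_one, Polynomial.coeff_one]
      by_cases hw : w = 0
      · simp [hw]
      · simp [hw]
    · obtain ⟨i, hi⟩ : ∃ i, toFun3 d i ≠ 0 := by
        by_contra! h
        exact hd (toFun3_eq_zero.1 (funext h))
      rw [if_neg (by simp [hd]), Set.ncard_empty, Finset.prod_eq_zero (Finset.mem_univ i),
        Polynomial.coeff_zero]
      obtain ⟨a, ha⟩ := Nat.exists_eq_succ_of_ne_zero hi
      rw [ha, Pi.zero_apply, Nat.succ_eq_add_one, multisetPoly]
  | succ M ih =>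
    obtain ⟨i, hi⟩ : ∃ i, m i ≠ 0 := by
      by_contra! h
      simp [h] at hM
    obtain ⟨n, hn⟩ := Nat.exists_eq_succ_of_ne_zero hi
    rw [Nat.succ_eq_add_one] at hn
    have hnν : n < ν i + 1 := by have := hm i; omega
    have hsum : ∑ j, Function.update m i n j = M := by
      have h1 := Finset.sum_update_of_mem (Finset.mem_univ i) m n
      have h2 := Finset.add_sum_erase Finset.univ m (Finset.mem_univ i)
      rw [Finset.sdiff_singleton_eq_erase] at h1
      omega
    have hle : ∀ j, Function.update m i n j ≤ ν j + 1 := by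
      intro j
      rcases eq_or_ne j i with rfl | hj
      · rw [Function.update_self]; omega
      · rw [Function.update_of_ne hj]; exact hm j
    have prod_update : ∀ e, ∏ j, multisetPoly (Function.update m i n j) (toFun3 e j) =
        multisetPoly n (toFun3 e i) * ∏ j ∈ Finset.univ.erase i, multisetPoly (m j) (toFun3 e j) := by
      intro e
      rw [← Finset.mul_prod_erase _ _ (Finset.mem_univ i), Function.update_self]
      congr 1
      refine Finset.prod_congr rfl fun j hj => ?_
      rw [Function.update_of_ne (Finset.ne_of_mem_erase hj)]
    have prod_m : ∀ e, ∏ j, multisetPoly (m j) (toFun3 e j) =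
        multisetPoly (n + 1) (toFun3 e i) * ∏ j ∈ Finset.univ.erase i, multisetPoly (m j) (toFun3 e j) := by
      intro e
      rw [← Finset.mul_prod_erase _ _ (Finset.mem_univ i), hn]
    obtain ⟨a, ha⟩ : ∃ a, toFun3 d i = a := ⟨_, rfl⟩
    induction a generalizing d w with
    | zero =>
      rw [expSet_update hnν hn, ih hle _ _ hsum, prod_update, prod_m, ha, multisetPoly]
      · intro s hs
        have := toFun3_add_unit3 s.1 i i
        rw [if_pos rfl, ← show d = s.1 + unit3 i from congrArg Prod.fst hs] at this
        omega
    | succ a iha =>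
      obtain ⟨d', rfl⟩ := exists_eq_add_unit3 (d := d) (i := i) (by omega)
      have hd' : toFun3 d' i = a := by
        have := toFun3_add_unit3 d' i i
        rw [if_pos rfl] at this
        omega
      have herase : ∏ j ∈ Finset.univ.erase i, multisetPoly (m j) (toFun3 (d' + unit3 i) j) =
          ∏ j ∈ Finset.univ.erase i, multisetPoly (m j) (toFun3 d' j) := by
        refine Finset.prod_congr rfl fun j hj => ?_
        rw [toFun3_add_unit3, if_neg (Finset.ne_of_mem_erase hj), add_zero]
      have e1 : (∏ j, multisetPoly (m j) (toFun3 (d' + unit3 i) j)) =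
          (∏ j, multisetPoly (Function.update m i n j) (toFun3 (d' + unit3 i) j)) +
          (∏ j, multisetPoly (m j) (toFun3 d' j)) * Polynomial.X ^ n := by
        rw [prod_m, prod_m, prod_update, herase, ha, hd']
        simp only [multisetPoly]
        ring
      rw [e1, Polynomial.coeff_add, Polynomial.coeff_mul_X_pow']
      split_ifs with hw
      · obtain ⟨w', rfl⟩ := Nat.exists_eq_add_of_le' hw
        rw [Nat.add_sub_cancel, ← iha _ _ hd', ← ih hle _ _ hsum]
        have := expSet_succ hnν hn (d', w')
        rw [Prod.mk_add_mk] at this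
        rw [this, Set.ncard_union_eq _ (expSet_finite _ _) ((expSet_finite _ _).image _),
          Set.ncard_image_of_injective _ (add_left_injective _)]
        rw [Set.disjoint_left]
        rintro e he ⟨e', -, rfl⟩
        have := he.1 ⟨i, ⟨n, hnν⟩⟩ (by simp)
        simp at this
      · rw [add_zero, expSet_update hnν hn, ih hle _ _ hsum]
        intro s hs
        have : w = s.2 + n := congrArg Prod.snd hs
        omega

/-- The number of monomials of multidegree `d` and weight index `w`. -/
def monCount (ν : Fin 3 → ℕ) (d : ℕ × ℕ × ℕ) (w : ℕ) : ℕ :=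
  (∏ i, multisetPoly (ν i + 1) (toFun3 d i)).coeff w

lemma finrank_piece (d : ℕ × ℕ × ℕ) (w : ℕ) :
    Module.finrank ℂ (piece ν (ixHom ν (d, w)).1 (ixHom ν (d, w)).2) = monCount ν d w := by
  rw [piece_eq_supported, Module.finrank_eq_nat_card_basis (basisRestrictSupport ℂ _), monCount,
    ← expSet_ncard (m := fun i => ν i + 1) fun i => le_rfl, Nat.card_coe_set_eq]
  congr 1
  ext e
  rw [Set.mem_ofPred_eq, Prod.mk.eta, weight_iff, expSet, Set.mem_ofPred_eq]
  refine (and_iff_right fun v _ => v.2.2).symm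

variable {hν : ∀ i, Even (ν i)}

lemma finrank_A_add {d : ℕ × ℕ × ℕ} {k w : ℕ}
    (h : ν 0 * d.1 + ν 1 * d.2.1 + ν 2 * d.2.2 = k + 2 * (w + 1)) :
    Module.finrank ℂ ((slAlg ν hν).A d k) + monCount ν d w = monCount ν d (w + 1) := by
  have h1 : ixHom ν (d, w) = (d, (k : ℤ) + 2) := by
    refine Prod.ext rfl ?_
    simp only [ixHom, AddMonoidHom.coe_mk, ZeroHom.coe_mk, h]; push_cast; ring
  have h2 : ixHom ν (d, w + 1) = (d, (k : ℤ)) := by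
    refine Prod.ext rfl ?_
    simp only [ixHom, AddMonoidHom.coe_mk, ZeroHom.coe_mk, h]; push_cast; ring
  rw [← finrank_piece, ← finrank_piece, h1, h2]
  exact SlAlg.finrank_A (S := slAlg ν hν) (d := d) (u := k) (by omega)

lemma finrank_A_top {d : ℕ × ℕ × ℕ} {k : ℕ} (h : ν 0 * d.1 + ν 1 * d.2.1 + ν 2 * d.2.2 = k) :
    Module.finrank ℂ ((slAlg ν hν).A d k) = monCount ν d 0 := by
  have h1 : ixHom ν (d, 0) = (d, (k : ℤ)) := by simp [ixHom, ← h]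
  have h2 : (slAlg ν hν).G d (k + 2) = ⊥ := by
    refine piece_eq_bot fun e he => ?_
    rw [← ixHom_weight] at he
    generalize Finsupp.weight (ixWt ν) e = t at he
    obtain ⟨d', w⟩ := t
    simp only [ixHom, AddMonoidHom.coe_mk, ZeroHom.coe_mk, Prod.mk.injEq] at he
    obtain ⟨rfl, he⟩ := he
    omega
  have := SlAlg.finrank_A (S := slAlg ν hν) (d := d) (u := k) (by omega)
  rw [h2, finrank_bot, add_zero] at this
  rw [this, ← finrank_piece, h1]
  rfl

end BinaryForms

namespace BinaryForms

lemma eval_div_mod {B : ℕ} (p : Polynomial ℕ) (h : p.eval 1 < B) (j : ℕ) :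
    p.eval B / B ^ j % B = p.coeff j := by
  have key : ∀ (p : Polynomial ℕ) (q : ℕ), p.eval q = q * p.divX.eval q + p.coeff 0 := fun p q => by
    conv_lhs => rw [← Polynomial.X_mul_divX_add p]
    simp
  induction j generalizing p with
  | zero =>
    have := key p 1
    rw [pow_zero, Nat.div_one, key p B, Nat.mul_add_mod, Nat.mod_eq_of_lt (by omega)]
  | succ j ih =>
    have := key p 1
    rw [pow_succ', ← Nat.div_div_eq_div_mul, key p B, Nat.mul_add_div (by omega),
      Nat.div_eq_of_lt (show p.coeff 0 < B by omega), add_zero, ih _ (by omega), Polynomial.coeff_divX]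

/-- Partial sums of a geometrically weighted list. -/
def scan (q : ℕ) (l : List ℕ) : ℕ → List ℕ :=
  List.rec (motive := fun _ => ℕ → List ℕ) (fun _ => []) (fun x _ ih y => (x + q * y) :: ih (x + q * y)) l

/-- The values at `q` of the polynomials `multisetPoly n a`, for `a ≤ A`. -/
def polyRow (q A n : ℕ) : List ℕ :=
  Nat.rec (motive := fun _ => List ℕ) (1 :: List.replicate A 0) (fun n ih => scan (q ^ n) ih 0) n

lemma scan_cons (q x : ℕ) (l : List ℕ) (y : ℕ) : scan q (x :: l) y = (x + q * y) :: scan q l (x + q * y) :=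
  rfl

lemma length_scan (q : ℕ) (l : List ℕ) (y : ℕ) : (scan q l y).length = l.length := by
  induction l generalizing y with
  | nil => rfl
  | cons x l ih => rw [scan_cons, List.length_cons, ih, List.length_cons]

lemma scan_getD (q : ℕ) (l : List ℕ) (y a : ℕ) (h : a < l.length) :
    (scan q l y).getD a 0 = l.getD a 0 + q * if a = 0 then y else (scan q l y).getD (a - 1) 0 := by
  induction l generalizing y a with
  | nil => simp at h
  | cons x l ih =>
    rw [scan_cons]
    rcases a with _ | a
    · simp
    · rw [List.getD_cons_succ, List.getD_cons_succ, ih _ _ (by simpa using h)]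
      rcases a with _ | a <;> simp

lemma length_polyRow (q A n : ℕ) : (polyRow q A n).length = A + 1 := by
  induction n with
  | zero => simp [polyRow]
  | succ n ih =>
    change (scan (q ^ n) (polyRow q A n) 0).length = _
    rw [length_scan, ih]

lemma polyRow_getD (q A n a : ℕ) (h : a ≤ A) : (polyRow q A n).getD a 0 = (multisetPoly n a).eval q := by
  induction n generalizing a with
  | zero =>
    change (1 :: List.replicate A 0).getD a 0 = _
    rcases a with _ | a
    · simp [multisetPoly]
    · rw [List.getD_cons_succ, multisetPoly, Polynomial.eval_zero]
      simp
  | succ n ih =>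
    have step : ∀ a ≤ A, (polyRow q A (n + 1)).getD a 0 = (polyRow q A n).getD a 0 + q ^ n *
        if a = 0 then 0 else (polyRow q A (n + 1)).getD (a - 1) 0 := fun a ha =>
      scan_getD _ (polyRow q A n) _ _ (by rw [length_polyRow]; omega)
    induction a with
    | zero => rw [step _ h, ih _ h]; simp [multisetPoly]
    | succ a iha =>
      rw [step _ h, ih _ h, if_neg (Nat.succ_ne_zero a), Nat.add_sub_cancel, iha (by omega), multisetPoly]
      simp

/-- Tables of generating polynomials at the given value. -/
structure Rows where
  r0 : List ℕ
  r1 : List ℕ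
  r2 : List ℕ

def mkRows (q A : ℕ) : Rows := ⟨polyRow q A 7, polyRow q A 5, polyRow q A 3⟩

def Rows.get (T : Rows) (d : ℕ × ℕ × ℕ) : ℕ :=
  (T.r0.getD d.1 0 * T.r1.getD d.2.1 0) * T.r2.getD d.2.2 0

/-- The test that there are `D` linearly independent highest weight vectors of degree `d` and order `k`. -/
def dimTest (T T₁ : Rows) (A : ℕ) (d : ℕ × ℕ × ℕ) (k D : ℕ) : Bool :=
  (fun w => Nat.ble d.1 A && (Nat.ble d.2.1 A && (Nat.ble d.2.2 A && (Nat.ble (T₁.get d + 1) (2 ^ 32) &&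
    (Nat.beq (6 * d.1 + 4 * d.2.1 + 2 * d.2.2) (k + 2 * w) &&
      Nat.beq (D + 2 ^ 32 * T.get d / (2 ^ 32) ^ w % 2 ^ 32) (T.get d / (2 ^ 32) ^ w % 2 ^ 32))))))
  ((6 * d.1 + 4 * d.2.1 + 2 * d.2.2 - k) / 2)

lemma dimTest_sound {hν : ∀ i, Even ((![6, 4, 2] : Fin 3 → ℕ) i)} {A k D : ℕ} {d : ℕ × ℕ × ℕ}
    (h : dimTest (mkRows (2 ^ 32) A) (mkRows 1 A) A d k D = true) :
    Module.finrank ℂ ((slAlg ![6, 4, 2] hν).A d k) = D := by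
  unfold dimTest at h
  generalize (6 * d.1 + 4 * d.2.1 + 2 * d.2.2 - k) / 2 = w at h
  simp only [Bool.and_eq_true, Nat.ble_eq, Nat.beq_eq] at h
  obtain ⟨h1, h2, h3, h4, h5, h6⟩ := h
  have hget : ∀ q, (mkRows q A).get d = (∏ i, multisetPoly ((![6, 4, 2] : Fin 3 → ℕ) i + 1) (toFun3 d i)).eval q := by
    intro q
    rw [Rows.get, mkRows, polyRow_getD _ _ _ _ h1, polyRow_getD _ _ _ _ h2, polyRow_getD _ _ _ _ h3,
      Fin.prod_univ_three, Polynomial.eval_mul, Polynomial.eval_mul]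
    rfl
  rw [hget] at h4 h6
  rw [eval_div_mod _ (by omega)] at h6
  rcases w with _ | w
  · rw [pow_zero, Nat.div_one, Nat.mul_mod_right, add_zero] at h6
    rw [finrank_A_top h5, h6]
    rfl
  · rw [pow_succ' (2 ^ 32) w, Nat.mul_div_mul_left _ _ (by positivity), eval_div_mod _ (by omega)] at h6
    have := finrank_A_add (ν := ![6, 4, 2]) (hν := hν) (d := d) (k := k) h5
    unfold monCount at this
    exact Nat.add_right_cancel (this.trans h6.symm)

end BinaryForms

namespace Elim

section Abstract

variable {M M' : Type} [AddCommGroup M] [Module ℂ M] [AddCommGroup M'] [Module ℂ M'] {ρ : Type}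

/-- The linear combination of a list of vectors with the given coefficients. -/
def comb : List M → (ℕ → ℂ) → M
  | [], _ => 0
  | v :: l, c => c 0 • v + comb l fun i => c (i + 1)

lemma map_comb (φ : M →ₗ[ℂ] M') (l : List M) (c : ℕ → ℂ) : φ (comb l c) = comb (l.map φ) c := by
  induction l generalizing c with
  | nil => simp [comb]
  | cons v l ih => simp [comb, ih]

def Indep (l : List M) : Prop := ∀ c, comb l c = 0 → ∀ i < l.length, c i = 0

/-- The vectors of `R` are independent, and the vectors of `Γ` are independent modulo the span
of `R` and `rest`. -/
def Sep (R Γ rest : List M) : Prop := Indep R ∧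
  ∀ c, comb Γ c ∈ Submodule.span ℂ {x | x ∈ R ∨ x ∈ rest} → ∀ i < Γ.length, c i = 0

lemma Indep.of_map {l : List M} (φ : M →ₗ[ℂ] M') (h : Indep (l.map φ)) : Indep l := by
  intro c hc i hi
  refine h c ?_ i (by simpa using hi)
  rw [← map_comb, hc, map_zero]

lemma Indep.cons {r : M} {l : List M} (φ : M →ₗ[ℂ] M) (h : Indep (l.map φ)) (h0 : φ r = 0) (hr : r ≠ 0) :
    Indep (r :: l) := by
  intro c hc
  have h1 : ∀ i < l.length, c (i + 1) = 0 := by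
    intro i hi
    refine h (fun i => c (i + 1)) ?_ i (by simpa using hi)
    have := congrArg φ hc
    rw [comb, map_add, map_smul, h0, smul_zero, zero_add, map_zero, map_comb] at this
    exact this
  have h2 : comb l (fun i => c (i + 1)) = 0 := by
    clear hc h
    have : ∀ (l : List M) (c : ℕ → ℂ), (∀ i < l.length, c i = 0) → comb l c = 0 := by
      intro l
      induction l with
      | nil => intro c _; rfl
      | cons v l ih =>
        intro c hc
        rw [comb, hc 0 (by simp), zero_smul, zero_add]
        exact ih _ fun i hi => hc _ (by simpa using hi)
    exact this _ _ h1
  rw [comb, h2, add_zero, smul_eq_zero, or_iff_left hr] at hc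
  rintro (_ | i) hi
  · exact hc
  · exact h1 i (by simpa using hi)

lemma Sep.of_map {R Γ rest : List M} (φ : M →ₗ[ℂ] M')
    (h : Sep (R.map φ) (Γ.map φ) (rest.map φ)) : Sep R Γ rest := by
  refine ⟨h.1.of_map φ, fun c hc i hi => h.2 c ?_ i (by simpa using hi)⟩
  rw [← map_comb]
  have := Submodule.mem_map_of_mem (f := φ) hc
  rw [Submodule.map_span] at this
  refine Submodule.span_mono ?_ this
  rintro _ ⟨x, hx | hx, rfl⟩
  · exact Or.inl (List.mem_map_of_mem hx)
  · exact Or.inr (List.mem_map_of_mem hx)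

lemma Sep.cons {r : M} {R Γ rest : List M} (φ : M →ₗ[ℂ] M)
    (h : Sep (R.map φ) (Γ.map φ) (rest.map φ)) (h0 : φ r = 0) (hr : r ≠ 0) : Sep (r :: R) Γ rest := by
  refine ⟨h.1.cons φ h0 hr, fun c hc i hi => h.2 c ?_ i (by simpa using hi)⟩
  rw [← map_comb]
  have := Submodule.mem_map_of_mem (f := φ) hc
  rw [Submodule.map_span] at this
  refine Submodule.span_le.2 ?_ this
  rintro _ ⟨x, hx | hx, rfl⟩
  · rcases List.mem_cons.1 hx with rfl | hx
    · rw [h0]; exact zero_mem _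
    · exact Submodule.subset_span (Or.inl (List.mem_map_of_mem hx))
  · exact Submodule.subset_span (Or.inr (List.mem_map_of_mem hx))

lemma Sep.nil {Γ rest : List M} (h : Indep Γ) (h0 : ∀ x ∈ rest, x = 0) : Sep [] Γ rest := by
  refine ⟨fun c _ i hi => by simp at hi, fun c hc => h c ?_⟩
  have : Submodule.span ℂ {x | x ∈ ([] : List M) ∨ x ∈ rest} = ⊥ := by
    rw [Submodule.span_eq_bot]
    rintro x (hx | hx)
    · simp at hx
    · exact h0 x hx
  rwa [this, Submodule.mem_bot] at hc

/-- Operations on the rows of an elimination. -/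
structure Rowop (ρ : Type) where
  piv : ρ → Bool
  red : ρ → ρ → ρ
  zero : ρ → Bool

/-- `Rel n v s` means that the row `s` represents the vector `v` up to precision `n`. -/
structure Rowop.Sound (op : Rowop ρ) (Rel : ℕ → M → ρ → Prop) : Prop where
  red : ∀ {n r s}, Rel (n + 1) r s → op.piv s = true → ∃ φ : M →ₗ[ℂ] M, φ r = 0 ∧ r ≠ 0 ∧
    ∀ v t, Rel (n + 1) v t → Rel n (φ v) (op.red s t)
  zero : ∀ {n v s}, Rel n v s → op.zero s = true → v = 0

def mapRec {α β : Type} (f : α → β) (l : List α) : List β :=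
  List.rec (motive := fun _ => List β) [] (fun s _ ih => f s :: ih) l

lemma mapRec_eq {α β : Type} (f : α → β) (l : List α) : mapRec f l = l.map f := by
  induction l with
  | nil => rfl
  | cons v l ih => rw [List.map_cons, ← ih]; rfl

def allRec {α : Type} (f : α → Bool) (l : List α) : Bool :=
  List.rec (motive := fun _ => Bool) true (fun s _ ih => f s && ih) l

lemma allRec_eq {α : Type} (f : α → Bool) (l : List α) : allRec f l = l.all f := by
  induction l with
  | nil => rfl
  | cons v l ih => rw [List.all_cons, ← ih]; rfl

def indepTest (op : Rowop ρ) (n : ℕ) : List ρ → Bool :=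
  Nat.rec (motive := fun _ => List ρ → Bool)
    (fun l => List.rec (motive := fun _ => Bool) true (fun _ _ _ => false) l)
    (fun _ ih l => List.rec (motive := fun _ => Bool) true
      (fun r t _ => op.piv r && ih (mapRec (op.red r) t)) l) n

def sepTest (op : Rowop ρ) (n : ℕ) : List ρ → List ρ → List ρ → Bool :=
  Nat.rec (motive := fun _ => List ρ → List ρ → List ρ → Bool)
    (fun R Γ rest => List.rec (motive := fun _ => Bool)
      (allRec op.zero rest && indepTest op 0 Γ) (fun _ _ _ => false) R)
    (fun n ih R Γ rest => List.rec (motive := fun _ => Bool)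
      (allRec op.zero rest && indepTest op (n + 1) Γ)
      (fun r t _ => op.piv r && ih (mapRec (op.red r) t) (mapRec (op.red r) Γ) (mapRec (op.red r) rest)) R) n

variable {op : Rowop ρ} {Rel : ℕ → M → ρ → Prop}

lemma forall₂_mapRec {n n' : ℕ} {φ : M → M} {f : ρ → ρ} (h : ∀ v s, Rel n v s → Rel n' (φ v) (f s)) {l : List M}
    {l' : List ρ} (hl : List.Forall₂ (Rel n) l l') : List.Forall₂ (Rel n') (l.map φ) (mapRec f l') := by
  rw [mapRec_eq, List.forall₂_map_left_iff, List.forall₂_map_right_iff]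
  exact hl.imp fun v s => h v s

lemma indepTest_sound (hop : op.Sound Rel) {n : ℕ} {l : List M} {l' : List ρ}
    (hl : List.Forall₂ (Rel n) l l') (h : indepTest op n l' = true) : Indep l := by
  induction n generalizing l l' with
  | zero =>
    rcases hl with _ | ⟨_, _⟩
    · intro c _ i hi; simp at hi
    · exact absurd h Bool.false_ne_true
  | succ n ih =>
    rcases hl with _ | ⟨h1, h2⟩
    · intro c _ i hi; simp at hi
    · have h' := (Bool.and_eq_true _ _ ▸ h : _ ∧ _)
      obtain ⟨φ, h0, hr, hφ⟩ := hop.red h1 h'.1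
      exact (ih (forall₂_mapRec hφ h2) h'.2).cons φ h0 hr

lemma eq_zero_of_allRec (hop : op.Sound Rel) {n : ℕ} {l : List M} {l' : List ρ}
    (hl : List.Forall₂ (Rel n) l l') (h : allRec op.zero l' = true) : ∀ x ∈ l, x = 0 := by
  induction hl with
  | nil => simp
  | cons h1 h2 ih =>
    have h' := (Bool.and_eq_true _ _ ▸ h : _ ∧ _)
    intro x hx
    rcases List.mem_cons.1 hx with rfl | hx
    · exact hop.zero h1 h'.1
    · exact ih h'.2 x hx

lemma sepTest_sound (hop : op.Sound Rel) {n : ℕ} {R Γ rest : List M} {R' Γ' rest' : List ρ}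
    (hR : List.Forall₂ (Rel n) R R') (hΓ : List.Forall₂ (Rel n) Γ Γ') (hrest : List.Forall₂ (Rel n) rest rest')
    (h : sepTest op n R' Γ' rest' = true) : Sep R Γ rest := by
  induction n generalizing R Γ rest R' Γ' rest' with
  | zero =>
    rcases hR with _ | ⟨_, _⟩
    · have h' := (Bool.and_eq_true _ _ ▸ h : _ ∧ _)
      exact Sep.nil (indepTest_sound hop hΓ h'.2) (eq_zero_of_allRec hop hrest h'.1)
    · exact absurd h Bool.false_ne_true
  | succ n ih =>
    rcases hR with _ | ⟨h1, h2⟩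
    · have h' := (Bool.and_eq_true _ _ ▸ h : _ ∧ _)
      exact Sep.nil (indepTest_sound hop hΓ h'.2) (eq_zero_of_allRec hop hrest h'.1)
    · have h' := (Bool.and_eq_true _ _ ▸ h : _ ∧ _)
      obtain ⟨φ, h0, hr, hφ⟩ := hop.red h1 h'.1
      exact (ih (forall₂_mapRec hφ h2) (forall₂_mapRec hφ hΓ) (forall₂_mapRec hφ hrest) h'.2).cons φ h0 hr

end Abstract

end Elim

namespace Lanes

/-- The `j`th digit of a natural number written in base `2 ^ 40`. -/
def digit (s j : ℕ) : ℕ := s / (2 ^ 40) ^ j % 2 ^ 40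

lemma digit_lt (s j : ℕ) : digit s j < 2 ^ 40 := Nat.mod_lt _ (by norm_num)

lemma digit_succ (s j : ℕ) : digit s (j + 1) = digit (s / 2 ^ 40) j := by
  rw [digit, digit, pow_succ', Nat.div_div_eq_div_mul]

lemma digit_eval (p : Polynomial ℕ) (h : ∀ j, p.coeff j < 2 ^ 40) (j : ℕ) :
    digit (p.eval (2 ^ 40)) j = p.coeff j := by
  induction j generalizing p with
  | zero =>
    conv_lhs => rw [← Polynomial.X_mul_divX_add p]
    rw [digit, pow_zero, Nat.div_one, Polynomial.eval_add, Polynomial.eval_mul, Polynomial.eval_X, Polynomial.eval_C,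
      Nat.mul_add_mod, Nat.mod_eq_of_lt (h 0)]
  | succ j ih =>
    conv_lhs => rw [← Polynomial.X_mul_divX_add p]
    rw [digit_succ, Polynomial.eval_add, Polynomial.eval_mul, Polynomial.eval_X, Polynomial.eval_C,
      Nat.mul_add_div (by norm_num), Nat.div_eq_of_lt (h 0), add_zero, ih, Polynomial.coeff_divX]
    intro i
    rw [Polynomial.coeff_divX]
    exact h _

lemma exists_poly (s : ℕ) : ∃ p : Polynomial ℕ, p.eval (2 ^ 40) = s ∧ ∀ j, p.coeff j = digit s j := by
  induction s using Nat.strong_induction_on with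
  | _ s ih =>
    rcases Nat.eq_zero_or_pos s with rfl | hs
    · exact ⟨0, by simp, fun j => by simp [digit]⟩
    · obtain ⟨p, hp, hj⟩ := ih (s / 2 ^ 40) (Nat.div_lt_self hs (by norm_num))
      refine ⟨Polynomial.X * p + Polynomial.C (s % 2 ^ 40), ?_, ?_⟩
      · rw [Polynomial.eval_add, Polynomial.eval_mul, Polynomial.eval_X, Polynomial.eval_C, hp, Nat.div_add_mod]
      · rintro (_ | j)
        · simp [digit]
        · rw [Polynomial.coeff_add, Polynomial.coeff_X_mul, Polynomial.coeff_C_succ, add_zero, hj, digit_succ]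

lemma digit_add {s t : ℕ} (h : ∀ j, digit s j + digit t j < 2 ^ 40) (j : ℕ) :
    digit (s + t) j = digit s j + digit t j := by
  obtain ⟨p, rfl, hp⟩ := exists_poly s
  obtain ⟨q, rfl, hq⟩ := exists_poly t
  rw [← Polynomial.eval_add, digit_eval, Polynomial.coeff_add, hp, hq]
  intro i
  rw [Polynomial.coeff_add, hp, hq]
  exact h i

lemma digit_mul_nat {s c : ℕ} (h : ∀ j, digit s j * c < 2 ^ 40) (j : ℕ) :
    digit (s * c) j = digit s j * c := by
  obtain ⟨p, rfl, hp⟩ := exists_poly s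
  have : Polynomial.eval (2 ^ 40) p * c = (p * Polynomial.C c).eval (2 ^ 40) := by simp
  rw [this, digit_eval, Polynomial.coeff_mul_C, hp]
  intro i
  rw [Polynomial.coeff_mul_C, hp]
  exact h i

lemma digit_mul {s t : ℕ} (h : ∀ j, ∑ x ∈ Finset.HasAntidiagonal.antidiagonal j, digit s x.1 * digit t x.2 < 2 ^ 40) (j : ℕ) :
    digit (s * t) j = ∑ x ∈ Finset.HasAntidiagonal.antidiagonal j, digit s x.1 * digit t x.2 := by
  obtain ⟨p, rfl, hp⟩ := exists_poly s
  obtain ⟨q, rfl, hq⟩ := exists_poly t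
  have key : ∀ j, (p * q).coeff j = ∑ x ∈ Finset.HasAntidiagonal.antidiagonal j, digit (p.eval (2 ^ 40)) x.1 * digit (q.eval (2 ^ 40)) x.2 :=
    fun j => by simp only [Polynomial.coeff_mul, hp, hq]
  rw [← Polynomial.eval_mul, digit_eval, key]
  intro i
  rw [key]
  exact h i

/-- The number whose first `N` digits are `2 ^ t - 1`. -/
def mask (t N : ℕ) : ℕ := Nat.rec (motive := fun _ => ℕ) 0 (fun _ m => 2 ^ 40 * m + (2 ^ t - 1)) N

lemma testBit_digit (s j i : ℕ) : (digit s j).testBit i = (decide (i < 40) && s.testBit (40 * j + i)) := by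
  rw [digit, Nat.testBit_mod_two_pow, ← pow_mul, Nat.testBit_div_two_pow, add_comm i]

lemma testBit_mask {t : ℕ} (ht : t ≤ 40) (N j i : ℕ) (hi : i < 40) :
    (mask t N).testBit (40 * j + i) = (decide (j < N) && decide (i < t)) := by
  have h1 : 2 ^ t - 1 < 2 ^ 40 := by
    have := Nat.pow_le_pow_right (n := 2) (by norm_num) ht
    have := Nat.pos_of_ne_zero (pow_ne_zero t (two_ne_zero (α := ℕ)))
    omega
  induction N generalizing j with
  | zero => simp [mask]
  | succ N ih =>
    change (2 ^ 40 * mask t N + (2 ^ t - 1)).testBit _ = _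
    rw [Nat.testBit_two_pow_mul_add _ h1]
    rcases j with _ | j
    · rw [if_pos (by omega), mul_zero, zero_add, Nat.testBit_two_pow_sub_one]
      simp
    · rw [if_neg (by omega), show 40 * (j + 1) + i - 40 = 40 * j + i by omega, ih]
      simp

lemma digit_land_mask {t : ℕ} (ht : t ≤ 40) (N s j : ℕ) :
    digit (Nat.land s (mask t N)) j = if j < N then digit s j % 2 ^ t else 0 := by
  apply Nat.eq_of_testBit_eq
  intro i
  rw [testBit_digit]
  change (_ && Nat.testBit (s &&& _) _) = _
  rw [Nat.testBit_and]
  by_cases hi : i < 40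
  · rw [testBit_mask ht _ _ _ hi]
    by_cases hj : j < N
    · rw [if_pos hj, Nat.testBit_mod_two_pow, testBit_digit]
      simp [hi, hj, Bool.and_comm]
    · simp [hj]
  · split_ifs
    · rw [Nat.testBit_mod_two_pow, testBit_digit]
      simp [hi]
    · simp [hi]

lemma digit_shift_mod (s j : ℕ) : digit (s >>> 13) j % 2 ^ 27 = digit s j / 2 ^ 13 := by
  apply Nat.eq_of_testBit_eq
  intro i
  rw [Nat.testBit_mod_two_pow, testBit_digit, Nat.testBit_div_two_pow, testBit_digit, Nat.testBit_shiftRight]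
  by_cases hi : i < 27
  · rw [show 13 + (40 * j + i) = 40 * j + (i + 13) by ring]
    simp [hi, show i < 40 by omega, show i + 13 < 40 by omega]
  · simp [hi, show ¬ i + 13 < 40 by omega]

/-- Partial reduction of the first `N` digits modulo `8191`. -/
def fold (N s : ℕ) : ℕ := Nat.land s (mask 13 N) + Nat.land (Nat.shiftRight s 13) (mask 27 N)

lemma digit_fold (N s j : ℕ) : digit (fold N s) j = if j < N then digit s j % 2 ^ 13 + digit s j / 2 ^ 13 else 0 := by
  have h1 : ∀ j, digit (Nat.land (Nat.shiftRight s 13) (mask 27 N)) j = if j < N then digit s j / 2 ^ 13 else 0 := by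
    intro j
    rw [digit_land_mask (by norm_num)]
    refine if_congr Iff.rfl ?_ rfl
    exact digit_shift_mod s j
  rw [fold, digit_add, digit_land_mask (by norm_num), h1]
  · split_ifs <;> rfl
  · intro j
    rw [digit_land_mask (by norm_num), h1]
    have := digit_lt s j
    split_ifs <;> omega

/-- `s` represents the sequence `z` modulo `8191` with precision `n`. -/
structure Rep (N n : ℕ) (z : ℕ → ℤ) (s : ℕ) : Prop where
  small : ∀ j, digit s j < 2 ^ 14
  high : ∀ j, N ≤ j → digit s j = 0
  cong : ∀ j < n, (digit s j : ℤ) ≡ z j [ZMOD 8191]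

lemma Rep.fold_fold {N n : ℕ} {z : ℕ → ℤ} {s : ℕ} (hn : n ≤ N) (h : ∀ j < N, digit s j < 2 ^ 38)
    (hc : ∀ j < n, (digit s j : ℤ) ≡ z j [ZMOD 8191]) : Rep N n z (fold N (fold N s)) := by
  have key : ∀ j, digit (fold N (fold N s)) j = if j < N then (digit s j % 2 ^ 13 + digit s j / 2 ^ 13) % 2 ^ 13 +
      (digit s j % 2 ^ 13 + digit s j / 2 ^ 13) / 2 ^ 13 else 0 := by
    intro j
    rw [digit_fold, digit_fold]
    split_ifs <;> rfl
  refine ⟨fun j => ?_, fun j hj => ?_, fun j hj => ?_⟩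
  · rw [key]
    split_ifs with hj
    · have := h j hj
      omega
    · norm_num
  · rw [key, if_neg (by omega)]
  · rw [key, if_pos (by omega)]
    refine Int.ModEq.trans ?_ (hc j hj)
    unfold Int.ModEq
    push_cast
    omega

def red2 (N s : ℕ) : ℕ := fold N (fold N s)

lemma Rep.add {N n : ℕ} {z w : ℕ → ℤ} {s t : ℕ} (hn : n ≤ N) (hs : Rep N n z s) (ht : Rep N n w t) :
    Rep N n (fun j => z j + w j) (red2 N (s + t)) := by
  have hd := digit_add (s := s) (t := t) fun j => by have := hs.small j; have := ht.small j; omega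
  refine Rep.fold_fold hn (fun j _ => ?_) (fun j hj => ?_)
  · rw [hd]; have := hs.small j; have := ht.small j; omega
  · rw [hd]; push_cast; exact (hs.cong j hj).add (ht.cong j hj)

lemma Rep.smul {N n : ℕ} {z : ℕ → ℤ} {s : ℕ} (hn : n ≤ N) (hs : Rep N n z s) (c : ℕ) :
    Rep N n (fun j => c * z j) (red2 N (s * (c % 8191))) := by
  have hc : c % 8191 < 8191 := Nat.mod_lt _ (by norm_num)
  have hb : ∀ j, digit s j * (c % 8191) < 2 ^ 28 := fun j => by
    have := hs.small j
    calc _ ≤ digit s j * 8191 := Nat.mul_le_mul_left _ hc.le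
      _ < _ := by omega
  have hd := digit_mul_nat (s := s) (c := c % 8191) fun j => (hb j).trans (by norm_num)
  refine Rep.fold_fold hn (fun j _ => ?_) (fun j hj => ?_)
  · rw [hd]; exact (hb j).trans (by norm_num)
  · rw [hd, mul_comm]; push_cast
    exact (Int.mod_modEq _ _).mul (hs.cong j hj)

lemma Rep.sub {N n : ℕ} {z w : ℕ → ℤ} {s t : ℕ} (hn : n ≤ N) (hs : Rep N n z s) (ht : Rep N n w t) :
    Rep N n (fun j => z j - w j) (red2 N (s + t * 8190)) := by
  have hb : ∀ j, digit t j * 8190 < 2 ^ 28 := fun j => by have := ht.small j; omega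
  have hd' := digit_mul_nat (s := t) (c := 8190) fun j => (hb j).trans (by norm_num)
  have hd := digit_add (s := s) (t := t * 8190) fun j => by rw [hd']; have := hs.small j; have := hb j; omega
  refine Rep.fold_fold hn (fun j _ => ?_) (fun j hj => ?_)
  · rw [hd, hd']; have := hs.small j; have := hb j; omega
  · rw [hd, hd']
    have h1 := hs.cong j hj
    have h2 := ht.cong j hj
    unfold Int.ModEq at *
    push_cast
    omega

lemma Rep.mul {N n : ℕ} {z w : ℕ → ℤ} {s t : ℕ} (hN : N ≤ 1024) (hn : n ≤ N) (hs : Rep N n z s) (ht : Rep N n w t) :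
    Rep N n (fun j => ∑ x ∈ Finset.HasAntidiagonal.antidiagonal j, z x.1 * w x.2) (red2 N (s * t)) := by
  have hb : ∀ j, ∑ x ∈ Finset.HasAntidiagonal.antidiagonal j, digit s x.1 * digit t x.2 < 2 ^ 38 := fun j => by
    rw [Finset.Nat.sum_antidiagonal_eq_sum_range_succ fun a b => digit s a * digit t b]
    calc _ ≤ ∑ a ∈ Finset.range (j + 1), if a < N then (2 ^ 14 - 1) * (2 ^ 14 - 1) else 0 := by
          refine Finset.sum_le_sum fun a _ => ?_
          split_ifs with ha
          · exact Nat.mul_le_mul (Nat.le_sub_one_of_lt (hs.small _)) (Nat.le_sub_one_of_lt (ht.small _))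
          · rw [hs.high a (by omega), zero_mul]
      _ ≤ ∑ a ∈ Finset.range N, (2 ^ 14 - 1) * (2 ^ 14 - 1) := by
          rw [← Finset.sum_filter]
          refine Finset.sum_le_sum_of_subset fun a ha => ?_
          exact Finset.mem_range.2 (Finset.mem_filter.1 ha).2
      _ < _ := by
          rw [Finset.sum_const, Finset.card_range, smul_eq_mul]
          omega
  have hd := digit_mul (s := s) (t := t) fun j => (hb j).trans (by norm_num)
  refine Rep.fold_fold hn (fun j _ => ?_) (fun j hj => ?_)
  · rw [hd]; exact hb j
  · rw [hd]; push_cast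
    refine Int.ModEq.sum fun x hx => ?_
    have := Finset.HasAntidiagonal.mem_antidiagonal.1 hx
    exact (hs.cong _ (by omega)).mul (ht.cong _ (by omega))

lemma Rep.zero (N n : ℕ) : Rep N n (fun _ => 0) 0 := by
  refine ⟨fun j => ?_, fun j _ => ?_, fun j _ => ?_⟩ <;> simp [digit]

lemma Rep.one {N : ℕ} (hN : 0 < N) (n : ℕ) : Rep N n (fun j => if j = 0 then 1 else 0) 1 := by
  have : ∀ j, digit 1 j = if j = 0 then 1 else 0 := fun j => by
    rcases j with _ | j
    · simp [digit]
    · rw [digit_succ]; simp [digit]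
  refine ⟨fun j => ?_, fun j hj => ?_, fun j _ => ?_⟩ <;> rw [this] <;> split_ifs <;> first | omega | simp

lemma Rep.seed (N n s : ℕ) : Rep N n (fun j => digit (Nat.land s (mask 13 N)) j) (Nat.land s (mask 13 N)) := by
  refine ⟨fun j => ?_, fun j hj => ?_, fun j _ => rfl⟩ <;> rw [digit_land_mask (by norm_num)]
  · split_ifs <;> omega
  · rw [if_neg (by omega)]

/-- The row operations for sequences represented modulo `8191`. -/
def rowop (N : ℕ) : Elim.Rowop ℕ where
  piv s := bif Nat.beq (s % 2 ^ 40 % 8191) 0 then false else true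
  red s t := Nat.shiftRight (red2 N (t * (s % 2 ^ 40 % 8191) + s * (8191 - t % 2 ^ 40 % 8191))) 40
  zero _ := false

lemma rowop_sound (N : ℕ) : (rowop N).Sound fun n (v : ℕ → ℂ) s =>
    n ≤ N ∧ ∃ z : ℕ → ℤ, v = (fun j => (z j : ℂ)) ∧ Rep N n z s where
  red := by
    rintro n _ s ⟨hn, z, rfl, hs⟩ h
    have h0 := hs.cong 0 (by omega)
    have e0 : ∀ s, digit s 0 = s % 2 ^ 40 := fun s => by simp [digit]
    have hz : z 0 ≠ 0 := by
      intro hz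
      rw [hz, e0] at h0
      have : s % 2 ^ 40 % 8191 = 0 := by
        unfold Int.ModEq at h0; omega
      change (bif Nat.beq (s % 2 ^ 40 % 8191) 0 then false else true) = true at h
      rw [this] at h
      exact Bool.false_ne_true h
    let φ : (ℕ → ℂ) →ₗ[ℂ] (ℕ → ℂ) :=
      { toFun := fun v j => z 0 * v (j + 1) - v 0 * z (j + 1)
        map_add' := fun v w => by ext j; simp only [Pi.add_apply]; ring
        map_smul' := fun c v => by ext j; simp only [Pi.smul_apply, smul_eq_mul, RingHom.id_apply]; ring }
    refine ⟨φ, by ext j; simp [φ], fun h => hz (by simpa using congrFun h 0), ?_⟩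
    rintro _ t ⟨-, w, rfl, ht⟩
    refine ⟨by omega, fun j => z 0 * w (j + 1) - w 0 * z (j + 1), by ext j; simp [φ], ?_⟩
    set a := s % 2 ^ 40 % 8191 with ha
    set b := 8191 - t % 2 ^ 40 % 8191 with hb
    have ha' : a < 8191 := Nat.mod_lt _ (by norm_num)
    have hb' : b ≤ 8191 := Nat.sub_le _ _
    have b1 : ∀ j, digit t j * a ≤ 2 ^ 14 * 8191 := fun j => Nat.mul_le_mul (ht.small j).le ha'.le
    have b2 : ∀ j, digit s j * b ≤ 2 ^ 14 * 8191 := fun j => Nat.mul_le_mul (hs.small j).le hb'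
    have d1 := digit_mul_nat (s := t) (c := a) fun j => (b1 j).trans_lt (by norm_num)
    have d2 := digit_mul_nat (s := s) (c := b) fun j => (b2 j).trans_lt (by norm_num)
    have d3 := digit_add (s := t * a) (t := s * b) fun j => by
      rw [d1, d2]; have := b1 j; have := b2 j; omega
    have key : Rep N (n + 1) (fun j => w j * z 0 + z j * - w 0) (red2 N (t * a + s * b)) := by
      refine Rep.fold_fold hn (fun j _ => ?_) (fun j hj => ?_)
      · rw [d3, d1, d2]; have := b1 j; have := b2 j; omega
      · rw [d3, d1, d2]; push_cast
        have ea : (a : ℤ) ≡ z 0 [ZMOD 8191] := by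
          refine Int.ModEq.trans ?_ h0
          rw [e0, ha]; unfold Int.ModEq; omega
        have eb : (b : ℤ) ≡ - w 0 [ZMOD 8191] := by
          refine Int.ModEq.trans ?_ (ht.cong 0 (by omega)).neg
          rw [e0, hb]; unfold Int.ModEq; omega
        exact ((ht.cong j hj).mul ea).add ((hs.cong j hj).mul eb)
    have es : ∀ s j, digit (Nat.shiftRight s 40) j = digit s (j + 1) := fun s j => by
      rw [digit_succ]; exact congrArg (digit · j) (Nat.shiftRight_eq_div_pow s 40)
    refine ⟨fun j => ?_, fun j hj => ?_, fun j hj => ?_⟩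
    · change digit (Nat.shiftRight _ 40) j < _
      rw [es]; exact key.small _
    · change digit (Nat.shiftRight _ 40) j = _
      rw [es]; exact key.high _ (by omega)
    · change (digit (Nat.shiftRight _ 40) j : ℤ) ≡ _ [ZMOD 8191]
      rw [es]
      refine (key.cong _ (by omega)).trans ?_
      rw [mul_comm, mul_neg, ← sub_eq_add_neg, mul_comm (w 0)]
  zero := fun _ h => absurd h Bool.false_ne_true

end Lanes

namespace SlAlg

variable {R : Type} [CommRing R] [Algebra ℂ R] (S : SlAlg R)

/-- Divided powers of the lowering operator. -/
def dp (m : ℕ) (x : R) : R := (m.factorial : ℂ)⁻¹ • (S.F ^ m) x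

variable {S} {d d₁ d₂ : ℕ × ℕ × ℕ} {x y : R}

lemma dp_zero (x : R) : S.dp 0 x = x := by simp [dp]

lemma F_dp (m : ℕ) (x : R) : S.F (S.dp m x) = ((m : ℂ) + 1) • S.dp (m + 1) x := by
  have h1 : (m.factorial : ℂ) ≠ 0 := Nat.cast_ne_zero.2 m.factorial_ne_zero
  have h2 : (m : ℂ) + 1 ≠ 0 := Nat.cast_add_one_ne_zero m
  rw [dp, dp, map_smul, ← Fpow_succ, smul_smul, Nat.factorial_succ]
  congr 1
  push_cast
  field_simp

lemma Fpow_eq_dp (m : ℕ) (x : R) : (S.F ^ m) x = (m.factorial : ℂ) • S.dp m x := by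
  rw [dp, smul_smul, mul_inv_cancel₀ (Nat.cast_ne_zero.2 m.factorial_ne_zero), one_smul]

lemma dp_eq_zero {k m : ℕ} (h : x ∈ S.A d k) (hm : k < m) : S.dp m x = 0 := by
  rw [dp, Fpow_eq_zero_of_lt h hm, smul_zero]

lemma dp_add (m : ℕ) (x y : R) : S.dp m (x + y) = S.dp m x + S.dp m y := by
  rw [dp, map_add, smul_add]; rfl

lemma dp_smul (m : ℕ) (c : ℂ) (x : R) : S.dp m (c • x) = c • S.dp m x := by
  rw [dp, map_smul, smul_comm]; rfl

lemma dp_dp (m l : ℕ) (x : R) : S.dp m (S.dp l x) = ((m + l).choose l : ℂ) • S.dp (m + l) x := by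
  rw [dp, dp, dp, map_smul, ← Module.End.mul_apply, ← pow_add, smul_smul, smul_smul]
  congr 1
  have h1 : (m.factorial : ℂ) ≠ 0 := Nat.cast_ne_zero.2 m.factorial_ne_zero
  have h2 : (l.factorial : ℂ) ≠ 0 := Nat.cast_ne_zero.2 l.factorial_ne_zero
  have h3 : ((m + l).factorial : ℂ) ≠ 0 := Nat.cast_ne_zero.2 (m + l).factorial_ne_zero
  have := congrArg (Nat.cast (R := ℂ)) (Nat.add_choose_mul_factorial_mul_factorial m l)
  push_cast at this
  field_simp
  rw [← this]
  ring

lemma dp_mul (m : ℕ) (x y : R) : S.dp m (x * y) =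
    ∑ i ∈ Finset.range (m + 1), S.dp i x * S.dp (m - i) y := by
  rw [← Finset.Nat.sum_antidiagonal_eq_sum_range_succ fun i j => S.dp i x * S.dp j y]
  induction m with
  | zero => simp [dp_zero]
  | succ m ih =>
    have h2 : (m : ℂ) + 1 ≠ 0 := Nat.cast_add_one_ne_zero m
    refine smul_right_injective R h2 ?_
    change ((m : ℂ) + 1) • S.dp (m + 1) (x * y) = ((m : ℂ) + 1) • _
    have e1 : ∀ a ∈ Finset.HasAntidiagonal.antidiagonal (m + 1), ((m : ℂ) + 1) • (S.dp a.1 x * S.dp a.2 y) =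
        (a.1 : ℂ) • (S.dp a.1 x * S.dp a.2 y) + (a.2 : ℂ) • (S.dp a.1 x * S.dp a.2 y) := by
      intro a ha
      have := congrArg (Nat.cast (R := ℂ)) (Finset.HasAntidiagonal.mem_antidiagonal.1 ha)
      push_cast at this
      rw [← add_smul, this]
    have e2 : S.F (∑ a ∈ Finset.HasAntidiagonal.antidiagonal m, S.dp a.1 x * S.dp a.2 y) =
        ∑ a ∈ Finset.HasAntidiagonal.antidiagonal m, ((a.1 : ℂ) + 1) • (S.dp (a.1 + 1) x * S.dp a.2 y) +
        ∑ a ∈ Finset.HasAntidiagonal.antidiagonal m, ((a.2 : ℂ) + 1) • (S.dp a.1 x * S.dp (a.2 + 1) y) := by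
      rw [map_sum, ← Finset.sum_add_distrib]
      refine Finset.sum_congr rfl fun a _ => ?_
      rw [S.F_mul, F_dp, F_dp, smul_mul_assoc, mul_smul_comm]
    rw [← F_dp, ih, e2, Finset.smul_sum, Finset.sum_congr rfl e1, Finset.sum_add_distrib,
      Finset.Nat.sum_antidiagonal_succ, Finset.Nat.sum_antidiagonal_succ']
    simp

/-- Transvection coefficients. -/
def cf (p n r l : ℕ) : ℕ := (p - l).descFactorial (r - l) * (n - r + l).descFactorial l

lemma cf_succ {p n r l : ℕ} (hr : r ≤ p) (hl : l < r) :
    cf p n r (l + 1) * (p - l) = cf p n r l * (n - r + l + 1) := by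
  have e1 : r - l = (r - (l + 1)) + 1 := by omega
  have e2 : p - l = (p - (l + 1)) + 1 := by omega
  rw [cf, cf, e1, ← add_assoc, Nat.succ_descFactorial_succ (n - r + l) l, e2, Nat.succ_descFactorial_succ]
  ring

/-- The greatest common divisor of the first values of a function. -/
def gcdTo (c : ℕ → ℕ) (r : ℕ) : ℕ := Nat.rec (motive := fun _ => ℕ) (c 0) (fun l g => Nat.gcd g (c (l + 1))) r

lemma gcdTo_dvd (c : ℕ → ℕ) {r l : ℕ} (h : l ≤ r) : gcdTo c r ∣ c l := by
  induction r with
  | zero => rw [Nat.le_zero.1 h]; exact dvd_rfl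
  | succ r ih =>
    rcases Nat.le_succ_iff.1 h with h | rfl
    · exact (Nat.gcd_dvd_left _ _).trans (ih h)
    · exact Nat.gcd_dvd_right _ _

/-- The normalized transvectant. -/
def tv (S : SlAlg R) (p n r : ℕ) (x y : R) : R := ∑ l ∈ Finset.range (r + 1),
  ((-1) ^ l * (cf p n r l / gcdTo (cf p n r) r : ℕ) : ℂ) • (S.dp l x * S.dp (r - l) y)

lemma tv_mem {p n r : ℕ} (hx : x ∈ S.A d₁ p) (hy : y ∈ S.A d₂ n) (hp : r ≤ p) (hn : r ≤ n) :
    S.tv p n r x y ∈ S.A (d₁ + d₂) ((p + n - 2 * r : ℕ) : ℤ) := by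
  have key := transvectant_mem (i := r) hx hy (fun l => ((-1) ^ l * (cf p n r l / gcdTo (cf p n r) r : ℕ) : ℂ) *
    ((l.factorial : ℂ)⁻¹ * ((r - l).factorial : ℂ)⁻¹)) ?_
  · rw [Nat.cast_sub (by omega)]
    push_cast
    convert key using 1
    refine Finset.sum_congr rfl fun l _ => ?_
    rw [dp, dp, smul_mul_smul_comm, smul_smul]
  · intro l hl
    have h0 : ∀ l : ℕ, ((l.factorial : ℕ) : ℂ) ≠ 0 := fun l => Nat.cast_ne_zero.2 l.factorial_ne_zero
    have e : r - l = (r - (l + 1)) + 1 := by omega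
    have h1 := h0 l
    have h2 := h0 (r - (l + 1))
    have h3 : (l : ℂ) + 1 ≠ 0 := Nat.cast_add_one_ne_zero l
    have h4 : ((r - (l + 1) : ℕ) : ℂ) + 1 ≠ 0 := Nat.cast_add_one_ne_zero _
    have e4 : ((r - (l + 1) : ℕ) : ℂ) + 1 = r - l := by
      rw [Nat.cast_sub (by omega)]; push_cast; ring
    have hg : gcdTo (cf p n r) r ≠ 0 := by
      intro h
      have := gcdTo_dvd (cf p n r) (le_refl r)
      rw [h, zero_dvd_iff, cf, Nat.mul_eq_zero, Nat.descFactorial_eq_zero_iff_lt, Nat.descFactorial_eq_zero_iff_lt] at this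
      omega
    have hg' : ((gcdTo (cf p n r) r : ℕ) : ℂ) ≠ 0 := Nat.cast_ne_zero.2 hg
    have hc := congrArg (Nat.cast (R := ℂ)) (cf_succ (n := n) hp hl)
    rw [Nat.cast_mul, Nat.cast_mul, Nat.cast_sub (by omega)] at hc
    push_cast [Nat.cast_sub hn] at hc
    rw [Nat.cast_div (gcdTo_dvd _ (by omega)) hg', Nat.cast_div (gcdTo_dvd _ (by omega)) hg', e, Nat.factorial_succ,
      Nat.factorial_succ]
    push_cast
    rw [← e4] at *
    field_simp
    rw [pow_succ]
    linear_combination (-(-1) ^ l) * hc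

end SlAlg

/-- Operations on representations of the elements of a ring. -/
structure Ops (σ : Type) where
  zero : σ
  one : σ
  add : σ → σ → σ
  sub : σ → σ → σ
  mul : σ → σ → σ
  smul : ℕ → σ → σ
  cons : σ → List σ → List σ

namespace Ops

variable {R : Type} [CommRing R] [Algebra ℂ R] {σ : Type}

structure Sound (op : Ops σ) (rel : R → σ → Prop) : Prop where
  zero : rel 0 op.zero
  one : rel 1 op.one
  add : ∀ {x y s t}, rel x s → rel y t → rel (x + y) (op.add s t)
  sub : ∀ {x y s t}, rel x s → rel y t → rel (x - y) (op.sub s t)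
  mul : ∀ {x y s t}, rel x s → rel y t → rel (x * y) (op.mul s t)
  smul : ∀ {x s} (c : ℕ), rel x s → rel ((c : ℂ) • x) (op.smul c s)
  cons : ∀ s l, op.cons s l = s :: l

variable (op : Ops σ)

def descFact (n k : ℕ) : ℕ := Nat.rec (motive := fun _ => ℕ) 1 (fun j ih => (n - j) * ih) k

lemma descFact_eq (n k : ℕ) : descFact n k = n.descFactorial k := by
  induction k with
  | zero => rfl
  | succ k ih => rw [Nat.descFactorial_succ, ← ih]; rfl

def binom (n k : ℕ) : ℕ := Nat.rec (motive := fun _ => ℕ) 1 (fun j ih => ih * (n - j) / (j + 1)) k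

lemma binom_eq (n k : ℕ) : binom n k = n.choose k := by
  induction k with
  | zero => simp [binom]
  | succ k ih =>
    change binom n k * (n - k) / (k + 1) = _
    rw [ih, ← Nat.choose_succ_right_eq, Nat.mul_div_cancel _ (Nat.succ_pos k)]

def coef (p n r l : ℕ) : ℕ := descFact (p - l) (r - l) * descFact (n - r + l) l

def coefGcd (p n r : ℕ) : ℕ :=
  Nat.rec (motive := fun _ => ℕ) (coef p n r 0) (fun l g => Nat.gcd g (coef p n r (l + 1))) r

lemma coef_eq (p n r : ℕ) : coef p n r = SlAlg.cf p n r := by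
  ext l
  rw [coef, SlAlg.cf, descFact_eq, descFact_eq]

lemma coefGcd_eq (p n r : ℕ) : coefGcd p n r = SlAlg.gcdTo (SlAlg.cf p n r) r := by
  rw [← coef_eq]; rfl

def scale (c : ℕ) (s : σ) : σ := bif Nat.beq c 1 then s else op.smul c s

/-- The inner product of two lists. -/
def dot (a : List σ) : List σ → σ :=
  List.rec (motive := fun _ => List σ → σ) (fun _ => op.zero)
    (fun x _ ih r => List.rec (motive := fun _ => σ) op.zero (fun y t _ => op.add (op.mul x y) (ih t)) r) a

/-- The first `n` values of a convolution. -/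
def conv (a : List σ) (n : ℕ) : List σ → List σ → List σ :=
  Nat.rec (motive := fun _ => List σ → List σ → List σ) (fun _ _ => [])
    (fun _ ih b acc => List.rec (motive := fun _ => List σ)
      (op.cons (op.dot a (op.zero :: acc)) (ih [] (op.zero :: acc)))
      (fun y t _ => op.cons (op.dot a (y :: acc)) (ih t (y :: acc))) b) n

def zip (f : σ → σ → σ) (a : List σ) : List σ → List σ :=
  List.rec (motive := fun _ => List σ → List σ) (fun _ => [])
    (fun x _ ih r => List.rec (motive := fun _ => List σ) [] (fun y t _ => op.cons (f x y) (ih t)) r) a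

/-- The entries of a list from position `l` on. -/
def drop (l : ℕ) : List σ → List σ :=
  Nat.rec (motive := fun _ => List σ → List σ) (fun a => a)
    (fun _ ih a => List.rec (motive := fun _ => List σ) [] (fun _ t _ => ih t) a) l

def scaleJet (c l : ℕ) (a : List σ) : ℕ → List σ :=
  List.rec (motive := fun _ => ℕ → List σ) (fun _ => [])
    (fun x _ ih m => op.cons (op.scale (c * binom (m + l) l) x) (ih (m + 1))) a

/-- The jet of `c` times the `l`th divided power of the lowering operator. -/
def derJet (c l : ℕ) (a : List σ) : List σ := op.scaleJet c l (drop l a) 0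

def tvTerm (p n r K : ℕ) (a b : List σ) (l : ℕ) : List σ :=
  op.conv (op.derJet (coef p n r l / coefGcd p n r) l a) K (op.derJet 1 (r - l) b) []

def tvSum (p n r K : ℕ) (a b : List σ) (l : ℕ) : List σ :=
  Nat.rec (motive := fun _ => List σ) (op.tvTerm p n r K a b 0)
    (fun l ih => op.zip (bif Nat.beq (l % 2) 0 then op.sub else op.add) ih (op.tvTerm p n r K a b (l + 1))) l

section

variable {op} {rel : R → σ → Prop}

lemma conv_succ (a : List σ) (n : ℕ) (b acc : List σ) (h : ∀ s l, op.cons s l = s :: l) :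
    op.conv a (n + 1) b acc = op.dot a (b.getD 0 op.zero :: acc) :: op.conv a n b.tail (b.getD 0 op.zero :: acc) := by
  rcases b with _ | ⟨y, t⟩ <;> exact h _ _

lemma rel_scale (hop : op.Sound rel) (c : ℕ) {x : R} {s : σ} (h : rel x s) : rel ((c : ℂ) • x) (op.scale c s) := by
  rw [scale]
  cases hc : Nat.beq c 1
  · exact hop.smul c h
  · rw [Nat.eq_of_beq_eq_true hc, Nat.cast_one, one_smul]; exact h

lemma rel_dot (hop : op.Sound rel) {a r : List σ} {u w : ℕ → R} (hu : ∀ i < a.length, rel (u i) (a.getD i op.zero))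
    (hu' : ∀ i, a.length ≤ i → u i = 0) (hw : ∀ i < r.length, rel (w i) (r.getD i op.zero)) :
    rel (∑ i ∈ Finset.range r.length, u i * w i) (op.dot a r) := by
  induction a generalizing r u w with
  | nil =>
    rw [Finset.sum_eq_zero fun i _ => by rw [hu' i (by simp), zero_mul]]
    exact hop.zero
  | cons x a ih =>
    rcases r with _ | ⟨y, r⟩
    · exact hop.zero
    · rw [List.length_cons, Finset.sum_range_succ', add_comm]
      refine hop.add (hop.mul (hu 0 (by simp)) (hw 0 (by simp))) ?_
      refine ih (u := fun i => u (i + 1)) (w := fun i => w (i + 1)) (fun i hi => ?_) (fun i hi => ?_) fun i hi => ?_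
      · have := hu (i + 1) (by simpa using hi)
        rwa [List.getD_cons_succ] at this
      · exact hu' _ (by simpa using hi)
      · have := hw (i + 1) (by simpa using hi)
        rwa [List.getD_cons_succ] at this

lemma rel_conv (hop : op.Sound rel) {a : List σ} {u v : ℕ → R} (hu : ∀ i < a.length, rel (u i) (a.getD i op.zero))
    (hu' : ∀ i, a.length ≤ i → u i = 0) (n : ℕ) {b acc : List σ} (hb : ∀ i, rel (v (acc.length + i)) (b.getD i op.zero))
    (hacc : ∀ i < acc.length, rel (v (acc.length - 1 - i)) (acc.getD i op.zero)) :
    (op.conv a n b acc).length = n ∧ ∀ m < n, rel (∑ i ∈ Finset.range (acc.length + m + 1), u i * v (acc.length + m - i))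
      ((op.conv a n b acc).getD m op.zero) := by
  induction n generalizing b acc with
  | zero => exact ⟨rfl, fun m hm => absurd hm (Nat.not_lt_zero m)⟩
  | succ n ih =>
    rw [conv_succ _ _ _ _ hop.cons]
    have h1 : ∀ i < (b.getD 0 op.zero :: acc).length, rel (v ((b.getD 0 op.zero :: acc).length - 1 - i))
        ((b.getD 0 op.zero :: acc).getD i op.zero) := by
      rintro (_ | i) hi
      · simpa using hb 0
      · have := hacc i (by simpa using hi)
        rw [List.getD_cons_succ, List.length_cons, show acc.length + 1 - 1 - (i + 1) = acc.length - 1 - i by omega]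
        exact this
    have h2 : ∀ i, rel (v ((b.getD 0 op.zero :: acc).length + i)) (b.tail.getD i op.zero) := by
      intro i
      have := hb (i + 1)
      rw [List.length_cons, show acc.length + 1 + i = acc.length + (i + 1) by ring]
      convert this using 1
      rcases b with _ | ⟨y, t⟩ <;> simp
    obtain ⟨e, h3⟩ := ih h2 h1
    refine ⟨by rw [List.length_cons, e], ?_⟩
    rintro (_ | m) hm
    · exact rel_dot hop (w := fun i => v (acc.length - i)) hu hu' h1
    · have := h3 m (by omega)
      rw [List.getD_cons_succ]
      rw [List.length_cons] at this
      rwa [show acc.length + (m + 1) = acc.length + 1 + m by ring]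

lemma rel_zip {T : Type} {rel : T → σ → Prop} (hcons : ∀ s l, op.cons s l = s :: l) {f : σ → σ → σ} {g : T → T → T}
    (hf : ∀ {x y s t}, rel x s → rel y t → rel (g x y) (f s t)) {n : ℕ} {a b : List σ} {u v : ℕ → T}
    (ha : a.length = n ∧ ∀ m < n, rel (u m) (a.getD m op.zero)) (hb : b.length = n ∧ ∀ m < n, rel (v m) (b.getD m op.zero)) :
    (op.zip f a b).length = n ∧ ∀ m < n, rel (g (u m) (v m)) ((op.zip f a b).getD m op.zero) := by
  induction n generalizing a b u v with
  | zero =>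
    rw [List.length_eq_zero_iff.1 ha.1]
    exact ⟨rfl, fun m hm => absurd hm (Nat.not_lt_zero m)⟩
  | succ n ih =>
    obtain ⟨x, a, rfl⟩ := List.exists_cons_of_length_eq_add_one ha.1
    obtain ⟨y, b, rfl⟩ := List.exists_cons_of_length_eq_add_one hb.1
    have e : op.zip f (x :: a) (y :: b) = f x y :: op.zip f a b := hcons _ _
    obtain ⟨h1, h2⟩ := ih (a := a) (b := b) (u := fun m => u (m + 1)) (v := fun m => v (m + 1))
      ⟨by simpa using ha.1, fun m hm => by simpa using ha.2 (m + 1) (by omega)⟩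
      ⟨by simpa using hb.1, fun m hm => by simpa using hb.2 (m + 1) (by omega)⟩
    rw [e]
    refine ⟨by rw [List.length_cons, h1], ?_⟩
    rintro (_ | m) hm
    · exact hf (by simpa using ha.2 0 hm) (by simpa using hb.2 0 hm)
    · rw [List.getD_cons_succ]; exact h2 m (by omega)

lemma drop_eq (l : ℕ) (a : List σ) : drop l a = a.drop l := by
  induction l generalizing a with
  | zero => rfl
  | succ l ih =>
    rcases a with _ | ⟨x, a⟩
    · rfl
    · exact ih a

end

/-- `a` represents the divided powers of the lowering operator applied to `x`. -/
def Jet (S : SlAlg R) (rel : R → σ → Prop) (x : R) (a : List σ) : Prop :=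
  (∀ m < a.length, rel (S.dp m x) (a.getD m op.zero)) ∧ ∀ m, a.length ≤ m → S.dp m x = 0

variable {op} {S : SlAlg R} {rel : R → σ → Prop}

lemma Jet.getD (hop : op.Sound rel) {x : R} {a : List σ} (h : op.Jet S rel x a) (m : ℕ) :
    rel (S.dp m x) (a.getD m op.zero) := by
  rcases lt_or_ge m a.length with hm | hm
  · exact h.1 m hm
  · rw [h.2 m hm, List.getD_eq_default _ _ hm]; exact hop.zero

lemma Jet.derJet (hop : op.Sound rel) {x : R} {a : List σ} (h : op.Jet S rel x a) (c l : ℕ) :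
    op.Jet S rel ((c : ℂ) • S.dp l x) (op.derJet c l a) := by
  have key : ∀ (a : List σ) (m₀ : ℕ), (op.scaleJet c l a m₀).length = a.length ∧ ∀ m < a.length,
      (op.scaleJet c l a m₀).getD m op.zero = op.scale (c * (m₀ + m + l).choose l) (a.getD m op.zero) := by
    intro a
    induction a with
    | nil => intro m₀; exact ⟨rfl, fun m hm => absurd hm (Nat.not_lt_zero m)⟩
    | cons x a ih =>
      intro m₀
      have e : op.scaleJet c l (x :: a) m₀ = op.scale (c * binom (m₀ + l) l) x :: op.scaleJet c l a (m₀ + 1) :=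
        hop.cons _ _
      obtain ⟨h1, h2⟩ := ih (m₀ + 1)
      rw [e]
      refine ⟨by rw [List.length_cons, List.length_cons, h1], ?_⟩
      rintro (_ | m) hm
      · rw [List.getD_cons_zero, List.getD_cons_zero, binom_eq]; rfl
      · rw [List.getD_cons_succ, List.getD_cons_succ, h2 m (by simpa using hm), show m₀ + 1 + m = m₀ + (m + 1) by ring]
  obtain ⟨h1, h2⟩ := key (drop l a) 0
  rw [drop_eq] at h1 h2
  constructor
  · intro m hm
    rw [Ops.derJet, drop_eq] at hm ⊢
    rw [h1] at hm
    rw [h2 m hm, SlAlg.dp_smul, SlAlg.dp_dp, smul_smul, ← Nat.cast_mul, zero_add]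
    refine rel_scale hop _ ?_
    have := h.getD hop (m + l)
    convert this using 1
    simp [List.getD_eq_getElem?_getD, add_comm]
  · intro m hm
    rw [Ops.derJet, drop_eq, h1, List.length_drop] at hm
    rw [SlAlg.dp_smul, SlAlg.dp_dp, h.2 (m + l) (by omega), smul_zero, smul_zero]

lemma Jet.tvSum (hop : op.Sound rel) {x y : R} {a b : List σ} (ha : op.Jet S rel x a) (hb : op.Jet S rel y b)
    (p n r K l : ℕ) : (op.tvSum p n r K a b l).length = K ∧ ∀ m < K, rel (S.dp m (∑ l ∈ Finset.range (l + 1),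
      ((-1) ^ l * (SlAlg.cf p n r l / SlAlg.gcdTo (SlAlg.cf p n r) r : ℕ) : ℂ) • (S.dp l x * S.dp (r - l) y)))
      ((op.tvSum p n r K a b l).getD m op.zero) := by
  have term : ∀ l, (op.tvTerm p n r K a b l).length = K ∧ ∀ m < K, rel (S.dp m (
      ((SlAlg.cf p n r l / SlAlg.gcdTo (SlAlg.cf p n r) r : ℕ) : ℂ) • (S.dp l x * S.dp (r - l) y)))
      ((op.tvTerm p n r K a b l).getD m op.zero) := by
    intro l
    rw [← coefGcd_eq, ← coef_eq]
    have h1 := ha.derJet hop (coef p n r l / coefGcd p n r) l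
    have h2 := hb.derJet hop 1 (r - l)
    obtain ⟨e, h3⟩ := rel_conv hop h1.1 h1.2 K (b := op.derJet 1 (r - l) b) (acc := [])
      (v := fun i => S.dp i (((1 : ℕ) : ℂ) • S.dp (r - l) y)) (fun i => by
        rw [List.length_nil, zero_add]; exact h2.getD hop i) (fun i hi => by simp at hi)
    refine ⟨e, fun m hm => ?_⟩
    have := h3 m hm
    rwa [List.length_nil, zero_add, ← SlAlg.dp_mul, Nat.cast_one, one_smul, smul_mul_assoc] at this
  induction l with
  | zero => simpa [Ops.tvSum] using term 0
  | succ l ih =>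
    have e : op.tvSum p n r K a b (l + 1) = op.zip (bif Nat.beq (l % 2) 0 then op.sub else op.add)
      (op.tvSum p n r K a b l) (op.tvTerm p n r K a b (l + 1)) := rfl
    rw [e]
    rcases Nat.mod_two_eq_zero_or_one l with hl | hl
    · rw [show (bif Nat.beq (l % 2) 0 then op.sub else op.add) = op.sub by rw [hl]; rfl]
      have := rel_zip hop.cons (f := op.sub) (g := fun x y => x - y) hop.sub ih (term (l + 1))
      refine ⟨this.1, fun m hm => ?_⟩
      convert this.2 m hm using 1
      rw [Finset.sum_range_succ, SlAlg.dp_add, sub_eq_add_neg, mul_smul, SlAlg.dp_smul, pow_succ,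
        Even.neg_one_pow (Nat.even_iff.2 hl), one_mul, neg_one_smul]
    · rw [show (bif Nat.beq (l % 2) 0 then op.sub else op.add) = op.add by rw [hl]; rfl]
      have := rel_zip hop.cons (f := op.add) (g := fun x y => x + y) hop.add ih (term (l + 1))
      refine ⟨this.1, fun m hm => ?_⟩
      convert this.2 m hm using 1
      rw [Finset.sum_range_succ, SlAlg.dp_add, mul_smul, SlAlg.dp_smul, pow_succ,
        Odd.neg_one_pow (Nat.odd_iff.2 hl), neg_one_mul, neg_neg, one_smul]

end Ops

/-- A represented covariant with its order and degree. -/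
structure Entry (σ : Type) where
  val : σ
  ord : ℕ
  deg : ℕ × ℕ × ℕ

def addDeg (d d' : ℕ × ℕ × ℕ) : ℕ × ℕ × ℕ := (d.1 + d'.1, (d.2.1 + d'.2.1, d.2.2 + d'.2.2))

lemma addDeg_eq (d d' : ℕ × ℕ × ℕ) : addDeg d d' = d + d' := rfl

namespace Entry

variable {R : Type} [CommRing R] [Algebra ℂ R] {σ : Type}

def tv (f : ℕ → ℕ → ℕ → σ → σ → σ) (x y : Entry σ) (r : ℕ) : Entry σ :=
  bif Nat.ble r x.ord && Nat.ble r y.ord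
  then ⟨f x.ord y.ord r x.val y.val, x.ord + y.ord - 2 * r, addDeg x.deg y.deg⟩ else x

def jetTv (op : Ops σ) (p n r : ℕ) (a b : List σ) : List σ := op.tvSum p n r (p + n - 2 * r + 1) a b r

structure Rel (S : SlAlg R) (P : R → σ → Prop) (x : Entry R) (y : Entry σ) : Prop where
  mem : x.val ∈ S.A x.deg x.ord
  ord : y.ord = x.ord
  deg : y.deg = x.deg
  val : P x.val y.val

lemma Rel.tv {S : SlAlg R} {op : Ops σ} {rel : R → σ → Prop} (hop : op.Sound rel) {x y : Entry R} {a b : Entry (List σ)}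
    (hx : x.Rel S (op.Jet S rel) a) (hy : y.Rel S (op.Jet S rel) b) (r : ℕ) :
    (x.tv S.tv y r).Rel S (op.Jet S rel) (a.tv (jetTv op) b r) := by
  rw [Entry.tv, Entry.tv, hx.ord, hy.ord]
  cases h : (Nat.ble r x.ord && Nat.ble r y.ord)
  · exact hx
  · rw [Bool.and_eq_true, Nat.ble_eq, Nat.ble_eq] at h
    have hM := SlAlg.tv_mem hx.mem hy.mem h.1 h.2
    refine ⟨hM, rfl, by simp only [cond_true, hx.deg, hy.deg], ?_⟩
    obtain ⟨h1, h2⟩ := Ops.Jet.tvSum hop hx.val hy.val x.ord y.ord r (x.ord + y.ord - 2 * r + 1) r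
    refine ⟨fun m hm => h2 m (by rw [← h1]; exact hm), fun m hm => SlAlg.dp_eq_zero hM ?_⟩
    change (op.tvSum _ _ _ _ _ _ _).length ≤ m at hm
    omega

end Entry

namespace Prog

section Lists

variable {α β : Type} {r : α → β → Prop}

/-- The entry of a list at a position, or the default value `x₀`. -/
def get (x₀ : α) (l : List α) (i : ℕ) : α :=
  Nat.rec (motive := fun _ => List α → α) (fun l => List.rec (motive := fun _ => α) x₀ (fun x _ _ => x) l)
    (fun _ ih l => List.rec (motive := fun _ => α) x₀ (fun _ t _ => ih t) l) i l

def filt (p : α → Bool) (l : List α) : List α :=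
  List.rec (motive := fun _ => List α) [] (fun x _ ih => bif p x then x :: ih else ih) l

/-- The entries of a list at the positions where the digits of `m` are `b`. -/
def pick (b m : ℕ) (l : List α) : List α :=
  List.rec (motive := fun _ => ℕ → List α) (fun _ => [])
    (fun x _ ih m => bif Nat.beq (m % 2) b then x :: ih (m / 2) else ih (m / 2)) l m

def append (l l' : List α) : List α :=
  List.rec (motive := fun _ => List α) l' (fun x _ ih => x :: ih) l

/-- The successive values of a straight line program with `n` instructions, last one first. -/
def run (step : α → α → ℕ → α) (x₀ : α) (n code : ℕ) (l : List α) : List α :=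
  Nat.rec (motive := fun _ => ℕ → List α → List α) (fun _ l => l)
    (fun _ ih code l => ih (code / 2 ^ 22)
      (step (get x₀ l (code % 2 ^ 9)) (get x₀ l (code / 2 ^ 9 % 2 ^ 9)) (code / 2 ^ 18 % 2 ^ 4) :: l)) n code l

lemma filt_eq (p : α → Bool) (l : List α) : filt p l = l.filter p := by
  induction l with
  | nil => rfl
  | cons x l ih =>
    rw [List.filter_cons, ← ih]
    change (bif p x then _ else _) = _
    cases p x <;> rfl

lemma append_eq (l l' : List α) : append l l' = l ++ l' := by
  induction l with
  | nil => rfl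
  | cons x l ih => rw [List.cons_append, ← ih]; rfl

lemma length_run (step : α → α → ℕ → α) (x₀ : α) (n code : ℕ) (l : List α) :
    (run step x₀ n code l).length = n + l.length := by
  induction n generalizing code l with
  | zero => exact (zero_add _).symm
  | succ n ih => exact (ih _ _).trans (by rw [List.length_cons]; ring)

lemma rel_get {x₀ : α} {y₀ : β} (h₀ : r x₀ y₀) {l : List α} {l' : List β} (h : List.Forall₂ r l l') (i : ℕ) :
    r (get x₀ l i) (get y₀ l' i) := by
  induction i generalizing l l' with
  | zero => rcases h with _ | ⟨h, _⟩ <;> assumption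
  | succ i ih =>
    rcases h with _ | ⟨_, h⟩
    · exact h₀
    · exact ih h

lemma rel_run {f : α → α → ℕ → α} {g : β → β → ℕ → β} {x₀ : α} {y₀ : β} (h₀ : r x₀ y₀)
    (hf : ∀ {x x' y y'} n, r x y → r x' y' → r (f x x' n) (g y y' n)) (n code : ℕ) {l : List α} {l' : List β}
    (h : List.Forall₂ r l l') : List.Forall₂ r (run f x₀ n code l) (run g y₀ n code l') := by
  induction n generalizing code l l' with
  | zero => exact h
  | succ n ih => exact ih _ (List.Forall₂.cons (hf _ (rel_get h₀ h _) (rel_get h₀ h _)) h)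

lemma rel_filt {p : α → Bool} {q : β → Bool} (hp : ∀ x y, r x y → p x = q y) {l : List α} {l' : List β}
    (h : List.Forall₂ r l l') : List.Forall₂ r (filt p l) (filt q l') := by
  induction h with
  | nil => exact List.Forall₂.nil
  | @cons x y l l' h _ ih =>
    change List.Forall₂ r (bif p x then _ else _) (bif q y then _ else _)
    rw [hp x y h]
    cases q y
    · exact ih
    · exact List.Forall₂.cons h ih

lemma rel_append {l m : List α} {l' m' : List β} (h : List.Forall₂ r l l') (hm : List.Forall₂ r m m') :
    List.Forall₂ r (append l m) (append l' m') := by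
  induction h with
  | nil => exact hm
  | cons h _ ih => exact List.Forall₂.cons h ih

lemma rel_pick (b m : ℕ) {l : List α} {l' : List β} (h : List.Forall₂ r l l') :
    List.Forall₂ r (pick b m l) (pick b m l') := by
  induction h generalizing m with
  | nil => exact List.Forall₂.nil
  | cons h _ ih =>
    change List.Forall₂ r (bif Nat.beq (m % 2) b then _ :: pick b (m / 2) _ else pick b (m / 2) _)
      (bif Nat.beq (m % 2) b then _ :: pick b (m / 2) _ else pick b (m / 2) _)
    cases Nat.beq (m % 2) b
    · exact ih _
    · exact List.Forall₂.cons h (ih _)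

lemma mem_of_mem_pick {b m : ℕ} {l : List α} {x : α} (h : x ∈ pick b m l) : x ∈ l := by
  induction l generalizing m with
  | nil => exact h
  | cons y l ih =>
    change x ∈ (bif Nat.beq (m % 2) b then y :: pick b (m / 2) l else pick b (m / 2) l) at h
    rw [List.mem_cons]
    cases hb : Nat.beq (m % 2) b <;> rw [hb] at h
    · exact Or.inr (ih h)
    · exact (List.mem_cons.1 h).imp_right ih

lemma mem_pick_or {l : List α} (m : ℕ) {x : α} (h : x ∈ l) : x ∈ pick 0 m l ∨ x ∈ pick 1 m l := by
  induction l generalizing m with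
  | nil => simp at h
  | cons y l ih =>
    change x ∈ (bif Nat.beq (m % 2) 0 then y :: pick 0 (m / 2) l else pick 0 (m / 2) l) ∨
      x ∈ (bif Nat.beq (m % 2) 1 then y :: pick 1 (m / 2) l else pick 1 (m / 2) l)
    rcases Nat.mod_two_eq_zero_or_one m with e | e
    · rw [show Nat.beq (m % 2) 0 = true by rw [e]; rfl, show Nat.beq (m % 2) 1 = false by rw [e]; rfl, cond_true,
        cond_false, List.mem_cons, or_assoc]
      exact (List.mem_cons.1 h).imp_right (ih _)
    · rw [show Nat.beq (m % 2) 0 = false by rw [e]; rfl, show Nat.beq (m % 2) 1 = true by rw [e]; rfl, cond_true,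
        cond_false, List.mem_cons, or_left_comm]
      exact (List.mem_cons.1 h).imp_right (ih _)

/-- Binary trees with labelled leaves. -/
inductive Tree (α : Type) where
  | leaf : α → Tree α
  | node : Tree α → Tree α → Tree α

/-- The tree of the entries of a list at positions `o + j * w` for `j < 2 ^ n`. -/
def build (x₀ : α) (l : List α) (n o w : ℕ) : Tree α :=
  Nat.rec (motive := fun _ => ℕ → ℕ → Tree α) (fun o _ => .leaf (get x₀ l o))
    (fun _ ih o w => .node (ih o (2 * w)) (ih (o + w) (2 * w))) n o w

def lookup (t : Tree α) : ℕ → α :=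
  Tree.rec (motive := fun _ => ℕ → α) (fun x _ => x)
    (fun _ _ h h' i => bif Nat.beq (i % 2) 0 then h (i / 2) else h' (i / 2)) t

inductive Tree.Rel (r : α → β → Prop) : Tree α → Tree β → Prop
  | leaf {x y} : r x y → Tree.Rel r (.leaf x) (.leaf y)
  | node {a b a' b'} : Tree.Rel r a a' → Tree.Rel r b b' → Tree.Rel r (.node a b) (.node a' b')

lemma rel_build {x₀ : α} {y₀ : β} (h₀ : r x₀ y₀) {l : List α} {l' : List β} (h : List.Forall₂ r l l') (n o w : ℕ) :
    Tree.Rel r (build x₀ l n o w) (build y₀ l' n o w) := by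
  induction n generalizing o w with
  | zero => exact .leaf (rel_get h₀ h _)
  | succ n ih => exact .node (ih _ _) (ih _ _)

lemma rel_lookup {t : Tree α} {t' : Tree β} (h : Tree.Rel r t t') (i : ℕ) : r (lookup t i) (lookup t' i) := by
  induction h generalizing i with
  | leaf h => exact h
  | node _ _ h h' =>
    change r (bif Nat.beq (i % 2) 0 then lookup _ _ else lookup _ _) (bif Nat.beq (i % 2) 0 then lookup _ _ else lookup _ _)
    cases Nat.beq (i % 2) 0
    · exact h' _
    · exact h _

lemma get_eq_or_mem (x₀ : α) (l : List α) (i : ℕ) : get x₀ l i = x₀ ∨ get x₀ l i ∈ l := by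
  induction i generalizing l with
  | zero => rcases l with _ | ⟨x, l⟩; exacts [Or.inl rfl, Or.inr List.mem_cons_self]
  | succ i ih => rcases l with _ | ⟨x, l⟩; exacts [Or.inl rfl, (ih l).imp_right (List.mem_cons_of_mem _)]

lemma lookup_build (x₀ : α) (l : List α) (n o w i : ℕ) :
    lookup (build x₀ l n o w) i = x₀ ∨ lookup (build x₀ l n o w) i ∈ l := by
  induction n generalizing o w i with
  | zero => exact get_eq_or_mem _ _ _
  | succ n ih =>
    change (bif Nat.beq (i % 2) 0 then lookup (build x₀ l n o (2 * w)) (i / 2)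
      else lookup (build x₀ l n (o + w) (2 * w)) (i / 2)) = x₀ ∨ (bif Nat.beq (i % 2) 0 then
      lookup (build x₀ l n o (2 * w)) (i / 2) else lookup (build x₀ l n (o + w) (2 * w)) (i / 2)) ∈ l
    cases Nat.beq (i % 2) 0 <;> exact ih _ _ _

end Lists

section Products

variable {σ τ : Type}

def mulE (mul : σ → σ → σ) (x y : Entry σ) : Entry σ := ⟨mul x.val y.val, x.ord + y.ord, addDeg x.deg y.deg⟩

def oneE (one : σ) : Entry σ := ⟨one, 0, (0, (0, 0))⟩

def eqDeg (d d' : ℕ × ℕ × ℕ) : Bool := Nat.beq d.1 d'.1 && (Nat.beq d.2.1 d'.2.1 && Nat.beq d.2.2 d'.2.2)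

def leDeg (d d' : ℕ × ℕ × ℕ) : Bool := Nat.ble d.1 d'.1 && (Nat.ble d.2.1 d'.2.1 && Nat.ble d.2.2 d'.2.2)

def subDeg (d d' : ℕ × ℕ × ℕ) : ℕ × ℕ × ℕ := (d.1 - d'.1, (d.2.1 - d'.2.1, d.2.2 - d'.2.2))

def fits (d : ℕ × ℕ × ℕ) (k : ℕ) (x : Entry σ) : Bool := leDeg x.deg d && Nat.ble x.ord k

def has (d : ℕ × ℕ × ℕ) (k : ℕ) (x : Entry σ) : Bool := eqDeg x.deg d && Nat.beq x.ord k

/-- The multiples of `acc` by the products of the entries of `l` with a given degree and order. -/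
def dfs (mul : σ → σ → σ) (n : ℕ) (l : List (Entry σ)) (d : ℕ × ℕ × ℕ) (k : ℕ) (acc : Entry σ) : List (Entry σ) :=
  Nat.rec (motive := fun _ => List (Entry σ) → ℕ × ℕ × ℕ → ℕ → Entry σ → List (Entry σ))
    (fun _ d k acc => bif eqDeg d (0, (0, 0)) && Nat.beq k 0 then [acc] else [])
    (fun _ ih l d k acc => bif eqDeg d (0, (0, 0)) && Nat.beq k 0 then [acc] else
      List.rec (motive := fun _ => List (Entry σ)) []
        (fun x t go => append (ih (x :: t) (subDeg d x.deg) (k - x.ord) (mulE mul acc x)) go) (filt (fits d k) l))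
    n l d k acc

def goDfs (mul : σ → σ → σ) (n : ℕ) (l : List (Entry σ)) (d : ℕ × ℕ × ℕ) (k : ℕ) (acc : Entry σ) : List (Entry σ) :=
  List.rec (motive := fun _ => List (Entry σ)) []
    (fun x t go => append (dfs mul n (x :: t) (subDeg d x.deg) (k - x.ord) (mulE mul acc x)) go) l

lemma eqDeg_iff (d d' : ℕ × ℕ × ℕ) : eqDeg d d' = true ↔ d = d' := by
  obtain ⟨a, b, c⟩ := d
  obtain ⟨a', b', c'⟩ := d'
  simp [eqDeg]

lemma leDeg_iff (d d' : ℕ × ℕ × ℕ) : leDeg d d' = true ↔ d ≤ d' := by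
  obtain ⟨a, b, c⟩ := d
  obtain ⟨a', b', c'⟩ := d'
  simp [leDeg]

lemma subDeg_eq (d d' : ℕ × ℕ × ℕ) : subDeg d d' = d - d' := rfl

lemma has_iff (d : ℕ × ℕ × ℕ) (k : ℕ) (x : Entry σ) : has d k x = true ↔ x.deg = d ∧ x.ord = k := by
  rw [has, Bool.and_eq_true, eqDeg_iff, Nat.beq_eq]

lemma fits_iff (d : ℕ × ℕ × ℕ) (k : ℕ) (x : Entry σ) : fits d k x = true ↔ x.deg ≤ d ∧ x.ord ≤ k := by
  rw [fits, Bool.and_eq_true, leDeg_iff, Nat.ble_eq]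

/-- A relation between entries compatible with products. -/
structure Compat (r : Entry σ → Entry τ → Prop) (f : σ → σ → σ) (g : τ → τ → τ) : Prop where
  ord : ∀ {x y}, r x y → y.ord = x.ord
  deg : ∀ {x y}, r x y → y.deg = x.deg
  mul : ∀ {x x' y y'}, r x y → r x' y' → r (mulE f x x') (mulE g y y')

variable {r : Entry σ → Entry τ → Prop} {f : σ → σ → σ} {g : τ → τ → τ}

lemma Compat.fits (h : Compat r f g) (d : ℕ × ℕ × ℕ) (k : ℕ) (x : Entry σ) (y : Entry τ) (hr : r x y) :
    fits d k x = Prog.fits d k y := by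
  rw [Prog.fits, Prog.fits, h.ord hr, h.deg hr]

lemma Compat.has (h : Compat r f g) (d : ℕ × ℕ × ℕ) (k : ℕ) (x : Entry σ) (y : Entry τ) (hr : r x y) :
    has d k x = Prog.has d k y := by
  rw [Prog.has, Prog.has, h.ord hr, h.deg hr]

lemma Compat.goDfs (h : Compat r f g) (n : ℕ) (ih : ∀ {l l'} (d : ℕ × ℕ × ℕ) (k : ℕ) {x y}, List.Forall₂ r l l' → r x y →
    List.Forall₂ r (dfs f n l d k x) (dfs g n l' d k y)) (d : ℕ × ℕ × ℕ) (k : ℕ) {l l' x y} (hl : List.Forall₂ r l l') (hr : r x y) :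
    List.Forall₂ r (goDfs f n l d k x) (goDfs g n l' d k y) := by
  induction hl with
  | nil => exact List.Forall₂.nil
  | @cons a b l l' hab hl ih' =>
    refine rel_append ?_ ih'
    rw [h.deg hab, h.ord hab]
    exact ih _ _ (List.Forall₂.cons hab hl) (h.mul hr hab)

lemma Compat.dfs (h : Compat r f g) (n : ℕ) {l l'} (d : ℕ × ℕ × ℕ) (k : ℕ) {x y} (hl : List.Forall₂ r l l') (hr : r x y) :
    List.Forall₂ r (dfs f n l d k x) (Prog.dfs g n l' d k y) := by
  induction n generalizing l l' d k x y with
  | zero =>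
    change List.Forall₂ r (bif _ then _ else _) (bif _ then _ else _)
    cases eqDeg d (0, (0, 0)) && Nat.beq k 0
    · exact List.Forall₂.nil
    · exact List.Forall₂.cons hr List.Forall₂.nil
  | succ n ih =>
    change List.Forall₂ r (bif _ then _ else Prog.goDfs f n (filt (Prog.fits d k) l) d k x)
      (bif _ then _ else Prog.goDfs g n (filt (Prog.fits d k) l') d k y)
    cases eqDeg d (0, (0, 0)) && Nat.beq k 0
    · exact h.goDfs n (fun d k => ih d k) d k (rel_filt (h.fits d k) hl) hr
    · exact List.Forall₂.cons hr List.Forall₂.nil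

end Products

end Prog

namespace Lanes

/-- The arithmetic of sequences represented modulo `8191`. -/
def ops (N : ℕ) : Ops ℕ where
  zero := 0
  one := 1
  add s t := red2 N (s + t)
  sub s t := red2 N (s + t * 8190)
  mul s t := red2 N (s * t)
  smul c s := red2 N (s * (c % 8191))
  cons s l := Nat.rec (motive := fun _ => List ℕ) (0 :: l) (fun n _ => Nat.succ n :: l) s

def seed (N v : ℕ) : ℕ := Nat.land (3 ^ (7700 + 7 * v)) (mask 13 N)

end Lanes

namespace Prog

variable {σ : Type}

def countUp (f : ℕ → σ) (n i : ℕ) : List σ :=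
  Nat.rec (motive := fun _ => ℕ → List σ) (fun _ => []) (fun _ ih i => f i :: ih (i + 1)) n i

/-- The entries of the three generic forms, with coordinates represented by `f`. -/
def initial (f : ℕ → σ) : List (Entry (List σ)) :=
  [⟨countUp f 3 12, 2, (0, (0, 1))⟩, ⟨countUp f 5 7, 4, (0, (1, 0))⟩, ⟨countUp f 7 0, 6, (1, (0, 0))⟩]

def jets (op : Ops σ) (f : ℕ → σ) (n code : ℕ) : List (Entry (List σ)) :=
  run (Entry.tv (Entry.jetTv op)) ⟨[], 0, (0, (0, 0))⟩ n code (initial f)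

def headE (z : σ) (x : Entry (List σ)) : Entry σ :=
  ⟨List.rec (motive := fun _ => σ) z (fun s _ _ => s) x.val, x.ord, x.deg⟩

def heads (op : Ops σ) (f : ℕ → σ) (n code : ℕ) : List (Entry σ) :=
  Elim.mapRec (headE op.zero) (jets op f n code)

def vals {ρ : Type} (dec : σ → ρ) (l : List (Entry σ)) : List ρ := Elim.mapRec (fun x => dec x.val) l

def lengthRec {α : Type} (l : List α) : ℕ := List.rec (motive := fun _ => ℕ) 0 (fun _ _ n => Nat.succ n) l

def keyDeg (c : ℕ) : ℕ × ℕ × ℕ := (c % 32, (c / 32 % 16, c / 512 % 16))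

def keyOrd (c : ℕ) : ℕ := c / 8192 % 32

def decomposables (op : Ops σ) (G : List (Entry σ)) (d : ℕ × ℕ × ℕ) (k : ℕ) : List (Entry σ) :=
  dfs op.mul (d.1 + (d.2.1 + d.2.2)) (filt (fun x => !eqDeg x.deg d) G) d k (oneE op.one)

/-- The test that the generators of degree `d` and order `k` are independent modulo products. -/
def genTest {ρ : Type} (op : Ops σ) (row : Elim.Rowop ρ) (ok : σ → Bool) (dec : σ → ρ) (N A : ℕ) (T T₁ : BinaryForms.Rows) (G : List (Entry σ))
    (d : ℕ × ℕ × ℕ) (k m : ℕ) : Bool :=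
  (fun ms Γ => Elim.allRec (fun x => ok x.val) ms && (Elim.allRec (fun x => ok x.val) Γ &&
    (Elim.sepTest row N (vals dec (pick 0 m ms)) (vals dec Γ) (vals dec (pick 1 m ms)) &&
      BinaryForms.dimTest T T₁ A d k (lengthRec (pick 0 m ms) + lengthRec Γ))))
  (decomposables op G d k) (filt (has d k) G)

def dropRec {α : Type} (n : ℕ) (l : List α) : List α :=
  Nat.rec (motive := fun _ => List α → List α) (fun l => l)
    (fun _ ih l => ih (List.rec (motive := fun _ => List α) [] (fun _ l _ => l) l)) n l

/-- Products described by instructions for a stack of entries: multiply the top of the stack by an entry, or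
output an entry and the top of the stack, and shorten the stack. -/
def monomials (op : Ops σ) (t : Tree (Entry σ)) (n code : ℕ) (st : List (Entry σ)) : List (Entry σ × Entry σ) :=
  Nat.rec (motive := fun _ => ℕ → List (Entry σ) → List (Entry σ × Entry σ)) (fun _ _ => [])
    (fun _ ih code st => bif Nat.beq code 0 then [] else
      (fun x y => Nat.rec (motive := fun _ => List (Entry σ × Entry σ)) (ih (code / 4096) (mulE op.mul y x :: st))
        (fun a _ => (x, y) :: ih (code / 4096) (dropRec (a + a / 6 * 6) st)) (code / 512 % 8))
      (lookup t (code % 512)) (List.rec (motive := fun _ => Entry σ) (oneE op.one) (fun x _ _ => x) st)) n code st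

def isProd (d : ℕ × ℕ × ℕ) (k : ℕ) (x : Entry σ × Entry σ) : Bool :=
  eqDeg (addDeg x.1.deg x.2.deg) d && (Nat.beq (x.1.ord + x.2.ord) k &&
    (!eqDeg x.1.deg (0, (0, 0)) && !eqDeg x.2.deg (0, (0, 0))))

/-- The test that the products described by `code` span the covariants of degree `d` and order `k`. -/
def prodTest (op : Ops σ) (row : Elim.Rowop σ) (N A : ℕ) (T T₁ : BinaryForms.Rows) (t : Tree (Entry σ))
    (d : ℕ × ℕ × ℕ) (k code : ℕ) : Bool :=
  (fun l => Elim.allRec (isProd d k) l &&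
    (Elim.indepTest row N (Elim.mapRec (fun x => op.mul x.1.val x.2.val) l) && BinaryForms.dimTest T T₁ A d k (lengthRec l)))
  (monomials op t 4096 code [])

/-- The products test for the members of a list of keys and codes. -/
def prodTests (op : Ops σ) (row : Elim.Rowop σ) (f : ℕ → σ) (N A n code : ℕ) (l : List (ℕ × ℕ)) : Bool :=
  (fun T T₁ t => Elim.allRec (fun x => prodTest op row N A T T₁ t (keyDeg x.1) (keyOrd x.1) x.2) l)
  (BinaryForms.mkRows (2 ^ 32) A) (BinaryForms.mkRows 1 A)
  (build ⟨op.zero, 0, (0, (0, 0))⟩ (heads op f n code) 9 0 1)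

def genTests {ρ : Type} (op : Ops σ) (row : Elim.Rowop ρ) (ok : σ → Bool) (dec : σ → ρ) (f : ℕ → σ) (N A n code : ℕ) (l : List (ℕ × ℕ)) : Bool :=
  (fun T T₁ G => Elim.allRec (fun x => genTest op row ok dec N A T T₁ G (keyDeg x.1) (keyOrd x.1) x.2) l)
  (BinaryForms.mkRows (2 ^ 32) A) (BinaryForms.mkRows 1 A) (heads op f n code)

end Prog

namespace Kron

/-- Evaluates a natural number before passing it on. -/
def force {ρ : Type} (n : ℕ) (k : ℕ → ρ) : ρ :=
  Nat.rec (motive := fun _ => ρ) (k 0) (fun m _ => k (Nat.succ m)) n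

def pair (s b : ℕ) : ℕ × ℕ := force s fun s => force b fun b => (s, b)

def lift₂ (f g : ℕ → ℕ → ℕ) (x y : ℕ × ℕ) : ℕ × ℕ :=
  Prod.rec (motive := fun _ => ℕ × ℕ)
    (fun s b => Prod.rec (motive := fun _ => ℕ × ℕ) (fun t c => pair (f s t) (g b c)) y) x

/-- The arithmetic of integers modulo `M` with bounds. -/
def ops (M : ℕ) : Ops (ℕ × ℕ) where
  zero := (0, 0)
  one := (1, 1)
  add := lift₂ (fun s t => (s + t) % M) (fun b c => b + c)
  sub := lift₂ (fun s t => (s + t * (M - 1)) % M) (fun b c => b + c)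
  mul := lift₂ (fun s t => s * t % M) (fun b c => b * c)
  smul c x := Prod.rec (motive := fun _ => ℕ × ℕ) (fun s b => pair (c * s % M) (c * b)) x
  cons x l := Prod.rec (motive := fun _ => List (ℕ × ℕ))
    (fun s b => force s fun s => force b fun b => (s, b) :: l) x

def ok (h : ℕ) (x : ℕ × ℕ) : Bool := Nat.ble (x.2 + 1) h

/-- The bits of `c` as digits in base `X`, with their sum. -/
def bits (X n c : ℕ) : ℕ × ℕ :=
  Nat.rec (motive := fun _ => ℕ → ℕ × ℕ) (fun _ => (0, 0))
    (fun _ ih c => Prod.rec (motive := fun _ => ℕ × ℕ) (fun s b => pair (c % 2 + X * s) (c % 2 + b)) (ih (c / 2))) n c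

def seed (X n v : ℕ) : ℕ × ℕ := bits X n (7 ^ (370 + 7 * v) / 2 ^ 20)

/-- The number with `N` digits `c` in base `2 ^ w`. -/
def rep (w c N : ℕ) : ℕ := Nat.rec (motive := fun _ => ℕ) 0 (fun _ m => 2 ^ w * m + c) N

/-- Converts digits between `-h` and `h` in base `2 * h` into digits with offset `H` in base `X`. -/
def digits (h H X n s : ℕ) : ℕ :=
  Nat.rec (motive := fun _ => ℕ → ℕ) (fun _ => 0)
    (fun _ ih s => force s fun s => (s + h) % (2 * h) + (H - h) + X * ih ((s + h) / (2 * h))) n s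

/-- The absolute difference. -/
def dist (m n : ℕ) : ℕ := (m - n) + (n - m)

/-- Makes the residues modulo `2 ^ 64` distinguish the values, for efficiency. -/
def tag (n : ℕ) : ℕ := n * 2 ^ 64 + n % 18446744073709551557

def untag (n : ℕ) : ℕ := Nat.shiftRight n 64

/-- The row whose entries are the digits of `q`, if these are bounded by the mask `m` and `p` holds. -/
def check (m : ℕ) (p : Bool) (g q : ℕ) : ℕ × ℕ :=
  bif p && Nat.beq (Nat.land (untag q) m) (untag q) then (g, q) else (0, 0)

/-- Fraction free row operations on vectors with `N` entries between `-2 ^ t` and `2 ^ t`,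
packed in base `2 ^ w`, together with the preceding pivot. -/
def rowop (w H o m : ℕ) : Elim.Rowop (ℕ × ℕ) where
  piv x := !Nat.beq x.1 0 && !Nat.beq (Nat.land (untag x.2) (2 ^ w - 1)) H
  red x y := Prod.rec (motive := fun _ => ℕ × ℕ) (fun _ x => Prod.rec (motive := fun _ => ℕ × ℕ) (fun g y =>
    (fun x y => force (Nat.land x (2 ^ w - 1)) fun a => force (Nat.land y (2 ^ w - 1)) fun b =>
      force (tag (Nat.sub ((a - H) * y + (H - b) * x + (2 ^ w * g + b - a) * o) ((H - a) * y + (b - H) * x))) fun n =>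
        force (tag (Nat.shiftRight (untag n) w / g)) fun q => force (dist a H) fun d =>
          check m (Nat.beq (Nat.shiftLeft (g * untag q) w) (untag n) && (Nat.ble 1 g && Nat.ble g H)) d q) (untag x) (untag y)) y) x
  zero x := !Nat.beq x.1 0 && Nat.beq (untag x.2) o

def start (h w H N : ℕ) (x : ℕ × ℕ) : ℕ × ℕ := pair 1 (tag (digits h H (2 ^ w) N x.1))

/-- The independence tests with packed rows. -/
def genTests (L A n code : ℕ) (l : List (ℕ × ℕ × ℕ × ℕ)) : Bool :=
  (fun T T₁ G => Elim.allRec (fun x => (fun t N => (fun w H =>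
      Prog.genTest (ops (2 ^ (256 * L))) (rowop w H (rep w H N) (rep w (2 * H - 1) N)) (ok (2 ^ 255)) (start (2 ^ 255) w H N)
        N A T T₁ G (Prog.keyDeg x.2.2.1) (Prog.keyOrd x.2.2.1) x.2.2.2) (2 * t + 3) (2 ^ t)) (x.1 + 255) x.2.1) l)
    (BinaryForms.mkRows (2 ^ 32) A) (BinaryForms.mkRows 1 A) (Prog.heads (ops (2 ^ (256 * L))) (seed (2 ^ 256) 8) n code)

end Kron

namespace Prog

section Span

variable {R : Type} [CommRing R]

lemma mem_goDfs {σ : Type} {mul : σ → σ → σ} {n : ℕ} {l : List (Entry σ)} {d : ℕ × ℕ × ℕ} {k : ℕ} {acc y : Entry σ} :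
    y ∈ goDfs mul n l d k acc ↔ ∃ x t, x :: t <:+ l ∧
      y ∈ dfs mul n (x :: t) (subDeg d x.deg) (k - x.ord) (mulE mul acc x) := by
  induction l with
  | nil => simp [goDfs]
  | cons a l ih =>
    have e : goDfs mul n (a :: l) d k acc = append (dfs mul n (a :: l) (subDeg d a.deg) (k - a.ord) (mulE mul acc a))
      (goDfs mul n l d k acc) := rfl
    rw [e, append_eq, List.mem_append, ih]
    constructor
    · rintro (h | ⟨x, t, h, hy⟩)
      · exact ⟨a, l, List.suffix_rfl, h⟩
      · exact ⟨x, t, h.trans (List.suffix_cons a l), hy⟩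
    · rintro ⟨x, t, h, hy⟩
      rcases List.suffix_cons_iff.1 h with h | h
      · obtain ⟨rfl, rfl⟩ := List.cons.inj h
        exact Or.inl hy
      · exact Or.inr ⟨x, t, h, hy⟩

lemma dfs_stop {σ : Type} (mul : σ → σ → σ) (n : ℕ) (l : List (Entry σ)) (acc : Entry σ) :
    dfs mul n l 0 0 acc = [acc] := by
  cases n <;> rfl

lemma stop_iff (d : ℕ × ℕ × ℕ) (k : ℕ) : (eqDeg d (0, (0, 0)) && Nat.beq k 0) = true ↔ d = 0 ∧ k = 0 := by
  rw [Bool.and_eq_true, eqDeg_iff, Nat.beq_eq]; rfl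

lemma dfs_succ {σ : Type} (mul : σ → σ → σ) (n : ℕ) (l : List (Entry σ)) {d : ℕ × ℕ × ℕ} {k : ℕ} (acc : Entry σ)
    (h : ¬ (d = 0 ∧ k = 0)) : dfs mul (n + 1) l d k acc = goDfs mul n (filt (fits d k) l) d k acc := by
  change (bif _ then _ else _) = _
  rw [← stop_iff, Bool.not_eq_true] at h
  rw [h]; rfl

lemma dfs_zero {σ : Type} (mul : σ → σ → σ) (l : List (Entry σ)) {d : ℕ × ℕ × ℕ} {k : ℕ} (acc : Entry σ)
    (h : ¬ (d = 0 ∧ k = 0)) : dfs mul 0 l d k acc = [] := by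
  change (bif _ then _ else _) = _
  rw [← stop_iff, Bool.not_eq_true] at h
  rw [h]; rfl

/-- The entries of the multiset `L` are in `l`, and have total degree `d` and total order `k`. -/
structure Total (l : List (Entry R)) (d : ℕ × ℕ × ℕ) (k : ℕ) (L : Multiset (Entry R)) : Prop where
  mem : ∀ s ∈ L, s ∈ l
  deg : (L.map Entry.deg).sum = d
  ord : (L.map Entry.ord).sum = k

def prodVal (L : Multiset (Entry R)) : R := (L.map Entry.val).prod

lemma exists_of_mem_dfs {n : ℕ} {l : List (Entry R)} {d : ℕ × ℕ × ℕ} {k : ℕ} {acc y : Entry R}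
    (h : y ∈ dfs (fun x y => x * y) n l d k acc) : ∃ L, Total l d k L ∧ y.val = acc.val * prodVal L := by
  induction n generalizing l d k acc y with
  | zero =>
    by_cases h0 : d = 0 ∧ k = 0
    · obtain ⟨rfl, rfl⟩ := h0
      rw [dfs_stop, List.mem_singleton] at h
      exact ⟨0, ⟨by simp, by simp, by simp⟩, by simp [h, prodVal]⟩
    · rw [dfs_zero _ _ _ h0] at h; simp at h
  | succ n ih =>
    by_cases h0 : d = 0 ∧ k = 0
    · obtain ⟨rfl, rfl⟩ := h0
      rw [dfs_stop, List.mem_singleton] at h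
      exact ⟨0, ⟨by simp, by simp, by simp⟩, by simp [h, prodVal]⟩
    · rw [dfs_succ _ _ _ _ h0, mem_goDfs] at h
      obtain ⟨x, t, ht, hy⟩ := h
      obtain ⟨L, hL, e⟩ := ih hy
      have hsub : ∀ z ∈ x :: t, z ∈ l ∧ fits d k z = true := fun z hz => by
        have := ht.subset hz
        rw [filt_eq, List.mem_filter] at this
        exact this
      have hx := (fits_iff _ _ _).1 (hsub x List.mem_cons_self).2
      refine ⟨x ::ₘ L, ⟨fun s hs => ?_, ?_, ?_⟩, ?_⟩
      · rcases Multiset.mem_cons.1 hs with rfl | hs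
        · exact (hsub s List.mem_cons_self).1
        · exact (hsub s (hL.mem s hs)).1
      · rw [Multiset.map_cons, Multiset.sum_cons, hL.deg, subDeg_eq, add_tsub_cancel_of_le hx.1]
      · rw [Multiset.map_cons, Multiset.sum_cons, hL.ord, add_tsub_cancel_of_le hx.2]
      · rw [e, prodVal, prodVal, Multiset.map_cons, Multiset.prod_cons]
        change acc.val * x.val * _ = _
        ring

lemma exists_suffix {α : Type} {L : Multiset α} (h0 : L ≠ 0) {l : List α} (h : ∀ s ∈ L, s ∈ l) :
    ∃ x t, x :: t <:+ l ∧ x ∈ L ∧ ∀ s ∈ L, s ∈ x :: t := by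
  induction l with
  | nil =>
    obtain ⟨s, hs⟩ := Multiset.exists_mem_of_ne_zero h0
    exact absurd (h s hs) (by simp)
  | cons a l ih =>
    by_cases ha : a ∈ L
    · exact ⟨a, l, List.suffix_rfl, ha, h⟩
    · obtain ⟨x, t, h1, h2⟩ := ih fun s hs => (List.mem_cons.1 (h s hs)).resolve_left fun e => ha (e ▸ hs)
      exact ⟨x, t, h1.trans (List.suffix_cons a l), h2⟩

lemma exists_mem_dfs {n : ℕ} {l : List (Entry R)} {d : ℕ × ℕ × ℕ} {k : ℕ} {L : Multiset (Entry R)}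
    (hL : Total l d k L) (h0 : ∀ s ∈ L, s.deg ≠ 0) (hn : L.card ≤ n) (acc : Entry R) :
    ∃ y ∈ dfs (fun x y => x * y) n l d k acc, y.val = acc.val * prodVal L := by
  induction n generalizing l d k L acc with
  | zero =>
    obtain rfl := Multiset.card_eq_zero.1 (Nat.le_zero.1 hn)
    obtain rfl : 0 = d := by simpa using hL.deg
    obtain rfl : 0 = k := by simpa using hL.ord
    rw [dfs_stop]
    exact ⟨acc, List.mem_singleton_self _, by simp [prodVal]⟩
  | succ n ih =>
    by_cases hL0 : L = 0
    · subst hL0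
      obtain rfl : 0 = d := by simpa using hL.deg
      obtain rfl : 0 = k := by simpa using hL.ord
      rw [dfs_stop]
      exact ⟨acc, List.mem_singleton_self _, by simp [prodVal]⟩
    · have hfit : ∀ s ∈ L, s ∈ filt (fits d k) l := fun s hs => by
        rw [filt_eq, List.mem_filter, fits_iff, ← hL.deg, ← hL.ord]
        exact ⟨hL.mem s hs, Multiset.single_le_sum (fun _ _ => zero_le) _ (Multiset.mem_map_of_mem _ hs),
          Multiset.single_le_sum (fun _ _ => zero_le) _ (Multiset.mem_map_of_mem _ hs)⟩
      obtain ⟨x, t, h1, hx, h2⟩ := exists_suffix hL0 hfit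
      obtain ⟨L', rfl⟩ := Multiset.exists_cons_of_mem hx
      have hdeg := hL.deg
      have hord := hL.ord
      rw [Multiset.map_cons, Multiset.sum_cons] at hdeg hord
      rw [dfs_succ]
      · have hL' : Total (x :: t) (subDeg d x.deg) (k - x.ord) L' := ⟨fun s hs => h2 s (Multiset.mem_cons_of_mem hs),
          by rw [subDeg_eq, ← hdeg, add_tsub_cancel_left], by rw [← hord, add_tsub_cancel_left]⟩
        obtain ⟨y, hy, e⟩ := ih hL' (fun s hs => h0 s (Multiset.mem_cons_of_mem hs))
          (by simpa using hn) (mulE (fun x y => x * y) acc x)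
        refine ⟨y, mem_goDfs.2 ⟨x, t, h1, hy⟩, ?_⟩
        rw [e, prodVal, prodVal, Multiset.map_cons, Multiset.prod_cons]
        change acc.val * x.val * _ = _
        ring
      · rintro ⟨rfl, -⟩
        refine h0 x hx ?_
        have := congrArg Prod.fst hdeg
        have := congrArg (fun d => d.2.1) hdeg
        have := congrArg (fun d => d.2.2) hdeg
        ext <;> simp_all

variable [Algebra ℂ R] {S : SlAlg R}

lemma prodVal_mem (h1 : (1 : R) ∈ S.A 0 0) {l : List (Entry R)} (hl : ∀ s ∈ l, s.val ∈ S.A s.deg s.ord)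
    {d : ℕ × ℕ × ℕ} {k : ℕ} {L : Multiset (Entry R)} (hL : Total l d k L) : prodVal L ∈ S.A d k := by
  obtain ⟨h, rfl, rfl⟩ := hL
  induction L using Multiset.induction_on with
  | empty => simpa [prodVal] using h1
  | cons s L ih =>
    rw [prodVal, Multiset.map_cons, Multiset.map_cons, Multiset.map_cons, Multiset.prod_cons, Multiset.sum_cons,
      Multiset.sum_cons, Nat.cast_add]
    exact SlAlg.A_mul (hl s (h s (Multiset.mem_cons_self _ _))) (ih fun s hs => h s (Multiset.mem_cons_of_mem hs))

def monos (l : List (Entry R)) (d : ℕ × ℕ × ℕ) (k : ℕ) : Set R := {t | ∃ L, Total l d k L ∧ t = prodVal L}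

def gens (l : List (Entry R)) (d : ℕ × ℕ × ℕ) (k : ℕ) : Set R := {t | ∃ s ∈ l, s.deg = d ∧ s.ord = k ∧ t = s.val}

lemma mem_filt_ne {l : List (Entry R)} {d : ℕ × ℕ × ℕ} {s : Entry R} :
    s ∈ filt (fun x => !eqDeg x.deg d) l ↔ s ∈ l ∧ s.deg ≠ d := by
  rw [filt_eq, List.mem_filter, Bool.not_eq_true', ← Bool.not_eq_true, eqDeg_iff]

lemma size_lt {d d₁ d₂ : ℕ × ℕ × ℕ} (h : d₁ + d₂ = d) (h0 : d₂ ≠ 0) : d₁.1 + (d₁.2.1 + d₁.2.2) < d.1 + (d.2.1 + d.2.2) := by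
  obtain ⟨a, b, c⟩ := d₂
  subst h
  have : a ≠ 0 ∨ b ≠ 0 ∨ c ≠ 0 := by
    by_contra! h
    exact h0 (by rw [h.1, h.2.1, h.2.2]; rfl)
  simp only [Prod.fst_add, Prod.snd_add]
  omega

lemma Q_le_monos {l : List (Entry R)} {d : ℕ × ℕ × ℕ} {k : ℕ}
    (h : ∀ d' : ℕ × ℕ × ℕ, d'.1 + (d'.2.1 + d'.2.2) < d.1 + (d.2.1 + d.2.2) → ∀ k : ℕ,
      S.A d' k ≤ Submodule.span ℂ (monos l d' k)) :
    S.Q d k ≤ Submodule.span ℂ (monos (filt (fun x => !eqDeg x.deg d) l) d k) := by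
  refine Submodule.span_le.2 ?_
  rintro _ ⟨d₁, d₂, u₁, u₂, h₁, h₂, hd, hu, x, hx, y, hy, rfl⟩
  rcases lt_or_ge u₁ 0 with hu₁ | hu₁
  · rw [SlAlg.A_neg hu₁ hx, zero_mul]; exact zero_mem _
  rcases lt_or_ge u₂ 0 with hu₂ | hu₂
  · rw [SlAlg.A_neg hu₂ hy, mul_zero]; exact zero_mem _
  lift u₁ to ℕ using hu₁
  lift u₂ to ℕ using hu₂
  have hx' := h d₁ (size_lt hd h₂) u₁ hx
  have hy' := h d₂ (size_lt (by rw [add_comm, hd]) h₁) u₂ hy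
  have key := Submodule.mul_mem_mul hx' hy'
  rw [Submodule.span_mul_span] at key
  refine Submodule.span_mono ?_ key
  rintro _ ⟨_, ⟨L, hL, rfl⟩, _, ⟨L', hL', rfl⟩, rfl⟩
  have aux : ∀ {e e' : ℕ × ℕ × ℕ} {j : ℕ} {L : Multiset (Entry R)}, e + e' = d → e' ≠ 0 → Total l e j L →
      ∀ s ∈ L, s ∈ filt (fun x => !eqDeg x.deg d) l := by
    intro e e' j L he he' hL s hs
    refine mem_filt_ne.2 ⟨hL.mem s hs, fun hsd => ?_⟩
    have h1 : s.deg ≤ e := hL.deg ▸ Multiset.single_le_sum (fun _ _ => zero_le) _ (Multiset.mem_map_of_mem _ hs)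
    rw [hsd, ← he] at h1
    have h2 := size_lt he he'
    obtain ⟨h3, h4, h5⟩ := h1
    simp only [Prod.fst_add, Prod.snd_add, ← he] at h2 h3 h4 h5
    omega
  refine ⟨L + L', ⟨fun s hs => ?_, ?_, ?_⟩, ?_⟩
  · rcases Multiset.mem_add.1 hs with hs | hs
    · exact aux hd h₂ hL s hs
    · exact aux (by rw [add_comm, hd]) h₁ hL' s hs
  · rw [Multiset.map_add, Multiset.sum_add, hL.deg, hL'.deg, hd]
  · rw [Multiset.map_add, Multiset.sum_add, hL.ord, hL'.ord]; exact_mod_cast hu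
  · rw [prodVal, prodVal, prodVal, Multiset.map_add, Multiset.prod_add]

lemma A_le_monos {l : List (Entry R)}
    (h : ∀ d : ℕ × ℕ × ℕ, d ≠ 0 → ∀ k : ℕ, S.A d k ≤ S.Q d k ⊔ Submodule.span ℂ (gens l d k)) (d : ℕ × ℕ × ℕ) (k : ℕ) :
    S.A d k ≤ Submodule.span ℂ (monos l d k) := by
  induction hn : d.1 + (d.2.1 + d.2.2) using Nat.strong_induction_on generalizing d k with
  | _ n ih =>
  by_cases hd : d = 0
  · subst hd
    intro x hx
    by_cases hk : k = 0
    · subst hk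
      obtain ⟨c, rfl⟩ := S.const (by exact_mod_cast SlAlg.A_le hx)
      rw [Algebra.algebraMap_eq_smul_one]
      exact Submodule.smul_mem _ _ (Submodule.subset_span ⟨0, ⟨by simp, by simp, by simp⟩, by simp [prodVal]⟩)
    · have := SlAlg.A_le hx
      rw [S.zero (by exact_mod_cast hk), Submodule.mem_bot] at this
      rw [this]; exact zero_mem _
  · refine (h d hd k).trans (sup_le ((Q_le_monos fun d' hd' k => ih _ (hn ▸ hd') d' k rfl).trans ?_) ?_)
    · refine Submodule.span_mono ?_
      rintro _ ⟨L, hL, rfl⟩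
      exact ⟨L, ⟨fun s hs => (mem_filt_ne.1 (hL.mem s hs)).1, hL.deg, hL.ord⟩, rfl⟩
    · refine Submodule.span_mono ?_
      rintro _ ⟨s, hs, rfl, rfl, rfl⟩
      exact ⟨{s}, ⟨by simpa using hs, by simp, by simp⟩, by simp [prodVal]⟩

lemma card_le_size {L : Multiset (Entry R)} (h0 : ∀ s ∈ L, s.deg ≠ 0) {d : ℕ × ℕ × ℕ}
    (h : (L.map Entry.deg).sum = d) : L.card ≤ d.1 + (d.2.1 + d.2.2) := by
  induction L using Multiset.induction_on generalizing d with
  | empty => simp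
  | cons s L ih =>
    have h1 := ih (fun s hs => h0 s (Multiset.mem_cons_of_mem hs)) rfl
    rw [Multiset.map_cons, Multiset.sum_cons, add_comm] at h
    have h2 := size_lt h (h0 s (Multiset.mem_cons_self _ _))
    rw [Multiset.card_cons]
    omega

end Span

end Prog

namespace Elim

variable {M : Type} [AddCommGroup M] [Module ℂ M]

lemma comb_eq_sum (l : List M) (c : ℕ → ℂ) : comb l c = ∑ i : Fin l.length, c i • l[i] := by
  induction l generalizing c with
  | nil => simp [comb]
  | cons v l ih => simp [comb, ih, Fin.sum_univ_succ]

lemma comb_append (l l' : List M) (c : ℕ → ℂ) : comb (l ++ l') c = comb l c + comb l' fun i => c (i + l.length) := by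
  induction l generalizing c with
  | nil => simp [comb]
  | cons v l ih =>
    simp only [List.cons_append, comb, ih, add_assoc, List.length_cons]

lemma comb_mem (l : List M) (c : ℕ → ℂ) : comb l c ∈ Submodule.span ℂ {x | x ∈ l} := by
  rw [comb_eq_sum]
  exact sum_mem fun i _ => Submodule.smul_mem _ _ (Submodule.subset_span (List.getElem_mem i.2))

lemma Sep.append {R Γ rest : List M} (h : Sep R Γ rest) : Indep (R ++ Γ) := by
  intro c hc
  rw [comb_append] at hc
  have h1 := h.2 (fun i => c (i + R.length)) (by
    rw [eq_neg_of_add_eq_zero_right hc]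
    refine neg_mem (Submodule.span_mono ?_ (comb_mem R c))
    exact fun x hx => Or.inl hx)
  have h2 : comb Γ (fun i => c (i + R.length)) = 0 := by
    rw [comb_eq_sum]
    exact Finset.sum_eq_zero fun i _ => by rw [h1 i i.2, zero_smul]
  rw [h2, add_zero] at hc
  intro i hi
  rcases lt_or_ge i R.length with hR | hR
  · exact h.1 c hc i hR
  · obtain ⟨j, rfl⟩ := Nat.exists_eq_add_of_le' hR
    exact h1 j (by rw [List.length_append] at hi; omega)

lemma Indep.le_span {l : List M} (h : Indep l) {P : Submodule ℂ M} (hl : ∀ x ∈ l, x ∈ P) [FiniteDimensional ℂ P]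
    (hP : Module.finrank ℂ P = l.length) : P ≤ Submodule.span ℂ {x | x ∈ l} := by
  have hind : LinearIndependent ℂ fun i : Fin l.length => l[i] := by
    rw [Fintype.linearIndependent_iff]
    intro g hg i
    have := h (fun j => if hj : j < l.length then g ⟨j, hj⟩ else 0) (by
      rw [comb_eq_sum, ← hg]
      exact Finset.sum_congr rfl fun i _ => by rw [dif_pos i.2]) i i.2
    rwa [dif_pos i.2] at this
  have hle : Submodule.span ℂ (Set.range fun i : Fin l.length => l[i]) ≤ P :=
    Submodule.span_le.2 (by rintro _ ⟨i, rfl⟩; exact hl _ (List.getElem_mem i.2))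
  have := Submodule.eq_of_le_of_finrank_eq hle (by rw [finrank_span_eq_card hind, hP, Fintype.card_fin])
  rw [← this]
  refine Submodule.span_mono ?_
  rintro _ ⟨i, rfl⟩
  exact List.getElem_mem i.2

end Elim

namespace Prog

section Sound

open SlAlg

variable {R : Type} [CommRing R] [Algebra ℂ R] {S : SlAlg R} {σ : Type} {op : Ops σ} {rel : R → σ → Prop}

lemma prodVal_mem_Q (h1 : (1 : R) ∈ S.A 0 0) {l : List (Entry R)} (hl : ∀ s ∈ l, s.val ∈ S.A s.deg s.ord)
    (h0 : ∀ s ∈ l, s.deg ≠ 0) {d : ℕ × ℕ × ℕ} (hd : d ≠ 0) {k : ℕ} {L : Multiset (Entry R)}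
    (hL : Total (filt (fun x => !eqDeg x.deg d) l) d k L) : prodVal L ∈ S.Q d k := by
  have hL0 : L ≠ 0 := by
    rintro rfl
    exact hd (by simpa using hL.deg.symm)
  obtain ⟨s, hs⟩ := Multiset.exists_mem_of_ne_zero hL0
  obtain ⟨L', rfl⟩ := Multiset.exists_cons_of_mem hs
  have hdeg := hL.deg
  have hord := hL.ord
  rw [Multiset.map_cons, Multiset.sum_cons] at hdeg hord
  have hs' := mem_filt_ne.1 (hL.mem s hs)
  rw [prodVal, Multiset.map_cons, Multiset.prod_cons, ← hdeg, ← hord, Nat.cast_add]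
  refine mul_mem_Q (h0 s hs'.1) (fun e => hs'.2 ?_) (hl s hs'.1)
    (prodVal_mem h1 (l := l) hl ⟨fun s hs => (mem_filt_ne.1 (hL.mem s (Multiset.mem_cons_of_mem hs))).1, rfl, rfl⟩)
  rw [← hdeg, e, add_zero]

lemma compat (hop : op.Sound rel) : Compat (Entry.Rel S rel) (fun x y => x * y) op.mul where
  ord h := h.ord
  deg h := h.deg
  mul {x x' y y'} h h' := by
    refine ⟨?_, congrArg₂ _ h.ord h'.ord, ?_, hop.mul h.val h'.val⟩
    · have := A_mul h.mem h'.mem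
      rwa [← Nat.cast_add] at this
    · change addDeg _ _ = addDeg _ _
      rw [h.deg, h'.deg]

lemma rel_one (hop : op.Sound rel) (h1 : (1 : R) ∈ S.A 0 0) : (oneE (1 : R)).Rel S rel (oneE op.one) :=
  ⟨h1, rfl, rfl, hop.one⟩

lemma forall₂_vals {ρ M : Type} {dec : σ → ρ} {ok : σ → Bool} {P : M → ρ → Prop} {φ : R → M}
    (hdec : ∀ x s, rel x s → ok s = true → P (φ x) (dec s)) {l : List (Entry R)} {l' : List (Entry σ)}
    (h : List.Forall₂ (Entry.Rel S rel) l l') (hok : ∀ x ∈ l', ok x.val = true) :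
    List.Forall₂ P ((l.map Entry.val).map φ) (vals dec l') := by
  rw [vals, Elim.mapRec_eq]
  induction h with
  | nil => exact List.Forall₂.nil
  | cons h _ ih =>
    exact List.Forall₂.cons (hdec _ _ h.val (hok _ List.mem_cons_self))
      (ih fun x hx => hok x (List.mem_cons_of_mem _ hx))

lemma lengthRec_eq {α : Type} (l : List α) : lengthRec l = l.length := by
  induction l with
  | nil => rfl
  | cons v l ih => rw [List.length_cons, ← ih]; rfl

/-- The entries of `G` generate all highest weight vectors. -/
def Spanned (S : SlAlg R) (G : List (Entry R)) : Prop :=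
  ∀ d : ℕ × ℕ × ℕ, d ≠ 0 → ∀ k : ℕ, S.A d k ≤ S.Q d k ⊔ Submodule.span ℂ (gens G d k)

/-- The entries of `G` of degree `d` and order `k` are independent modulo the decomposables, and span. -/
structure Good (S : SlAlg R) (G : List (Entry R)) (d : ℕ × ℕ × ℕ) (k : ℕ) : Prop where
  span : S.A d k ≤ S.Q d k ⊔ Submodule.span ℂ (gens G d k)
  indep : Spanned S G → ∀ c, Elim.comb ((filt (has d k) G).map Entry.val) c ∈ S.Q d k →
    ∀ i < (filt (has d k) G).length, c i = 0

lemma genTest_sound {ρ M : Type} [AddCommGroup M] [Module ℂ M] (hop : op.Sound rel) (h1 : (1 : R) ∈ S.A 0 0)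
    {row : Elim.Rowop ρ} {P : ℕ → M → ρ → Prop} (hrow : row.Sound P) (φ : R →ₗ[ℂ] M) {ok : σ → Bool} {dec : σ → ρ}
    {N A : ℕ} {T T₁ : BinaryForms.Rows} (hdec : ∀ x s, rel x s → ok s = true → P N (φ x) (dec s)) {d : ℕ × ℕ × ℕ} {k : ℕ}
    (hdim : ∀ D, BinaryForms.dimTest T T₁ A d k D = true → Module.finrank ℂ (S.A d k) = D)
    {G : List (Entry R)} {G' : List (Entry σ)} (hG : List.Forall₂ (Entry.Rel S rel) G G')
    (h0 : ∀ s ∈ G, s.deg ≠ 0) (hd : d ≠ 0) {m : ℕ} (h : genTest op row ok dec N A T T₁ G' d k m = true) : Good S G d k := by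
  have hmem : ∀ s ∈ G, s.val ∈ S.A s.deg s.ord := by
    clear h h0
    induction hG with
    | nil => simp
    | cons h _ ih =>
      intro s hs
      rcases List.mem_cons.1 hs with rfl | hs
      exacts [h.mem, ih s hs]
  have hfilt : List.Forall₂ (Entry.Rel S rel) (filt (fun x => !eqDeg x.deg d) G) (filt (fun x => !eqDeg x.deg d) G') :=
    rel_filt (fun x y hxy => by rw [hxy.deg]) hG
  set ms := dfs (fun x y => x * y) (d.1 + (d.2.1 + d.2.2)) (filt (fun x => !eqDeg x.deg d) G) d k (oneE (1 : R)) with hms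
  have hms' : List.Forall₂ (Entry.Rel S rel) ms (decomposables op G' d k) :=
    (compat hop).dfs _ d k hfilt (rel_one hop h1)
  have hΓ : List.Forall₂ (Entry.Rel S rel) (filt (has d k) G) (filt (has d k) G') := rel_filt ((compat hop).has d k) hG
  obtain ⟨ht1, ht⟩ := (Bool.and_eq_true _ _ ▸ h : _ ∧ _)
  obtain ⟨ht2, ht⟩ := (Bool.and_eq_true _ _ ▸ ht : _ ∧ _)
  obtain ⟨ht3, ht4⟩ := (Bool.and_eq_true _ _ ▸ ht : _ ∧ _)
  rw [Elim.allRec_eq, List.all_eq_true] at ht1 ht2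
  have hR0 := rel_pick 0 m hms'
  have hR1 := rel_pick 1 m hms'
  have hsep := (Elim.sepTest_sound hrow (forall₂_vals hdec hR0 fun x hx => ht1 x (mem_of_mem_pick hx))
    (forall₂_vals hdec hΓ ht2) (forall₂_vals hdec hR1 fun x hx => ht1 x (mem_of_mem_pick hx)) ht3).of_map φ
  have hdimD := hdim _ ht4
  rw [lengthRec_eq, lengthRec_eq, ← hR0.length_eq, ← hΓ.length_eq] at hdimD
  have hmsQ : ∀ x ∈ ms, x.val ∈ S.Q d k := fun x hx => by
    obtain ⟨L, hL, e⟩ := exists_of_mem_dfs hx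
    rw [e, oneE, one_mul]
    exact prodVal_mem_Q h1 hmem h0 hd hL
  constructor
  · have hfin : FiniteDimensional ℂ (S.A d k) := by
      have := S.fin d k
      exact Submodule.finiteDimensional_of_le A_le
    refine (hsep.append.le_span (P := S.A d k) ?_ (by rw [hdimD]; simp)).trans (Submodule.span_le.2 ?_)
    · intro x hx
      rcases List.mem_append.1 hx with hx | hx
      · obtain ⟨s, hs, rfl⟩ := List.mem_map.1 hx
        exact Q_le (hmsQ s (mem_of_mem_pick hs))
      · obtain ⟨s, hs, rfl⟩ := List.mem_map.1 hx
        rw [filt_eq, List.mem_filter, has_iff] at hs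
        obtain ⟨hs, rfl, rfl⟩ := hs
        exact hmem s hs
    · intro x hx
      rcases List.mem_append.1 hx with hx | hx
      · obtain ⟨s, hs, rfl⟩ := List.mem_map.1 hx
        exact Submodule.mem_sup_left (hmsQ s (mem_of_mem_pick hs))
      · obtain ⟨s, hs, rfl⟩ := List.mem_map.1 hx
        rw [filt_eq, List.mem_filter, has_iff] at hs
        exact Submodule.mem_sup_right (Submodule.subset_span ⟨s, hs.1, hs.2.1, hs.2.2, rfl⟩)
  · intro hsp c hc i hi
    refine hsep.2 c ?_ i (by simpa using hi)
    have hQ := Q_le_monos (S := S) (l := G) (d := d) (k := k) (fun d' _ k => A_le_monos hsp d' k) hc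
    refine Submodule.span_mono ?_ hQ
    rintro _ ⟨L, hL, rfl⟩
    have hL0 : ∀ s ∈ L, s.deg ≠ 0 := fun s hs => h0 s (mem_filt_ne.1 (hL.mem s hs)).1
    obtain ⟨y, hy, e⟩ := exists_mem_dfs hL hL0 (card_le_size hL0 hL.deg) (oneE (1 : R))
    rw [oneE, one_mul] at e
    rw [← e]
    exact (mem_pick_or m hy).imp (fun h => List.mem_map_of_mem h) fun h => List.mem_map_of_mem h

lemma rel_dropRec {α β : Type} {r : α → β → Prop} (n : ℕ) {l : List α} {l' : List β} (h : List.Forall₂ r l l') :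
    List.Forall₂ r (dropRec n l) (dropRec n l') := by
  induction n generalizing l l' with
  | zero => exact h
  | succ n ih =>
    cases h with
    | nil => exact ih .nil
    | cons _ h => exact ih h

lemma rel_monomials (hop : op.Sound rel) (h1 : (1 : R) ∈ S.A 0 0) {t : Tree (Entry R)} {t' : Tree (Entry σ)}
    (ht : Tree.Rel (Entry.Rel S rel) t t') (n code : ℕ) {st : List (Entry R)} {st' : List (Entry σ)}
    (hst : List.Forall₂ (Entry.Rel S rel) st st') : ∃ l : List (Entry R × Entry R),
    List.Forall₂ (fun x y => x.1.Rel S rel y.1 ∧ x.2.Rel S rel y.2) l (monomials op t' n code st') := by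
  induction n generalizing code st st' with
  | zero => exact ⟨[], .nil⟩
  | succ n ih =>
    rw [monomials]
    dsimp only
    rcases Nat.beq code 0 with _ | _
    · rw [cond_false]
      have hy : ∃ y : Entry R, y.Rel S rel (List.rec (motive := fun _ => Entry σ) (oneE op.one) (fun x _ _ => x) st') := by
        cases hst with
        | nil => exact ⟨_, rel_one hop h1⟩
        | cons h _ => exact ⟨_, h⟩
      obtain ⟨y, hy⟩ := hy
      rcases code / 512 % 8 with _ | a
      · exact ih _ (.cons ((compat hop).mul hy (rel_lookup ht _)) hst)
      · obtain ⟨l, hl⟩ := ih (code / 4096) (rel_dropRec (a + a / 6 * 6) hst)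
        exact ⟨(lookup t (code % 512), y) :: l, .cons ⟨rel_lookup ht _, hy⟩ hl⟩
    · exact ⟨[], .nil⟩

lemma prodTest_sound {M : Type} [AddCommGroup M] [Module ℂ M] (hop : op.Sound rel) (h1 : (1 : R) ∈ S.A 0 0)
    {row : Elim.Rowop σ} {P : ℕ → M → σ → Prop} (hrow : row.Sound P) (φ : R →ₗ[ℂ] M) {N A : ℕ} {T T₁ : BinaryForms.Rows}
    (hdec : ∀ x s, rel x s → P N (φ x) s) {d : ℕ × ℕ × ℕ} {k code : ℕ}
    (hdim : ∀ D, BinaryForms.dimTest T T₁ A d k D = true → Module.finrank ℂ (S.A d k) = D)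
    {t : Tree (Entry R)} {t' : Tree (Entry σ)} (ht : Tree.Rel (Entry.Rel S rel) t t')
    (h : prodTest op row N A T T₁ t' d k code = true) : S.Red d k := by
  obtain ⟨ht1, h⟩ := (Bool.and_eq_true _ _ ▸ h : _ ∧ _)
  obtain ⟨ht2, ht3⟩ := (Bool.and_eq_true _ _ ▸ h : _ ∧ _)
  obtain ⟨l, hl⟩ := rel_monomials hop h1 ht 4096 code .nil
  have hQ : ∀ x ∈ l, x.1.val * x.2.val ∈ S.Q d k := by
    have : ∀ {l' : List (Entry σ × Entry σ)}, List.Forall₂ (fun x y => x.1.Rel S rel y.1 ∧ x.2.Rel S rel y.2) l l' →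
        Elim.allRec (isProd d k) l' = true → ∀ x ∈ l, x.1.val * x.2.val ∈ S.Q d k := by
      clear hl ht1
      intro l' hl ht
      rw [Elim.allRec_eq, List.all_eq_true] at ht
      induction hl with
      | nil => simp
      | @cons a b l l' hab _ ih =>
        intro x hx
        rcases List.mem_cons.1 hx with rfl | hx
        · have hb := ht b List.mem_cons_self
          simp only [isProd, Bool.and_eq_true, eqDeg_iff, Nat.beq_eq, Bool.not_eq_true', ← Bool.not_eq_true] at hb
          obtain ⟨e1, e2, h3, h4⟩ := hb
          rw [hab.1.deg, hab.2.deg, addDeg_eq] at e1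
          rw [hab.1.ord, hab.2.ord] at e2
          rw [hab.1.deg] at h3
          rw [hab.2.deg] at h4
          rw [← e1, ← e2, Nat.cast_add]
          exact mul_mem_Q h3 h4 hab.1.mem hab.2.mem
        · exact ih (fun x hx => ht x (List.mem_cons_of_mem _ hx)) x hx
    exact this hl ht1
  have hrel : List.Forall₂ (P N) ((l.map fun x => x.1.val * x.2.val).map φ)
      (Elim.mapRec (fun x => op.mul x.1.val x.2.val) (monomials op t' 4096 code [])) := by
    rw [Elim.mapRec_eq, List.forall₂_map_left_iff, List.forall₂_map_left_iff, List.forall₂_map_right_iff]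
    exact hl.imp fun x y hxy => hdec _ _ (hop.mul hxy.1.val hxy.2.val)
  have hind := (Elim.indepTest_sound hrow hrel ht2).of_map φ
  have hfin : FiniteDimensional ℂ (S.A d k) := by
    have := S.fin d k
    exact Submodule.finiteDimensional_of_le A_le
  refine (hind.le_span (P := S.A d k) ?_ (by rw [hdim _ ht3, lengthRec_eq, ← hl.length_eq]; simp)).trans (Submodule.span_le.2 ?_)
  · intro x hx
    obtain ⟨y, hy, rfl⟩ := List.mem_map.1 hx
    exact Q_le (hQ y hy)
  · intro x hx
    obtain ⟨y, hy, rfl⟩ := List.mem_map.1 hx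
    exact hQ y hy

end Sound

end Prog

namespace Prog

section Forms

open SlAlg BinaryForms

abbrev ν : Fin 3 → ℕ := ![6, 4, 2]

lemma even_ν (i : Fin 3) : Even (ν i) := by fin_cases i <;> decide

abbrev S : SlAlg (Pol ν) := slAlg ν even_ν

/-- The three generic forms. -/
def forms : List (Entry (Pol ν)) :=
  [⟨coord ν 2 0, 2, (0, (0, 1))⟩, ⟨coord ν 1 0, 4, (0, (1, 0))⟩, ⟨coord ν 0 0, 6, (1, (0, 0))⟩]

/-- The covariants computed by a straight line program. -/
def covs (n code : ℕ) : List (Entry (Pol ν)) := run (Entry.tv S.tv) ⟨0, 0, (0, (0, 0))⟩ n code forms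

lemma one_mem : (1 : Pol ν) ∈ S.A 0 0 :=
  mem_A.2 ⟨isWeightedHomogeneous_one ℂ (wt ν), by rw [slAlg_E]; exact Derivation.map_one_eq_zero _⟩

lemma dp_coord (i : Fin 3) (m : ℕ) : S.dp m (coord ν i 0) = coord ν i m := by
  rw [dp, Fpow_coord, smul_smul, inv_mul_cancel₀ (by exact_mod_cast Nat.factorial_ne_zero m), one_smul]

variable {σ : Type} {op : Ops σ} {rel : Pol ν → σ → Prop}

lemma length_countUp (f : ℕ → σ) (n i : ℕ) : (countUp f n i).length = n := by
  induction n generalizing i with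
  | zero => rfl
  | succ n ih => exact congrArg Nat.succ (ih (i + 1))

lemma getD_countUp (f : ℕ → σ) (z : σ) {n i m : ℕ} (h : m < n) : (countUp f n i).getD m z = f (i + m) := by
  induction n generalizing i m with
  | zero => omega
  | succ n ih =>
    rcases m with _ | m
    · rfl
    · exact (ih (by omega)).trans (by rw [add_assoc, add_comm 1])

lemma jet_coord {f : ℕ → σ} {i : Fin 3} {o : ℕ} (h : ∀ k ≤ ν i, rel (coord ν i k) (f (o + k))) :
    op.Jet S rel (coord ν i 0) (countUp f (ν i + 1) o) := by
  rw [Ops.Jet, length_countUp]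
  refine ⟨fun m hm => ?_, fun m hm => by rw [dp_coord, coord_of_lt hm]⟩
  rw [dp_coord, getD_countUp f _ hm]
  exact h m (by omega)

/-- The position of the coordinates of each form. -/
def offset : Fin 3 → ℕ := ![0, 7, 12]

lemma rel_initial {f : ℕ → σ} (h : ∀ i : Fin 3, ∀ k ≤ ν i, rel (coord ν i k) (f (offset i + k))) :
    List.Forall₂ (Entry.Rel S (op.Jet S rel)) forms (initial f) :=
  .cons ⟨coord_zero_mem 2, rfl, rfl, jet_coord (h 2)⟩ (.cons ⟨coord_zero_mem 1, rfl, rfl, jet_coord (h 1)⟩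
    (.cons ⟨coord_zero_mem 0, rfl, rfl, jet_coord (h 0)⟩ .nil))

lemma rel_heads (hop : op.Sound rel) {f : ℕ → σ} (h : ∀ i : Fin 3, ∀ k ≤ ν i, rel (coord ν i k) (f (offset i + k)))
    (n code : ℕ) : List.Forall₂ (Entry.Rel S rel) (covs n code) (heads op f n code) := by
  have h0 : (⟨0, 0, (0, (0, 0))⟩ : Entry (Pol ν)).Rel S (op.Jet S rel) ⟨[], 0, (0, (0, 0))⟩ :=
    ⟨zero_mem _, rfl, rfl, fun m hm => absurd hm (Nat.not_lt_zero m), fun m _ => by simp [dp]⟩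
  rw [heads, Elim.mapRec_eq, List.forall₂_map_right_iff]
  refine (rel_run h0 (fun r hx hy => Entry.Rel.tv hop hx hy r) n code (rel_initial h)).imp fun x y hxy => ?_
  refine ⟨hxy.mem, hxy.ord, hxy.deg, ?_⟩
  have := hxy.val.getD hop 0
  rw [dp_zero] at this
  rcases hy : y.val with _ | ⟨s, l⟩ <;> rw [hy] at this <;> simpa [headE, hy] using this

lemma genTests_sound {ρ M : Type} [AddCommGroup M] [Module ℂ M] (hop : op.Sound rel) {f : ℕ → σ}
    (hf : ∀ i : Fin 3, ∀ k ≤ ν i, rel (coord ν i k) (f (offset i + k))) {row : Elim.Rowop ρ} {P : ℕ → M → ρ → Prop}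
    (hrow : row.Sound P) (φ : Pol ν →ₗ[ℂ] M) {ok : σ → Bool} {dec : σ → ρ} {N A n code : ℕ}
    (hdec : ∀ x s, rel x s → ok s = true → P N (φ x) (dec s)) (h0 : ∀ s ∈ covs n code, s.deg ≠ 0) {l : List (ℕ × ℕ)}
    (h : genTests op row ok dec f N A n code l = true) :
    ∀ x ∈ l, keyDeg x.1 ≠ 0 → Good S (covs n code) (keyDeg x.1) (keyOrd x.1) := by
  intro x hx hd
  have h : Elim.allRec (fun x => genTest op row ok dec N A (mkRows (2 ^ 32) A) (mkRows 1 A) (heads op f n code)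
    (keyDeg x.1) (keyOrd x.1) x.2) l = true := h
  rw [Elim.allRec_eq, List.all_eq_true] at h
  exact genTest_sound hop one_mem hrow φ hdec (fun D => dimTest_sound) (rel_heads hop hf n code) h0 hd (h x hx)

lemma prodTests_sound {M : Type} [AddCommGroup M] [Module ℂ M] (hop : op.Sound rel) {f : ℕ → σ}
    (hf : ∀ i : Fin 3, ∀ k ≤ ν i, rel (coord ν i k) (f (offset i + k))) {row : Elim.Rowop σ} {P : ℕ → M → σ → Prop}
    (hrow : row.Sound P) (φ : Pol ν →ₗ[ℂ] M) {N A n code : ℕ} (hdec : ∀ x s, rel x s → P N (φ x) s)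
    {l : List (ℕ × ℕ)} (h : prodTests op row f N A n code l = true) : ∀ x ∈ l, S.Red (keyDeg x.1) (keyOrd x.1) := by
  intro x hx
  have h : Elim.allRec (fun x => prodTest op row N A (mkRows (2 ^ 32) A) (mkRows 1 A)
    (build ⟨op.zero, 0, (0, (0, 0))⟩ (heads op f n code) 9 0 1) (keyDeg x.1) (keyOrd x.1) x.2) l = true := h
  rw [Elim.allRec_eq, List.all_eq_true] at h
  have h0 : (⟨0, 0, (0, (0, 0))⟩ : Entry (Pol ν)).Rel S rel ⟨op.zero, 0, (0, (0, 0))⟩ :=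
    ⟨zero_mem _, rfl, rfl, hop.zero⟩
  exact prodTest_sound hop one_mem hrow φ hdec (fun _ => dimTest_sound) (rel_build h0 (rel_heads hop hf n code) 9 0 1) (h x hx)

end Forms

end Prog

namespace Prog

section Evaluation

open BinaryForms

/-- The values of polynomials at power series with integral coefficients. -/
def ev (a : ℕ → PowerSeries ℤ) : Pol ν →ₐ[ℂ] PowerSeries ℂ :=
  aeval fun v => PowerSeries.map (Int.castRingHom ℂ) (a (offset v.1 + v.2))

def coeffs (a : ℕ → PowerSeries ℤ) : Pol ν →ₗ[ℂ] ℕ → ℂ :=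
  LinearMap.pi fun j => PowerSeries.coeff j ∘ₗ (ev a).toLinearMap

variable {σ : Type}

/-- Polynomials whose value is represented by `s`. -/
def EvRel (a : ℕ → PowerSeries ℤ) (P : PowerSeries ℤ → σ → Prop) (f : Pol ν) (s : σ) : Prop :=
  ∃ z, ev a f = PowerSeries.map (Int.castRingHom ℂ) z ∧ P z s

variable {a : ℕ → PowerSeries ℤ} {P : PowerSeries ℤ → σ → Prop}

lemma coeffs_eq {f : Pol ν} {z : PowerSeries ℤ} (h : ev a f = PowerSeries.map (Int.castRingHom ℂ) z) :
    coeffs a f = fun j => ((PowerSeries.coeff j z : ℤ) : ℂ) := by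
  funext j
  change PowerSeries.coeff j (ev a f) = _
  rw [h, PowerSeries.coeff_map]
  rfl

lemma evRel_coord {f : ℕ → σ} (h : ∀ m, P (a m) (f m)) (i : Fin 3) (k : ℕ) (hk : k ≤ ν i) :
    EvRel a P (coord ν i k) (f (offset i + k)) := by
  refine ⟨a (offset i + k), ?_, h _⟩
  rw [coord, dif_pos (Nat.lt_succ_of_le hk), ev, aeval_X]

lemma evRel_sound {op : Ops σ} (zero : P 0 op.zero) (one : P 1 op.one)
    (add : ∀ {x y s t}, P x s → P y t → P (x + y) (op.add s t)) (sub : ∀ {x y s t}, P x s → P y t → P (x - y) (op.sub s t))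
    (mul : ∀ {x y s t}, P x s → P y t → P (x * y) (op.mul s t))
    (smul : ∀ {x s} (c : ℕ), P x s → P (PowerSeries.C (c : ℤ) * x) (op.smul c s)) (cons : ∀ s l, op.cons s l = s :: l) :
    op.Sound (EvRel a P) where
  zero := ⟨0, by simp, zero⟩
  one := ⟨1, by simp, one⟩
  add := by
    rintro x y s t ⟨z, h, hz⟩ ⟨w, h', hw⟩
    exact ⟨z + w, by rw [map_add, map_add, h, h'], add hz hw⟩
  sub := by
    rintro x y s t ⟨z, h, hz⟩ ⟨w, h', hw⟩
    exact ⟨z - w, by rw [map_sub, map_sub, h, h'], sub hz hw⟩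
  mul := by
    rintro x y s t ⟨z, h, hz⟩ ⟨w, h', hw⟩
    exact ⟨z * w, by rw [map_mul, map_mul, h, h'], mul hz hw⟩
  smul := by
    rintro x s c ⟨z, h, hz⟩
    refine ⟨PowerSeries.C (c : ℤ) * z, ?_, smul c hz⟩
    rw [map_smul, h, map_mul, PowerSeries.map_C, PowerSeries.smul_eq_C_mul, eq_intCast, Int.cast_natCast]
  cons := cons

end Evaluation

end Prog

namespace Lanes

open Prog

def seedSeries (N v : ℕ) : PowerSeries ℤ := PowerSeries.mk fun j => (digit (seed N v) j : ℤ)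

def SeriesRel (N : ℕ) (z : PowerSeries ℤ) (s : ℕ) : Prop := Rep N N (fun j => PowerSeries.coeff j z) s

lemma ops_sound {N : ℕ} (h0 : 0 < N) (hN : N ≤ 1024) : (ops N).Sound (EvRel (seedSeries N) (SeriesRel N)) := by
  refine evRel_sound ?_ ?_ ?_ ?_ ?_ ?_ ?_
  · change Rep N N _ 0
    simpa using Rep.zero N N
  · change Rep N N _ 1
    simpa [PowerSeries.coeff_one] using Rep.one h0 N
  · intro x y s t hs ht
    change Rep N N _ (red2 N (s + t))
    simpa using Rep.add le_rfl hs ht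
  · intro x y s t hs ht
    change Rep N N _ (red2 N (s + t * 8190))
    simpa using Rep.sub le_rfl hs ht
  · intro x y s t hs ht
    change Rep N N _ (red2 N (s * t))
    simpa [PowerSeries.coeff_mul] using Rep.mul hN le_rfl hs ht
  · intro x s c hs
    change Rep N N _ (red2 N (s * (c % 8191)))
    simpa only [PowerSeries.coeff_C_mul] using Rep.smul le_rfl hs c
  · intro s l
    cases s <;> rfl

lemma seed_rel (N m : ℕ) : SeriesRel N (seedSeries N m) (seed N m) := by
  simp only [SeriesRel, seedSeries, PowerSeries.coeff_mk]
  exact Rep.seed N N (3 ^ (7700 + 7 * m))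

lemma coeffs_rel {N : ℕ} (f : BinaryForms.Pol ν) (s : ℕ) (h : EvRel (seedSeries N) (SeriesRel N) f s) :
    N ≤ N ∧ ∃ z : ℕ → ℤ, coeffs (seedSeries N) f = (fun j => (z j : ℂ)) ∧ Rep N N z s := by
  obtain ⟨z, hz, h⟩ := h
  exact ⟨le_rfl, _, coeffs_eq hz, h⟩

lemma prodTests_sound {N A n code : ℕ} (h0 : 0 < N) (hN : N ≤ 1024) {l : List (ℕ × ℕ)}
    (h : prodTests (ops N) (rowop N) (seed N) N A n code l = true) : ∀ x ∈ l, S.Red (keyDeg x.1) (keyOrd x.1) :=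
  Prog.prodTests_sound (ops_sound h0 hN) (evRel_coord (seed_rel N)) (rowop_sound N) (coeffs (seedSeries N)) coeffs_rel h

lemma genTests_sound {N A n code : ℕ} (h0 : 0 < N) (hN : N ≤ 1024) (hd : ∀ s ∈ covs n code, s.deg ≠ 0) {l : List (ℕ × ℕ)}
    (h : genTests (ops N) (rowop N) (fun _ => true) (fun s => s) (seed N) N A n code l = true) :
    ∀ x ∈ l, keyDeg x.1 ≠ 0 → Good S (covs n code) (keyDeg x.1) (keyOrd x.1) :=
  Prog.genTests_sound (ops_sound h0 hN) (evRel_coord (seed_rel N)) (rowop_sound N) (coeffs (seedSeries N))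
    (fun f s hs _ => coeffs_rel f s hs) hd h

end Lanes

namespace Kron

open Prog
open scoped Polynomial

lemma force_eq {ρ : Type} (n : ℕ) (k : ℕ → ρ) : force n k = k n := by
  cases n <;> rfl

lemma pair_eq (s b : ℕ) : pair s b = (s, b) := by
  rw [pair, force_eq, force_eq]

lemma lift₂_eq (f g : ℕ → ℕ → ℕ) (x y : ℕ × ℕ) : lift₂ f g x y = (f x.1 y.1, g x.2 y.2) := by
  obtain ⟨s, b⟩ := x
  obtain ⟨t, c⟩ := y
  exact pair_eq _ _

/-- `x.1` is the value modulo `W ^ L` of a power series at `W`, and `x.2` bounds the sum of the absolute values of the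
first `L` coefficients. -/
def Approx (W L : ℕ) (z : PowerSeries ℤ) (x : ℕ × ℕ) : Prop :=
  ∃ (p : ℤ[X]) (q : ℕ[X]), (∀ j < L, PowerSeries.coeff j z = p.coeff j) ∧ (x.1 : ℤ) ≡ p.eval (W : ℤ) [ZMOD (W ^ L : ℕ)] ∧
    (∀ j, |p.coeff j| ≤ q.coeff j) ∧ q.eval 1 = x.2

lemma ops_sound {W : ℕ} (hW : 0 < W) (L : ℕ) {a : ℕ → PowerSeries ℤ} : (ops (W ^ L)).Sound (EvRel a (Approx W L)) := by
  refine evRel_sound ?_ ?_ ?_ ?_ ?_ ?_ ?_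
  · exact ⟨0, 0, by simp, by simp [ops], by simp, by simp [ops]⟩
  · refine ⟨1, 1, fun j _ => by rw [PowerSeries.coeff_one, Polynomial.coeff_one], by simp [ops], fun j => ?_, by simp [ops]⟩
    rw [Polynomial.coeff_one, Polynomial.coeff_one]
    split_ifs <;> simp
  · rintro x y s t ⟨p, q, h1, h2, h3, h4⟩ ⟨p', q', h1', h2', h3', h4'⟩
    change Approx W L _ (lift₂ _ _ s t)
    rw [lift₂_eq]
    refine ⟨p + p', q + q', fun j hj => by rw [map_add, h1 j hj, h1' j hj, Polynomial.coeff_add], ?_, fun j => ?_, by rw [Polynomial.eval_add, h4, h4']⟩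
    · rw [Polynomial.eval_add]
      push_cast
      exact (Int.mod_modEq _ _).trans (by simpa using h2.add h2')
    · rw [Polynomial.coeff_add, Polynomial.coeff_add, Nat.cast_add]
      exact (abs_add_le _ _).trans (add_le_add (h3 j) (h3' j))
  · rintro x y s t ⟨p, q, h1, h2, h3, h4⟩ ⟨p', q', h1', h2', h3', h4'⟩
    change Approx W L _ (lift₂ _ _ s t)
    rw [lift₂_eq]
    refine ⟨p - p', q + q', fun j hj => by rw [map_sub, h1 j hj, h1' j hj, Polynomial.coeff_sub], ?_, fun j => ?_, by rw [Polynomial.eval_add, h4, h4']⟩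
    · rw [Polynomial.eval_sub]
      have hM : 1 ≤ W ^ L := Nat.one_le_pow _ _ hW
      rw [Int.natCast_mod]
      refine (Int.mod_modEq _ _).trans ?_
      rw [Nat.cast_add, Nat.cast_mul, Nat.cast_sub hM, Nat.cast_one]
      refine Int.ModEq.trans ?_ (h2.sub h2')
      refine (Int.modEq_iff_dvd.2 ⟨-t.1, ?_⟩)
      ring
    · rw [Polynomial.coeff_sub, Polynomial.coeff_add, Nat.cast_add]
      exact (abs_sub _ _).trans (add_le_add (h3 j) (h3' j))
  · rintro x y s t ⟨p, q, h1, h2, h3, h4⟩ ⟨p', q', h1', h2', h3', h4'⟩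
    change Approx W L _ (lift₂ _ _ s t)
    rw [lift₂_eq]
    refine ⟨p * p', q * q', fun j hj => ?_, ?_, fun j => ?_, by rw [Polynomial.eval_mul, h4, h4']⟩
    · rw [PowerSeries.coeff_mul, Polynomial.coeff_mul]
      refine Finset.sum_congr rfl fun x hx => ?_
      have := Finset.HasAntidiagonal.mem_antidiagonal.1 hx
      rw [h1 _ (by omega), h1' _ (by omega)]
    · rw [Polynomial.eval_mul, Int.natCast_mod]
      exact (Int.mod_modEq _ _).trans (by simpa using h2.mul h2')
    · rw [Polynomial.coeff_mul, Polynomial.coeff_mul, Nat.cast_sum]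
      refine (Finset.abs_sum_le_sum_abs _ _).trans (Finset.sum_le_sum fun x _ => ?_)
      rw [abs_mul, Nat.cast_mul]
      exact mul_le_mul (h3 _) (h3' _) (abs_nonneg _) (Nat.cast_nonneg _)
  · rintro x ⟨s, b⟩ c ⟨p, q, h1, h2, h3, h4⟩
    change Approx W L _ (pair _ _)
    rw [pair_eq]
    refine ⟨Polynomial.C (c : ℤ) * p, Polynomial.C c * q, fun j hj => ?_, ?_, fun j => ?_, by rw [Polynomial.eval_mul, Polynomial.eval_C, h4]⟩
    · rw [PowerSeries.coeff_C_mul, Polynomial.coeff_C_mul, h1 j hj]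
    · rw [Polynomial.eval_mul, Polynomial.eval_C, Int.natCast_mod]
      exact (Int.mod_modEq _ _).trans (by simpa using h2.mul_left (c : ℤ))
    · rw [Polynomial.coeff_C_mul, Polynomial.coeff_C_mul, abs_mul, Nat.cast_mul, Nat.abs_cast]
      exact mul_le_mul_of_nonneg_left (h3 j) (Nat.cast_nonneg _)
  · rintro ⟨s, b⟩ l
    change force s (fun s => force b fun b => (s, b) :: l) = _
    rw [force_eq, force_eq]

lemma exists_bits (X n c : ℕ) : ∃ p : ℕ[X], p.eval X = (bits X n c).1 ∧ p.eval 1 = (bits X n c).2 := by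
  induction n generalizing c with
  | zero => exact ⟨0, by simp [bits], by simp [bits]⟩
  | succ n ih =>
    obtain ⟨p, h1, h2⟩ := ih (c / 2)
    have e : bits X (n + 1) c = (c % 2 + X * (bits X n (c / 2)).1, c % 2 + (bits X n (c / 2)).2) := by
      change Prod.rec (motive := fun _ => ℕ × ℕ) (fun s b => pair (c % 2 + X * s) (c % 2 + b)) (bits X n (c / 2)) = _
      rcases bits X n (c / 2) with ⟨s, b⟩
      exact pair_eq _ _
    exact ⟨Polynomial.C (c % 2) + Polynomial.X * p, by simp [e, h1], by simp [e, h2]⟩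

def seedPoly (X n v : ℕ) : ℕ[X] := (exists_bits X n (7 ^ (370 + 7 * v) / 2 ^ 20)).choose

def seedSeries (X n v : ℕ) : PowerSeries ℤ := ((seedPoly X n v).map (Nat.castRingHom ℤ) : ℤ[X])

lemma seed_approx (W n L v : ℕ) : Approx W L (seedSeries W n v) (seed W n v) := by
  obtain ⟨h1, h2⟩ := (exists_bits W n (7 ^ (370 + 7 * v) / 2 ^ 20)).choose_spec
  refine ⟨_, seedPoly W n v, fun j _ => Polynomial.coeff_coe _ _, ?_, fun j => by simp, h2⟩
  rw [seed, ← h1, Polynomial.eval_natCast_map, ← eq_natCast (Nat.castRingHom ℤ)]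
  rfl

/-- The digits of a polynomial with small coefficients can be recovered from its value. -/
lemma digits_eq {h H X L n s : ℕ} {p : ℤ[X]} (hH : h ≤ H) (hn : n ≤ L) (hp : ∀ j, |p.coeff j| < h)
    (hs : (s : ℤ) ≡ p.eval ((2 * h : ℕ) : ℤ) [ZMOD ((2 * h) ^ L : ℕ)]) :
    (digits h H X n s : ℤ) = ∑ j ∈ Finset.range n, (p.coeff j + H) * (X : ℤ) ^ j := by
  induction n generalizing L s p with
  | zero => rfl
  | succ n ih =>
    obtain ⟨L, rfl⟩ := Nat.exists_eq_add_of_le' (show 1 ≤ L by omega)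
    have h0 := abs_lt.1 (hp 0)
    have hdiv : s = p.coeff 0 + (2 * h : ℕ) * ((s + h) / (2 * h) : ℕ) ∧ (((s + h) % (2 * h) : ℕ) : ℤ) = p.coeff 0 + h := by
      have h1 : (s : ℤ) ≡ p.coeff 0 [ZMOD (2 * h : ℕ)] := by
        refine (hs.of_dvd (by rw [pow_succ]; push_cast; exact Dvd.intro_left _ rfl)).trans ?_
        conv_lhs => rw [← Polynomial.X_mul_divX_add p]
        rw [Polynomial.eval_add, Polynomial.eval_mul, Polynomial.eval_X, Polynomial.eval_C]
        exact Int.modEq_iff_dvd.2 ⟨-(Polynomial.divX p).eval ((2 * h : ℕ) : ℤ), by ring⟩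
      have h2 : (((s + h) % (2 * h) : ℕ) : ℤ) = p.coeff 0 + h := by
        rw [Int.natCast_mod, Nat.cast_add, (h1.add_right (h : ℤ)).eq]
        exact Int.emod_eq_of_lt (by omega) (by push_cast; omega)
      refine ⟨?_, h2⟩
      have := Nat.mod_add_div (s + h) (2 * h)
      zify at this h2 ⊢
      linarith
    have hs' : (((s + h) / (2 * h) : ℕ) : ℤ) ≡ (Polynomial.divX p).eval ((2 * h : ℕ) : ℤ) [ZMOD ((2 * h) ^ L : ℕ)] := by
      rw [hdiv.1] at hs
      conv_rhs at hs => rw [← Polynomial.X_mul_divX_add p]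
      rw [Polynomial.eval_add, Polynomial.eval_mul, Polynomial.eval_X, Polynomial.eval_C, add_comm (p.coeff 0)] at hs
      have := Int.ModEq.add_right_cancel' _ hs
      rw [pow_succ', Nat.cast_mul (2 * h) ((2 * h) ^ L)] at this
      exact Int.ModEq.mul_left_cancel' (by norm_cast; omega) this
    change ((force s fun s => (s + h) % (2 * h) + (H - h) + X * digits h H X n ((s + h) / (2 * h)) : ℕ) : ℤ) = _
    rw [force_eq, Finset.sum_range_succ', Nat.cast_add, Nat.cast_add, Nat.cast_mul, hdiv.2, Nat.cast_sub hH,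
      ih (by omega) (fun j => by rw [Polynomial.coeff_divX]; exact hp _) hs', Finset.mul_sum]
    simp only [Polynomial.coeff_divX, pow_succ']
    rw [add_comm]
    congr 1
    · exact Finset.sum_congr rfl fun j _ => by ring
    · ring

end Kron

namespace Kron

open Prog

lemma rep_eq (w c N : ℕ) : (rep w c N : ℤ) = ∑ j ∈ Finset.range N, (c : ℤ) * ((2 ^ w : ℕ) : ℤ) ^ j := by
  induction N with
  | zero => rfl
  | succ N ih =>
    change ((2 ^ w * rep w c N + c : ℕ) : ℤ) = _
    rw [Finset.sum_range_succ', Nat.cast_add, Nat.cast_mul, ih, Finset.mul_sum, pow_zero, mul_one]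
    exact congrArg (· + _) (Finset.sum_congr rfl fun j _ => by ring)

lemma untag_tag (n : ℕ) : untag (tag n) = n := by
  have : n % 18446744073709551557 < 2 ^ 64 := (Nat.mod_lt _ (by norm_num)).trans (by norm_num)
  change (n * 2 ^ 64 + n % 18446744073709551557) >>> 64 = n
  rw [Nat.shiftRight_eq_div_pow, add_comm, Nat.add_mul_div_right _ _ (by norm_num), Nat.div_eq_of_lt this, zero_add]

lemma eq_zero_of_sum {X : ℤ} {N : ℕ} {c : ℕ → ℤ} (hc : ∀ j, |c j| < X) (h : ∑ j ∈ Finset.range N, c j * X ^ j = 0) :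
    ∀ j < N, c j = 0 := by
  induction N generalizing c with
  | zero => simp
  | succ N ih =>
    have hX : X ≠ 0 := ((abs_nonneg _).trans_lt (hc 0)).ne'
    have e : ∑ j ∈ Finset.range N, c (j + 1) * X ^ (j + 1) = X * ∑ j ∈ Finset.range N, c (j + 1) * X ^ j := by
      rw [Finset.mul_sum]
      exact Finset.sum_congr rfl fun j _ => by ring
    rw [Finset.sum_range_succ', e, pow_zero, mul_one] at h
    have h0 : c 0 = 0 := Int.eq_zero_of_abs_lt_dvd (Dvd.intro (-∑ j ∈ Finset.range N, c (j + 1) * X ^ j) (by linarith)) (hc 0)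
    rw [h0, add_zero, mul_eq_zero, or_iff_right hX] at h
    rintro (_ | j) hj
    · exact h0
    · exact ih (c := fun j => c (j + 1)) (fun j => hc _) h j (by omega)

lemma abs_sum_lt {X : ℤ} (hX : 0 < X) (N : ℕ) {c : ℕ → ℤ} (hc : ∀ j, |c j| < X) :
    |∑ j ∈ Finset.range N, c j * X ^ j| < X ^ N := by
  induction N with
  | zero => simp
  | succ N ih =>
    rw [Finset.sum_range_succ]
    refine (abs_add_le _ _).trans_lt ?_
    rw [abs_mul, abs_pow, abs_of_pos hX, pow_succ]
    have := mul_le_mul_of_nonneg_right (Int.le_sub_one_of_lt (hc N)) (pow_pos hX N).le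
    linarith

/-- `u` has the digits `z j + H` in base `X`. -/
structure Packed (X H N : ℕ) (z : ℕ → ℤ) (u : ℕ) : Prop where
  small : ∀ j, |z j| ≤ H
  high : ∀ j, N ≤ j → z j = 0
  eq : (u : ℤ) = ∑ j ∈ Finset.range N, (z j + H) * (X : ℤ) ^ j

lemma Packed.mod {X H N : ℕ} {z : ℕ → ℤ} {u : ℕ} (h : Packed X H N z u) (hX : 2 * H < X) (hN : 0 < N) :
    ((u % X : ℕ) : ℤ) = z 0 + H := by
  obtain ⟨N, rfl⟩ := Nat.exists_eq_add_of_le' hN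
  have := abs_le.1 (h.small 0)
  have e : ∑ j ∈ Finset.range N, (z (j + 1) + H) * (X : ℤ) ^ (j + 1) =
      (∑ j ∈ Finset.range N, (z (j + 1) + H) * (X : ℤ) ^ j) * X := by
    rw [Finset.sum_mul]
    exact Finset.sum_congr rfl fun j _ => by ring
  rw [Int.natCast_mod, h.eq, Finset.sum_range_succ', e, pow_zero, mul_one, add_comm, Int.add_mul_emod_self_right,
    Int.emod_eq_of_lt] <;> omega

lemma Packed.eq' {w H N : ℕ} {z : ℕ → ℤ} {u : ℕ} (h : Packed (2 ^ w) H N z u) :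
    (u : ℤ) = ∑ j ∈ Finset.range N, z j * ((2 ^ w : ℕ) : ℤ) ^ j + rep w H N := by
  rw [h.eq, rep_eq, ← Finset.sum_add_distrib]
  exact Finset.sum_congr rfl fun j _ => by ring

lemma exists_digits {w t N u : ℕ} (ht : t < w) (h : Nat.land u (rep w (2 * 2 ^ t - 1) N) = u) :
    ∃ d : ℕ → ℕ, (∀ j, d j < 2 * 2 ^ t) ∧ u = ∑ j ∈ Finset.range N, d j * (2 ^ w) ^ j := by
  induction N generalizing u with
  | zero => exact ⟨fun _ => 0, fun _ => by positivity, by rw [← h]; exact Nat.and_zero u⟩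
  | succ N ih =>
    have h1 : u &&& (2 ^ w * rep w (2 * 2 ^ t - 1) N + (2 * 2 ^ t - 1)) = u := h
    have hlt : 2 * 2 ^ t - 1 < 2 ^ w := by
      have := Nat.pow_le_pow_right (n := 2) (by norm_num) (Nat.succ_le_of_lt ht)
      rw [Nat.succ_eq_add_one, pow_succ'] at this
      have := Nat.pos_of_ne_zero (pow_ne_zero t (two_ne_zero (α := ℕ)))
      omega
    have h2 := congrArg (· % 2 ^ w) h1
    have h3 := congrArg (· / 2 ^ w) h1
    simp only [Nat.and_mod_two_pow, Nat.and_div_two_pow, Nat.mul_add_mod, Nat.mod_eq_of_lt hlt] at h2 h3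
    rw [Nat.mul_add_div (by positivity), Nat.div_eq_of_lt hlt, add_zero] at h3
    obtain ⟨d, hd, e⟩ := ih h3
    refine ⟨fun j => Nat.casesOn j (u % 2 ^ w) d, ?_, ?_⟩
    · rintro (_ | j)
      · change u % 2 ^ w < _
        rw [← h2, ← pow_succ', Nat.and_two_pow_sub_one_eq_mod]
        exact Nat.mod_lt _ (by positivity)
      · exact hd j
    · rw [Finset.sum_range_succ']
      change u = ∑ j ∈ Finset.range N, d j * (2 ^ w) ^ (j + 1) + u % 2 ^ w * (2 ^ w) ^ 0
      have : ∑ j ∈ Finset.range N, d j * (2 ^ w) ^ (j + 1) = 2 ^ w * (u / 2 ^ w) := by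
        rw [e, Finset.mul_sum]
        exact Finset.sum_congr rfl fun j _ => by ring
      rw [this, pow_zero, mul_one, Nat.div_add_mod]

lemma exists_packed {w t N u : ℕ} (ht : t < w) (h : Nat.land u (rep w (2 * 2 ^ t - 1) N) = u) :
    ∃ z, Packed (2 ^ w) (2 ^ t) N z u := by
  obtain ⟨d, hd, e⟩ := exists_digits ht h
  refine ⟨fun j => if j < N then (d j : ℤ) - (2 ^ t : ℕ) else 0, fun j => ?_, fun j hj => if_neg (by omega), ?_⟩
  · have := hd j
    split_ifs
    · rw [abs_le]; omega
    · simp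
  · rw [e, Nat.cast_sum]
    refine Finset.sum_congr rfl fun j hj => ?_
    rw [if_pos (Finset.mem_range.1 hj)]
    push_cast
    ring

/-- Either the row is marked as invalid, or it represents a multiple of `v`. -/
def RowRel (X H N : ℕ) (v : ℕ → ℂ) (x : ℕ × ℕ) : Prop :=
  x.1 ≠ 0 → ∃ z, Packed X H N z (untag x.2) ∧ ∃ c : ℂ, c ≠ 0 ∧ ∀ j, c * v j = z j

lemma Packed.red {w H N : ℕ} (hX : 3 * (H * H) < 2 ^ w) (hX' : 2 * H < 2 ^ w) (hH : 0 < H) (hN : 0 < N) {r v q : ℕ → ℤ}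
    {x y u g : ℕ} (hr : Packed (2 ^ w) H N r x) (hv : Packed (2 ^ w) H N v y) (hq : Packed (2 ^ w) H N q u) (hg : 0 < g)
    (hgH : g ≤ H) (h : g * u * 2 ^ w =
      ((x % 2 ^ w - H) * y + (H - y % 2 ^ w) * x + (2 ^ w * g + y % 2 ^ w - x % 2 ^ w) * rep w H N) -
        ((H - x % 2 ^ w) * y + (y % 2 ^ w - H) * x)) (j : ℕ) :
    (g : ℤ) * q j = r 0 * v (j + 1) - v 0 * r (j + 1) := by
  have ha := hr.mod hX' hN
  have hb := hv.mod hX' hN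
  have hax : x % 2 ^ w < 2 ^ w := Nat.mod_lt _ (by positivity)
  have hxg : 2 ^ w ≤ 2 ^ w * g := Nat.le_mul_of_pos_right _ hg
  have ex := hr.eq'
  have ey := hv.eq'
  have eu := hq.eq'
  have ho := rep_eq w H N
  generalize x % 2 ^ w = a at *
  generalize y % 2 ^ w = b at *
  generalize rep w H N = o at *
  generalize 2 ^ w = X at *
  have hXpos : (0 : ℤ) < X := by omega
  have hXc : 3 * ((H : ℤ) * H) < X := by exact_mod_cast hX
  have hbd : ∀ {s t : ℤ}, |s| ≤ H → |t| ≤ H → |s * t| ≤ (H : ℤ) * H := fun hs ht => by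
    rw [abs_mul]; exact mul_le_mul hs ht (abs_nonneg _) (Nat.cast_nonneg _)
  have hc : ∀ i j, |r 0 * v j - v 0 * r i| ≤ 2 * ((H : ℤ) * H) := fun i j =>
    (abs_sub _ _).trans (by linarith [hbd (hr.small 0) (hv.small j), hbd (hv.small 0) (hr.small i)])
  have hlt := abs_lt.1 (abs_sum_lt hXpos N (c := fun j => r 0 * v j - v 0 * r j) fun j => (hc j j).trans_lt (by linarith [mul_nonneg (Nat.cast_nonneg (α := ℤ) H) (Nat.cast_nonneg H)]))
  have ho' : (X : ℤ) ^ N ≤ X * g * o := by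
    obtain ⟨N, rfl⟩ := Nat.exists_eq_add_of_le' hN
    have h1 : (H : ℤ) * (X : ℤ) ^ N ≤ o := by
      rw [ho]
      exact Finset.single_le_sum (f := fun j => (H : ℤ) * (X : ℤ) ^ j) (fun j _ => by positivity) (Finset.self_mem_range_succ N)
    have h2 : (1 : ℤ) ≤ g * H := by exact_mod_cast Nat.mul_pos hg hH
    have h3 : (0 : ℤ) ≤ X * (X : ℤ) ^ N := by positivity
    have h5 : (1 : ℤ) ≤ g := by exact_mod_cast hg
    have h6 : (1 : ℤ) ≤ H := by exact_mod_cast hH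
    have h4 : (X : ℤ) ^ N ≤ o := le_trans (le_mul_of_one_le_left (by positivity) h6) h1
    calc (X : ℤ) ^ (N + 1) = X * 1 * X ^ N := by ring
      _ ≤ X * g * o := by gcongr
  have esum : ∑ j ∈ Finset.range N, (r 0 * v j - v 0 * r j) * (X : ℤ) ^ j =
      r 0 * (y - o) - v 0 * (x - o) := by
    rw [ex, ey, add_sub_cancel_right, add_sub_cancel_right, Finset.mul_sum, Finset.mul_sum, ← Finset.sum_sub_distrib]
    exact Finset.sum_congr rfl fun j _ => by ring
  have e1 : (((a - H : ℕ) : ℤ)) - ((H - a : ℕ) : ℤ) = r 0 := by omega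
  have e2 : (((b - H : ℕ) : ℤ)) - ((H - b : ℕ) : ℤ) = v 0 := by omega
  have e3 : ((X * g + b - a : ℕ) : ℤ) = X * g + v 0 - r 0 := by
    rw [Nat.cast_sub (by omega)]; push_cast; omega
  have key : (g : ℤ) * u * X = r 0 * (y - o) - v 0 * (x - o) + X * g * o := by
    have hle : (H - a) * y + (b - H) * x ≤ (a - H) * y + (H - b) * x + (X * g + b - a) * o := by
      zify
      rw [e3]
      linear_combination hlt.1.le + ho' + esum - y * e1 + x * e2
    zify [hle] at h
    rw [h, e3, ← e1, ← e2]
    ring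
  have key2 : ∑ j ∈ Finset.range N, (g * q j - (r 0 * v (j + 1) - v 0 * r (j + 1))) * (X : ℤ) ^ j = 0 := by
    have h1 : ∑ j ∈ Finset.range N, (r 0 * v j - v 0 * r j) * (X : ℤ) ^ j =
        X * ∑ j ∈ Finset.range N, (r 0 * v (j + 1) - v 0 * r (j + 1)) * (X : ℤ) ^ j := by
      have := Finset.sum_range_succ (fun j => (r 0 * v j - v 0 * r j) * (X : ℤ) ^ j) N
      rw [Finset.sum_range_succ', hr.high N le_rfl, hv.high N le_rfl] at this
      rw [Finset.mul_sum]
      simp only [mul_zero, sub_zero, zero_mul, add_zero] at this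
      rw [← this, show r 0 * v 0 - v 0 * r 0 = 0 by ring, zero_mul, add_zero]
      exact Finset.sum_congr rfl fun j _ => by ring
    have h2 : (X : ℤ) * ∑ j ∈ Finset.range N, (g * q j - (r 0 * v (j + 1) - v 0 * r (j + 1))) * (X : ℤ) ^ j = 0 := by
      simp only [sub_mul _ _ (_ ^ _), Finset.sum_sub_distrib, mul_assoc (g : ℤ), ← Finset.mul_sum] at esum h1 ⊢
      rw [eu] at key
      linear_combination key - esum + h1
    exact (mul_eq_zero.1 h2).resolve_left hXpos.ne'
  rcases lt_or_ge j N with hj | hj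
  · have := eq_zero_of_sum (fun j => (abs_sub _ _).trans_lt ?_) key2 j hj
    · linarith
    · have h1 := hc (j + 1) (j + 1)
      have h2 := hbd (s := g) (by rw [Nat.abs_cast]; exact_mod_cast hgH) (hq.small j)
      linarith
  · rw [hq.high j hj, hv.high (j + 1) (by omega), hr.high (j + 1) (by omega)]
    ring

lemma rowop_sound {t w H N : ℕ} (ht : H = 2 ^ t) (hw : w = 2 * t + 3) (hN : 0 < N) :
    (rowop w H (rep w H N) (rep w (2 * H - 1) N)).Sound fun _ => RowRel (2 ^ w) H N := by
  have hH : 0 < H := by rw [ht]; positivity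
  have hX8 : 2 ^ w = 8 * (H * H) := by rw [ht, hw]; ring
  have hX : 3 * (H * H) < 2 ^ w := by rw [hX8]; nlinarith
  have hX' : 2 * H < 2 ^ w := by rw [hX8]; nlinarith
  have hland : ∀ u, Nat.land u (2 ^ w - 1) = u % 2 ^ w := fun u => Nat.and_two_pow_sub_one_eq_mod u w
  constructor
  · rintro - r ⟨g₀, x⟩ hr h
    obtain ⟨h1, h2⟩ := (Bool.and_eq_true _ _ ▸ h : _ ∧ _)
    have h1 : g₀ ≠ 0 := fun e => by rw [e] at h1; exact Bool.false_ne_true h1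
    have h2 : Nat.land (untag x) (2 ^ w - 1) ≠ H := fun e => by rw [e, Nat.beq_refl] at h2; exact Bool.false_ne_true h2
    obtain ⟨z, hz, c, hc, hzc⟩ := hr h1
    change Packed _ _ _ _ (untag x) at hz
    rw [hland] at h2
    have hz0 : z 0 ≠ 0 := fun e => h2 (by have := hz.mod hX' hN; rw [e] at this; omega)
    let φ : (ℕ → ℂ) →ₗ[ℂ] (ℕ → ℂ) :=
      { toFun := fun v j => r 0 * v (j + 1) - v 0 * r (j + 1)
        map_add' := fun v w => by ext j; simp only [Pi.add_apply]; ring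
        map_smul' := fun c v => by ext j; simp only [Pi.smul_apply, smul_eq_mul, RingHom.id_apply]; ring }
    refine ⟨φ, by ext j; simp [φ], fun e => hz0 (by have := hzc 0; rw [e] at this; simpa using this.symm), ?_⟩
    rintro v ⟨g, y⟩ hv h3
    set a := untag x % 2 ^ w with ha
    set b := untag y % 2 ^ w with hb
    set n := (a - H) * untag y + (H - b) * untag x + (2 ^ w * g + b - a) * rep w H N -
      ((H - a) * untag y + (b - H) * untag x) with hn
    set q := Nat.shiftRight n w / g with hq
    have e : (rowop w H (rep w H N) (rep w (2 * H - 1) N)).red (g₀, x) (g, y) =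
        check (rep w (2 * H - 1) N) (Nat.beq (Nat.shiftLeft (g * q) w) n && (Nat.ble 1 g && Nat.ble g H)) (dist a H) (tag q) := by
      change force (Nat.land (untag x) (2 ^ w - 1)) (fun a => force (Nat.land (untag y) (2 ^ w - 1)) fun b =>
        force (tag (Nat.sub ((a - H) * untag y + (H - b) * untag x + (2 ^ w * g + b - a) * rep w H N)
          ((H - a) * untag y + (b - H) * untag x))) fun n =>
        force (tag (Nat.shiftRight (untag n) w / g)) fun q => force (dist a H) fun d =>
          check (rep w (2 * H - 1) N) (Nat.beq (Nat.shiftLeft (g * untag q) w) (untag n) && (Nat.ble 1 g && Nat.ble g H)) d q) = _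
      simp only [force_eq, untag_tag, hland]
      rfl
    rw [e] at h3 ⊢
    rw [check, untag_tag] at h3 ⊢
    generalize hB : (Nat.beq (Nat.shiftLeft (g * q) w) n && (Nat.ble 1 g && Nat.ble g H) &&
      Nat.beq (Nat.land q (rep w (2 * H - 1) N)) q) = B at h3 ⊢
    rcases B with _ | _
    · exact absurd rfl h3
    simp only [Bool.and_eq_true, Nat.beq_eq, Nat.ble_eq] at hB
    obtain ⟨⟨h4, h5, h6⟩, h7⟩ := hB
    obtain ⟨z', hz', c', hc', hzc'⟩ := hv (by change g ≠ 0; omega)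
    change Packed _ _ _ _ (untag y) at hz'
    obtain ⟨p, hp⟩ := exists_packed (w := w) (t := t) (by omega) (ht ▸ h7)
    rw [← ht] at hp
    have key := hz.red hX hX' hH hN hz' hp (Nat.pos_of_ne_zero (by omega)) h6
      (((Nat.shiftLeft_eq (g * q) w).symm.trans h4).trans hn)
    refine ⟨p, by change Packed _ _ _ _ (untag (tag q)); rwa [untag_tag], c * c' / g, ?_, fun j => ?_⟩
    · exact div_ne_zero (mul_ne_zero hc hc') (by norm_cast; omega)
    · have hg : (g : ℂ) ≠ 0 := by norm_cast; omega
      have hj : (g : ℂ) * p j = z 0 * z' (j + 1) - z' 0 * z (j + 1) := by exact_mod_cast key j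
      rw [← hzc, ← hzc, ← hzc', ← hzc'] at hj
      rw [div_mul_eq_mul_div, div_eq_iff hg, mul_comm _ (g : ℂ), hj]
      change _ * (r 0 * v (j + 1) - v 0 * r (j + 1)) = _
      ring
  · rintro - v ⟨g, y⟩ hv h
    obtain ⟨h1, h2⟩ := (Bool.and_eq_true _ _ ▸ h : _ ∧ _)
    obtain ⟨z, hz, c, hc, hzc⟩ := hv fun e => by rw [show g = 0 from e] at h1; exact Bool.false_ne_true h1
    have h2 : untag y = rep w H N := Nat.eq_of_beq_eq_true h2
    have := hz.eq'
    rw [h2, right_eq_add] at this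
    have h0 := eq_zero_of_sum (fun j => (hz.small j).trans_lt (by exact_mod_cast (by omega : H < 2 ^ w))) this
    ext j
    have hj : z j = 0 := by
      rcases lt_or_ge j N with h | h
      exacts [h0 j h, hz.high j h]
    have := hzc j
    rw [hj, Int.cast_zero, mul_eq_zero, or_iff_right hc] at this
    exact this

/-- The first `N` coefficients of the value of a polynomial. -/
def truncCoeffs (a : ℕ → PowerSeries ℤ) (N : ℕ) : BinaryForms.Pol ν →ₗ[ℂ] ℕ → ℂ :=
  LinearMap.pi fun j => if j < N then LinearMap.proj j ∘ₗ coeffs a else 0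

lemma truncCoeffs_apply (a : ℕ → PowerSeries ℤ) (N : ℕ) (f : BinaryForms.Pol ν) (j : ℕ) :
    truncCoeffs a N f j = if j < N then coeffs a f j else 0 := by
  rw [truncCoeffs, LinearMap.pi_apply]
  split_ifs <;> rfl

lemma start_rel {h H w L N : ℕ} {a : ℕ → PowerSeries ℤ} (hH : h ≤ H) (hN : N ≤ L) {f : BinaryForms.Pol ν} {x : ℕ × ℕ}
    (hx : EvRel a (Approx (2 * h) L) f x) (hok : ok h x = true) :
    RowRel (2 ^ w) H N (truncCoeffs a N f) (start h w H N x) := by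
  obtain ⟨z, hz, p, q, h1, h2, h3, h4⟩ := hx
  have hok : x.2 < h := Nat.le_of_ble_eq_true hok
  have hp : ∀ j, |p.coeff j| < h := fun j => by
    refine (h3 j).trans_lt (Nat.cast_lt.2 (lt_of_le_of_lt ?_ hok))
    rw [← h4, Polynomial.eval_eq_sum, Polynomial.sum]
    simp only [one_pow, mul_one]
    by_cases hj : j ∈ q.support
    · exact Finset.single_le_sum (f := q.coeff) (fun _ _ => Nat.zero_le _) hj
    · rw [Polynomial.notMem_support_iff.1 hj]; exact Nat.zero_le _
  intro _
  refine ⟨fun j => if j < N then p.coeff j else 0, ⟨fun j => ?_, fun j hj => if_neg (by omega), ?_⟩, 1, one_ne_zero, fun j => ?_⟩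
  · have := (hp j).le
    split_ifs
    · exact this.trans (by exact_mod_cast hH)
    · simp
  · rw [start, pair_eq, untag_tag, digits_eq hH hN hp h2]
    exact Finset.sum_congr rfl fun j hj => by rw [if_pos (Finset.mem_range.1 hj)]
  · rw [truncCoeffs_apply, one_mul, coeffs_eq hz]
    by_cases hj : j < N
    · simp only [if_pos hj, h1 j (by omega)]
    · simp only [if_neg hj, Int.cast_zero]

lemma genTests_sound {L A n code : ℕ} (hd : ∀ s ∈ covs n code, s.deg ≠ 0) {l : List (ℕ × ℕ × ℕ × ℕ)}
    (hl : ∀ x ∈ l, 0 < x.2.1 ∧ x.2.1 ≤ L) (h : genTests L A n code l = true) :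
    ∀ x ∈ l, keyDeg x.2.2.1 ≠ 0 → Good S (covs n code) (keyDeg x.2.2.1) (keyOrd x.2.2.1) := by
  intro x hx h0
  have h : Elim.allRec (fun x => Prog.genTest (ops (2 ^ (256 * L)))
    (rowop (2 * (x.1 + 255) + 3) (2 ^ (x.1 + 255)) (rep (2 * (x.1 + 255) + 3) (2 ^ (x.1 + 255)) x.2.1)
      (rep (2 * (x.1 + 255) + 3) (2 * 2 ^ (x.1 + 255) - 1) x.2.1)) (ok (2 ^ 255))
      (start (2 ^ 255) (2 * (x.1 + 255) + 3) (2 ^ (x.1 + 255)) x.2.1) x.2.1 A (BinaryForms.mkRows (2 ^ 32) A)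
      (BinaryForms.mkRows 1 A) (heads (ops (2 ^ (256 * L))) (seed (2 ^ 256) 8) n code) (keyDeg x.2.2.1) (keyOrd x.2.2.1)
      x.2.2.2) l = true := h
  rw [Elim.allRec_eq, List.all_eq_true] at h
  have h := h x hx
  obtain ⟨h1, h2⟩ := hl x hx
  rw [pow_mul] at h
  exact genTest_sound (ops_sound (by positivity) L) one_mem (rowop_sound rfl rfl h1)
    (truncCoeffs (seedSeries (2 ^ 256) 8) x.2.1)
    (fun f s hs hok => start_rel (Nat.pow_le_pow_right (by norm_num) (by omega)) h2
      (by rwa [show 2 * 2 ^ 255 = 2 ^ 256 by rw [← pow_succ']]) hok)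
    (fun D => BinaryForms.dimTest_sound)
    (rel_heads (ops_sound (by positivity) L) (evRel_coord fun m => seed_approx (2 ^ 256) 8 L m) n code) hd h0 h

end Kron

namespace Elim

variable {M : Type} [AddCommGroup M] [Module ℂ M]

lemma exists_comb_filter {α : Type} (p : α → Bool) (v : α → M) (l : List α) (c : ℕ → ℂ)
    (hc : ∀ i (h : i < l.length), p l[i] ≠ true → c i = 0) :
    ∃ c', comb ((l.filter p).map v) c' = comb (l.map v) c ∧
      ((∀ i < (l.filter p).length, c' i = 0) → ∀ i < l.length, c i = 0) := by
  induction l generalizing c with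
  | nil => exact ⟨c, rfl, fun _ i hi => absurd hi (Nat.not_lt_zero i)⟩
  | cons x l ih =>
    obtain ⟨c', h1, h2⟩ := ih (fun i => c (i + 1)) fun i h hp => hc (i + 1) (Nat.succ_lt_succ h) hp
    by_cases hx : p x = true
    · refine ⟨fun i => Nat.casesOn i (c 0) c', ?_, fun h i hi => ?_⟩
      · rw [List.filter_cons_of_pos hx, List.map_cons, List.map_cons, comb, comb, ← h1]
        rfl
      · rw [List.filter_cons_of_pos hx] at h
        rcases i with _ | i
        · exact h 0 (Nat.succ_pos _)
        · exact h2 (fun j hj => h (j + 1) (Nat.succ_lt_succ hj)) i (Nat.lt_of_succ_lt_succ hi)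
    · have h0 : c 0 = 0 := hc 0 (Nat.succ_pos _) hx
      refine ⟨c', ?_, fun h i hi => ?_⟩
      · rw [List.filter_cons_of_neg hx, List.map_cons, comb, h0, zero_smul, zero_add, h1]
      · rw [List.filter_cons_of_neg hx] at h
        rcases i with _ | i
        · exact h0
        · exact h2 h i (Nat.lt_of_succ_lt_succ hi)

end Elim

namespace Prog

open BinaryForms

/-- A list of highest weight vectors that is a basis modulo decomposables yields a minimal basis. -/
theorem exists_basis {G : List (Entry (Pol ν))} (h0 : ∀ s ∈ G, s.deg ≠ 0) (hmem : ∀ s ∈ G, s.val ∈ S.A s.deg s.ord)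
    (hsp : Spanned S G) (hind : ∀ d ≠ 0, ∀ k : ℕ, ∀ c, Elim.comb ((filt (has d k) G).map Entry.val) c ∈ S.Q d k →
      ∀ i < (filt (has d k) G).length, c i = 0) :
    (∃ B : Fin G.length → ↥(Covariants ν), IsMinimalBasis ν B) ∧
      Module.finrank ℂ ↥((Cplus ν).map (CplusSq ν).mkQ) = G.length := by
  refine exists_isMinimalBasis even_ν (fun x => G[x].val) (fun x => G[x].deg) (fun x => G[x].ord)
    (fun x => h0 _ (List.getElem_mem x.2)) (fun x => hmem _ (List.getElem_mem x.2)) (fun d hd k => ?_) fun d hd k c hc hQ => ?_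
  · refine (hsp d hd k).trans (sup_le_sup_left (Submodule.span_mono ?_) _)
    rintro _ ⟨s, hs, rfl, rfl, rfl⟩
    obtain ⟨i, hi, rfl⟩ := List.mem_iff_getElem.1 hs
    exact ⟨⟨i, hi⟩, ⟨rfl, rfl⟩, rfl⟩
  · obtain ⟨c', h1, h2⟩ := Elim.exists_comb_filter (has d k) Entry.val G (fun i => if h : i < G.length then c ⟨i, h⟩ else 0)
      fun i hi hp => by rw [dif_pos hi]; exact hc _ fun h => hp ((has_iff d k _).2 h)
    rw [← filt_eq] at h1 h2
    have h3 := hind d hd k c' ?_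
    · funext x
      have := h2 h3 x x.2
      rwa [dif_pos x.2] at this
    · rw [h1, Elim.comb_eq_sum]
      convert hQ using 1
      refine Fintype.sum_equiv (finCongr (List.length_map _)) _ _ fun x => ?_
      have hx : (x : ℕ) < G.length := x.2.trans_eq (List.length_map _)
      rw [dif_pos hx]
      simp
      rfl

/-- The test that a list of keys contains the key of a given degree and order. -/
def hit (l : List ℕ) (d : ℕ × ℕ × ℕ) (k : ℕ) : Bool :=
  (Nat.blt d.1 32 && (Nat.blt d.2.1 16 && (Nat.blt d.2.2 16 && Nat.blt k 32))) &&
    (fun c => List.rec (motive := fun _ => Bool) false (fun x _ ih => Nat.beq c x || ih) l)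
      (d.1 + 32 * d.2.1 + 512 * d.2.2 + 8192 * k)

lemma exists_of_hit {l : List ℕ} {d : ℕ × ℕ × ℕ} {k : ℕ} (h : hit l d k = true) : ∃ x ∈ l, keyDeg x = d ∧ keyOrd x = k := by
  obtain ⟨a, b, c⟩ := d
  simp only [hit, Bool.and_eq_true, Nat.blt_eq] at h
  obtain ⟨⟨h1, h2, h3, h4⟩, h5⟩ := h
  refine ⟨a + 32 * b + 512 * c + 8192 * k, ?_, ?_, ?_⟩
  · induction l with
    | nil => cases h5
    | cons x l ih =>
      rcases (Bool.or_eq_true _ _ ▸ h5 : _ ∨ _) with h | h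
      · rw [Nat.eq_of_beq_eq_true h]
        exact List.mem_cons_self
      · exact List.mem_cons_of_mem _ (ih h)
  · simp only [keyDeg, Prod.mk.injEq]
    omega
  · simp only [keyOrd]
    omega

/-- The degrees that can occur in a critical product of two vectors of orders `p` and `q` and the form `i`. -/
def candidates (l : List ℕ) (i : Fin 3) (p q r : ℕ) : List (ℕ × ℕ × ℕ) :=
  if r ≤ p + 2 then
    ((l.filter fun x => Nat.beq (keyOrd x) (ν i - p)).map fun x => subDeg (keyDeg x) (unit3 i)).filter fun d =>
      decide (∀ a < p + 1, r ≤ a + 2 → hit l (d + unit3 i) (p + ν i - 2 * a) = true) && (hit l d p || Nat.blt (q + 2) r)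
  else (l.filter fun x => Nat.beq (keyOrd x) p).map keyDeg

lemma mem_candidates {l : List ℕ} {i : Fin 3} {p q r : ℕ} {d : ℕ × ℕ × ℕ} (hp : p < r) (hr : r ≤ ν i)
    (h1 : ∀ a, a ≤ p → a ≤ r → r ≤ a + 2 → hit l (d + unit3 i) (p + ν i - 2 * a) = true)
    (h2 : r ≤ q + 2 → hit l d p = true) (hpq : r ≤ p + 2 ∨ r ≤ q + 2) : d ∈ candidates l i p q r := by
  rw [candidates]
  split_ifs with h
  · rw [List.mem_filter, List.mem_map, Bool.and_eq_true, decide_eq_true_eq, Bool.or_eq_true, Nat.blt_eq]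
    refine ⟨?_, fun a ha ha' => h1 a (by omega) (by omega) ha', ?_⟩
    · obtain ⟨x, hx, hx1, hx2⟩ := exists_of_hit (h1 p le_rfl hp.le h)
      refine ⟨x, List.mem_filter.2 ⟨hx, by rw [Nat.beq_eq]; omega⟩, ?_⟩
      rw [hx1]
      simp [subDeg]
    · rcases Nat.lt_or_ge (q + 2) r with h3 | h3
      · exact .inr h3
      · exact .inl (h2 h3)
  · obtain ⟨x, hx, hx1, hx2⟩ := exists_of_hit (h2 (hpq.resolve_left h))
    exact List.mem_map.2 ⟨x, List.mem_filter.2 ⟨hx, by rwa [Nat.beq_eq]⟩, hx1⟩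

/-- Finite tables of keys that control all degrees and orders. -/
structure Complete (l z : List ℕ) : Prop where
  unit : ∀ i : Fin 3, hit l (unit3 i) (ν i) = true
  mul : ∀ x ∈ l, ∀ i : Fin 3, selIx (keyDeg x + unit3 i) = i → ∀ r < 6, r + 1 ≤ ν i → r + 1 ≤ keyOrd x →
    (hit l (keyDeg x + unit3 i) (keyOrd x + ν i - 2 * (r + 1)) || hit z (keyDeg x + unit3 i) (keyOrd x + ν i - 2 * (r + 1))) = true
  critical : ∀ i : Fin 3, ∀ p ∈ [2, 4], ∀ q ∈ [2, 4], ∀ r ∈ [3, 4, 5, 6], r ≤ ν i → p < r → q < r → r ≤ p + q →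
    ∀ d₁ ∈ candidates l i p q r, ∀ d₂ ∈ candidates l i q p r, selIx (d₁ + d₂ + unit3 i) = i →
    (hit l (d₁ + d₂ + unit3 i) (p + q + ν i - 2 * r) || hit z (d₁ + d₂ + unit3 i) (p + q + ν i - 2 * r)) = true

lemma Complete.red {l z : List ℕ} (h : Complete l z) (hz : ∀ x ∈ z, S.Red (keyDeg x) (keyOrd x)) {d : ℕ × ℕ × ℕ} (hd : d ≠ 0)
    {k : ℕ} (hk : hit l d k ≠ true) : S.Red d k := by
  have hor : ∀ {d k}, (hit l d k || hit z d k) = true → hit l d k = true ∨ S.Red d k := by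
    intro d k h
    refine ((Bool.or_eq_true _ _).mp h).imp_right fun h => ?_
    obtain ⟨x, hx, rfl, rfl⟩ := exists_of_hit h
    exact hz x hx
  refine SlAlg.red_of_not_mem S (fun d k => hit l d k = true) (fun d => (unit3 (selIx d), ν (selIx d))) exists_sel
    ?_ ?_ ?_ d hd k hk
  · intro d hd
    have := h.unit (selIx d)
    dsimp only at hd
    rwa [hd] at this
  · intro d' d r p e hK h1 h2 h3
    obtain ⟨x, hx, rfl, rfl⟩ := exists_of_hit hK
    dsimp only at e h2 ⊢
    have h6 : ν (selIx d) ≤ 6 := by generalize selIx d = i; fin_cases i <;> decide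
    have := hor (h.mul x hx (selIx d) (by rw [e]) (r - 1) (by omega) (by omega) (by omega))
    rwa [e, Nat.sub_add_cancel h1] at this
  · intro d₁ d₂ d r p q e h3 hr hp hq hpq ep eq H1 H2
    dsimp only at e hr H1 H2 ⊢
    have h6 : ν (selIx d) ≤ 6 := by generalize selIx d = i; fin_cases i <;> decide
    have hp' : p = 2 ∨ p = 4 := by
      obtain ⟨a, rfl⟩ := ep
      omega
    have hq' : q = 2 ∨ q = 4 := by
      obtain ⟨a, rfl⟩ := eq
      omega
    have := hor (h.critical (selIx d) p (by simpa using hp') q (by simpa using hq') r (by simp; omega) hr hp hq hpq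
      d₁ (mem_candidates hp hr (fun a h4 h5 h6 => (H1 a (r - a) (by omega) h4 (by omega) (by omega)).1)
        (fun h4 => (H2 q (r - q) (by omega) le_rfl (by omega) (by omega)).2) (by omega))
      d₂ (mem_candidates hq hr (fun a h4 h5 h6 => (H2 a (r - a) (by omega) h4 (by omega) (by omega)).1)
        (fun h4 => (H1 p (r - p) (by omega) le_rfl (by omega) (by omega)).2) (by omega)) (by rw [e]))
    rwa [e] at this

/-- The arithmetic of a point. -/
def unitOps : Ops Unit where
  zero := ()
  one := ()
  add _ _ := ()
  sub _ _ := ()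
  mul _ _ := ()
  smul _ _ := ()
  cons s l := s :: l

/-- The test that the keys of the covariants computed by a program belong to a list. -/
def keysTest (l : List ℕ) (n code : ℕ) : Bool :=
  Elim.allRec (fun s => hit l s.deg s.ord) (heads unitOps (fun _ => ()) n code)

lemma covs_spec (n code : ℕ) {l : List ℕ} (h : keysTest l n code = true) :
    ∀ s ∈ covs n code, s.val ∈ S.A s.deg s.ord ∧ hit l s.deg s.ord = true := by
  have hop : unitOps.Sound (R := Pol ν) fun _ _ => True :=
    ⟨trivial, trivial, fun _ _ => trivial, fun _ _ => trivial, fun _ _ => trivial, fun _ _ => trivial, fun _ _ => rfl⟩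
  rw [keysTest, Elim.allRec_eq, List.all_eq_true] at h
  intro s hs
  obtain ⟨t, ht, hst⟩ : ∃ t ∈ heads unitOps (fun _ => ()) n code, s.Rel S (fun _ _ => True) t := by
    have := rel_heads hop (f := fun _ => ()) (fun _ _ _ => trivial) n code
    clear h
    generalize heads unitOps (fun _ => ()) n code = L' at this ⊢
    generalize covs n code = L at this hs
    induction this with
    | nil => cases hs
    | cons hst _ ih =>
      rcases List.mem_cons.1 hs with rfl | hs
      · exact ⟨_, List.mem_cons_self, hst⟩
      · obtain ⟨t, ht, hst⟩ := ih hs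
        exact ⟨t, List.mem_cons_of_mem _ ht, hst⟩
  have e : hit l t.deg t.ord = true := h t ht
  rw [hst.deg, hst.ord] at e
  exact ⟨hst.mem, e⟩

lemma length_covs (n code : ℕ) : (covs n code).length = n + 3 := length_run _ _ _ _ _

theorem exists_basis_of_tables {l z : List ℕ} (hl : ∀ x ∈ l, keyDeg x ≠ 0) (h : Complete l z) {n code : ℕ}
    (hkeys : keysTest l n code = true) (hz : ∀ x ∈ z, S.Red (keyDeg x) (keyOrd x))
    (hgood : (∀ s ∈ covs n code, s.deg ≠ 0) → ∀ x ∈ l, Good S (covs n code) (keyDeg x) (keyOrd x)) :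
    (∃ B : Fin (n + 3) → ↥(Covariants ν), IsMinimalBasis ν B) ∧
      Module.finrank ℂ ↥((Cplus ν).map (CplusSq ν).mkQ) = n + 3 := by
  have hspec := covs_spec n code hkeys
  have h0 : ∀ s ∈ covs n code, s.deg ≠ 0 := by
    intro s hs
    obtain ⟨x, hx, e, -⟩ := exists_of_hit (hspec s hs).2
    rw [← e]
    exact hl x hx
  have hgood := hgood h0
  have hsp : Spanned S (covs n code) := by
    intro d hd k
    by_cases hk : hit l d k = true
    · obtain ⟨x, hx, rfl, rfl⟩ := exists_of_hit hk
      exact (hgood x hx).span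
    · exact le_sup_of_le_left (h.red hz hd hk)
  rw [← length_covs n code]
  refine exists_basis h0 (fun s hs => (hspec s hs).1) hsp fun d hd k c hc i hi => ?_
  have hi' : (filt (has d k) (covs n code))[i] ∈ filt (has d k) (covs n code) := List.getElem_mem hi
  generalize (filt (has d k) (covs n code))[i] = s at hi'
  rw [filt_eq, List.mem_filter, has_iff] at hi'
  obtain ⟨hs, e1, e2⟩ := hi'
  have hk := (hspec _ hs).2
  rw [e1, e2] at hk
  obtain ⟨x, hx, rfl, rfl⟩ := exists_of_hit hk
  exact (hgood x hx).indep hsp c hc i hi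

end Prog

namespace Prog

open BinaryForms

/-- The program whose covariants form a minimal basis. -/
def slp : ℕ := 0x8d8352371ac9886a25f1b063a6828e1a8980bb2632e8632b928c2e4a2ebc28b308a2ace28a370a26ef1d5974a231128bc406370f191438a450d295c30a2f1228f444a5115293c70a651b1ae41873ca51b1c10ac5032b3408abf082afc1c6bd0b2ae428ac3091adc40ab30f2acc3caaf172abc58aab162aac54ae3012ac464aa51d2a8c74aa12f2aa4c8a9d372b54c0add182becb8708eb1a4d00712e92c0bb8718e71bfbc8afcf11bebd86f8f61bdbd86813f29fcf8a7d3e2bbbf4a833b2a04ec700e71b9bfca8d372a24dca89361a6cd4a9b342a04e0a81372a74c4a8f352a3cd06d1111a7cb4a9d2c29cce4a992f2a0cd8a833529f4d4a7d3429f4cca7b3c2a94a0a7f3929f4e46cd032a0cb4a813629fcd8a8d3429ece0a99322a44d86dafb29fce4a81382a3d1069d0b2a6c286e8b31a5c40695102a4c3c6a9051a3c446990c1a642c689171a1c5ca85152a0c54699051a5c1467d1b19ec6ca791a29dc686751c29cc70692fe1a4bf467b0919e4246691b199c6ca88f8298c60a611819b43465d1b29a42ca5919295c64a5519294c6466905199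c1464d1b292c68a491a197c14a451a199bd464f08298bcca4b06197bec65104296be4a4308290420a3f08297bd4a450628e428a370a289c3865af018ec18a2f081953c4a350618f3d463cf428e3cca36f928d3e4a34f828c3f4a30fc28b3f4a2cfc287bf863af728c3e4a24fb28d3e86606517ebf09f8fc18f3045fefa17fbe49fcf817f3dc9faf617fbd46485b17fbcc9fcf217c3dc9eef618bad062cb417f3b45fcec27ebac9e2f117f3a45e8ed179bb462c5317e3945e0eb27db8c9dce9176bac6205317d37c9d4ea17738c5dce2181ab8604ae1753805d4df27faac9cedd273b7060499180a645f4af17cabc5ded01733585beda16fb649c6d3271b489b6d626db545c6ce16e34c5c2cd16e3449becb26d33c9b4ce16e32c5e04c16d32c9b2ca172a905c8a4166b30998cb265b2c5c0a516b2f859ac716631c996c5265b10992c4264b0c5b0a51672ec592bf1642fc98ebe261308984c11622f8586bf2612f8982be16a93897ebf1612d0582b42602c897eb725f2dc57ab925e2e0978b725dae85789a15e2649769816497457c9515da545769415b26896a9915ca4497090158a6c5708e15826495e98159a40564901582405569915526495a8d25425894e96155a2895489154a2c54c8c15322c54295250250558411559045507a150a1494c7824fa0c5309114fa0452e8f24b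2385328314c20c92e8124b20452c7f14a9fc9287d2499f45287c1489f851e7f14521891a7d14a8e0528381489a8514792479a0910771429e850a791468e85183a14499c50475243994900731409c89007114019c8fe651418e85006313f98c4f06f23e9808ec6d13b9b04f83913c9888f0612389a44f03d13a9888e8611399904ce6613a90c8e8424321904cc631339844e0452379104da3c1319788d63a2309708d0351338d84d0422339044c8342318cc4c84313190c4b05622b9544be3512a9508ba332299490a2512289444ac4a12c8f84ac2c12b0c44a44712692c8a0452259244a0272278984a0392278e04982822589c4962b122104892292210fd0823d1218ec48a2b1208e8880391208884802211e8dc87c1f21d8d447a2711c8d48703411c8808701f11b88886c211198c0468232188c4468241198908642341888845e2011789045a1f11688c8561d215884c521b41406844c1821285c448172118584481d1110608421711005cc3e1520f0544381210e8648381810c8408300f10b83c82c0e10a83c8280e10a0390260d10903c8220e10783481c0c20783d01c0e6068344180b205828c14094048204100620381480a054020104060220100480000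

/-- Keys without relations, of dimension at most `11`. -/
def freeKeys11 : List (ℕ × ℕ) :=
  [(1024, 0), (16928, 0), (33312, 0), (64, 0), (32832, 0), (33281, 0), (49665, 0), (16417, 0), (32801, 0), (49185, 0), (65569, 0), (2, 0),
   (32770, 0), (65538, 0), (1056, 0), (17440, 0), (33344, 0), (96, 0), (49248, 0), (17409, 0), (33793, 0), (545, 0), (33282, 0),
   (66050, 0), (34, 0), (16418, 0), (16387, 0), (65539, 0), (98307, 0), (17472, 0), (1537, 0), (17921, 0), (1057, 0), (97, 0), (17410, 0),
   (546, 0), (515, 0), (16899, 0), (49156, 0), (81924, 0), (67, 0), (32773, 0), (1632, 0), (37, 0), (2051, 0), (1540, 0), (1029, 0),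
   (16392, 0), (520, 0), (15, 0), (49153, 0), (32800, 0), (16896, 0), (16960, 0), (16929, 0), (16449, 0), (32833, 0), (65601, 0),
   (16898, 0), (49666, 0), (49186, 0), (81954, 0), (49155, 0), (1088, 0), (33376, 0), (577, 0), (1026, 0), (50178, 0), (16450, 0), (4, 0),
   (32772, 0), (17504, 0), (1569, 0), (1089, 0), (578, 0), (36, 0), (16389, 0), (65541, 0), (2081, 0), (18434, 0), (517, 0), (32775, 0),
   (39, 0), (3075, 0), (2564, 0), (1031, 0), (16394, 0), (522, 0), (33313, 0), (49697, 0), (49217, 0), (32802, 0), (65570, 0), (16481, 0),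
   (32865, 0), (66, 0), (33283, 0), (49667, 0), (16419, 0), (609, 0), (34306, 0), (547, 0), (33284, 0), (16420, 0), (2050, 0), (1570, 0),
   (1539, 0), (17412, 0), (548, 0), (16901, 0), (6, 0), (49158, 0), (69, 0), (2053, 0), (1542, 0), (17441, 0), (16961, 0), (33794, 0),
   (32803, 0), (16513, 0), (17922, 0), (1058, 0), (98, 0), (17411, 0), (33795, 0), (16900, 0), (1121, 0), (641, 0), (17923, 0), (1059, 0),
   (99, 0), (1028, 0), (2113, 0), (131, 0), (38, 0), (16391, 0), (519, 0), (32777, 0), (41, 0), (1033, 0), (16396, 0), (524, 0),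
   (33825, 0), (16930, 0), (49218, 0), (49187, 0), (65571, 0), (17953, 0), (32897, 0), (16482, 0), (1601, 0), (610, 0), (1153, 0),
   (2594, 0), (33314, 0), (130, 0), (16903, 0), (10, 0), (33345, 0), (32834, 0), (16993, 0), (17442, 0), (16931, 0), (49188, 0),
   (16514, 0), (68, 0), (16421, 0), (2082, 0), (1602, 0), (642, 0), (162, 0), (549, 0), (33286, 0), (16422, 0), (17414, 0), (550, 0),
   (71, 0), (40, 0), (43, 0), (49698, 0), (16451, 0), (32804, 0), (579, 0), (16452, 0), (1571, 0), (580, 0), (163, 0), (17473, 0),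
   (32835, 0), (17025, 0), (32805, 0), (2083, 0), (1090, 0), (1091, 0), (1060, 0), (1572, 0), (1061, 0), (101, 0), (16905, 0), (32866, 0)]

lemma genTests_freeKeys11 : genTests (Lanes.ops 11) (Lanes.rowop 11) (fun _ => true) (fun s => s) (Lanes.seed 11) 11 15 491 slp freeKeys11 = true := by
  decide +kernel

/-- Keys without relations, of dimension at most `36`. -/
def freeKeys36 : List (ℕ × ℕ) :=
  [(16546, 0), (100, 0), (674, 0), (195, 0), (42, 0), (45, 0), (16962, 0), (33315, 0), (17954, 0), (16932, 0), (70, 0), (16423, 0),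
   (551, 0), (16424, 0), (552, 0), (73, 0), (33346, 0), (16483, 0), (611, 0), (17443, 0), (1122, 0), (133, 0), (17474, 0), (16933, 0),
   (16963, 0), (32867, 0), (132, 0), (16484, 0), (16453, 0), (612, 0), (581, 0), (16454, 0), (582, 0), (16994, 0), (32836, 0), (103, 0),
   (1123, 0), (72, 0), (16515, 0), (643, 0), (102, 0), (1092, 0), (16964, 0), (16995, 0)]

lemma genTests_freeKeys36 : genTests (Lanes.ops 36) (Lanes.rowop 36) (fun _ => true) (fun s => s) (Lanes.seed 36) 36 13 491 slp freeKeys36 = true := by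
  decide +kernel

/-- Keys with relations, of dimension at most `33`: bit size, dimension, key, dependent products. -/
def relKeys33 : List (ℕ × ℕ × ℕ × ℕ) :=
  [(0, 3, 82435, 0x4), (0, 5, 66052, 0x4), (0, 6, 66563, 0x70), (0, 7, 49729, 0x20), (0, 7, 66082, 0xa0), (0, 7, 49669, 0x20),
   (0, 7, 18947, 0x20), (0, 8, 50180, 0x380), (0, 8, 18436, 0x20), (0, 9, 50691, 0x3c0), (0, 9, 34819, 0x2c0), (0, 10, 34308, 0x700),
   (0, 10, 33797, 0x300), (0, 10, 17925, 0x100), (0, 11, 33857, 0x1a00), (0, 11, 17985, 0x400), (0, 13, 33826, 0x400),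
   (0, 13, 50210, 0x36600), (0, 14, 49699, 0x3020), (0, 14, 18466, 0x1100), (0, 17, 34338, 0x2dc000), (82, 18, 33316, 0x800),
   (268, 18, 32807, 0x1000), (424, 20, 1063, 0x20000), (94, 21, 33827, 0x3b0200), (155, 21, 17955, 0x88800), (199, 21, 17444, 0x800),
   (678, 22, 16426, 0x20000), (716, 22, 554, 0x8000), (836, 22, 75, 0x8000), (326, 24, 32837, 0x200000), (540, 27, 1093, 0x4000000),
   (720, 28, 165, 0x18000000), (632, 32, 16516, 0x80000000), (690, 32, 644, 0x40000000), (827, 33, 16935, 0x50020000)]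

lemma genTests_relKeys33 : Kron.genTests 33 11 491 slp relKeys33 = true := by
  decide +kernel

/-- Keys with relations, of dimension at most `46`: bit size, dimension, key, dependent products. -/
def relKeys46 : List (ℕ × ℕ × ℕ × ℕ) :=
  [(1174, 35, 135, 0x7c00000000), (1167, 37, 16456, 0x8b00000000), (1246, 37, 584, 0xd800000000), (1490, 38, 105, 0x6a00000000),
   (1011, 46, 16965, 0x1c02000000000), (1273, 46, 16486, 0x7380000000000), (1386, 46, 614, 0x63c0000000000)]

lemma genTests_relKeys46 : Kron.genTests 46 9 491 slp relKeys46 = true := by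
  decide +kernel

/-- Reducible keys of dimension at most `10`, with codes of spanning products. -/
def redKeys10 : List (ℕ × ℕ) :=
  [(17408, 0),
   (1568, 0),
   (16448, 0),
   (49216, 0),
   (1600, 0),
   (16480, 0),
   (16512, 0),
   (49280, 0),
   (2049, 0),
   (65, 0),
   (129, 0),
   (16386, 0),
   (49154, 0),
   (81922, 0),
   (1538, 0),
   (2562, 0),
   (32771, 0),
   (1027, 0),
   (16388, 0),
   (5, 0),
   (16390, 0),
   (7, 0),
   (11, 0),
   (13, 0),
   (32864, 0x3e71ec),
   (81923, 0x3de1ed),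
   (114692, 0x3b91ed),
   (161, 0x3a41e7),
   (17, 0x2001df),
   (33824, 0x3e91eb5ea1ec),
   (50177, 0x3e51eb5ea1ed),
   (81985, 0x3e11ec5e61ed),
   (17952, 0x3e91ea5dc1eb),
   (32896, 0x3e61e75d81ec),
   (65664, 0x3e61e67e71ec1ec),
   (34305, 0x3e51ea5d61eb),
   (131076, 0x3dd1dd7de1ed1ed),
   (18433, 0x3d61ea5b41eb),
   (19, 0x3df1df379000),
   (66081, 0x3e11eb5e51ec5e91ed),
   (49760, 0x3e61e95da5e71eb1ec),
   (98819, 0x3dd1e55c55de1eb1ed),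
   (65540, 0x3dd1df5bb1ed5de1de),
   (98308, 0x3dd1de5ba5df1ed1ed),
   (98309, 0x3b91de5b81df5771ed),
   (81926, 0x3771de5761df5211ed),
   (33856, 0x3e61ea5da1eb5dc1ec5e91e9),
   (65633, 0x3e21e65e01e75ca3cb1ec),
   (82017, 0x3e11e65c95e71ed5e31ec1ec),
   (66562, 0x3dd1ea5c51eb5d61ed5e51e5),
   (66051, 0x3de1e55ba1eb5c75df1eb1ed),
   (98339, 0x3dd1e25b91ec5be3bf1ed),
   (114723, 0x3dd1e15bd5de1ec5e31ed1ed),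
   (17984, 0x3dc1e95da1ea5b75e71ea1eb),
   (49157, 0x3bb1de5791ed5ba5ed1df1df),
   (81925, 0x3bb1dd5ba1de5785df1de1ed),
   (114693, 0x3ba1dd7df1dd5de1de5bb1ed1ed),
   (32774, 0x3bb1bb5791de5785de1df1df),
   (8, 0x3791794be5795df1df1df1df),
   (49249, 0x3e31e65e11e75d81ed5cc3cd1ec),
   (81986, 0x3e11e25be3bf1ec5ca3cb1ed),
   (33888, 0x3dc1e65da5eb1e71e95b75ea1e71ec),
   (18016, 0x3da1dc7e71ea3b71e97dc1e75d81ea1eb),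
   (16545, 0x3cc3cd1d85a23a35e31e71e7),
   (65543, 0x3771bb5211de5791b95205b91df1df),
   (49160, 0x3211bb5791774bc2bd5771df1df),
   (50209, 0x3e51e95e11ea5d61ec5dc1ed5d03d11eb),
   (98370, 0x3dd1e65e11e15c91ed5bd5e31ed5de1ec1ec),
   (81955, 0x3de1e15dd1e35ba1ec5c03c15df1ec1ed),
   (50690, 0x3d61e55b41ed5c51ea59d5de1ea5c71eb1eb),
   (49668, 0x3bb1e55871ed5c71de5c51df5785de1df1eb),
   (32929, 0x3a41e65ca3cb1d85a03a15e21e71e7),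
   (65542, 0x3ba1bb5781de7df1df3791dd7bb1df3221ed),
   (18946, 0x3b41d65161eb56459f1eb5c75df1eb1ea1ea),
   (16393, 0x3221794be1bb46d5791bb5225bb1df1df1df),
   (16398, 0x20f1794be03640457903640f4361df1df1df),
   (66113, 0x3e51e65e11e95da1ed5c91eb5d03d15e31eb1ec),
   (82466, 0x3e11e55dd1e95bd1eb5c55de1eb1ec5d03d11ed),
   (49281, 0x3d81e15cc3cd1e65c91e75a23a35e31e71ec),
   (50179, 0x3d61de5c71e55ba1ea5855df1e51eb59f5df1ea1ed),
   (82947, 0x3d61dd5c61e45c51e559d1ed7de1e55c71ed5ba1eb1eb),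
   (82436, 0x3c51de5ba1e57df1eb3c71dd7df1e55bb1eb3851ed),
   (18465, 0x3d61dc5b41e95741eb5b03b15d41eb5e31ea1ea),
   (34818, 0x3b41e55d61d659d1ea5645c71ea59f5df1ea1eb1eb),
   (33285, 0x3871de5c71bb5791e55221eb5855bb1eb5e51df1df),
   (98310, 0x3ba1ba7de1df3781dd7bb1de5ba1df7df1df3791ed1ed),
   (49159, 0x3781bb5221de7df1df3791ba9df1df3791df2be1ed),
   (32776, 0x3781795221bb4be1de7bb1bb5791de5785de1df1df1df),
   (32779, 0x2361bb46c1794be12141b57912146c5211df1df1df),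
   (65602, 0x3e11e35de1e65dd1e75e21e25c03c11ec5cc3cd1ed),
   (34337, 0x3d61e95b41ec5d03d11ea5b03b15e31ea5d41eb1eb),
   (34307, 0x3b41de5c71d659f1e55855df1e51ea5475d61df5871eb1eb),
   (18435, 0x3c71b459f1d64fc5b41df1eb5475d61df5871eb5bb1ea1ea),
   (81927, 0x3781ba5221dd7781df1ed7dd1df5ed1bb1bb7ba1df5791ed5bb1de1de),
   (12, 0x2be0be7791791794104be1797791794be5795df1df1df1df1df1df),
   (81956, 0x3be1de5b91e35771ec5bc1df5ba1e257d37e37f5df1e21ed),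
   (49313, 0x3a23a31e65c91d85665e31d81ec7ed1d85cc3cd1ec5e11e71e7),
   (17413, 0x3c718759f1bb5791d65221ea4c81eb5475bb1ea5871eb5d61df1df),
   (49162, 0x32112246c1bb4361de4be1774bc2bd1796bc2bd5771df1df1df),
   (65572, 0x3c31dd5bb1e15781ec5c03c11de5bd1df5ba1e35803815df1e31ed),
   (98340, 0x3bd1de5b91e25ba1e15c03c15df1ec1dd57c5df1e15bb1ec5c31ed1ed),
   (33796, 0x3bb1d659f1de5871e55781ea5c71c759d1df52e5c71df5795df1df1eb1eb),
   (66053, 0x3871dd5781e55c71ba5c51bb5851de52e1ed7bb1de5ba1df5795df1df1ed1eb),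
   (17924, 0x3b41bb59f1c75871d65641df52e5c71df1ea4dc59f1df5795df1df1ea1eb)]

lemma prodTests_redKeys10 : prodTests (Lanes.ops 10) (Lanes.rowop 10) (Lanes.seed 10) 10 19 491 slp redKeys10 = true := by
  decide +kernel

/-- Reducible keys of dimension at most `20`, with codes of spanning products. -/
def redKeys20 : List (ℕ × ℕ) :=
  [(194, 0x3a41a454e34f5df1d81d85003015c31d85903915df1e71e71e7),
   (226, 0x3003015c31d81d84af5903911d854e34f5df1d85c31e71e71e7),
   (14, 0x2104be1791796be0be7791791794104be1797791794be5795df1df1df1df1df1df1df),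
   (33377, 0x3da1e35d81e55d41e65d03d11e75cc3cd1e95a23a31eb5ac3ad1ec),
   (49250, 0x3d71df5c21e65a41ed5cc3cd1e25ca3cb1e35be3bf1e758e38f1ec),
   (67075, 0x3c61d55c51d65b41dd59e1e45641ed59d1e57ba1ea59f1ed5c71e55855df1e51eb1eb),
   (65544, 0x3781785221ba4be1dd7791de1de7791bb26d1ed7781de7df1df3791dd7bb1df3221ed1df),
   (19459, 0x3161d679f1eb3641b47b41c759f1d67b41df2fc1eb7d61df5bb1ea5871eb3471ea1ea),
   (32778, 0x3221224be1787de17917946d5791bb1bb6be1de5781795221bb7bb1bb5785de1df1df1df1df),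
   (32781, 0x32203640f1bb4be06c41b5211791796361bb4be12146c17941b46c5211df1df1df1df),
   (16904, 0x3221874c81bb4be1c752e5eb1791797871bb4be1eb5c717952e5eb1795c75eb1df1df1df1df),
   (49161, 0x3221784be1ba7bb1bb1bb46d1de7791791ed7781bb5221de7df1df3791ba9df1df3791df2be1ed1df),
   (65603, 0x3c21e15b91e75c81df5be3bf1e358e38f1ed5c03c11e257d37e37f5df1e21ec),
   (66564, 0x3c61c65c51c75ba1d659d1de5861e45851e57df1ea39f1dd7c51df5781eb1eb7d61df5871eb3471ed),
   (49189, 0x3781e35ba1c35803811de5791e15221ec52a1ed5c03c11bb57c5c31ed5ec1bb5e11df1df),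
   (49670, 0x3c71785ba1875791c552e1de5221e54c81ed7791de1eb5855eb1bb1bb7871ed5781eb5e51bb5c51df1df),
   (16578, 0x3a23a31a454a34b34c34d1d84fd2fe2ff5e31a45c21d858e38f1e71e7),
   (33287, 0x3781874c81de5791855221c74be1e552e1bb46d5791bb1eb7c71bb5221eb5855bb1eb5e51df1df1df),
   (227, 0x29b29c1d85003015c31d81a44615381d85903911a44e32e42e55df1a41e71e7),
   (16397, 0x26d0be4101bb6be1bb5221791796be12246d5bb1791796be1bb52217946d5bb1795225bb1df1df1df1df1df),
   (16, 0x2100be6be0be7791791791796104be1791796be0be7791791794104be1797791794be5795df1df1df1df1df1df1df1df),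
   (50241, 0x3dc1e15da1e55d61e65d31e85c91ea5b71ed5d03d11e95b03b11ec5a63a75d41ec5cd1eb1eb),
   (65634, 0x3d81dd5ca1e25c91e35bd1e75cc3cd1e15c03c11e65a23a31ed58b38c38d5c31ec1ec),
   (49219, 0x3c31e15c21e25bb1e65ba1e75cc3cd1de5c91df5903911ed5c03c11e35803815df1e31ec),
   (17505, 0x3d61d85b71e35da1d45cc3cd1dc5ac3ad1e95a23a31ea5b03b11e756b36c5d41e71eb),
   (65573, 0x3781e25771e35211ec5ba1c25791e057d37e37f1de5283291ed57a37b5c21ed5e01df1df),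
   (51203, 0x3b31c659e1d55c51b459d1d65161ed5641e579f1ed5ba1ea1ea7de1b459f1e55855df1e51ea5475d61df1eb1eb),
   (35331, 0x39e1b359d1b45641d65161e57c71b459f1d64fc1eb1eb7de1b459f1e55475df1d65871eb1eb5855df1e51ea1ea),
   (66594, 0x3dc1dd5d61e15d51e25d31e45c61e85c51e95bd1ea59d1ec5d03d11e55b03b11ed5935c03c11eb1eb),
   (81987, 0x3c91de5be1e25bd1e35cc3cd1dd5c03c11e15ba1e657c5bb1ec1ec58b38c38d5df1e65c31ec1ed),
   (66083, 0x3d41dd5d01de5c71e15c61e25c51e35ba1e957c1eb5c03c11e55855bb1eb5df1e51ec59839939a5df1e91ed),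
   (33409, 0x3a41e85d01d85cc3cd1da5ac3ad1e65a23a31e95665e31d81eb56b36c1ec5a63a75cd1eb5d41ec1e7),
   (49282, 0x3ca1cc5be1d85a41e15a23a31e25a03a11e358e38f1e658838938a1e754a34b34c34d1ec),
   (18497, 0x3b21db5da1b45b71d65b03b11dc5741e951d5b41e71eb56e36f5d61e75d41e95ac3ad1eb5cc3cd1ea1ea),
   (32806, 0x3781c352a1de5221e35c03c11795803811bb4be1ec5263275c31de5e31bb5791ec5c03c15ec1df1df1df),
   (49190, 0x37d1bb5781c25771c35221e25211e34c41ed5bf3be1795293281de7bb1e25bf3be1df3253243231df),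
   (259, 0x2af1a44615903911a45381d81d843454e34f1a44e32e42e55df1a41d849b29c5c31a45381e71e71e7),
   (44, 0x2710be4101c341e4be1c352a1791794094be12a4715c317917941e4be1c352a1794715c317952a5c31df1df1df1df1df),
   (47, 0x2110be4100c44054be0c44391791794014390be4114c41791794054be0c44391794114c41794394c41df1df1df1df1df),
   (18, 0x2be0be0be6104be1791791796100be6be0be7791791791796104be1791796be0be7791791794104be1797791794be5795df1df1df1df1df1df1df1df1df),
   (81957, 0x3781e15771e27bb1ec37c1de7df1ec3c13c01ba7df1e33813801dd7bb1e35791ec7df1ec3c13c01df3273261ed),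
   (50181, 0x39f1ba59d1bb5871c55861c65851c75781d65471de52e1e57ba1df1ea7851df5795df1df1e55221eb1eb4dc59f1df5795df1df1ea1ed),
   (16610, 0x3661a44fd2fe2ff5e31a45c21d81d84ad2ae5cc3cd1a458e38f1d854a34b34c34d5c21e71e71e7),
   (18948, 0x36419f5471b45161c77b41df2fc1d679f19f5871b45161df1eb79f1c75871d65641df7c71df32e1ea79f1df7df1df3791ea2dc1eb1ea),
   (17415, 0x34717952219f4c81c74be1d64dc1bb46d1ea52e18743c5791871eb79f1bb5221ea5c71874c81eb5475bb1ea5871eb5d61df1df1df),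
   (65546, 0x32112146d1ba6be1de1de7791dd5781de5221ed1797791ba5781bb5221de4be1ed1bb7781785221ba9df1df1df2be1dd9bb1df3221df26d1ed1df),
   (34369, 0x3d31db5d01dc5b71e55b41e65b21e85da1d65741ec5b03b11e95a63a75d41ec1ea56e36f5e71d65d41e95cd1ea5ac1eb1eb),
   (32898, 0x3a41e25a23a31e35903911e65cc1cc5cc3cd1cd5c03c11d854e34f5df1d81ec58b38c38d5c31ec5de1e71e7),
   (50692, 0x3b41ba59e1c659d1c75861d55851d65641de7df1ea39f1c57d61df3471e57b41df5871ea2fc1ed79f1de59d1df5871e55781ea52e1eb1eb),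
   (49163, 0x26d1784101ed7221de4be1ed5ba1791796be1de5221bb1bb7ba0be57812246d1de7ed1791797bb1bb1bb7221de4be1ed5781bb7ed1795ba5ed1df1df1df1df1df),
   (16399, 0x2101226be0be1bb7220be46d5bb17917917966d0be4101bb6be1bb5221791797220be46d5bb1791796be1bb52217946d5bb1795225bb1df1df1df1df1df1df),
   (49220, 0x3c01c25bb1ca5771e75381ed5be3bf1c358e38f1de5283291ec5803811e258838938a1df57d37e37f5e21df1e3),
   (18437, 0x36418754719f52e1b45161bb4fc1c779f1df2dc1d678719f5791b47b41df2fc1df1eb7871c75791d65221ea4c81eb7d61df5bb1ea5871eb3471df1ea),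
   (16906, 0x2c812252e0be46d18743c1bb4101eb7871bb4be1eb5c71791797c70be5221874c81bb52e5eb1791797871bb4be1eb52e5eb1795c75eb1df1df1df1df1df),
   (49730, 0x3da1de5d41e15d21e25c51e75d03d11e35cc3cd1e55c71e65c03c11e95ac3ad1ed59839939a1ec58b38c38d5df1e61eb),
   (17537, 0x3a41db5b71cd5ac3ad1da5a23a31dc5661ea5b03b11d856b36c1e95195d41d81eb56e36f5cd1ea5d41e95ac3ad1eb5d61e71e7),
   (18978, 0x3741d65161e95b03b11b45641dc4b95d41b459f1dc1eb5125d41d659f1e95e31b45c71dc5613625df1dc1eb59839939a5c31eb1ea1ea),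
   (34820, 0x39e19e59d19f5861b35851b45641c75471d65161de4fc5b41df1e57bb1d659d1df5871e55781ea1ea7b41bb59f1c75871d65641df52e1ea4dc7df1df1ea1eb1eb),
   (34309, 0x38719d58619e5781b45641bb5471c752e1d64fc1de7df1ea39f18579f1df7df1df3791ea2dc1e57871c75791d65221ea4c81eb7d61df5871eb3471df1eb),
   (33798, 0x38618658518757919d57819f5471bb52e1c75221d64c81e57791ea2dc1de7871bb5791c74be1eb1eb7bb1d659d1df5871e55781ea9df1eb3c71df32e1eb1df)]

lemma prodTests_redKeys20 : prodTests (Lanes.ops 20) (Lanes.rowop 20) (Lanes.seed 20) 20 18 491 slp redKeys20 = true := by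
  decide +kernel

/-- Reducible keys of dimension at most `38`, with codes of spanning products. -/
def redKeys38 : List (ℕ × ℕ) :=
  [(17926, 0x36417954718752e19f5221b44fc1bb4c81d67791ea2dc1c778718757919f4be1ea1eb7b41bb59f1c75871d652e1ea4dc1eb7c71ea7df1ea39f1eb3641df1df),
   (20, 0x2100106100be6be0be7791791791791798be0be0be6104be1791791796100be6be0be7791791791796104be1791796be0be7791791794104be1797791794be5795df1df1df1df1df1df1df1df1df1df),
   (50722, 0x3d31d55d01d65c61db5c51dc5b41e15b31e25b21e459e1e85741ed5b03b11e559d1e95641ec5931ea55c5c71e959f1ec5c03c11ea59839939a1eb1eb),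
   (33289, 0x32212e4c81784be18546d1c743c1de7871bb4be1eb1bb7871de5791e55221eb17977918557818752e1bb5221c74c81de4be1e546d1eb7bb1c75221eb7df1e55bb1eb3851df1df1df),
   (16425, 0x32212a4711bb46d1c35813800be7bb1c35791e32c32c217972a1bb5221c34be1e35813801797bb1c35791e37df1e33813801df2c32c21df2381df),
   (32930, 0x3661e35ca3cb1a45a23a31cc5a23a31cd54e34f1e658b38c38d1d85003015c31d81ec5483495c31e65de1d85903911ec5c03c11e71e7),
   (65574, 0x3771c252a1dd5221e15211e25c13c01787df1df3791bd5273261de7df1e33813801ba7bb1bb5791de5781df1ec7bb1c35791e37df1e33813801df2c32c21ed),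
   (46, 0x21012a6be1c321e0be6be12a7791c32711792091796710be4101c372a1794be1c321e1796be12a7791c327117972a1794be1c37791c37c31df32a1df2711df21e1df2091df1df),
   (49, 0x2001c34100394054c40be0be4014390be4114c41791791796100c44110be4054c40be4391791794014390be4111794054c40be4391794114c41794394c41df1df1df1df1df1df),
   (164, 0x3381a454e34f19054e34f1915003011c34cf2d05c31c31d84af5903911d81df48828928a5903911c35791d854e34f5d81df1df52a5c31df1e71e7),
   (16401, 0x21006d7220be0be6101bb46d0be7bb0be5221791791796101227bb0be0be7220be46d5bb1791791796101bb46d0be7bb0be5221791797220be46d5bb1791797bb0be52217946d5bb1795225bb1df1df1df1df1df1df1df),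
   (22, 0x2100be0be8be0be0be6104be1791791791796100106100be6be0be7791791791791798be0be0be6104be1791791796100be6be0be7791791791796104be1791796be0be7791791794104be1797791794be5795df1df1df1df1df1df1df1df1df1df1df),
   (49700, 0x3c31c55c03c11c75bb1d05ba1d459839939a1de5931df5871e15861e25851e35803815df1e31e55781e95263275c11df1eb52e5795df1df1eb1ec5423435d41df1ed),
   (34850, 0x3b31d35b21d559e1db5741e559d1dc5641e95161ec5d03d11b45b03b11d655c59f1ec5c03c11ea1ea51259f1e95e31b45d41d659839939a1ea5613625df1dc1eb1eb),
   (49191, 0x3211c25ba12a5c03c11225813801784be1e14711ed4c22c31de46d1ec57c5c31ed5e31de1795265ec1795e31bb1bb7781e352a1ed5801de5221ec5e11795c11bb57c5ec1bb5e11df1df1df),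
   (49165, 0x2361214101ba7de1225ed0be0be7221225780be46d1bb1bb66d1de5781225ba0be7ed17917917966d1784101ed7221bb1bb7de1225ed0be5ba17917966d1de5781225ba0be7bb1bb1bb7ed0be5781bb7ed1795ba5ed1df1df1df1df1df1df),
   (33378, 0x3ca1d45c61d85c31d95c21da5b51df5a41e559b1e65ac3ad1e25903911e858e38f1e955935a1ec5a83a93aa3ab1e35943953963971e754a34b34c34d1eb),
   (49251, 0x3c31c95c21ca57c1e75c03c11cc5c03c11cd5ba1d85a23a31de5903911e158e38f1e25803811e654e34f5d81df1ed58b38c38d5df1e61e35343353363371ec),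
   (16934, 0x32a1c75221d44c81e35803811875423431bb4be1e952e1c34711eb59839939a5c31eb1794d42d52d65e31875d41bb5c71c352a1eb5e917959839939a5c31eb5e91df1df1df),
   (50211, 0x3c71d05c51d45c21d55c03c11d65ba1dc5b03b11de59f1e159e1e259d1e359b1e459839939a1e55861e85851e957c1ea53b33c5d03d11df1eb5475d61df5871eb1ec5613625dc1df1ed),
   (65604, 0x3c01c05c11c15bd1c357c1e35781e65cd3cc1ba5913901dd5813801e158d38c38b1de7df1e237f37e37d1e27c11df5791ec3273261ec7cd3cc1df3373363353341ed),
   (32808, 0x32a1784711de46d1e35c13c00be5813801227791ec3273261797bb1c35791e32c32c21bb7801bb5781c352a1de5221e34be1ec5c13c01797bb1e35791ec7df1ec3c13c01df3273261df1df),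
   (17417, 0x2dc1224c812e46d19f7871871bb43c1c77bb1ea5871eb3470be79f1bb5871c75791d65221ea4c81eb17974717952e18752219f4dc1bb4c81c74be1d646d1ea43c1eb79f1bb5871c74c81eb7d61df5bb1ea5871eb3471df1df1df),
   (16908, 0x26d0c843c1224101c77871bb4be1eb0be7221874c81bb4be1c77791eb32e1791796c81224be12e46d18743c1bb7791791c76be1792101eb7221874c81bb4be1c77791eb32e1797871bb4be1eb7c71df7df1df3791eb32e1df1df1df1df),
   (33317, 0x3861c25851c35781d452a1e55221e95983991bb5423431de4c81ec5d03d11795c03c11875803811c752e1e34c22c35791e31eb53b33c5ec1875c71e35803811eb5d03d15e31eb1df1df),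
   (24, 0x2be0be0be0be6100106100be6be0be7791791791791791798100be0be8be0be0be6104be1791791791796100106100be6be0be7791791791791798be0be0be6104be1791791796100be6be0be7791791791796104be1791796be0be7791791794104be1797791794be5795df1df1df1df1df1df1df1df1df1df1df1df),
   (32962, 0x3a21a24af1ec5cd3cc1665a33a21a35a13a01a45013001e67d81de5c31e65913901ec3493481d87a41e25cd3cc1cc5c13c01d85a33a21e35913901e654f34e1ec58d38c38b1e71e7),
   (33347, 0x3c21d25bb1da59b1e25871e65851e75d03d11c35c71cc5ac3ad1de5903911e55c03c11d45803811e95423431ec59839939a1e35a63a75d41ec5e91e31df5343353363375cd3cc1df1eb),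
   (17026, 0x3d23d31a45ac3ad1cc5ac3ad1cd5a23a31d456b36c1e35903911da54e34f1e959839939a5df1e91d85003015c31d81eb5543553563573585df1da5c31e95903911eb5c71e71e7),
   (32899, 0x3a21c25381e65ca1905c11a45a03a11c35913901cb58e38f1cc58e38f1cd5651df54e34f1e257d37e37f1d854a34b34c34d1e34e32e42e55a41df1ec52f3303313323331e7),
   (18467, 0x39e1b25741c75641d45471dc5161e34fc1e95b13b019f7dc1df3623611d67871dc5741df2aa1eb7df1e95c31eb39a3993981b47c31d659f1e35871e95b13b01df5813801ea7d41df3433421eb2f52f41ea),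
   (32809, 0x2361e35780c452812246c1c34391de46d1c257e37f37d0be46e26f2701bb4bf2c02c15e21791794375211c34c41de5221c25e20be5291bb57d1794bf2c02c15c21bb57e37f37d5e21df1df1df1df),
   (48, 0x21007140952a0be0be6101c34710be41e5c30be52a17917917961012a41e5c30be0be40952a0be4715c31791791796101c34710be41e5c30be52a17917940952a0be4715c317917941e5c30be52a1794715c317952a5c31df1df1df1df1df1df1df),
   (16403, 0x2101bb46d0be0be6101227bb0be0be7220be46d5bb17917917917961006d7220be0be6101bb46d0be7bb0be5221791791796101227bb0be0be7220be46d5bb1791791796101bb46d0be7bb0be5221791797220be46d5bb1791797bb0be52217946d5bb1795225bb1df1df1df1df1df1df1df1df),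
   (33858, 0x3d01d45c71da5b71de5b21e259f1e659d1e75d21d25d31d35cc3cd1d65c03c11dc5b03b11e35ac3ad1e55613621ec58b38c38d1ea59839939a1e95543553563573585c31e95903911eb1eb),
   (17986, 0x3b21d259b1db5da19f5cc3cd1b45c71b75ac3ad1d65741e35641e75613621e959839939a1dc5b03b11d45543553563573585e31d41ea50e30f3105df1b759f1e75c31dc5d41d45903911ea1eb),
   (17506, 0x3b61c35b21cc5a41d659e1d85751df5da19b5ac3ad1d25903911db58e38f1dc5703711e355935a1e95a83a93aa1d454a34b34c34d1ea55d35e35f3601e750630730830959b1e71eb),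
   (16547, 0x3661c35913901a25913901a358f38e1a454f34e1cc54f34e1cd5013001e37cd1df5c31e33373363353341d87bb1d85cd3cc1c35a33a21df5913901e35813801e72e22e12e02df1e7),
   (74, 0x2c40c447112a4101e74cf2d00be41e4be1c31c34412425e70be52a1c359039117917941452a12a5903910be4711c34cf2d05c31c35e71791794412425e70be52a1c35903911794cf2d05e71795903915e71df1df1df1df1df),
   (16428, 0x32a03643912240f1c346d0c44111bb4101c246e26f2700be41c21d5c20be5281791794084361c35220c44391bb5293280be46e26f2705c217917941c21d4c41bb5c20be46e26f2705c21795293285c21df1df1df1df1df),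
   (77, 0x21112a4710394101384202210be41e0c44054be0c41c340b5380be4391c347827917917940352a0394782790be4710c44111c34202214c41c353817917940b52a0c44391c34782791794202214c41c34782795381df1df1df1df1df),
   (34339, 0x3b01c759d1d459b1d55861db5851dc5741de5641e35471e94fc1ec5d33d219e5d13d019f5623611e57df1ec3c13c01b47df1e939a3993981d67d01df5871ec33c33b1ea7c31d65871e95801ea5421eb7d41eb3b13b01df2f52f41eb),
   (17445, 0x38619b52a1d65221dc5613621bb5471c34c81e958138019f5423431c75b03b117959839918752e1d44dc1e34c22c35791e31ea47e27f5c31875791d41eb4f42f55e91875c71d459f1e35801ea5423431eb5b03b15e31ea5d41eb1df1df),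
   (196, 0x34e14e4af1c354f34e14f5013001905013001917a41df2e52e42e31a47791d85913901c354f34e1df28a2892881d879019059119152a1d854f34e1c37c31d83013001df7c31c35791e75913901df2d02cf1e72552541e7),
   (32868, 0x3781d85381e252a1e65a23a31bb58e38f1c254e34f1de5903911c05903911c158b38c38d1c35803811cc5803811cd5263271e74cf2d05791e71ec5343353363371e35483495c03c11e75903911ec5cc3cd1e31df),
   (49221, 0x38b1bb57d1c257c1c35791c952a1e15221e65cd3cc1785913901ba5813801c05813801c15293281e25273261e37791e32c32c21ec7791e72d02cf1ed5373363353341de7c91df5c11e35bb1e65ba1e75913901ed7df1e33813801ec1df),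
   (16485, 0x3381c25221d85cd3cc12a5a33a217958138019058138019154f34e1bb4d02cf1e37791e32c32c21e77c31e35bb1e73373363353341c37bb1d85cd3cc1c35a33a21df5913901e37df1e33813801e72e22e12e02df1df),
   (16455, 0x2c41c24711e346d1e75cd3cc0be59139012258138012a4d02cf1bb4c32c21c37c31e35bb1e733733633533417972a1e35221e75cd3cc1795913901bb5813801c37c31e35cd3cc1df3373363353341df2772762751df),
   (33828, 0x3b01bb59d1c35851d45781dc55c1df5471e352e1e94dc1ec5d33d21865d13d01875c13c019f5623611de59a3993981c77df1e33813801d67d41df3433421e57c11df7df1df3791ec3273261ea7991df5871e352a1eb7df1df3791e92d62d52d41eb),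
   (17956, 0x39b19e59839939a19f5871b05861b25803811b45741bb5641c35613621c75471d45423431d652e1dc5125d41d61df4fc5b41df1e34dc59f1df1e94d42d52d659839939a1df5795df1df1e91ea4952965871d45791dc5613625dc1df1df52a1ea1eb)]

lemma prodTests_redKeys38 : prodTests (Lanes.ops 38) (Lanes.rowop 38) (Lanes.seed 38) 38 24 491 slp redKeys38 = true := by
  decide +kernel

/-- Reducible keys of dimension at most `64`, with codes of spanning products. -/
def redKeys64 : List (ℕ × ℕ) :=
  [(17475, 0x3b21c259b1d25871da5471e75cd3cc19f5b13b01c35ad3ac1c75913901d65813801dc5623611e35433421e959a3993981d47dc1e35d41e936f36e1df7cd3cc1df3373363353341ea7c31d45871e75ad3ac1df2f12f02ef2ee1eb),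
   (134, 0x3381384c41a44711d854f34e12a5013001794d02cf1904d02cf1916be1e75913901792422411e77791d852a1e75913901c328a2892881c379019052a1d859139019154f34e1c35013001df7c31c35791e75913901df2d02cf1e72552541df),
   (197, 0x2611c34341df50130013849c29b19049c29b1914e52e42e314e4e52e42e314f74f1df28a2892881a47791a47a41df2e52e42e31df24a2492481d872a1a44c41d859139013849c29b1df4792781e74e52e42e31c322f22e1e7),
   (104, 0x2c413841e1e759139007154f34e0be4d02cf12a72a1c34be1e72422411c37791d852a1e75913901c328a2892881796be1d84711e759139012a54f34e1797c31c32d02cf1c37791d852a1e75913901c37d81df34f34e1df28a2892881df2272261df),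
   (17058, 0x3a23a31ac56b36c1cc5661d45191e35a83a93aa1a45a23a31ad56b36c1cd54e34f1da5003011e94af1eb5543553563573585c31e95903911eb1d85023033043055e31ad5d41cd5c31da5903911e954e34f1eb5c71d859839939a1e71e7),
   (228, 0x3913900af50130014e50130014f7a41c329c29b1a479019052a1d859139019154f34e1c37c31d83013001df2552541d87381a44af1df54f34e19054f34e1915013001c37c31c35901df2d02cf1d87791d854f1df52a1e77df1e73913901c328a2892881e71e7),
   (50, 0x21e0106101c34710be0be61012a41e5c30be0be40952a0be4715c317917917917961007140952a0be0be6101c34710be41e5c30be52a17917917961012a41e5c30be0be40952a0be4715c31791791796101c34710be41e5c30be52a17917940952a0be4715c317917941e5c30be52a1794715c317952a5c31df1df1df1df1df1df1df1df),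
   (49283, 0x3a41be5a23a31c05a31c15903911c958e38f1ca58f1cb58b38c1cc58b38c1cd57c1d85661de54e34f1e154a34b34c34d1e25483491e35343353363371e67ba1e71e74df2e02e12e25bb1d85a23a31df5903911e35803811e71ec5003015903911e71ed),
   (49252, 0x3901be58f1c15881c35801ca57d1cd5771d85381e15913901bf57e37d1cc7df1df3791d75293281e65253243231e754d34c34b34a1de5373363353341e27a41df2e52e42e31ed78f1df2ce2cd2cc2cb2ca1ec7cb3ca1df33333233133032f1e3),
   (32838, 0x3801804c41e24be1e64711ec5cd3cc1225c13c012a5913901785813801815293281c25273261c34d02cf1de4c32c21e35363353341bb7e31e35de1e75c31ec38d38c38b1797901de5791e65781e752a1ec5cd3cc1bb5813801e37e31e35df1e638d38c38b1df2c91df),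
   (16579, 0x2af1e359139016654f34e1a254f34e1a35013001cc5013001cd54d34c34b34a1a47bb1d85cd3cc1c35a33a21df5913901e32e22e12e02df1d87a41c25901cc5661df5a33a21c35913901cd5813801d854f34e1e35373363353341e729a2991e7),
   (32931, 0x3651c358e38f1a258e38f1a35661c254e34f1ca54e34f1cb49b29c1ec5a13a01905003011e24fd2fe2ff1e358b38c38d1a454a34b34c1cc54d34a34b34c1cd4e32e42e55df1a41e652f3303313323331d84dd2de5a01df5901e25c21cc57d37e1e71e7),
   (49193, 0x2c41774711ba46c1c24361e241e1ed5c13c006d5293281217bb1e33261224c32c21787bb1ec5c31ed37c0be7bb1c05791e15781e35221ec17977918152a1bb5221c34be1e32381de77917c52a1ba4be1e146d1ec4711ed5c13c01225813801787bb1e33261bb4c32c21de7bb1c15781e35221ec52a1ed7df1e15bb1ec37c1df1df1df),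
   (32810, 0x2c41214c21224711784361c241e1de4101ec58138006d7c31de3273260be72a1bb5221c34be1e32381bb7811bb5781c352a1de5221e34be1ec5c13c017917972a1784711de46d1e35c13c00be5813801224c32c21bb7791ec3273261797801bb5781c352a1de5221e34be1ec7bb1e37df1ec3c13c01df3273261df1df1df),
   (33348, 0x3a81bb59b1c05981c25901c658e1c75871ca5861cc5381e552a1e85791d955935a1de52c32d1e75283291e94d72d81ec5803811d257d37f1d45423431e25943953963971c34ca2cb2cc2cd2ce1eb53d33e33f3403411e35503513523535d41e258f1eb5d33d21e35d91df1df),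
   (16936, 0x3803810c85423431224711c746d1d452e12a43c1e359839939a0be4c22c318747e27f5871c31bb41e4be1c31eb4d42d52d65e31875c71c352a1eb5e91791797221d45c712a4c81e35e90be52e1c35423431bb4711eb59839939a1794d42d52d65e31875d41bb52a1eb5e917959839939a5c31eb5e91df1df1df1df),
   (32839, 0x32a17d52218e4711e246c1e74391ec5cb3ca0be5c13c00c45913901215813801284c32c21c24792781de4c12c02bf1c347026f26e1e34ce2cd2cc2cb2ca1bb7c31e233333233133032f17978f1bb5801c25381de52a1e25291e34c41ec7c21e35cb3ca1df33333233133032f1df2741df),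
   (76, 0x2710714390c441e12a4091c359139001072a1c34be1e72422410be72a12a4711c35913900be7c31c35791e72d02cf1792141796c40c447112a41e1c34101e77c31c32d02cf0be72a1c34be1e759139017924224117972a12a4711c35913900be4d02cf17972a1c34be1e75913901799df1e73913901df2d02cf1df2422411df2141df1df),
   (16430, 0x23906d43607141112240f12a4051bb4041c35293280106c41bb4be1c221d21c0be6c41224be1284391bb4361c37791c227026f26e17920817966d0c443912243612a4111bb4101c240f1c347026f26e0be7281794be1c221d21c1796be12946f1794391bb4361c36c41bb4be1c27791c27c21df3293281df27026f26e1df21d21c1df2081df1df),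
   (79, 0x21e0394110714090c440512a4011c34001e74792780106c412a4be1384391c320b0be6710c443912a4111c34792780be7381794c41c322122017920317963907141e0c441112a4101384051c36c41c32212200be6391c347927817920b1796710c44792780be4212201796c412a4792781796c41c37381df2792781df2212201df20b1df2031df1df),
   (16548, 0x3a23a31385003011c249b29c1e354e34f18f4e32e42e51cc4e32e42e51cd54e34f18e54c34d34a34b19054c34d34a34b1915343353363371a44fd2fe2ff1c34ad2ae1df4ca2cb2cc2cd2ce58f38e1df1d848228328428528628758e1c354a34b1df5283291e71e7),
   (32869, 0x3781a45211d84c41e65ca3cb12a5c03c113858018f57d19154a34b1bb5283291cc5283291cd4782791ec5a03a11794e32e42e51de57e37f37d1905343353363371c24bf2c02c11e752f3303313323331c34cf2d05791e71e24ca2cb2cc2cd2ce1e34dd2de5913901e258f1e35a03a11df1df),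
   (52, 0x2000c440901061012a41e5c30be0be0be67101040952a0be0be6101c34710be41e5c30be52a17917917917961e0106101c34710be0be61012a41e5c30be0be40952a0be4715c317917917917967101040952a0be0be6101c34710be41e5c30be52a17917917961012a41e5c30be0be40952a0be4715c31791791796101c34710be41e5c30be52a17917940952a0be47117941e5c30be52a1794715c317952a5c31df1df1df1df1df1df1df1df1df),
   (260, 0x30010054f34e0af5013001017913901a42611a47381a44af1df54f34e19054f34e1915013001c37c31c35901df2d02cf1d81d874e14e4af1c354f34e14f5013001905013001917a41df2e52e42e31a47791d85913901c354f34e1df28a2892881d879019059119152a1d854f34e1c35013001df7c31c35901df5791e72d02cf1e72552541e71e7),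
   (229, 0x2af1384341c359139006149c29b14e49c29b14f4e52e42e31004e52e42e310179019054f34e1c35013001df2552541a473819052a1a44c41d849c29b1df4e52e42e31c322f22e1d86611df54f34e1384d02cf1a449c29b1c34792781d84e52e42e31917a41df2e52e42e31907791a44e41df4c41e724a2492481e721a1e7),
   (17476, 0x39819b59019e58e19f5871a85861ac5701bb5611c25381d652a1db5791b655935a1c75431d35283291dc4da2db1e74d72d81e95803811b25423431d255d35e35f3601c34f62f72f81e353d33e33f3411d44ca2cb2cc2cd2ce1ea48d28e28f2902911eb50a30b30c30d5b21e35d33d21d458f1ea55935a1eb5b61df1df),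
   (33319, 0x32a1855291865261874c41c64711e546d1e943c1ec5d13d00be5c13c00c859939812258138012e5433421784c72c61c24c32c21c747f27e1de7871e32d52d41bb72a1bb5221c34be1e32381eb7c31e55bb1e95871ec5813801eb33c33b1797991bb5781d452e1e352a1e55221e94c81ec5c13c01875433421de4c32c21eb7c71e35801eb5871ec7e31eb3d13d01df33c33b1df1df),
   (17027, 0x3381da5a23a319b5911ab58e38f1ac58e38f1ad56b36c1c255935a1cc55935a1cd54e34f1d254e34f1d349b29c1eb5173181df5a83a93aa3ab19059839939a1a456736836936a1c354a34b34c34d1d45063073083091e34e32e42e55df1a41e953d33e33f3403411d84e62e72e82e92ea2eb2ec2ed1e7),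
   (166, 0x2af17950130012a4d02cf14e4d02cf14f4792781a44e52e42e313848a28928819048a2892881917913901792422411d872a1d859139019054f34e1c32552541c36be1d84711e759139012a54f34e1797791e72d02cf1c32272261e77381a44af1df54f34e19054f34e1915013001c37913901df2d02cf1d87791d854f34e1df28a2892881e71df),
   (33379, 0x3a61c35a41c659b1ca5381e85c01ad5ac3ad1c15a23a31c75983991cd5911d058e38f1d258b38d1d45851d85803811da56b36c1de55935a1e25423431e65d13d019059a3983991cc54e34f5d81df1e55343353363371e953b33c1e74ee2ef2f02f15871e71ec5543553563573581e34df2e02e12e25a23a31df5803811e75913901e31eb),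
   (107, 0x21e1384101a44051e75913900114d02cf0394792780714422410c442122012a6c412a4391c320b1c37381c34c41e724a2492480be72a1384be1a44391e75913900c44e52e41794792781c32171796711384111e75913900394d02cf0c447927812a4212201c34e52e42e30be44a2492481796be1a44791c35913900c47791a47a41df2e52e42e31df24a2492481df2171df2071df),
   (292, 0x3013000af74f34e1a42341a474e14e4af1c354f34e14f5013001905013001917a41df2e52e42e31a47791d85913901c354f34e1df28a2892881d81d87913900af50130014e50130014f7a41c329c29b1a479019059119152a1d854f34e1c37c31d83013001df2552541d87381a44af1df54f34e19054f34e1915013001c37c31c35901df2d02cf1d87901c35791d852a1e728a2892881e71e71e7),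
   (16457, 0x2391c241e1e359139006d5813800715293280c44d02cf1224c32c212a4422411bb72a1bb5221c32381c37c31e35bb1e73373363353340be72a1e35221e75cd3cc1795813801c32772762751796c41c24711e346d1e75cd3cc0be59139012258138012a4d02cf1bb4c32c21c37bb1e733733633533417972a1e35913901bb7c31e35cd3cc1df3373363353341df2772762751df1df),
   (16458, 0x27112846d13840f1e759039103658038103947827912246e26f27012a41e1c24111e34202211bb4cb2cd2ce2ca0be4c22c30c441c21d5c20be5bb0c41c343d23e23f2405e30c45281c358e1791794135e703653812252912a4711c24391e34782791bb58f38e0be5803810c446e26f2701c34cc2ca5c21c317943d23e23f2405e30c44cb2cc2cd2ce2ca58f38e1df1df1df1df),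
   (167, 0x2611795013000c449c29b12a47927814e47927814f4422411a44212201d84e52e42e30cf4e52e42e30d048a28928813844a2492481917791a424a2492481906c41d84e52e42e31c322f22e1c36be1a44391e75913900c44792781c34e52e42e31792171e76611df49c29b1c34792781d84e52e42e31904e52e42e319144a2492481e77913901df2d02cf1a421a1df)]

lemma prodTests_redKeys64 : prodTests (Lanes.ops 64) (Lanes.rowop 64) (Lanes.seed 64) 64 20 491 slp redKeys64 = true := by
  decide +kernel

/-- Reducible keys of dimension at most `95`, with codes of spanning products. -/
def redKeys95 : List (ℕ × ℕ) :=
  [(32900, 0x38e18e58f18f5661bb5cb3ca13858d38b1915813801a25813801a354f34e1c054f34e1c154b34a1c25493481c35013001de58d38c38b19057f37e37d1a47c11df3273261d878b1df5781e72c91e75373363353341cc5373363353341cd7a41df2e52e42e31e27791e75913901df2d02cf1e67791d852a1e754f34e1df28a2892881ec7a31df5911e35813801e72e22e12e02df1e3),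
   (16517, 0x3661795a33a212a58f38e13854f34e18054f34e1815293281a45013001bb4d02cf1cc4d02cf1cd4c32c21d84e52e42e31c25373363353341905373363353341914e22e12e02df1c37901c35791d828a2892881e37901bb52a1e35221e75cd3cc1795813801c32772762751e77661df5913901cc5913901cd5813801d87d81df34f34e1e35373363353341e729a2991df),
   (106, 0x2391384101d84091e759139001e4d02cf0714792780c444224112a72a12a4711c32141c372a1e75913901c328a2892880be6be1d84711e759139012a54f34e1797791e72d02cf1c32272261796c413841e1e759139007154f34e0be4d02cf12a6be1e72422411c37791d852a1e728a2892881796be1d84711e759139012a4d02cf1c37791d852a1e75913901c37d81df34f34e1df28a2892881df2272261df1df),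
   (137, 0x34e34f0394e32e42e507149b29c0be44124213841e1a44111d84202211904202211914d02cf0784d02cf07944824924a12a42e22f17940b4be1384782791791e748828928a5d817952a1e70c44174be1a44e41794391e75903910c44782791c31c340e4cf1384711a44391d85903910785903910794e32e512a49b29c1794202211e754e34f0c444824924a1c342e22f5a412a5d80c449b29c1df1df1df),
   (16996, 0x38e19b5861a452e1d852a1da5d33d21385a33a21875993981915813801ac5813801ad56c36b1bb55a3591c254f34e1c75433421cc5433421cd4d02cf1e959a3993981905373363353341d44f12f02ef2ee1e37791e92d62d52d41e75583573563553541c37901c35791d852a1e728a2892881eb7cd3cc1d45ad3ac1e35993981e75913901e97d81df34f34e1eb3053043033021df),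
   (261, 0x39139003454f34e06149c29b10049c29b1014e52e42e30af74f1915381a44af1df54f34e1905013001c31a46611df54f34e1384d02cf1a449c29b1c34792781d84e52e42e31917a41df2e52e42e319021a1d86611c34341df50130013849c29b19049c29b1914e52e42e314e4e52e42e314f48a2892881a47791a44e52e41df24a2492481d872a1a44c41d849c1df4792781e74e52e42e31c322f22e1e71e7),
   (32812, 0x26c0c443912141e17840f1c24091de5c13c00105293280364c32c206d7221c323812272212a4711bb46d1c31bb7781c352a1de5221e34be1ec5813801bb0be6c21bb4711de46d1e35c13c00be5813801227bb1e35791ec3273261791796c21224711784361c241e1de4101ec58138006d5273260be72a1bb4be1e32381bb7781c35221e34be1ec5c13c017917972a1784711de46d1e35c13c00be4c32c21bb7801bb5781c352a1de5221e34be1ec7bb1e37df1ec3c13c01df3273261df1df1df1df),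
   (16580, 0x3661384af1c249b29c1cc50030118f4fd2fe2ff1914e32e42e51a349b29c1cd54d34c34a34b14e54d34c34a34b14f50030118e4e32e42e51a24611e34ad2ae1c34fd2fe2ff1904df2e02e12e25a21df5e31901a448228328428528628758e1c354a34b1df5c21901d84535381cd4e32e42e51e354c34a34b1c34fd2fe2ff1df58f38e1905801a45283291d84ca2cb2cc2cd2ce1e71e7),
   (17447, 0x32a1474d71864c419e4811c24711d646d1dc43c1e95b13b00be5993980c85813800dc56236112254334212e4c72c619b4c32c219f4962951bb47f27e1c76c81c34be1d42231eb72a1bb5221c34be1e32381ea7871e352a1eb2d62d52d41877871e95813801ea5433421eb2f52f41797871995471c352e1d452a1d65221dc4dc1e34c81e95623611bb5433421c74c32c21ea47f27e1eb7c71d459f1e35871e95801ea5421eb7e31ea5d41eb3b13b01df2f52f41df1df),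
   (78, 0x23903941e0714110c440912a7c31c32d02cf01072a12a4711c35913900be2140be6c40c447112a41e1c34101e77c31c32d02cf0be72a1c34be1e75913901792422411791796710714390c441e12a4091c359139001072a1c34be1e72422410be6711c35913900be7c31c35791e72d02cf1792141796c40c447112a41e1c34101e74d02cf0be6be1e724224117972a12a4711c35913900be4d02cf17972a1c34be1e75913901799df1e73913901df2d02cf1df2422411df2141df1df1df),
   (17507, 0x39b1a85901b15701c255a1d35471d85381db5a33a219f5993981ad5913901b058f38e1b25813801b756f36e1c356c36b1c75623611cc5623611cd55a3591d25433421da4f52f41e759a3993981ac7d81df34f34e1d651030f30e1e35373363353341dc5583573563553541d47871e72f12f02ef2ee1e97a31df5913901e35813801e72e22e12e02df1ea7871d85913901d456c36b1df5433421e72a22a12a029f1eb),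
   (136, 0x2cf0cf4391a441e1d854f34e0715013000be4d02cf0d04792781384422411904422411914e52e42e30c448a28928812a72a12a5913900be2141e76be1d84711e759139012a4d02cf1c32272261c379019052a1d859139019154f34e1c37c31c35791e72d02cf1e72552541797381384c41a44711d854f34e12a5013001794d02cf1904d02cf19148a2892881c37791904be1e72422411e779019052a1d85913901917913901e73013001df2552541df1df),
   (49253, 0x3771a452a1c94c91e35bf3be13859139017c58d38b18157e37d18f54f34e1ba5293281ca5293281cb5273261cc5273261cd4c32c21e67e31e73a33a217858d38c38b1805363353341c05363353341c153133032f1c27791e72d02cf1e14e22e12e02df1de4ce2cd2cc2cb2ca1e272a1e35221e72772762751ec7791d852a1e728a2892881ed78f1e25801e65cd3cc1c15913901e17df1e638d38b1e35363353341ec7d81df34f34e1ed1df),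
   (16966, 0x2be1da4711e95d33d20c45cd3cc0c85ad3ac12259939812a59139012e54334218054334218152932819b4d82d71c24d02cf1c74c32c21d447f27e1e35363353341874d62d52d41c34f12f02ef2ee1bb72a1c34be1e72422411eb7d41e35c71e75c31e95901eb3583573563553541797991c35801d45791da52e1e752a1e95cd3cc1875ad3ac1bb5913901c75433421e34d02cf1eb7da1df5d41e35913901eb3583573563553541df28c28b1df),
   (49223, 0x32a17c52817d5261814be1c946d1e65bf3be0c458f38e1215273261804c32c21c04c32c21c17791c32711e157f37e37d1297791e72d02cf1ba4c12c02bf1c247026f26e1e27791814be1e32381ec72a1e32772762751de72a1c34be1e72422411ed7bb1e73373363353341787e31e35de1e75c31ec38d38c38b12278b1bb5801c152a1e15291e25221e65cd3cc1785913901ba5363351de5273261e34c32c21ec4d02cf1ed7c91df5c11e35bb1e67df1e33801ec5913901ed1df1df),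
   (16487, 0x26d1d84381e75cd3cc0715a33a20be58f38e0c454f34e1225293281384d02cf1804d02cf1814c32c21904c32c21914792781c248a2892881bb6be1e72422411e37221e72772762751c37c31e35bb1e733733633533412a7c31cc5bb1d85901e35813801e72e22e12e02df1797381c25221d85cd3cc12a5a33a217959139018054f34e1bb4d02cf1e34c32c21e75373363353341c37bb1d85a33a21df7df1e73913901e32e22e12e02df1df1df),
   (32840, 0x3281285291295211384c21814391e24381e341e1ec5cd3cc06d5c13c007157f37d0c452732612a4c32c21804422411de7c31c32d02cf17847026f26e1c27c31e33363353341227811e35791e65781e752a1ec2c91797901bb5221e72772762751bb7e31e35de1e75c31ec38d38c38b0be7801804c41e24be1e64711ec5cd3cc1225c13c012a59139017858c38b1795293281c25273261c34d02cf1de4c32c21e35363353341bb7801e352a1ec5cd3cc1bb7e31e35df1e638d38c38b1df2c91df1df),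
   (16938, 0x2c40c74c20c847112e43918643818743619b41f1c241e1c74101e94091eb58138003c54334206d7871c327f27e12272a1874c81c32231bb7c31c75bb1d45871e352a1eb2d62d52d40be72e1c352a1c75221d44c81e34be1e94711eb5433421bb7c31eb39a39939817917972a12e4711c746d1d443c1e341e1eb5813800c85433421224c32c218747f27e1bb7c31eb39a3993980be7791e92d62d52d41797421bb52a1c75221d44c81e34be1e94711eb7bb1d45871e35791e952a1eb7df1e95c31eb39a3993981df2d62d52d41df1df1df),
   (33349, 0x38718b5221da4c81e64c41e85d13d012a5cd3cc12e5ad3ac1785913901855813801985813801995563541bb5433421c05433421c153c33b1c35293281d25293281d35273261d44d82d71e24d02cf1e54c32c21e947f27e1ec54033e33d1c27e51e75d41ec3a73a61795373363353341c74f12f02ef2ee1de7871e32d62d52d41e372a1e35221e72772762751eb7c11d45991e35871e65801e95913901e55433421ec7e31e95d41ec3a73a61df7cd3cc1df3373363353341eb1df),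
   (16518, 0x29b29c1bb4782791cc4782791cd5a23a30c454e34f12854e34f1294fd2fe2ff1794e42e52e31814cf2d018e48828928a1c254b34c34d34a12a5343353363371384e42e52e31804cf2d018f4c22c31a446e26f2701d84ce2ca2cb2cc2cd19144824924a1e34ce2ca2cb2cc2cd1904822832842852862871c343d23e23f2404c41e35281c31e74535801a45291d858f1914e31e358e38f19054a1c34ca2cb2cc2cd1e74fd2fe2ff5a41e31df1df),
   (32870, 0x3211a44c91c34711e65cb3ca0c45a33a212258f38e12857f37d13854f34e1785273261905273261914e02df1bb4d02cf1c04d02cf1c14c32c21cc4c32c21cd4792781e24422411ec58d38c38b12a53633533418053633533418148a2892881de7c31e65901ec34934817972a1e32772762751e34ce2cd2cc2cb2ca1c27781c352a1de5221e34be1ec5c13c01791e778f1c25781d852a1e65cd3cc1805913901c154f34e1de5493481df5273261e77913901df2d02cf1ec7cd3cc1df3373363353341e31df),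
   (198, 0x2e30e34af12a4e42e30e449c29b1384e52e42e30e57c31c32d02cf1007c31c32d02cf10148a28928814e48a28928814f7791a424a2492481a479019054f34e1c325525419079019059139019154f34e1c32552541916be1d859139012a54f34e1794d02cf1c32272261d874e14e4af1c354f34e14f5013001905013001917a41df2e52e42e31a47791d854f1df28a2892881d81df7381384c41a44711d854f34e12a5013001794d02cf1904d02cf1917791d828a2892881c37901905001df2552541df7791904be1e74d02cf1df2422411e71e7),
   (16488, 0x2d012946d1a44361d85cd3cc03958f38e0714d02cf1284c32c21384792781804792781814422411c24212201e341d21c1e74e52e42e312247026f26e19047026f26e19144a2492481bb44023f23e23d1c37c21e734d34c34b34a0be4ce2cd2cc2cb2ca12a7c31e35bb1e73373363353340c47381e35281e728728628528428328217974a17952a18f4e31bb5cd3cc0c45913901294792781e34cc2cb2ca1c347026f26e1e77913901c254d34c34b34a1df2872862852842832821df2251df),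
   (109, 0x2140c44091384011e75913900054d02cf01147927801e4422410394212200716c412a20b12a4e52e42e30106710c443912a4111c32031c372a1384be1a44391e75913900c44792781c32170be6711384391904111e74d02cf0c447927812a4212201c34e52e42e30be6c41e724a24924817920717961e1384101a440b1c34051e75913900114792780714422410c442122012a7c31c32d02cf03944a2492480be6e41794c41904391e74792781c32171796391904d02cf0c447927812a4e52e42e30be6be1a44791c35913900c47791a47a41df2e52e42e31df24a2492481df2171df2071df1df),
   (32932, 0x3381a04af1de58d38b14e58138016654b34a18e5493481905493481915013001c05013001c14fe2fd1c249c29b1e258d38c38b14f54c34b34a18f5363353341a34e52e42e31ca4e52e42e31cb78d38c1df2c91d85373363353341a24e22e12e02df1cc4e22e12e02df1cd7911cd5801d85661df29a2991e37ca1df33333233133032f1a47791d854f34e1df28a2892881e679019059119154e1c352a1d85013001df2552541ec78e1c25801cd5781d854f1de52a1e65c13c019058c38b1c35813801cc5493481df5273261e74d02cf1ec5363353341e31e7)]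

lemma prodTests_redKeys95 : prodTests (Lanes.ops 95) (Lanes.rowop 95) (Lanes.seed 95) 95 14 491 slp redKeys95 = true := by
  decide +kernel

/-- Reducible keys of dimension at most `137`, with codes of spanning products. -/
def redKeys137 : List (ℕ × ℕ) :=
  [(80, 0x21e01e4110394090714050c472a1c32422410106c40c447112a41e1c34101e77c31c32d02cf0be0be6710714390c441e12a4091c359139001072a1c34be1e72422410be72a12a4711c35913900be7c31c35791e72d02cf17921417917963903941e0714110c440912a7c31c32d02cf01072a12a4711c35913900be2140be6c40c447112a41e1c34101e77c31c32d02cf0be77919052a1c34be1e72422411791796710714390c441e12a5913900106711792091c372a1c34be1e75913901792422410be6c40c447112a44117941e1c34101e74d02cf0be72a12a4711c35913900be4d02cf17972a1c34be1e75913901799df1e73913901df2d02cf1df2422411df2141df1df1df1df),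
   (199, 0x2af0c446112a43417949c29b0cf49c29b0d047927810047927810145525413842f22e19042f22e19148a2892880e348a2892880e448a2892880e544a24924814e44a24924814f72a1902272261a46be1a45913900c44e52e42e31792171d86e31914e42e31904d02cf1a449c29b1c34792781d821a1c36611c34341df4e42e314e49c29b19049c29b1914e52e42e314f74f1df28a2892881a49a41df2e31df24a2492481d81df6711a44391d854f34e0c44e42e312a4d02cf13849c29b17947927819047927819142f22e1df44a2492481c36c41c34781df2212201e720e1e7),
   (108, 0x21113859139000954f34e0104d02cf01e4792780394422410714212200c472a12a21412a6c40c447112a41e1c34101e71c36be1d84711e759139012a7c31c32d02cf1c32272260be6c413847119041e1e754f34e0be4d02cf12a6be1e72422411c37901c35791d852a1e728a2892881791796391384141c34101d84091e759139001e4792780c444224112a7c31c32d02cf0717901c352a1e728a2892880be74e1794d01c34be1d84711e72272261796c413841e1e759139007154f34e0be4d02cf12a4422411c348a2892881796cf1c34be1d84711e759139012a7791d852a1e75913901c37d81df34f34e1df28a2892881df2272261df1df1df),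
   (17477, 0x33819e5221b74c81da4c41db5cd3cc0dc5b13b012a5ad3ac12e59139014756f36e17956236118056236118155735418754334219854334219954033d19b5293281b24f52f41c34d82d71d24d82d71d34d02cf1d64c32c21dc4962951e347f27e1e951030f30e1bb4f82f72f61c253733633533419f4f12f02ef2ee1c77871e32d62d52d41d47791cc52a1e35221e72772762751ea7871905421c352a1d44c81e724e24d24c1eb7801dc5471e75993981d45913901d65623611e35433421e95373363353341ea4f12f02ef2ee1eb7dc1e35d41e95cd3cc1ea5ad3ac1eb36f36e1df1df),
   (16549, 0x32a1664af1bb5013001805013001814d02cf1a24d02cf1a349c29b1c249a2991c34552541e354c34b34a1384e52e42e318e4e52e42e318f48a2892881cc48a2892881cd53733633533414e53733633533414f7901e32e22e12e02df1907911e32e22e12e02df1914ce2cd2cc2cb2ca1a47811c352a1e35cd3cc1792772762751d87911a35661c35913901a258f38e1a454f34e1cc54f34e1cd5013001e37cd1df3373363353341d81df7221d85cd3cc12a5a33a217958138019054f34e1bb4d02cf1e34c32c21e75373363353341c34e22e12e02df1df1e7),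
   (16459, 0x2710c243812a4361384111c24091e35cd3cc01058138001e5293280394d02cf06d47026f0c444224112272a12a2141bb72212a4711bb46d1c31c372a1e35221e75913901bb5813801c32772762750be72a1815221904c41c24711e346d1e75cd3cc0be4d02cf1bb4c32c21c37c31e35bb1e73373363353341791796391c24381c341e1e359139006d5813800715293280c44d02cf1224c32c212a4422411bb72a1e35221e72772762751797c31e35bb1e73373363353340be72a1804c41c24711e346d1e75cd3cc0be5913901224d02cf1bb4c32c21c372a1e35913901bb7c31e35cd3cc1df3373363353341df2772762751df1df1df),
   (16460, 0x2390c24380c440b1bb4091c24051e34041e759139000f58f38e01058138001152932801e4d02cf03647927806d46f26e07142122012241d21c12a6391bb4361c32081c37381bb52a1c24c41e35293281c324023f23e23d0be6be18e4711c24391e34361e74cc2ca1794792781bb7791c227026f26e1c321317967112846d13841e1c24111e340f1e75913900365813800394c32c20c44792781224212201bb41d21c1c347026f26e12a4ce2cd2cb2ca0be77918e5281c324023f23e23d17972912a4c41804711c258f38e0be4792781bb6c41e378f38e1df2ce2cd2cc2cb2ca1df24023f23e23d1df2131df1df),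
   (230, 0x2611384d02cf0af4e52e42e309b4e52e42e309c48a28928810048a28928810179119125525414e79119125525414f72a1a422f22e1a47381a454f34e19054f34e1911907913900af50130014e50130014f49c29b1a41df74e14e4af1c354f34e14f5013001905013001914e52e42e31a41c36c41a44711d854f34e12a5013001794d02cf1904d02cf1917901c35791d828a2892881c379019052a1d85013001df2552541df1d89df1df3790af50130012a4d02cf14e4d02cf14f4792781a44e52e42e313848a28928819048a2892881917901905013001df2552541c377919052a1c34d02cf1df2422411d874e17952a1904be1d84711e77791e72d02cf1c348a2892881df2272261e71e7),
   (168, 0x2af0be50130007149c29b0c445525412a44224114e44224114f4212201a44e52e42e30784e52e42e307948a2892880cf48a2892880d07791a424a24924813874e17952a19122722619172a12a4be1914d02cf1792141d86be1d859139012a54f34e1792272261906c413841e1e759139007154f34e0be4d02cf12a7791d828a2892881791e77381384c41a44711d854f34e12a5013001794d02cf1904d02cf1917791d828a2892881c37791904be1e72422411e71c36af17950130012a4e42e31384d02cf14e4d02cf14f4792781a44552541c34422411d848a2892881917791d828a28928819074e1794be1d82272261e774f34e19054f34e1914d02cf1d874f1e75913901d82af1df1df1df),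
   (139, 0x21712a4141384091a44051d84031e759139000b54f34e0114422410784422410794272260c44212200cf4212200d04e52e42e301e72a1e728a2892880396c41e724a24924807172a1a44c41d85913901384792781e722f22e0be6711a44391d849c29b1794792781904792781914212201e720e1796c40d04111e759139003947927812a4212201c34e52e42e30be6c41e724a2492481792071c361e1a44171c34111d840b1e754f34e03949c29b0be4792780cf4792780d04422411384212201904212201914e52e42e307148a2892880c444a24924812a6e41c34781e722f22e1796c414e4711a44391d84e52e312a47927819047927819172a1a44c41d849c29b1df22f22e1df20e1df1df),
   (17028, 0x36618755918e55a18f5191bb5ab3a813856c36b18056c36b18154f34e19854f34e19954b34a19b5433421a25433421a35013001c74d02cf1da5583563541914e52e42e31d24e52e42e31d34d62d52d41d85373363353341ac5373363353341ad5093083073061c25053043033021c34f12f02ef2ee1cc4f12f02ef2ee1cd4e22e12e02df1d47791d828a2892881e955835735635535419054134033f33e33d1a47913901d42a22a12a029f1e379019059119152a1d854f34e1c32552541eb7991c35801d45791da5421e352e1e752a1e94d02cf1eb28c28b1e77ac1cd5a31d45991d85911da56b1e35d33d21a454f34e1e95013001eb5563553541e71df),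
   (138, 0x2780784111a44091d86101e71e759139001454f34e01e4792780794422410cf4422410d04212201384e52e42e303948a2892880716c41e724a2492480c46711e759139012a22722612a61e1e75913900714d02cf12a4422411c31c379019052a1d859139019154f34e1c37c31c32d02cf1e72552540be7381384711d854f34e12a5013001794d02cf1904d02cf1916be1e72422411e77791d828a2892881c31796cf0cf4391a441e1d84141e754f34e0715013000be4d02cf0d04792781384422411914e52e42e30c448a28928812a6d01e72552541797791904be1e724224119074e1794be1d84711e72272261c36c41a44711d854f34e12a4d02cf1904d02cf1914892881c34422411e779019052a1d85913901917913901e73013001df2552541df1df1df),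
   (169, 0x2610be41a17941719150130003949c29b0714552540c442f22e12a42722613842122014e42122014f4e52e42e30414e52e42e304248a28928807848a28928807944a2492480cf44a2492480d06e41794c41902171906d01795913900be2141a46c412a4be13847927817920b1d86711a44391d854f34e0c449c29b17947927819047927819144a2492481c320e1c36711384111e75913900394d02cf0c447927812a4212201c34e52e42e30be6c41e724a2492481792071e76cf0e34d00e44611795013000c449c29b12a47927814e47927814f4422411a442f22e1c348a28928813844a24924819044a2492481916c41c32212201d86e41794be1a44391e72171e76611df4e52e31904e52e31914792781d87913901df2d02cf1a421a1df1df),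
   (82, 0x21101140901e4050394010c440013872a12a4711c32140106710714390c441e12a4091c359139001072a1c34be1e72422410be0be63903941e07140912a7c31c32d02cf01072a12a4711c35913900be2140be6c40c447112a41e1c34101e74d02cf0be77919052a1c34be1e724224117917917961e01e4110394090714050c472a1c32422410106c40c447112a41e1c34101e77c31c32d02cf0be0be6710714390c441e12a4091c359139001072a1c34be1e72422410be6be1904711c37c31c35791e72d02cf17921417917963903941e0714110c440912a7c31c32d02cf01067112a44117941e1c34101e717972a12a4711c35913900be4d02cf1792140be6710714390c441e12a4091c35913900106be1e75913901792422410be6c40c447112a44117941e1c34101e74d02cf0be72a12a4711c35913900be4d02cf17972a1c34be1e75913901799df1e73913901df2d02cf1df2422411df2141df1df1df1df1df),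
   (32842, 0x2c30c346c1386cf1bb1bb4141de4111e24101e64091ec5c13c001e58f38e0365813800384c02bf0c447927812144224117841d21c1c257f37e37d0397bb1c32c32c20c247026f26e12847026f26e1297c31de5bb1e332732607172a1e35221e72772761227c31e35bb1e733733633533406d7c21c25781e752a1ec5cd3cc1bb5c13c01c35913901de5813801e32c90be7351bb5281c25221cd4c41e24c21e34be1e64711ec5273261c34d02cf1de7c31ec38d38c38b17917972812852912952612a4c91794c21814391e24381e341e1ec5cd3cc06d5c13c00714c32c218046f26e1c24422411de5363353341227791e72d02cf1787e31e338d38c38b0be7901bb2772762751bb7801805341bb5291c24c41e24be1e64711ec5c13c012a5913901784c32c21e37801e352a1ec5cd3cc1bb7e31e35df1e638d38c38b1df2c91df1df1df),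
   (16489, 0x2361a44141e35cd3cc01e59139003858f38e03954f34e06d4c32c20cf4c32c20d04792781284792781294422411804422411814272261bb4212201c24ce2cd2ca0c448a28928812247026f26e1387bb1e73363353340717901bb52a1e35221e727727627512a7bb1d85913901e35813801e72e22e12e02df0be7801905221d85cd3cc12a5a33a21794d02cf1e34c32c21e71796c41c24711e346d1e75cd3cc0be5913901224d02cf1bb4c32c21c35373363353341791c37281384c418f46d1d84381e75cd3cc0715a33a20be54f34e1224d02cf1804d02cf1814c32c21904c32c21914792781c24422411e348a2892881bb4772762751c353733633533412a4e22e12e02df1796cf1e35cd3cc12a59139018054f34e1bb7bb1d85a33a21df7df1e73913901e32e22e12e02df1df1df1df),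
   (16550, 0x3011294c41664611bb5013001284fe2fd12a4ae2ad17949c29b18049c29b1814792781a24792781a34552541c274a1c32531c342f22e1e348a28928818e48a28928818f4772762751a444a2492481cc44a2492481cd54d34c34b34a0cf54d34c34b34a0d05373363353340e45373363353340e54e22e12e02df1387c31e33373363353340e34ce2cd2cc2cb2ca14e4ce2cd2cc2cb2ca14f4872862852842832821917281c34c41e324023f23e23d1d87901c228728628528428328219074a1795cd3cc0c44e42e31bb4d02cf1c24792781e347026f26e1e74ce2cd2cc2cb2ca1c32251e774f18f5341a45cd3cc0e34ae2ad1df49c29b1e354d34b34a19154d34c34b34a19078f1df2ce2cd2cc2cb2ca1d84872862852842832821e71df),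
   (16968, 0x2d81284d71294c71384c21434381d44231e341e1e94141eb5d33d20395cd3cc03c5ad3ac06d4c32c214247f27e18047f27e1814792781864422411c754134033d0c47c31c32d02cf12e47727627518747026f26e19b4452442431c27c31eb39a3993980717c31e33363353340c872a1eb2d62d52d412a7c31d45871e72f12f02ee1227871904c81e724e24d24c1bb7d41e35c71e75c31e95913901eb3583573540be7991c35791da5431e352e1e752a1e97791e72d02cf1eb28c28b17974218052819b4be1da4711e95d33d20c45cd3cc0c85ad3ac12259939812a59139012e4d82d71c24d02cf1c74c32c21d447f27e1e34422411eb5563553541795363353341874d62d52d41c34f12f02ef2ee1bb7801d45421e352a1e94cf1eb5cd3cc1875ad3ac1bb5913901c77da1df5d41e35913901eb3583573563553541df28c28b1df1df)]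

lemma prodTests_redKeys137 : prodTests (Lanes.ops 137) (Lanes.rowop 137) (Lanes.seed 137) 137 18 491 slp redKeys137 = true := by
  decide +kernel

/-- Reducible keys of dimension at most `173`, with codes of spanning products. -/
def redKeys173 : List (ℕ × ℕ) :=
  [(231, 0x23412a6c41a41a44d02cf0614792780af42f22e14f4e52e42e30544e52e42e305548a28928809b48a28928809c44a24924810172a1a422f22e14e7791a424a2492481006d02cf1a44e52e42e319021a1906e42e31904d02cf1a44e52e42e319121a1916611c34e42e314e4e42e314f49c29b19049c29b19148a2892881a41c36af1384341c35913900614e42e31004e42e310149c29b14e49c29b14f7901905011df2552541a41df6711a44391d854f34e0c44e42e312a4d02cf13849c29b17947927819047927819144a2492481c36c41d849c1df22f22e1df20e1d86611795013000c449c29b12a47927814e47927814f4422411a44212201d84e52e42e30cf4e52e42e30d048a28928813844a24924819044a2492481916e41c34c41d822f22e1c36e41904d01a44781d821a1df6e41794c41904be1a44781c34481df4391e72171e71e7),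
   (16519, 0x2be1664381d85a33a20715013001224e52e31294c32c214e4c32c214f49a29917947927818e47927818f4552541bb4422411cc4422411cd4e52e42e312848a28928818048a28928818147727627519147026f26e1a444a2492481c254d34c34b34a0c45373363353340cf5373363353340d07901bb2772762751907221d85363353341c31c37bb1d82e22e12e02df12a4ce2cd2cc2cb2ca1386be1d859139012a4d02cf1c32272261e36c41c24711e346d1e75cd3cc0be59139012258138012a4d02cf1bb4c32c21c35373363353341791e77661795a33a212a5293281a45013001bb4e42e31c24d02cf1cc4d02cf1cd4c32c21d853633533419053633533419148a2892881e34772762751e74e22e12e02df1c37801d85661df5913901cc5913901cd7d81df34f34e1e329a2991df1df),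
   (110, 0x21407140b0c44051384d02cf00947927801144224101e4212200396c40c447112a12a72a1e728a2892880106710714390c441e12a4091c35913900101c36c413841e1e759139007154f34e0be4d02cf12a72a1c34be1e72422411c30be6391384141c34101d84091e759139001e4792780c444224112a7c31c32d02cf0717901c352a1e728a2892880be74e1794d01c34be1d87791c32711e722722617917961113859139000954f34e0104d02cf01e4792780394422410714212200c472a12a21412a6c40c447112a41e1c34101e71c36be1d84711e759139012a4d02cf1c32272260be6be14e47119041e1e74422411c37791d852a1e728a2892881791796141c34101d859139001e4d02cf0714792780c444224112a4272261797791d828a2892880be68917941e1e759139007154f34e0be4d02cf12a4422411c36cf1c34be1d84711e759139012a7791d852a1e75913901c37d81df34f34e1df28a2892881df2272261df1df1df1df),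
   (262, 0x29b09b43413849c29b09c79139014e14e4e52e42e306174f34e19054f34e19114f7913901c354f34e1df28a2892880af7901905001df59139019154f34e1c325525410079019059139019154f34e1c35013001df25525410173814e4611df4d02cf1a449c29b1c34e52e42e31917a41df2e52e42e319021a1a49df1df3790af50130012a4d02cf14e4d02cf14f4792781a44e52e42e313848a28928819074f1df28a2892881917901905001df2552541c377919052a1c34d02cf1df2422411d81d86e30e34af12a4e42e30e44d02cf10149c29b1384e52e42e30e57c31c32d02cf10048a28928814e48a28928814f7901902552541907911912552541917791a424a2492481a474e17952a1904be1d84d02cf1c32272261d86af1c35013001905013001914e52e42e31a47791d828a2892881d81df6c41a44711d85013001794d02cf1904d02cf1914552541df7791d828a2892881c37791904d01df4be1e72422411e71e71e7),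
   (16490, 0x2381384171bb4141c240f1d840b1e34081e75cd3cc01158f38e01e54f34e0364792780c24792780c347026f0d044224112844224112942122018042122018141d21c19041d21c1914e52e42e306d47026f26e0cf44a24924812244023f23e23d12a7bb1e73373363353340394ce2cd2cc2cb2ca0717901bb5221e72772762750c474a1794d01c24792781e347026f26e1e72251797901c25381e35293281e72872862852842832820be6ca1794be18e4711c24391e34361e74792781bb47026f26e1c32131c36d012846d1a44361d85cd3cc03958f38e0715353340c44792781804792781814422411c24212201e341d21c1e74cc2cb2ca12a47026f26e19047026f26e19144a2492481bb54d34c34b34a0be44023f23e23d1c37281e728728628528428328217972a18f4e31bb5913901294792781e37913901c254d34c34b34a1df2872862852842832821df2251df1df),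
   (16998, 0x3281594e31864e01874711da5a33a20c85993980cf56c36b12255835412a54f34e12e54133d1384d82d718e4d82d718f4c72c61a44c32c21ac4c32c21ad48c28b1c347f27e1cc47f27e1cd4792781d24792781d34422411e959a3993980d05363353341425363353341434d62d52d41904d62d52d419148a2892881c74772762751d45ab3aa3a93a80c44f12f02ef2ee1804f12f02ef2ee1814a22a12a029f1bb7c71d83053043033021794ce2cd2cc2cb2ca19b49129028f28e28d1c278719052a1d45433421c324e24d24c1e36be1d859139012a4d02cf1c32272261eb72e1c352a1c75221d44c81e34be1e94711eb5993981795433421bb1e77901985861a456b1bb55a1c25541c354f1c752e1d852a1da4cf1e95cd3cc1425913901994d62d52d41e748a2892881eb5373363353341d44f12f02ef2ee1e37cd3cc1d45ad3ac1e35913901e97d81df34f34e1eb3053043033021df1df),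
   (32902, 0x3341345221664c21a35a13a00c45913900c954d34a12954934812a53533413553032f13852732614e52732614f4e02df1814c32c21a249a2991bb4792781ca4792781cb4552541de4422411e658d38c38b0cf58d38c38b0d07c31d83013001784e52e42e317d4e52e42e317e4e52e42e317f4c12c02bf1a448a2892881c14772762751cc4772762751cd44a2492481e254d34c34b34a1285373363353341364e22e12e02df1804cd2cc2cb2ca18f7791d828a2892881c07351c352a1cd5221d84cf1e31e34ce2cd2cc2cb2ca18e4872862852842832821c26be1d859139012a4d02cf1c32272261ec77918b5781905281c24cf1de4c41e24c21e34be1e64711ec5cd3cc1225353341bb5273261c31e778f18f57d1a45661bb5481c35341cc4c91e758d38b19058d38b19154f34e1c15273261d85013001de4e42e31e24d02cf1e648a2892881ec7911e32e22e12e02df1e37c11d85a41e25a31e35913901e654f34e1ec1df1df),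
   (32872, 0x2c912a46c1a477918b1c341e1e65cd3cc0385cb3ca0395a33a206d4d02cf1264d02cf1274422411c04422411c14272261de4212201e258d38c38b07157f37e37d07857f37e37d0797c31cc5bb1d82e01224c12c02bf13847727627518147026f26e18e47026f26e18f7d81de5c31e63493480be5373363353340c25373363353340c34ce2cd2cc2ca1284cd2cc2cb2ca1297791d828a2892881787901bb27727627518044023f23e23d1c253333233133032f0c46711c35913900be4d02cf1792141ec7221914cf1bb4c41c24c21c34711e35cd3cc0be5353341791e36711de46d1e35c13c00be5813801224c32c21bb7791ec3273261791e774817953418053518152818e5261914e01bb4d01c04ca1c24c91c34c41ca4711e65a33a212258d38b12a54f34e1785273261904d02cf1c14c32c21cc4c32c21cd4792781e24422411ec48a2892881de72a1e32772762751e378f1c25781d852a1e64cf1ec5cd3cc1805913901c15373363341e37cd3cc1e35913901ec3493481df1df1df),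
   (16520, 0x2531794381a45a33a203949c29b12248a28912944224118e44224118f42f22e1bb4272261c274a1792251c34212201cc4212201cd4ff2fe2fd0be4e52e42e30c24e52e42e30c34e22e12df0c448a28928812847727627513847026f26e14e47026f26e14f44a24924818044a24924818154d34c34b34a0715373363353340785373363353340794ce2cd2cb2ca0cf44023f23e23d19044023f23e23d1917281794be1c221d21c1d86e41794be1a44792781c32171e37c21c32ce2cd2cc2cb2ca0d048728628528428328212a6ca1794711c24391e34361e758f38e0be5813800c44792781bb47026f26e1c32131e76fd1794e31804d018e4cf18f54f34e12954d34a12a4c32c21a449c29b1bb4792781cc4792781cd48a2892881c247026f26e1d844a2492481e34cd2cc2cb2ca1904cd2cc2cb2ca19144023f23e23d1e74872862852842832821c378f1915801a45291d84e31e358f38e1907a41e32ff2fe2fd1df2531df1df),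
   (141, 0x2011d859139000354f34e0054d02cf00b4792780144272260394212200414212200424e52e42e30097381e729c29b01048a2892880116c41e724a24924801e6391e75913900c42170716711384111e759139003947927812a20712a6e312a4711a44391d84792781904792781914212201e720e0be61e1384101a440b1c34051e75913900114d02cf0394792780714422410c442122012a6c41e724a2492480be1c361e1a44111d840b1e754f34e0394792780cf4792780d04422411384212201904212201914e52e42e307148a2892880c444a24924812a6781c34391e72171c36e41c34c41d84792781e722f22e17917961712a4141384091a44071c34051d84031e759139000b54f34e0114422410784422410794272260c44212200cf4212200d04e52e42e301e44a2492480717901c328a2892880396c41d84781e722f22e0be69c1794781904391d844a2492481c320e17969b0be4710e341e1a44111d84892880c44792780cf4792780d042122019042122019144a24924812a6c414e4711a44e52e312a47927819047927819172a1a44c41d849c29b1df22f22e1df20e1df1df1df)]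

lemma prodTests_redKeys173 : prodTests (Lanes.ops 173) (Lanes.rowop 173) (Lanes.seed 173) 173 14 491 slp redKeys173 = true := by
  decide +kernel

/-- Reducible keys of dimension at most `205`, with codes of spanning products. -/
def redKeys205 : List (ℕ × ℕ) :=
  [(200, 0x2880884710af4610c448928808947927809b47927809c4552540cf4552540d044224110044224110142f22e13842722614e42722614f6be1a42171a448a28928808a44a2492480e344a2492480e444a2492480e56c41a454f34e12a4d02cf1901906c413847119054f34e0be4d02cf12a1d86c41a44711d854f34e12a4d02cf1904d02cf19119174e14e54f34e14f5013001905013001914e52e42e31a47791d828a2892881d81796af17950130012a4d02cf14e4d02cf14f4792781a44552541c34422411d84e52e42e313848a2892881917791d828a2892881901c36cf0cf4391a441e1d84141e754f34e0715013000be4d02cf0d04792781384422411914e52e42e30c448a28928812a6d01e72552541797791904be1e724224119074e1794d01c34be1d84711e72272261c31e76e30e34af12a6411e71e74e42e30e44d02cf1004d02cf10149c29b1384e52e42e30e548a28928814e48a28928814f79119125525419144a2492481a47901904d01e725525419072a1904d01c34be1d82272261d874e14e54f34e14f5013001905013001917a41df2e42e31a474f1df28a2891d81df1df),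
   (140, 0x2410414140d040b1384051a454f34e00950130001044224104242122007842122007972a12a2140cf4e52e42e301148a28928801e44a2492480397913900c42170c479139012a2272260716710714390c441e12a5913900101e77381384c41a44711d854f34e12a4d02cf1904d02cf1916be1e72422411e70be6391384141c34101d84091e759139001e4d02cf0714792780c444224112a7901c328a2892880be1c36cf0cf4391a441e1d854f34e0715013000be4e42e30c44d02cf0d047927813845525417944224119044224119148a28928812a74e1794be1d82272261c36be1904711c37791e72d02cf1792141e71796780784111a44091d86101e71e759139001454f34e01e4792780794422410cf4422410d04212201384e52e42e303948a28928807144a2492480c461e1e74422411c31c37901905911914d01e72552540be6be1d84711e759139012a22722612a7001794d01904711d84422411e748a2892881c31796cf0cf4d00d04c40e34391a441e1d84141e754f34e0715013000be4552541794422411914272261c348a28928812a7791902422411906cf1914c41a44891c34711d854f34e12a4d02cf19079019052a1d85913901917913901e73013001df2552541df1df1df1df),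
   (201, 0x2610714390af4340be41a12a54f34e01745525407845525407944224109b44224109c42f22e0cf42f22e0d04272260e34272260e542122010042122010144a24924808844a24924808944a24924808a74e1792272260e469c29b17947927819020e19069c29b17947927819047927819120e1916c413859139007154f34e0be48a2892881791a46711385913900394d02cf0c447927812a4e52e42e30be44a2492481792071d86d00e44611795013000c449c29b12a47927814e47927814f4422411a442f22e1c34212201d848a28928813844a24924819044a2492481911c361e1a44111d840b1e754f34e03949c29b0be4792780cf4792780d04422411384212201904212201914e52e42e307148a2892880c444a24924812a6781c34391e72171c36e41c34c41d84781e722f22e1791e76af0c446112a43417941a1c340e1e749c29b0cf49c29b0d047927810047927810145525413842f22e1914272261a448a2892880e348a2892880e448a2892880e544a24924814e44a24924814f6781e722f22e1906e41794c41904be1a44781c34391e72171d86e314e49b1914e52e314f49c29b1904892881a444a2481d874f1a47a41df2e31d82341df1df1df),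
   (170, 0x21713840b1a454f34e01450130001e49c29b0394272260cf4272260d04e52e42e30204e52e42e302148a28928804148a28928804244a24924807844a2492480797381904c41d822f22e0c47901905913901912552540717381a454f34e19054f34e1914d02cf1d80be7381384c41a44711d854f34e12a4d02cf1904d02cf19112a6391384101d84091e759139001e4d02cf0714792780c444224112a48a2892880be1e76e41384af17950130012a4d02cf14e4d02cf14f4792781a44422411d848a28928819048a28928819174e1794be1d84711e72272261e71796cf0cf4391a441e1d854f34e0715013000be4d02cf0d04792781384552541794422411904422411914e52e42e30c448a28928812a6be1d82272261c36be1907791e72d01792141e71c36af0be6891c31c34141d850130007149c29b0c445525412a44224114e44224114f4212201a44e52e42e30784e52e42e307948a2892880cf44a24924813872a1912272261917791d828a2892880d072a1904be1d822722619061e1e74422411c348a2892881791e76411d854f34e0cf50130012a4792781a44272261e748a2892881917791d828a28928819074f34e19054f34e1914d02cf1d874f1e75913901d82af1df1df1df1df),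
   (112, 0x21401e40b0394011384001a44792780054422410094212200116710c42030c46710714390c441e12a12a63903941e0714110c440912a1c36711e759139012a7c31c32d02cf1c32272260106391384101d84091e759139001e4d02cf0714792780c444224112a72a12a4711c32141c372a1e75913901c328a2892880be0be6200c441412a41113859139000954f34e0104d02cf01e47927803944224107167112a41e1c34101e71c36be1d84711e74d02cf1c32272260be6be14e47119041e1e76be1e72422411c37901c35791d852a1e728a28928817917917960b0c44051384d02cf00947927801144224101e42122003972a12a21407172a1e728a2892880106710714390c441e12a4091c35913900101c361e1e759139007154f34e0be4d02cf12a4422411c30be6391384141c34101d84091e759139001e4d02cf0714792780c444224112a48a2892880be74e1794d01c34711e722722617917961113859139000954f34e0104d02cf01e4792780394422410714212200c472a12a21412a6be1d859139012a2272260be6261794101d859139001e4d02cf0714792780c444224112a7791d828a2892880be68917941e1e759139007154f34e0be4d02cf12a4422411c36cf1c34be1d84711e759139012a7791d852a1e75913901c37d81df34f34e1df28a2892881df2272261df1df1df1df1df),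
   (171, 0x21a0be54f34e00b5013000114d02cf01749c29b01e45525403942f22e0714272260784272260796e312a20e12a4e52e42e301448a28928802048a28928802144a24924804144a2492480426c40c447112a4d02cf0be1a46710c443912a4792780be2031d86711384391914e42e30be47927812a2071916c40d04711385913900394e42e30be47927812a20719061e1384101a44051e75913900114d02cf0394792780714422410c442122012a6c41e724a2492480be1e76d00e446117949c29b12a47927814e47927814f4422411a44212201d848a28928813844a24924819044a2492481916e41794391e72171e717961e1a44171c34111d840b1e749c29b0be4792780cf4792780d04422411384212201904212201917c31e734f34e0394e52e42e307148a2892880c444a24924812a6c41d84781e722f22e1791c36610be41a1794171914141a440e1c340b1d849c29b0714552540c442f22e12a42722613842122014e42122014f7c31d83013000394e52e42e30414e52e42e304248a28928807944a2492480cf44a2492480d07791d828a2892880786be0e44492481792071e76e41794c41904be1a44781c34391e72171906cf0e349b12a4411a454f34e07944a24819044a2481914212201d86611df4e52e31904e52e31914792781d87913901df2d02cf1a421a1df1df1df)]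

lemma prodTests_redKeys205 : prodTests (Lanes.ops 205) (Lanes.rowop 205) (Lanes.seed 205) 205 16 491 slp redKeys205 = true := by
  decide +kernel

/-- Reducible keys of dimension at most `302`, with codes of spanning products. -/
def redKeys302 : List (ℕ × ℕ) :=
  [(232, 0x2340c441a1384792780614422410af4272261004272261014e52e42e302e4e52e42e302f48a28928805448a28928805544a24924809b44a24924809c74e14e54f34e14f12a70130014e50130014f1796711a454f34e0c44e42e312a4d02cf13849c29b17920e1a46e31384af17950130012a4d02cf14e4d02cf14f4792781a448a2892881911916af17950130012a4e42e31384d02cf14e4d02cf14f4792781a448a28928819048a2892881911906cf0cf4391a441e1d854f34e0715013000be4d02cf0d04792781384552541794422411914e52e42e30c448a28928812a7791902422411901d86af12a4e52e30e34d02cf1004d02cf10149c29b1384552541904552541914e52e42e30e448a28928814e48a28928814f44a2492481a474e1794d01c34be1d82272261d81c36611384d02cf0af42f22e1a44e52e42e309b4e52e42e309c48a28928810048a28928810179019059119125525414e79139019125525414f6c41a44891c34711d84d02cf1901d87913900af50130014e50130014f49c29b1a47901905011df2552541d81df1df6af0be6891c31c350130007149c29b0c445525412a44224114e44224114f4272261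914e52e42e30784e52e42e307948a2892880cf48a2892880d044a2492481386c41c32212201a472a1904d01c32272261906be1904711c34d02cf1792141d86d014e4af1794891904792781a44552541c34422411d81df61e1e75913900714272261df6be1e72422411c37901c35791d828a2892881791e71e7),
   (142, 0x2200204031384011a447927800b44224101442722601e4212200216391e72170394e52e42e300548a28928800944a24924801161e1e75913900710717901905913901914d02cf1e72552540106711384111e75913900394d02cf0c42070c46391384101d84091e759139001e4d02cf0714792780c444224112a12a61412a4111385913900094792780394422410714212200c47c31e734f34e0107c31c32d02cf01e1c36cf0cf4391a441e1d84141e754f34e0715013000be4d02cf0d04792781384422411914e52e42e30c448a28928812a6be1e72422411906d01c34be1d82272261c30be6780784111a44091d86101e71e759139001454f34e01e4792780794422410cf4422410d042722612a4212201384e52e42e303948a28928807144a2492480c461e1e74422411c31c37901904d01e72552540be7001794d01904711d86be1e72422411e77791d828a2892881c317917964104140b1384051a454f34e0094d02cf0144422410424272260714212200784212200796c41902170c44e52e42e301148a28928801e44a2492480397913901e73013000106cf12a41e1e759139007112a6cf1914c41a44711d854f34e12a4d02cf1904422411e70be6890be4780c44710d04141c34101d84091e759139001e44224112a1c36d00d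04c40e441e1d84141e74422411904422411914272261c374e1c34d01e72552541791796780784790794390e44111a44091d859139001454f34e01e44a2480c44422410cf4422410d048a2892880717901905911912552540be6be1d859139012a22722612a6cf0cf4c40e34551794391a44261c341e1d854f34e0715013000be44224119148a28928812a7791902422411906cf1914c41a44891c34711d854f34e12a4d02cf19079019052a1d85913901917913901e73013001df2552541df1df1df1df1df),
   (172, 0x2100af4031a46710711d850130000949c29b01147927801745525401e42f22e0394272260414272260426711382071384e52e42e300b48a28928801444a24924802044a24924802163913841e1904101d84d02cf0711906391384101d859139001e4d02cf0711916d01384711a44391d854f34e0c447927819047927819120e0c461113859139000954f34e0104d02cf01e4792780394422410714212200c41e76cf0cf4d00d04391a441e1d84141e754f34e07147927813844224119044224119148a28928812a12a70130012a4d02cf14e4d02cf14f4792781a44422411d84e52e42e313848a28928819048a2892881916be1d82272261e70be6780784111a44091d86101e71e75913900144792780794422410cf4422410d042722612a4212201387c31e734f34e01e4e52e42e303948a28928807144a2492480c47901904d01e72552540be1c36af0be6891c31c350130007149c29b0c445525412a44224114e44224114f4272261904272261914212201a44e52e42e30784e52e42e307948a2892880cf44a2492481386be1904711c32141d87901c3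5791d828a2892880d061e1e76be1e72422411c37791d828a2892881791e717961713841414f40b1a450130001e49c29b03945525407142f22e0c44272260cf4272260d072a12a21414e4e52e42e30204e52e42e302148a28928804148a28928804244a24924807844a2492480796e41384d014e4af1791796cf12a47119154f34e0be1916c40c44be0d047112a4411791d86cf12a48917947119054f34e0be1906d00d041e1d85913900414552541794272261c31c36890be44112a4141c34101d84091e759139001e74e1792272261791e76af0be4890d04780e44790e54141d85013000714792780e345525412a44224114e44224114f4212201a448a2892880cf72a19122722619172a1904be1d822722619074f34e0cf50130012a4792781a448a2892881917791d828a28928819074f34e19054f34e1914d02cf1d874f1e75913901d82af1df1df1df1df1df),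
   (202, 0x24804843906141e0af41a0c440e1386be14f14f50130001444924804944224105444224105542f22e07842f22e07942122009b42122009c4e52e42e301748a28928802648a28928802744a24924804a6c413854f34e0be14e70130012a4d02cf14e4d02cf14f12a6711384d02cf0c447927812a4e52e42e30be2071a46391384101d84d02cf0714792780c444224112a48a2892880be1d86cf0cf4391a441e1d854f34e0715013000be4d02cf0d04792781384422411904e52e42e30c448a28928812a1906cf0cf4391a441e1d854f34e0715013000be4d02cf0d04792781384422411904422411914e52e42e30c448a28928812a1916e30e34af12a4e52e40e44d02cf1004d02cf10149c29b13845525419148a28928814e48a28928814f79019025525419044a2492481a474e1794be1d82272261d81796af0be4141d850130007149c29b0c445525412a44224114e44224114f4272261914212201a44e52e42e30784e52e42e307948a2892880cf44a2492481386be1d82272261907901c35791d828a2892880d01c36780784111a44091d859139001454f34e01e4d02cf04247927807942722612a4212201384e52e42e30397c31c32d02cf04148a2892880717901902552540be44a2492480c46c40c44be0d041e1c34101e71e76d01904711d84422411e77791d828a2892881c31791e76880884610c448a28808a47927809b47927809c7791c32710af4552540d044224110044224110142f22e1386be1a42171a47911912552540cf44a2492480e344a2492480e444a2492480e572a1912272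2614f7791d828a28928808972a1914d01c322722614e6c41a44891c354f34e12a4d02cf1901906d00d04411904391a441e1d84141e74552541794272261c31e76e40e44af12a4261d85013000cf4e52e30e348a28928814e48a28928814f79019025525419079119125525419144a2492481a474e14e54f34e14f5013001905013001917a41df2e42e31a474f1df28a2891d81df1df1df)]

lemma prodTests_redKeys302 : prodTests (Lanes.ops 302) (Lanes.rowop 302) (Lanes.seed 302) 302 14 491 slp redKeys302 = true := by
  decide +kernel

def genKeys : List ℕ :=
  freeKeys11.map (fun x => x.1) ++ freeKeys36.map (fun x => x.1) ++ relKeys33.map (fun x => x.2.2.1) ++ relKeys46.map (fun x => x.2.2.1)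

def redKeys : List ℕ :=
  (redKeys10 ++ redKeys20 ++ redKeys38 ++ redKeys64 ++ redKeys95 ++ redKeys137 ++ redKeys173 ++ redKeys205 ++ redKeys302).map fun x => x.1

lemma complete_keys : Complete genKeys redKeys where
  unit := by decide +kernel
  mul := by decide +kernel
  critical := by decide +kernel

lemma keyDeg_ne_zero : ∀ x ∈ genKeys, keyDeg x ≠ 0 := by decide +kernel

lemma keysTest_slp : keysTest genKeys 491 slp = true := by decide +kernel

lemma red_of_mem {x : ℕ} (hx : x ∈ redKeys) : S.Red (keyDeg x) (keyOrd x) := by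
  obtain ⟨y, hy, rfl⟩ := List.mem_map.1 hx
  simp only [List.mem_append, or_assoc] at hy
  rcases hy with h | h | h | h | h | h | h | h | h
  · exact Lanes.prodTests_sound (by decide) (by decide) prodTests_redKeys10 y h
  · exact Lanes.prodTests_sound (by decide) (by decide) prodTests_redKeys20 y h
  · exact Lanes.prodTests_sound (by decide) (by decide) prodTests_redKeys38 y h
  · exact Lanes.prodTests_sound (by decide) (by decide) prodTests_redKeys64 y h
  · exact Lanes.prodTests_sound (by decide) (by decide) prodTests_redKeys95 y h
  · exact Lanes.prodTests_sound (by decide) (by decide) prodTests_redKeys137 y h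
  · exact Lanes.prodTests_sound (by decide) (by decide) prodTests_redKeys173 y h
  · exact Lanes.prodTests_sound (by decide) (by decide) prodTests_redKeys205 y h
  · exact Lanes.prodTests_sound (by decide) (by decide) prodTests_redKeys302 y h

lemma good_of_mem (hd : ∀ s ∈ covs 491 slp, s.deg ≠ 0) {x : ℕ} (hx : x ∈ genKeys) :
    Good S (covs 491 slp) (keyDeg x) (keyOrd x) := by
  have h0 := keyDeg_ne_zero x hx
  simp only [genKeys, List.mem_append, List.mem_map, or_assoc] at hx
  rcases hx with ⟨y, h, rfl⟩ | ⟨y, h, rfl⟩ | ⟨y, h, rfl⟩ | ⟨y, h, rfl⟩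
  · exact Lanes.genTests_sound (by decide) (by decide) hd genTests_freeKeys11 y h h0
  · exact Lanes.genTests_sound (by decide) (by decide) hd genTests_freeKeys36 y h h0
  · exact Kron.genTests_sound hd (by decide +kernel) genTests_relKeys33 y h h0
  · exact Kron.genTests_sound hd (by decide +kernel) genTests_relKeys46 y h h0

end Prog

/-- **Minimal covariant basis of `S₆ ⊕ S₄ ⊕ S₂`.** For `V = S₆ ⊕ S₄ ⊕ S₂`, the
covariant algebra `Cov(V)` admits a minimal basis consisting of exactly `494`
homogeneous covariants; equivalently, `dim_ℂ (C₊ / C₊²) = 494`, where `C₊` is the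
ideal of `Cov(V)` spanned by the homogeneous components of positive total degree. -/
theorem minimal_covariant_basis_S6_S4_S2 :
    (∃ B : Fin 494 → ↥(Covariants (![6, 4, 2] : Fin 3 → ℕ)),
      IsMinimalBasis (![6, 4, 2] : Fin 3 → ℕ) B) ∧
    Module.finrank ℂ
      ↥((Cplus (![6, 4, 2] : Fin 3 → ℕ)).map (CplusSq (![6, 4, 2] : Fin 3 → ℕ)).mkQ)
      = 494 := Prog.exists_basis_of_tables Prog.keyDeg_ne_zero Prog.complete_keys Prog.keysTest_slp
    (fun _ => Prog.red_of_mem) fun hd _ => Prog.good_of_mem hd
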